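/- Let 1/2 < α < β < 1. Let f : I × I → ℝ be Hölder continuous with ∫ f dν = 0 and c := ∫₀¹ f(0,ω) dω ≠ 0. Then the distributions of S_n f / n^α under ν converge weakly, as n → ∞, to the probability measure on ℝ whose characteristic function is t ↦ exp( −A |c|^{1/α} Γ(1 − 1/α) cos(π/(2α)) |t|^{1/α} (1 − i · sgn(ct) · tan(π/(2α))) ), where A = (1/4)(α p₁)^{-1/α} ∫₀¹ h(1/2,ω) dω and Γ denotes the Gamma function. -/

import Mathlib

open MeasureTheory Filter Set Topology

noncomputable section

/-- The Liverani–Saussol–Vaienti map `T_a` on `[0,1]`. -/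
def lsv (a x : ℝ) : ℝ := if x ≤ 1 / 2 then x * (1 + (2 : ℝ) ^ a * x ^ a) else 2 * x - 1

/-- Random parameter selection: `α` on `[0,p₁)`, `β` on `[p₁,1]`. -/
def alphaOf (α β p₁ ω : ℝ) : ℝ := if ω < p₁ then α else β

/-- The noise dynamics `φ` on `[0,1]`. -/
def phiMap (p₁ ω : ℝ) : ℝ := if ω < p₁ then ω / p₁ else (ω - p₁) / (1 - p₁)

/-- The skew product `S(x,ω) = (T_{α(ω)} x, φ ω)`. -/
def skewLSV (α β p₁ : ℝ) (p : ℝ × ℝ) : ℝ × ℝ :=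
  (lsv (alphaOf α β p₁ p.2) p.1, phiMap p₁ p.2)

/-- The base of inducing, `Δ₀ = (1/2,1] × [0,1]`. -/
def Δ0 : Set (ℝ × ℝ) := Ioc (1 / 2 : ℝ) 1 ×ˢ Icc (0 : ℝ) 1

/-- Birkhoff sums `S_n f` of the skew product. -/
def birkhoff (α β p₁ : ℝ) (f : ℝ × ℝ → ℝ) (n : ℕ) (p : ℝ × ℝ) : ℝ :=
  ∑ k ∈ Finset.range n, f ((skewLSV α β p₁)^[k] p)

/-- The constant `A = (1/4)(α p₁)^{-1/α} ∫₀¹ h(1/2,ω) dω`. -/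
def Aconst (α p₁ : ℝ) (h : ℝ × ℝ → ℝ) : ℝ :=
  (1 / 4 : ℝ) * (α * p₁) ^ (-(1 / α)) * ∫ ω in Icc (0 : ℝ) 1, h (1 / 2, ω)

/-- A full-branch Gibbs–Markov system: a probability measure `m` carried by `D`, a map `F` with
countably many inverse branches `ψ i : D → D` of Jacobian `J i`, contracting the distance `d`
uniformly and with uniformly bounded distortion. -/
structure FullBranch (X ι : Type*) [MeasurableSpace X] where
  m : Measure X
  D : Set X
  d : X → X → ℝ
  F : X → X
  ψ : ι → X → X
  J : ι → X → ℝ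
  κ : ℝ
  Dc : ℝ
  prob : IsProbabilityMeasure m
  compl_null : m Dᶜ = 0
  d_nonneg : ∀ x y, 0 ≤ d x y
  d_le_one : ∀ x ∈ D, ∀ y ∈ D, d x y ≤ 1
  d_symm : ∀ x y, d x y = d y x
  κ_nonneg : 0 ≤ κ
  κ_lt : κ < 1
  Dc_nonneg : 0 ≤ Dc
  maps : ∀ i, ∀ x ∈ D, ψ i x ∈ D
  contr : ∀ i, ∀ x ∈ D, ∀ y ∈ D, d (ψ i x) (ψ i y) ≤ κ * d x y
  J_nonneg : ∀ i, ∀ x ∈ D, 0 ≤ J i x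
  J_dist : ∀ i, ∀ x ∈ D, ∀ y ∈ D, J i x ≤ Real.exp (Dc * d x y) * J i y
  F_ψ : ∀ i, ∀ x ∈ D, F (ψ i x) = x
  meas_F : Measurable F
  meas_ψ : ∀ i, Measurable (ψ i)
  meas_J : ∀ i, Measurable (J i)
  dual : m = Measure.sum fun i =>
    (m.withDensity fun x => ENNReal.ofReal (J i x)).map (ψ i)
  meas_reg : ∀ u : X → ℂ, (∃ K : ℝ, ∀ x ∈ D, ∀ y ∈ D, ‖u x - u y‖ ≤ K * d x y) →
    AEStronglyMeasurable u m

namespace FullBranch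

variable {X ι : Type*} [MeasurableSpace X] (S : FullBranch X ι)

instance : IsProbabilityMeasure S.m := S.prob

/-- Bounded and Lipschitz functions on `D`, with a common constant. -/
def Reg {E : Type*} [NormedAddCommGroup E] (K : ℝ) (u : X → E) : Prop :=
  (∀ x ∈ S.D, ‖u x‖ ≤ K) ∧ ∀ x ∈ S.D, ∀ y ∈ S.D, ‖u x - u y‖ ≤ K * S.d x y

/-- The cone of nonnegative functions with `a`-Lipschitz logarithm. -/
def Cone (a : ℝ) (u : X → ℝ) : Prop :=
  (∀ x ∈ S.D, 0 ≤ u x) ∧ ∀ x ∈ S.D, ∀ y ∈ S.D, u x ≤ Real.exp (a * S.d x y) * u y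

/-- The transfer operator. -/
def L {E : Type*} [NormedAddCommGroup E] [NormedSpace ℝ E] (u : X → E) (x : X) : E :=
  ∑' i, S.J i x • u (S.ψ i x)

/-- The mass of the `i`-th branch. -/
def j (i : ι) : ℝ := ∫ x, S.J i x ∂S.m

/-- Branchwise regularity with constants `U i`. -/
def Branchwise {E : Type*} [NormedAddCommGroup E] (U : ι → ℝ) (u : X → E) : Prop :=
  (∀ i, ∀ x ∈ S.D, ‖u (S.ψ i x)‖ ≤ U i) ∧
    ∀ i, ∀ x ∈ S.D, ∀ y ∈ S.D, ‖u (S.ψ i x) - u (S.ψ i y)‖ ≤ U i * S.d x y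

lemma ae_mem : ∀ᵐ x ∂S.m, x ∈ S.D := by
  rw [ae_iff]; exact S.compl_null

lemma nonempty_D : S.D.Nonempty := by
  by_contra h
  rw [Set.not_nonempty_iff_eq_empty] at h
  have := S.compl_null
  rw [h, Set.compl_empty, measure_univ] at this
  exact one_ne_zero this

lemma exp_d_le {a : ℝ} (ha : 0 ≤ a) {x y : X} (hx : x ∈ S.D) (hy : y ∈ S.D) :
    Real.exp (a * S.d x y) ≤ Real.exp a :=
  Real.exp_le_exp.2 (by nlinarith [S.d_le_one x hx y hy])

lemma J_le_exp (i : ι) {x y : X} (hx : x ∈ S.D) (hy : y ∈ S.D) :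
    S.J i x ≤ Real.exp S.Dc * S.J i y :=
  (S.J_dist i x hx y hy).trans
    (mul_le_mul_of_nonneg_right (S.exp_d_le S.Dc_nonneg hx hy) (S.J_nonneg i y hy))

lemma J_integrable (i : ι) : Integrable (S.J i) S.m := by
  obtain ⟨y, hy⟩ := S.nonempty_D
  refine Integrable.mono' (integrable_const (Real.exp S.Dc * S.J i y))
    (S.meas_J i).aestronglyMeasurable ?_
  filter_upwards [S.ae_mem] with x hx
  rw [Real.norm_of_nonneg (S.J_nonneg i x hx)]
  exact S.J_le_exp i hx hy

lemma j_nonneg (i : ι) : 0 ≤ S.j i :=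
  integral_nonneg_of_ae (by filter_upwards [S.ae_mem] with x hx using S.J_nonneg i x hx)

lemma J_le (i : ι) {x : X} (hx : x ∈ S.D) : S.J i x ≤ Real.exp S.Dc * S.j i := by
  have : ∫ _, S.J i x ∂S.m ≤ ∫ y, Real.exp S.Dc * S.J i y ∂S.m := by
    refine integral_mono_ae (integrable_const _) ((S.J_integrable i).const_mul _) ?_
    filter_upwards [S.ae_mem] with y hy using S.J_le_exp i hx hy
  simpa [integral_const_mul, j] using this

lemma J_sub_le (i : ι) {x y : X} (hx : x ∈ S.D) (hy : y ∈ S.D) :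
    |S.J i x - S.J i y| ≤ S.Dc * Real.exp (2 * S.Dc) * S.j i * S.d x y := by
  wlog hxy : S.J i y ≤ S.J i x generalizing x y
  · rw [abs_sub_comm, S.d_symm]; exact this hy hx (le_of_not_ge hxy)
  rw [abs_of_nonneg (by linarith)]
  have h1 := S.J_dist i x hx y hy
  have h2 := S.J_le i hy
  have h0 := S.J_nonneg i y hy
  have h3 : Real.exp (S.Dc * S.d x y) - 1 ≤ S.Dc * S.d x y * Real.exp S.Dc := by
    have e1 := S.exp_d_le S.Dc_nonneg hx hy
    have e2 := Real.add_one_le_exp (-(S.Dc * S.d x y))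
    rw [Real.exp_neg] at e2
    have e3 := Real.exp_pos (S.Dc * S.d x y)
    have e4 : Real.exp (S.Dc * S.d x y) * (-(S.Dc * S.d x y) + 1) ≤ 1 := by
      calc _ ≤ Real.exp (S.Dc * S.d x y) * (Real.exp (S.Dc * S.d x y))⁻¹ := by gcongr
        _ = 1 := mul_inv_cancel₀ e3.ne'
    nlinarith [mul_nonneg S.Dc_nonneg (S.d_nonneg x y)]
  have h4 : 0 ≤ S.Dc * S.d x y * Real.exp S.Dc := by
    have := S.Dc_nonneg; have := S.d_nonneg x y; positivity
  calc S.J i x - S.J i y ≤ (Real.exp (S.Dc * S.d x y) - 1) * S.J i y := by linarith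
    _ ≤ (S.Dc * S.d x y * Real.exp S.Dc) * (Real.exp S.Dc * S.j i) := by gcongr
    _ = _ := by rw [two_mul, Real.exp_add]; ring

/-- Change of variables, for nonnegative functions. -/
lemma lintegral_dual {g : X → ENNReal} (hg : AEMeasurable g S.m) :
    ∫⁻ x, g x ∂S.m = ∑' i, ∫⁻ x, ENNReal.ofReal (S.J i x) * g (S.ψ i x) ∂S.m := by
  conv_lhs => rw [S.dual]
  rw [lintegral_sum_measure]
  congr 1 with i
  have hle : (S.m.withDensity fun x => ENNReal.ofReal (S.J i x)).map (S.ψ i) ≤ S.m := by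
    conv_rhs => rw [S.dual]
    exact Measure.le_sum (fun i => (S.m.withDensity fun x => ENNReal.ofReal (S.J i x)).map (S.ψ i))
        i
  have hg' := hg.mono_measure hle
  rw [lintegral_map' hg' (S.meas_ψ i).aemeasurable]
  change ∫⁻ a, (g ∘ S.ψ i) a ∂_ = _
  rw [lintegral_withDensity_eq_lintegral_mul₀' (S.meas_J i).ennreal_ofReal.aemeasurable
      (hg'.comp_measurable (S.meas_ψ i))]
  rfl

/-- Change of variables, for integrable functions. -/
lemma integral_dual {E : Type*} [NormedAddCommGroup E] [NormedSpace ℝ E]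
    {g : X → E} (hg : Integrable g S.m) :
    (∀ i, Integrable (fun x => S.J i x • g (S.ψ i x)) S.m) ∧
    HasSum (fun i => ∫ x, S.J i x • g (S.ψ i x) ∂S.m) (∫ x, g x ∂S.m) := by
  have hJ : ∀ i, ∀ᵐ x ∂S.m, 0 ≤ S.J i x := fun i => by
    filter_upwards [S.ae_mem] with x hx using S.J_nonneg i x hx
  have hsum : Integrable g (Measure.sum fun i =>
      (S.m.withDensity fun x => ENNReal.ofReal (S.J i x)).map (S.ψ i)) := S.dual ▸ hg
  have hi : ∀ i, Integrable g ((S.m.withDensity fun x => ENNReal.ofReal (S.J i x)).map (S.ψ i)) :=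
    fun i => hsum.mono_measure (Measure.le_sum _ i)
  have hi' : ∀ i, Integrable (fun x => g (S.ψ i x))
      (S.m.withDensity fun x => ENNReal.ofReal (S.J i x)) := fun i =>
    (integrable_map_measure (hi i).aestronglyMeasurable (S.meas_ψ i).aemeasurable).1 (hi i)
  have heq : ∀ i, ∀ᵐ x ∂S.m, (ENNReal.ofReal (S.J i x)).toReal • g (S.ψ i x) =
      S.J i x • g (S.ψ i x) := fun i => by
    filter_upwards [hJ i] with x hx
    rw [ENNReal.toReal_ofReal hx]
  refine ⟨fun i => ?_, ?_⟩
  · have := (integrable_withDensity_iff_integrable_smul' (S.meas_J i).ennreal_ofReal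
      (by simp)).1 (hi' i)
    exact (integrable_congr (heq i)).1 this
  · have h := hasSum_integral_measure hsum
    rw [← S.dual] at h
    convert h using 2 with i
    rw [integral_map (S.meas_ψ i).aemeasurable (hi i).aestronglyMeasurable,
      integral_withDensity_eq_integral_toReal_smul (S.meas_J i).ennreal_ofReal (by simp)]
    exact (integral_congr_ae (heq i)).symm

lemma j_hasSum : HasSum S.j 1 := by
  have := (S.integral_dual (integrable_const (1 : ℝ))).2
  have h := this
  simp only [smul_eq_mul, mul_one, integral_const, probReal_univ] at h
  exact h

lemma summable_L {E : Type*} [NormedAddCommGroup E] [NormedSpace ℝ E] [CompleteSpace E]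
    {U : ι → ℝ} {u : X → E} (hu : S.Branchwise U u) (hU : Summable fun i => S.j i * U i)
    {x : X} (hx : x ∈ S.D) : Summable fun i => S.J i x • u (S.ψ i x) := by
  refine Summable.of_norm_bounded (hU.mul_left (Real.exp S.Dc)) fun i => ?_
  rw [norm_smul, Real.norm_of_nonneg (S.J_nonneg i x hx), ← mul_assoc]
  exact mul_le_mul (S.J_le i hx) (hu.1 i x hx) (norm_nonneg _)
    (mul_nonneg (Real.exp_pos _).le (S.j_nonneg i))

/-- The constant in `L_reg`. -/
def C₁ : ℝ := Real.exp S.Dc + S.Dc * Real.exp (2 * S.Dc)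

lemma C₁_pos : 0 < S.C₁ := by
  have := S.Dc_nonneg; unfold C₁; positivity

lemma L_reg {E : Type*} [NormedAddCommGroup E] [NormedSpace ℝ E] [CompleteSpace E]
    {U : ι → ℝ} {u : X → E} (hu : S.Branchwise U u) (hU : Summable fun i => S.j i * U i) :
    S.Reg (S.C₁ * ∑' i, S.j i * U i) (S.L u) := by
  obtain ⟨z, hz⟩ := S.nonempty_D
  have hU0 : ∀ i, 0 ≤ U i := fun i => (norm_nonneg _).trans (hu.1 i z hz)
  have hjU : ∀ i, 0 ≤ S.j i * U i := fun i => mul_nonneg (S.j_nonneg i) (hU0 i)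
  have hDc := S.Dc_nonneg
  constructor
  · intro x hx
    rw [← tsum_mul_left]
    refine tsum_of_norm_bounded (hU.mul_left S.C₁).hasSum fun i => ?_
    rw [norm_smul, Real.norm_of_nonneg (S.J_nonneg i x hx), ← mul_assoc]
    refine mul_le_mul ((S.J_le i hx).trans ?_) (hu.1 i x hx) (norm_nonneg _)
      (mul_nonneg S.C₁_pos.le (S.j_nonneg i))
    refine mul_le_mul_of_nonneg_right ?_ (S.j_nonneg i)
    unfold C₁
    have : 0 ≤ S.Dc * Real.exp (2 * S.Dc) := by positivity
    linarith
  · intro x hx y hy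
    unfold L
    rw [← (S.summable_L hu hU hx).tsum_sub (S.summable_L hu hU hy), ← tsum_mul_left,
      ← tsum_mul_right]
    refine tsum_of_norm_bounded ((hU.mul_left S.C₁).mul_right _).hasSum fun i => ?_
    have e : S.J i x • u (S.ψ i x) - S.J i y • u (S.ψ i y) =
        (S.J i x - S.J i y) • u (S.ψ i x) + S.J i y • (u (S.ψ i x) - u (S.ψ i y)) := by
      rw [sub_smul, smul_sub]; abel
    rw [e]
    have hd := S.d_nonneg x y
    have hj := S.j_nonneg i
    calc _ ≤ |S.J i x - S.J i y| * ‖u (S.ψ i x)‖ + S.J i y * ‖u (S.ψ i x) - u (S.ψ i y)‖ := by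
          refine (norm_add_le _ _).trans ?_
          rw [norm_smul, norm_smul, Real.norm_of_nonneg (S.J_nonneg i y hy), Real.norm_eq_abs]
      _ ≤ (S.Dc * Real.exp (2 * S.Dc) * S.j i * S.d x y) * U i
          + (Real.exp S.Dc * S.j i) * (U i * S.d x y) := by
          gcongr
          · exact S.J_sub_le i hx hy
          · exact hu.1 i x hx
          · exact S.J_le i hy
          · exact hu.2 i x hx y hy
      _ = _ := by unfold C₁; ring

lemma integrable_of_branchwise {E : Type*} [NormedAddCommGroup E]
    {U : ι → ℝ} {u : X → E} (hu : ∀ i, ∀ x ∈ S.D, ‖u (S.ψ i x)‖ ≤ U i)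
    (hU : Summable fun i => S.j i * U i)
    (hm : AEStronglyMeasurable u S.m) : Integrable u S.m := by
  refine ⟨hm, ?_⟩
  obtain ⟨z, hz⟩ := S.nonempty_D
  have hU0 : ∀ i, 0 ≤ U i := fun i => (norm_nonneg _).trans (hu i z hz)
  unfold HasFiniteIntegral
  rw [S.lintegral_dual hm.enorm]
  calc ∑' i, ∫⁻ x, ENNReal.ofReal (S.J i x) * ‖u (S.ψ i x)‖ₑ ∂S.m
      ≤ ∑' i, ENNReal.ofReal (S.j i * U i) := by
        refine ENNReal.tsum_le_tsum fun i => ?_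
        rw [ENNReal.ofReal_mul (S.j_nonneg i), j, ofReal_integral_eq_lintegral_ofReal
          (S.J_integrable i) (by filter_upwards [S.ae_mem] with x hx using S.J_nonneg i x hx),
          ← lintegral_mul_const _ (S.meas_J i).ennreal_ofReal]
        refine lintegral_mono_ae ?_
        filter_upwards [S.ae_mem] with x hx
        gcongr
        rw [← ofReal_norm]
        exact ENNReal.ofReal_le_ofReal (hu i x hx)
    _ < ⊤ := by
        rw [← ENNReal.ofReal_tsum_of_nonneg (fun i => mul_nonneg (S.j_nonneg i) (hU0 i)) hU]
        exact ENNReal.ofReal_lt_top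

/-- Duality between `L` and composition with `F`. -/
lemma integral_L_mul [Countable ι] {E : Type*} [RCLike E] {U : ι → ℝ} {u : X → E}
    (hu : S.Branchwise U u)
    (hU : Summable fun i => S.j i * U i) (hm : AEStronglyMeasurable u S.m)
    {w : X → E} (hw : Measurable w) {B : ℝ} (hB : ∀ x, ‖w x‖ ≤ B) :
    ∫ x, S.L u x * w x ∂S.m = ∫ x, u x * w (S.F x) ∂S.m := by
  have hB0 : 0 ≤ B := by
    obtain ⟨z, hz⟩ := S.nonempty_D
    exact (norm_nonneg _).trans (hB z)
  have hui := S.integrable_of_branchwise hu.1 hU hm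
  have hintb : Integrable (fun x => u x * w (S.F x)) S.m :=
    hui.mul_bdd (c := B) (hw.comp S.meas_F).aestronglyMeasurable (ae_of_all _ fun x => hB _)
  have h1 := (S.integral_dual hintb).2
  have h2 : ∀ i, ∫ x, S.J i x • (u (S.ψ i x) * w (S.F (S.ψ i x))) ∂S.m =
      ∫ x, (S.J i x • u (S.ψ i x)) * w x ∂S.m := fun i => by
    refine integral_congr_ae ?_
    filter_upwards [S.ae_mem] with x hx
    rw [S.F_ψ i x hx, smul_mul_assoc]
  simp_rw [h2] at h1
  have hUz : ∀ i, 0 ≤ U i := fun i => by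
    obtain ⟨z, hz⟩ := S.nonempty_D
    exact (norm_nonneg _).trans (hu.1 i z hz)
  have hi : ∀ i, Integrable (fun x => (S.J i x • u (S.ψ i x)) * w x) S.m := fun i => by
    refine (((S.integral_dual hui).1 i).mul_bdd (c := B) hw.aestronglyMeasurable
      (ae_of_all _ fun x => hB _))
  have h3 := hasSum_integral_of_summable_integral_norm hi (by
    refine Summable.of_nonneg_of_le (fun i => integral_nonneg fun x => norm_nonneg _) (fun i => ?_)
      (hU.mul_left B)
    calc ∫ x, ‖(S.J i x • u (S.ψ i x)) * w x‖ ∂S.m ≤ ∫ x, S.J i x * (U i * B) ∂S.m := by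
          refine integral_mono_ae (hi i).norm ((S.J_integrable i).mul_const _) ?_
          filter_upwards [S.ae_mem] with x hx
          rw [norm_mul, norm_smul, Real.norm_of_nonneg (S.J_nonneg i x hx), mul_assoc]
          have := S.J_nonneg i x hx
          have := hu.1 i x hx
          have := hB x
          have := hUz i
          gcongr
      _ = B * (S.j i * U i) := by rw [integral_mul_const]; unfold j; ring)
  rw [h1.unique h3]
  refine integral_congr_ae ?_
  filter_upwards [S.ae_mem] with x hx
  unfold L
  rw [tsum_mul_right]

end FullBranch

namespace FullBranch

variable {X ι : Type*} [MeasurableSpace X] (S : FullBranch X ι)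

lemma integral_L [Countable ι] {E : Type*} [RCLike E] {U : ι → ℝ} {u : X → E}
    (hu : S.Branchwise U u) (hU : Summable fun i => S.j i * U i)
    (hm : AEStronglyMeasurable u S.m) : ∫ x, S.L u x ∂S.m = ∫ x, u x ∂S.m := by
  simpa using S.integral_L_mul hu hU hm (w := fun _ => 1) measurable_const (B := 1) (by simp)

variable {S} in
lemma Reg.branchwise {E : Type*} [NormedAddCommGroup E] {K : ℝ} {u : X → E} (hu : S.Reg K u) :
    S.Branchwise (fun _ => K) u := by
  refine ⟨fun i x hx => hu.1 _ (S.maps i x hx), fun i x hx y hy => ?_⟩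
  have hK : 0 ≤ K := (norm_nonneg _).trans (hu.1 x hx)
  refine (hu.2 _ (S.maps i x hx) _ (S.maps i y hy)).trans (mul_le_mul_of_nonneg_left ?_ hK)
  refine (S.contr i x hx y hy).trans ?_
  nlinarith [S.κ_lt, S.d_nonneg x y]

lemma summable_const (K : ℝ) : Summable fun i => S.j i * K := S.j_hasSum.summable.mul_right K

lemma tsum_j_mul (K : ℝ) : ∑' i, S.j i * K = K := by
  rw [tsum_mul_right, S.j_hasSum.tsum_eq, one_mul]

lemma exp_sub_one_le {t : ℝ} : Real.exp t - 1 ≤ t * Real.exp t := by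
  have h := Real.add_one_le_exp (-t)
  rw [Real.exp_neg] at h
  have e3 := Real.exp_pos t
  have e4 : Real.exp t * (-t + 1) ≤ 1 := by
    calc _ ≤ Real.exp t * (Real.exp t)⁻¹ := by gcongr
      _ = 1 := mul_inv_cancel₀ e3.ne'
  nlinarith

lemma aestronglyMeasurable_of_lip {u : X → ℝ} {K : ℝ}
    (h : ∀ x ∈ S.D, ∀ y ∈ S.D, |u x - u y| ≤ K * S.d x y) : AEStronglyMeasurable u S.m := by
  have := S.meas_reg (fun x => (u x : ℂ)) ⟨K, fun x hx y hy => by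
    rw [← Complex.ofReal_sub, Complex.norm_real]; exact h x hx y hy⟩
  simpa using Complex.continuous_re.comp_aestronglyMeasurable this

/-- The aperture of the invariant cone. -/
def a₀ : ℝ := (S.Dc + 1) / (1 - S.κ)

lemma one_le_a₀ : 1 ≤ S.a₀ := by
  have := S.κ_lt
  rw [a₀, le_div_iff₀ (by linarith)]
  linarith [S.κ_nonneg, S.Dc_nonneg]

lemma a₀_eq : S.κ * S.a₀ + S.Dc = S.a₀ - 1 := by
  have := S.κ_lt
  have h : S.a₀ * (1 - S.κ) = S.Dc + 1 := by
    rw [a₀, div_mul_cancel₀]; linarith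
  linarith

/-- The contraction rate on the cone. -/
def δ : ℝ := Real.exp (-(2 * S.a₀)) / S.a₀

lemma δ_pos : 0 < S.δ := div_pos (Real.exp_pos _) (by linarith [S.one_le_a₀])

lemma δ_le_one : S.δ ≤ 1 := by
  have := S.one_le_a₀
  rw [δ, div_le_one (by linarith)]
  exact (Real.exp_le_one_iff.2 (by linarith)).trans this

variable {S} in
lemma Cone.le_exp {a : ℝ} (ha : 0 ≤ a) {u : X → ℝ} (hu : S.Cone a u) {x y : X} (hx : x ∈ S.D)
    (hy : y ∈ S.D) : u x ≤ Real.exp a * u y :=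
  (hu.2 x hx y hy).trans (mul_le_mul_of_nonneg_right (S.exp_d_le ha hx hy) (hu.1 y hy))

variable {S} in
lemma Cone.lip {a : ℝ} (ha : 0 ≤ a) {u : X → ℝ} (hu : S.Cone a u) {B : ℝ}
    (hB : ∀ x ∈ S.D, u x ≤ B) {x y : X} (hx : x ∈ S.D) (hy : y ∈ S.D) :
    |u x - u y| ≤ a * Real.exp a * B * S.d x y := by
  wlog hxy : u y ≤ u x generalizing x y
  · rw [abs_sub_comm, S.d_symm]; exact this hy hx (le_of_not_ge hxy)
  rw [abs_of_nonneg (by linarith)]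
  have h1 := hu.2 x hx y hy
  have h0 := hu.1 y hy
  have hd := S.d_nonneg x y
  have h2 := exp_sub_one_le (t := a * S.d x y)
  have h3 := S.exp_d_le ha hx hy
  calc u x - u y ≤ (Real.exp (a * S.d x y) - 1) * u y := by linarith
    _ ≤ (a * S.d x y * Real.exp a) * B := by
      refine mul_le_mul (h2.trans ?_) (hB y hy) h0 (by positivity)
      gcongr
    _ = _ := by ring

variable {S} in
lemma Cone.aesm {a : ℝ} (ha : 0 ≤ a) {u : X → ℝ} (hu : S.Cone a u) :
    AEStronglyMeasurable u S.m := by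
  obtain ⟨z, hz⟩ := S.nonempty_D
  exact S.aestronglyMeasurable_of_lip fun x hx y hy =>
    hu.lip ha (fun x hx => hu.le_exp ha hx hz) hx hy

variable {S} in
lemma Cone.integrable {a : ℝ} (ha : 0 ≤ a) {u : X → ℝ} (hu : S.Cone a u) :
    Integrable u S.m := by
  obtain ⟨z, hz⟩ := S.nonempty_D
  refine Integrable.mono' (integrable_const (Real.exp a * u z)) (hu.aesm ha) ?_
  filter_upwards [S.ae_mem] with x hx
  rw [Real.norm_of_nonneg (hu.1 x hx)]
  exact hu.le_exp ha hx hz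

variable {S} in
lemma Cone.integral_nonneg {a : ℝ} {u : X → ℝ} (hu : S.Cone a u) :
    0 ≤ ∫ x, u x ∂S.m :=
  integral_nonneg_of_ae (by filter_upwards [S.ae_mem] with x hx using hu.1 x hx)

variable {S} in
lemma Cone.le_integral {a : ℝ} (ha : 0 ≤ a) {u : X → ℝ} (hu : S.Cone a u) {x : X}
    (hx : x ∈ S.D) : u x ≤ Real.exp a * ∫ y, u y ∂S.m := by
  have : ∫ _, u x ∂S.m ≤ ∫ y, Real.exp a * u y ∂S.m := by
    refine integral_mono_ae (integrable_const _) ((hu.integrable ha).const_mul _) ?_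
    filter_upwards [S.ae_mem] with y hy using hu.le_exp ha hx hy
  simpa [integral_const_mul] using this

variable {S} in
lemma Cone.integral_le {a : ℝ} (ha : 0 ≤ a) {u : X → ℝ} (hu : S.Cone a u) {x : X}
    (hx : x ∈ S.D) : ∫ y, u y ∂S.m ≤ Real.exp a * u x := by
  have : ∫ y, u y ∂S.m ≤ ∫ _, Real.exp a * u x ∂S.m := by
    refine integral_mono_ae (hu.integrable ha) (integrable_const _) ?_
    filter_upwards [S.ae_mem] with y hy using hu.le_exp ha hy hx
  simpa using this

variable {S} in
lemma Cone.reg {a : ℝ} (ha : 0 ≤ a) {u : X → ℝ} (hu : S.Cone a u) :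
    S.Reg ((Real.exp a + a * Real.exp a * Real.exp a) * ∫ y, u y ∂S.m) u := by
  have hI := hu.integral_nonneg
  have h0 : 0 ≤ a * Real.exp a * Real.exp a := by positivity
  refine ⟨fun x hx => ?_, fun x hx y hy => ?_⟩
  · rw [Real.norm_of_nonneg (hu.1 x hx)]
    exact (hu.le_integral ha hx).trans (by nlinarith)
  · refine (hu.lip ha (fun x hx => hu.le_integral ha hx) hx hy).trans ?_
    refine mul_le_mul_of_nonneg_right ?_ (S.d_nonneg x y)
    nlinarith [Real.exp_pos a]

variable {S} in
lemma Cone.L_mem {u : X → ℝ} (hu : S.Cone S.a₀ u) : S.Cone (S.a₀ - 1) (S.L u) := by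
  have ha : 0 ≤ S.a₀ := by linarith [S.one_le_a₀]
  have hr := (hu.reg ha).branchwise
  have hs := S.summable_const ((Real.exp S.a₀ + S.a₀ * Real.exp S.a₀ * Real.exp S.a₀) * ∫ y, u y
      ∂S.m)
  refine ⟨fun x hx => tsum_nonneg fun i => mul_nonneg (S.J_nonneg i x hx)
    (hu.1 _ (S.maps i x hx)), fun x hx y hy => ?_⟩
  unfold L
  rw [← tsum_mul_left]
  refine (S.summable_L hr hs hx).tsum_le_tsum (fun i => ?_)
    ((S.summable_L hr hs hy).mul_left _)
  have h1 := S.J_dist i x hx y hy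
  have h2 := hu.2 _ (S.maps i x hx) _ (S.maps i y hy)
  have h3 := S.contr i x hx y hy
  have h4 := hu.1 _ (S.maps i y hy)
  have h5 := S.J_nonneg i y hy
  rw [← S.a₀_eq]
  simp only [smul_eq_mul]
  calc _ ≤ (Real.exp (S.Dc * S.d x y) * S.J i y) *
        (Real.exp (S.a₀ * S.d (S.ψ i x) (S.ψ i y)) * u (S.ψ i y)) :=
        mul_le_mul h1 h2 (hu.1 _ (S.maps i x hx)) (by positivity)
    _ ≤ (Real.exp (S.Dc * S.d x y) * S.J i y) *
        (Real.exp (S.a₀ * (S.κ * S.d x y)) * u (S.ψ i y)) := by gcongr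
    _ = _ := by
        rw [show (S.κ * S.a₀ + S.Dc) * S.d x y = S.Dc * S.d x y + S.a₀ * (S.κ * S.d x y) by ring,
          Real.exp_add]
        ring

variable {S} in
lemma Cone.sub_const {u : X → ℝ} (hu : S.Cone (S.a₀ - 1) u) :
    S.Cone S.a₀ (fun x => u x - S.δ * ∫ y, u y ∂S.m) := by
  have h1 := S.one_le_a₀
  have ha : 0 ≤ S.a₀ - 1 := by linarith
  have hI := hu.integral_nonneg
  have key : ∀ x ∈ S.D, S.a₀ * Real.exp S.a₀ * (S.δ * ∫ y, u y ∂S.m) ≤ u x := by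
    intro x hx
    have := hu.integral_le ha hx
    calc _ = Real.exp (-S.a₀) * ∫ y, u y ∂S.m := by
          rw [δ, show -(2 * S.a₀) = -S.a₀ + -S.a₀ by ring, Real.exp_add, Real.exp_neg]
          have := Real.exp_pos S.a₀
          field_simp
      _ ≤ Real.exp (-S.a₀) * (Real.exp (S.a₀ - 1) * u x) := by gcongr
      _ = Real.exp (-1) * u x := by rw [← mul_assoc, ← Real.exp_add]; ring_nf
      _ ≤ 1 * u x := by
          gcongr
          · exact hu.1 x hx
          · exact Real.exp_le_one_iff.2 (by norm_num)
      _ = u x := one_mul _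
  have hc : 0 ≤ S.δ * ∫ y, u y ∂S.m := mul_nonneg S.δ_pos.le hI
  set c := S.δ * ∫ y, u y ∂S.m
  refine ⟨fun x hx => ?_, fun x hx y hy => ?_⟩
  · have := key x hx
    have h2 := Real.one_le_exp (x := S.a₀) (by linarith)
    have : c ≤ S.a₀ * Real.exp S.a₀ * c := by
      have : 1 ≤ S.a₀ * Real.exp S.a₀ := by nlinarith
      nlinarith
    linarith
  · have hd := S.d_nonneg x y
    have h2 := hu.2 x hx y hy
    have h3 := key y hy
    have h4 : (Real.exp (S.a₀ * S.d x y) - 1) * c ≤ S.d x y * u y := by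
      have := exp_sub_one_le (t := S.a₀ * S.d x y)
      have h5 := S.exp_d_le (a := S.a₀) (by linarith) hx hy
      calc _ ≤ (S.a₀ * S.d x y * Real.exp S.a₀) * c := by
            refine mul_le_mul_of_nonneg_right (this.trans ?_) hc
            gcongr
        _ = S.d x y * (S.a₀ * Real.exp S.a₀ * c) := by ring
        _ ≤ _ := by gcongr
    have h6 : Real.exp ((S.a₀ - 1) * S.d x y) + S.d x y ≤ Real.exp (S.a₀ * S.d x y) := by
      rw [show S.a₀ * S.d x y = (S.a₀ - 1) * S.d x y + S.d x y by ring, Real.exp_add]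
      have := Real.add_one_le_exp (S.d x y)
      have := Real.one_le_exp (x := (S.a₀ - 1) * S.d x y) (by positivity)
      nlinarith
    have h7 := hu.1 y hy
    nlinarith

/-- Mean-zero functions written as differences of cone functions of mass at most `M`. -/
def Dec (M : ℝ) (v : X → ℂ) : Prop :=
  ∃ u₁ u₂ u₃ u₄ : X → ℝ, S.Cone S.a₀ u₁ ∧ S.Cone S.a₀ u₂ ∧ S.Cone S.a₀ u₃ ∧ S.Cone S.a₀ u₄ ∧
    ∫ x, u₁ x ∂S.m ≤ M ∧ ∫ x, u₃ x ∂S.m ≤ M ∧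
    ∫ x, u₂ x ∂S.m = ∫ x, u₁ x ∂S.m ∧ ∫ x, u₄ x ∂S.m = ∫ x, u₃ x ∂S.m ∧
    ∀ x ∈ S.D, v x = ((u₁ x - u₂ x : ℝ) : ℂ) + ((u₃ x - u₄ x : ℝ) : ℂ) * Complex.I

variable {S}

lemma Cone.add {a : ℝ} {u v : X → ℝ} (hu : S.Cone a u) (hv : S.Cone a v) :
    S.Cone a (fun x => u x + v x) :=
  ⟨fun x hx => add_nonneg (hu.1 x hx) (hv.1 x hx), fun x hx y hy => by
    have h1 := hu.2 x hx y hy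
    have h2 := hv.2 x hx y hy
    rw [mul_add]; linarith⟩

lemma Dec.congr {M : ℝ} {v v' : X → ℂ} (hv : S.Dec M v) (h : ∀ x ∈ S.D, v' x = v x) :
    S.Dec M v' := by
  obtain ⟨u₁, u₂, u₃, u₄, h1, h2, h3, h4, h5, h6, h7, h8, h9⟩ := hv
  exact ⟨u₁, u₂, u₃, u₄, h1, h2, h3, h4, h5, h6, h7, h8, fun x hx => (h x hx).trans (h9 x hx)⟩

lemma Dec.mono {M M' : ℝ} {v : X → ℂ} (hv : S.Dec M v) (h : M ≤ M') : S.Dec M' v := by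
  obtain ⟨u₁, u₂, u₃, u₄, h1, h2, h3, h4, h5, h6, h7⟩ := hv
  exact ⟨u₁, u₂, u₃, u₄, h1, h2, h3, h4, h5.trans h, h6.trans h, h7⟩

lemma Dec.add {M M' : ℝ} {v v' : X → ℂ} (hv : S.Dec M v) (hv' : S.Dec M' v') :
    S.Dec (M + M') (fun x => v x + v' x) := by
  have ha : 0 ≤ S.a₀ := by linarith [S.one_le_a₀]
  obtain ⟨u₁, u₂, u₃, u₄, h1, h2, h3, h4, h5, h6, h7, h8, h9⟩ := hv
  obtain ⟨w₁, w₂, w₃, w₄, k1, k2, k3, k4, k5, k6, k7, k8, k9⟩ := hv'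
  refine ⟨_, _, _, _, h1.add k1, h2.add k2, h3.add k3, h4.add k4, ?_, ?_, ?_, ?_, ?_⟩
  · rw [integral_add (h1.integrable ha) (k1.integrable ha)]; linarith
  · rw [integral_add (h3.integrable ha) (k3.integrable ha)]; linarith
  · rw [integral_add (h1.integrable ha) (k1.integrable ha),
      integral_add (h2.integrable ha) (k2.integrable ha)]; linarith
  · rw [integral_add (h3.integrable ha) (k3.integrable ha),
      integral_add (h4.integrable ha) (k4.integrable ha)]; linarith
  · intro x hx
    show v x + v' x = _
    rw [h9 x hx, k9 x hx]; push_cast; ring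

lemma Cone.integral_L [Countable ι] {u : X → ℝ} (hu : S.Cone S.a₀ u) :
    ∫ x, S.L u x ∂S.m = ∫ x, u x ∂S.m :=
  have ha : 0 ≤ S.a₀ := by linarith [S.one_le_a₀]
  FullBranch.integral_L S (hu.reg ha).branchwise (S.summable_const _) (hu.aesm ha)

lemma Dec.L_contract [Countable ι] {M : ℝ} {v : X → ℂ} (hv : S.Dec M v) :
    S.Dec ((1 - S.δ) * M) (S.L v) := by
  have h1a := S.one_le_a₀
  have ha : 0 ≤ S.a₀ := by linarith
  have hδ := S.δ_le_one
  obtain ⟨u₁, u₂, u₃, u₄, h1, h2, h3, h4, h5, h6, h7, h8, h9⟩ := hv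
  have hi : ∀ u : X → ℝ, S.Cone S.a₀ u →
      ∫ x, (S.L u x - S.δ * ∫ y, S.L u y ∂S.m) ∂S.m = (1 - S.δ) * ∫ x, u x ∂S.m := by
    intro u hu
    rw [integral_sub (hu.L_mem.integrable (by linarith)) (integrable_const _), hu.integral_L]
    simp; ring
  refine ⟨_, _, _, _, h1.L_mem.sub_const, h2.L_mem.sub_const, h3.L_mem.sub_const,
    h4.L_mem.sub_const, ?_, ?_, ?_, ?_, ?_⟩
  · rw [hi _ h1]; gcongr
  · rw [hi _ h3]; gcongr
  · rw [hi _ h1, hi _ h2, h7]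
  · rw [hi _ h3, hi _ h4, h8]
  · intro x hx
    have hs : ∀ u : X → ℝ, S.Cone S.a₀ u →
        HasSum (fun i => ((S.J i x * u (S.ψ i x) : ℝ) : ℂ)) ((S.L u x : ℝ) : ℂ) := fun u hu =>
      Complex.hasSum_ofReal.2
        (S.summable_L (hu.reg ha).branchwise (S.summable_const _) hx).hasSum
    have hsum := ((hs _ h1).sub (hs _ h2)).add (((hs _ h3).sub (hs _ h4)).mul_right Complex.I)
    rw [h1.integral_L, h2.integral_L, h3.integral_L, h4.integral_L, h7, h8]
    have : S.L v x = ((S.L u₁ x : ℝ) : ℂ) - (S.L u₂ x : ℝ)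
        + (((S.L u₃ x : ℝ) : ℂ) - (S.L u₄ x : ℝ)) * Complex.I := by
      rw [← hsum.tsum_eq]
      unfold L
      congr 1 with i
      rw [h9 _ (S.maps i x hx), Complex.real_smul]
      push_cast; ring
    rw [this]; push_cast; ring

variable (S) in
/-- The constant in `Dec.reg`. -/
def C₂ : ℝ := 4 * (Real.exp S.a₀ + S.a₀ * Real.exp S.a₀ * Real.exp S.a₀)

lemma C₂_pos : 0 < S.C₂ := by
  have := S.one_le_a₀
  unfold C₂; positivity

lemma Reg.mono {E : Type*} [NormedAddCommGroup E] {K K' : ℝ} {u : X → E} (hu : S.Reg K u)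
    (h : K ≤ K') : S.Reg K' u :=
  ⟨fun x hx => (hu.1 x hx).trans h, fun x hx y hy => (hu.2 x hx y hy).trans
    (mul_le_mul_of_nonneg_right h (S.d_nonneg x y))⟩

lemma Reg.congr {E : Type*} [NormedAddCommGroup E] {K : ℝ} {u u' : X → E} (hu : S.Reg K u)
    (h : ∀ x ∈ S.D, u' x = u x) : S.Reg K u' :=
  ⟨fun x hx => by rw [h x hx]; exact hu.1 x hx, fun x hx y hy => by
    rw [h x hx, h y hy]; exact hu.2 x hx y hy⟩

lemma Reg.add {E : Type*} [NormedAddCommGroup E] {K K' : ℝ} {u u' : X → E} (hu : S.Reg K u)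
    (hu' : S.Reg K' u') : S.Reg (K + K') (fun x => u x + u' x) :=
  ⟨fun x hx => (norm_add_le _ _).trans (add_le_add (hu.1 x hx) (hu'.1 x hx)), fun x hx y hy => by
    rw [add_sub_add_comm, add_mul]
    exact (norm_add_le _ _).trans (add_le_add (hu.2 x hx y hy) (hu'.2 x hx y hy))⟩

lemma Reg.const_mul {K : ℝ} {u : X → ℂ} (hu : S.Reg K u) (c : ℂ) :
    S.Reg (‖c‖ * K) (fun x => c * u x) :=
  ⟨fun x hx => by rw [norm_mul]; gcongr; exact hu.1 x hx, fun x hx y hy => by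
    rw [← mul_sub, norm_mul, mul_assoc]; gcongr; exact hu.2 x hx y hy⟩

lemma Reg.ofReal {K : ℝ} {u : X → ℝ} (hu : S.Reg K u) : S.Reg K (fun x => (u x : ℂ)) :=
  ⟨fun x hx => by rw [Complex.norm_real]; exact hu.1 x hx, fun x hx y hy => by
    rw [← Complex.ofReal_sub, Complex.norm_real]; exact hu.2 x hx y hy⟩

lemma Reg.aesm {K : ℝ} {u : X → ℂ} (hu : S.Reg K u) : AEStronglyMeasurable u S.m :=
  S.meas_reg u ⟨K, hu.2⟩

lemma Reg.nonneg {E : Type*} [NormedAddCommGroup E] {K : ℝ} {u : X → E} (hu : S.Reg K u) :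
    0 ≤ K := by
  obtain ⟨z, hz⟩ := S.nonempty_D
  exact (norm_nonneg _).trans (hu.1 z hz)

lemma Reg.integrable {K : ℝ} {u : X → ℂ} (hu : S.Reg K u) : Integrable u S.m :=
  Integrable.mono' (integrable_const K) hu.aesm
    (by filter_upwards [S.ae_mem] with x hx using hu.1 x hx)

lemma Reg.norm_integral_le {K : ℝ} {u : X → ℂ} (hu : S.Reg K u) : ‖∫ x, u x ∂S.m‖ ≤ K := by
  have := norm_integral_le_of_norm_le_const (μ := S.m) (C := K) (f := u)
    (by filter_upwards [S.ae_mem] with x hx using hu.1 x hx)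
  simpa using this

lemma Dec.reg {M : ℝ} {v : X → ℂ} (hv : S.Dec M v) : S.Reg (S.C₂ * M) v := by
  have h1a := S.one_le_a₀
  have ha : 0 ≤ S.a₀ := by linarith
  obtain ⟨u₁, u₂, u₃, u₄, h1, h2, h3, h4, h5, h6, h7, h8, h9⟩ := hv
  have hc : 0 ≤ Real.exp S.a₀ + S.a₀ * Real.exp S.a₀ * Real.exp S.a₀ := by positivity
  have r : ∀ u, S.Cone S.a₀ u → ∫ x, u x ∂S.m ≤ M →
      S.Reg ((Real.exp S.a₀ + S.a₀ * Real.exp S.a₀ * Real.exp S.a₀) * M) (fun x => (u x : ℂ)) :=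
    fun u hu hM => ((hu.reg ha).mono (mul_le_mul_of_nonneg_left hM hc)).ofReal
  have R := ((r _ h1 h5).add ((r _ h2 (h7 ▸ h5)).const_mul (-1))).add
    (((r _ h3 h6).add ((r _ h4 (h8 ▸ h6)).const_mul (-1))).const_mul Complex.I)
  refine (R.mono (le_of_eq ?_)).congr fun x hx => ?_
  · simp [C₂]; ring
  · rw [h9 x hx]; push_cast; ring

lemma Reg.re {K : ℝ} {v : X → ℂ} (hv : S.Reg K v) : S.Reg K (fun x => (v x).re) :=
  ⟨fun x hx => (Complex.abs_re_le_norm _).trans (hv.1 x hx), fun x hx y hy => by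
    rw [← Complex.sub_re]; exact (Complex.abs_re_le_norm _).trans (hv.2 x hx y hy)⟩

lemma Reg.im {K : ℝ} {v : X → ℂ} (hv : S.Reg K v) : S.Reg K (fun x => (v x).im) :=
  ⟨fun x hx => (Complex.abs_im_le_norm _).trans (hv.1 x hx), fun x hx y hy => by
    rw [← Complex.sub_im]; exact (Complex.abs_im_le_norm _).trans (hv.2 x hx y hy)⟩

lemma Reg.cone {K : ℝ} {u : X → ℝ} (hu : S.Reg K u) :
    S.Cone S.a₀ (fun x => u x + 2 * K) := by
  have h1a := S.one_le_a₀
  have hK := hu.nonneg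
  refine ⟨fun x hx => ?_, fun x hx y hy => ?_⟩
  · have := abs_le.1 (hu.1 x hx); linarith
  · have h1 := abs_le.1 (hu.1 y hy)
    have h2 := (abs_le.1 (hu.2 x hx y hy)).2
    have h3 := Real.add_one_le_exp (S.a₀ * S.d x y)
    have hd := S.d_nonneg x y
    have h4 : 1 + S.d x y ≤ Real.exp (S.a₀ * S.d x y) := by nlinarith
    nlinarith

lemma cone_const {a K : ℝ} (ha : 0 ≤ a) (hK : 0 ≤ K) : S.Cone a (fun _ => K) :=
  ⟨fun _ _ => hK, fun x _ y _ => by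
    have := Real.one_le_exp (mul_nonneg ha (S.d_nonneg x y))
    nlinarith⟩

lemma Reg.dec {K : ℝ} {v : X → ℂ} (hv : S.Reg K v) (h0 : ∫ x, v x ∂S.m = 0) :
    S.Dec (2 * K) v := by
  have hK := hv.nonneg
  have ha : 0 ≤ S.a₀ := by linarith [S.one_le_a₀]
  have hi := hv.integrable
  have hre : ∫ x, ((v x).re + 2 * K) ∂S.m = 2 * K := by
    have h : ∫ x, (v x).re ∂S.m = (∫ x, v x ∂S.m).re := integral_re hi
    have hir : Integrable (fun x => (v x).re) S.m := hi.re
    rw [integral_add hir (integrable_const _), h, h0]; simp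
  have him : ∫ x, ((v x).im + 2 * K) ∂S.m = 2 * K := by
    have h : ∫ x, (v x).im ∂S.m = (∫ x, v x ∂S.m).im := integral_im hi
    have hir : Integrable (fun x => (v x).im) S.m := hi.im
    rw [integral_add hir (integrable_const _), h, h0]; simp
  refine ⟨_, fun _ => 2 * K, _, fun _ => 2 * K, hv.re.cone, cone_const ha (by linarith),
    hv.im.cone, cone_const ha (by linarith), hre.le, him.le, ?_, ?_, fun x _ => ?_⟩
  · rw [hre]; simp
  · rw [him]; simp
  · simp

end FullBranch

namespace FullBranch

variable {X ι : Type*} [MeasurableSpace X] {S : FullBranch X ι}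

lemma L_add {U U' : ι → ℝ} {u u' : X → ℂ} (hu : S.Branchwise U u)
    (hU : Summable fun i => S.j i * U i) (hu' : S.Branchwise U' u')
    (hU' : Summable fun i => S.j i * U' i) {x : X} (hx : x ∈ S.D) :
    S.L (fun x => u x + u' x) x = S.L u x + S.L u' x := by
  unfold L
  rw [← (S.summable_L hu hU hx).tsum_add (S.summable_L hu' hU' hx)]
  simp only [smul_add]

lemma L_const_mul (c : ℂ) (u : X → ℂ) (x : X) :
    S.L (fun x => c * u x) x = c * S.L u x := by
  unfold L
  rw [← tsum_mul_left]
  congr 1 with i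
  rw [mul_smul_comm]

lemma L_ofReal (u : X → ℝ) (x : X) : S.L (fun x => (u x : ℂ)) x = (S.L u x : ℝ) := by
  unfold L
  rw [Complex.ofReal_tsum]
  congr 1 with i
  simp

/-- An invariant probability density with a regular version `h`. -/
structure Density (S : FullBranch X ι) (h : X → ℝ) (K₀ : ℝ) : Prop where
  reg : S.Reg K₀ h
  mass : ∫ x, h x ∂S.m = 1
  inv : ∀ x ∈ S.D, S.L h x = h x

lemma Density.lower_bound [Countable ι] {h : X → ℝ} {K₀ : ℝ} (hh : S.Density h K₀) {x : X}
    (hx : x ∈ S.D) : Real.exp (-S.a₀) ≤ h x := by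
  have ha : 0 ≤ S.a₀ := by linarith [S.one_le_a₀]
  have hδ := S.δ_le_one
  have hδ' := S.δ_pos
  have key : ∀ n : ℕ, ∃ g : X → ℝ, S.Cone S.a₀ g ∧ ∫ x, g x ∂S.m = 1 ∧
      S.Dec ((1 - S.δ) ^ n * (2 * (1 + K₀))) (fun x => ((g x : ℝ) : ℂ) - (h x : ℝ)) := by
    intro n
    induction n with
    | zero =>
      refine ⟨fun _ => 1, cone_const ha zero_le_one, by simp, ?_⟩
      rw [pow_zero, one_mul]
      have h1 : S.Reg 1 (fun _ : X => (1 : ℂ)) :=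
        ⟨fun x _ => by simp, fun x _ y _ => by simp [S.d_nonneg]⟩
      have r : S.Reg (1 + K₀) (fun x => (((1 : ℝ)) : ℂ) - (h x : ℝ)) := by
        have := h1.add (hh.reg.ofReal.const_mul (-1))
        refine (this.mono (by simp)).congr fun x _ => ?_
        push_cast; ring
      refine r.dec ?_
      rw [integral_sub (integrable_const _) hh.reg.ofReal.integrable,
        integral_complex_ofReal (f := h), hh.mass]
      simp
    | succ n ih =>
      obtain ⟨g, hg, hg1, hd⟩ := ih
      have c := hg.L_mem
      refine ⟨S.L g, ⟨c.1, fun x hx y hy => (c.2 x hx y hy).trans ?_⟩,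
        hg.integral_L.trans hg1, ?_⟩
      · refine mul_le_mul_of_nonneg_right (Real.exp_le_exp.2 ?_) (c.1 y hy)
        nlinarith [S.d_nonneg x y]
      · rw [pow_succ', mul_assoc]
        refine hd.L_contract.congr fun x hx => ?_
        have r1 := (hg.reg ha).ofReal.branchwise
        have r2 := (hh.reg.ofReal.const_mul (-1)).branchwise
        have := L_add r1 (S.summable_const _) r2 (S.summable_const _) hx
        rw [L_const_mul, L_ofReal, L_ofReal, hh.inv x hx] at this
        rw [show S.L (fun x => ((g x : ℝ) : ℂ) - (h x : ℝ)) x =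
          S.L (fun x => (g x : ℂ) + -1 * (h x : ℂ)) x by congr 1; ext x; ring, this]
        ring
  have hlim : Tendsto (fun n : ℕ => Real.exp (-S.a₀) - S.C₂ * ((1 - S.δ) ^ n * (2 * (1 + K₀))))
      atTop (𝓝 (Real.exp (-S.a₀) - S.C₂ * (0 * (2 * (1 + K₀))))) := by
    refine tendsto_const_nhds.sub (Tendsto.const_mul _ (Tendsto.mul_const _ ?_))
    exact tendsto_pow_atTop_nhds_zero_of_lt_one (by linarith) (by linarith)
  rw [zero_mul, mul_zero, sub_zero] at hlim
  refine le_of_tendsto' hlim fun n => ?_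
  obtain ⟨g, hg, hg1, hd⟩ := key n
  have h1 := hg.integral_le ha hx
  rw [hg1] at h1
  have h2 : ‖(g x : ℂ) - (h x : ℝ)‖ ≤ _ := hd.reg.1 x hx
  rw [← Complex.ofReal_sub, Complex.norm_real] at h2
  have h3 := (abs_le.1 h2).2
  have h4 : Real.exp (-S.a₀) ≤ g x := by
    rw [Real.exp_neg]
    have := Real.exp_pos S.a₀
    rw [inv_le_iff_one_le_mul₀ this]; linarith
  linarith

section Perturbed

variable (S) in
/-- The twisted transfer operator. -/
def Lt (v : X → ℝ) (t : ℝ) (u : X → ℂ) : X → ℂ :=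
  S.L (fun x => Complex.exp (Complex.I * (t * v x : ℝ)) * u x)

lemma norm_exp_sub_le (a b : ℝ) :
    ‖Complex.exp (Complex.I * a) - Complex.exp (Complex.I * b)‖ ≤ |a - b| := by
  have : Complex.exp (Complex.I * a) - Complex.exp (Complex.I * b) =
      Complex.exp (Complex.I * b) * (Complex.exp (Complex.I * (a - b : ℝ)) - 1) := by
    rw [mul_sub, ← Complex.exp_add]; push_cast; ring_nf
  rw [this, norm_mul, mul_comm Complex.I (b : ℂ), Complex.norm_exp_ofReal_mul_I, one_mul]
  exact Real.norm_exp_I_mul_ofReal_sub_one_le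

lemma norm_exp_I_mul (a : ℝ) : ‖Complex.exp (Complex.I * a)‖ = 1 := by
  rw [mul_comm, Complex.norm_exp_ofReal_mul_I]

variable {V : ι → ℝ} {v : X → ℝ}

lemma Branchwise.perturb (hv : S.Branchwise V v) {K : ℝ} {u : X → ℂ}
    (hu : S.Branchwise (fun _ => K) u) (t : ℝ) :
    S.Branchwise (fun i => 2 * |t| * K * V i)
      (fun x => (Complex.exp (Complex.I * (t * v x : ℝ)) - 1) * u x) := by
  have key : ∀ i, ∀ x ∈ S.D, ‖Complex.exp (Complex.I * (t * v (S.ψ i x) : ℝ)) - 1‖ ≤ |t| * V i := by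
    intro i x hx
    refine Real.norm_exp_I_mul_ofReal_sub_one_le.trans ?_
    rw [norm_mul]
    exact mul_le_mul_of_nonneg_left (hv.1 i x hx) (abs_nonneg t)
  have hVK : ∀ i, ∀ x ∈ S.D, 0 ≤ V i ∧ 0 ≤ K := fun i x hx =>
    ⟨(norm_nonneg _).trans (hv.1 i x hx), (norm_nonneg _).trans (hu.1 i x hx)⟩
  refine ⟨fun i x hx => ?_, fun i x hx y hy => ?_⟩
  · obtain ⟨h0, h1⟩ := hVK i x hx
    rw [norm_mul]
    have := mul_le_mul (key i x hx) (hu.1 i x hx) (norm_nonneg _) (by positivity)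
    have h3 : 0 ≤ |t| * V i * K := by positivity
    linarith
  · obtain ⟨h0, h1⟩ := hVK i x hx
    have hd := S.d_nonneg x y
    set e := fun x => Complex.exp (Complex.I * (t * v x : ℝ)) with he
    have e1 : (e (S.ψ i x) - 1) * u (S.ψ i x) - (e (S.ψ i y) - 1) * u (S.ψ i y) =
      (e (S.ψ i x) - e (S.ψ i y)) * u (S.ψ i x)
        + (e (S.ψ i y) - 1) * (u (S.ψ i x) - u (S.ψ i y)) := by ring
    have e2 : ‖e (S.ψ i x) - e (S.ψ i y)‖ ≤ |t| * (V i * S.d x y) := by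
      refine (norm_exp_sub_le _ _).trans ?_
      rw [← mul_sub, abs_mul]
      exact mul_le_mul_of_nonneg_left (hv.2 i x hx y hy) (abs_nonneg t)
    change ‖(e (S.ψ i x) - 1) * u (S.ψ i x) - (e (S.ψ i y) - 1) * u (S.ψ i y)‖ ≤ _
    rw [e1]
    refine (norm_add_le _ _).trans ?_
    rw [norm_mul, norm_mul]
    have := mul_le_mul e2 (hu.1 i x hx) (norm_nonneg _) (by positivity)
    have := mul_le_mul (key i y hy) (hu.2 i x hx y hy) (norm_nonneg _) (by positivity)
    linarith

/-- The mean of the branchwise constants. -/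
def vbar (S : FullBranch X ι) (V : ι → ℝ) : ℝ := ∑' i, S.j i * V i

lemma Branchwise.vbar_nonneg (hv : S.Branchwise V v) : 0 ≤ S.vbar V := by
  obtain ⟨z, hz⟩ := S.nonempty_D
  exact tsum_nonneg fun i => mul_nonneg (S.j_nonneg i) ((norm_nonneg _).trans (hv.1 i z hz))

lemma summable_perturb (hV : Summable fun i => S.j i * V i) (c : ℝ) :
    Summable fun i => S.j i * (c * V i) :=
  (hV.mul_left c).congr fun i => by ring

lemma Branchwise.reg_perturb (hv : S.Branchwise V v) (hV : Summable fun i => S.j i * V i)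
    {K : ℝ} {u : X → ℂ} (hu : S.Branchwise (fun _ => K) u) (t : ℝ) :
    S.Reg (2 * S.C₁ * S.vbar V * |t| * K)
      (S.L fun x => (Complex.exp (Complex.I * (t * v x : ℝ)) - 1) * u x) := by
  refine (S.L_reg (hv.perturb hu t) (summable_perturb hV _)).mono (le_of_eq ?_)
  unfold vbar
  rw [show (fun i => S.j i * (2 * |t| * K * V i)) = fun i => (2 * |t| * K) * (S.j i * V i) by
    ext i; ring, tsum_mul_left]
  ring

lemma Branchwise.Lt_eq (hv : S.Branchwise V v) (hV : Summable fun i => S.j i * V i)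
    {K : ℝ} {u : X → ℂ} (hu : S.Branchwise (fun _ => K) u) (t : ℝ) {x : X} (hx : x ∈ S.D) :
    S.Lt v t u x =
      S.L u x + S.L (fun x => (Complex.exp (Complex.I * (t * v x : ℝ)) - 1) * u x) x := by
  rw [← L_add hu (S.summable_const _) (hv.perturb hu t) (summable_perturb hV _) hx]
  unfold Lt
  congr 1; ext x; ring

lemma Branchwise.reg_Lt (hv : S.Branchwise V v) (hV : Summable fun i => S.j i * V i)
    {K : ℝ} {u : X → ℂ} (hu : S.Branchwise (fun _ => K) u) (t : ℝ) :
    S.Reg (S.C₁ * K + 2 * S.C₁ * S.vbar V * |t| * K) (S.Lt v t u) := by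
  have h1 := S.L_reg hu (S.summable_const _)
  rw [S.tsum_j_mul] at h1
  exact (h1.add (hv.reg_perturb hV hu t)).congr fun x hx => hv.Lt_eq hV hu t hx

lemma Branchwise.twist (hv : S.Branchwise V v) (hV : Summable fun i => S.j i * V i)
    {K : ℝ} {u : X → ℂ} (hu : S.Branchwise (fun _ => K) u) (t : ℝ) :
    ∃ W : ι → ℝ, (Summable fun i => S.j i * W i) ∧
      S.Branchwise W (fun x => Complex.exp (Complex.I * (t * v x : ℝ)) * u x) := by
  have p := hv.perturb hu t
  refine ⟨fun i => K + 2 * |t| * K * V i, ?_, ?_, ?_⟩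
  · simpa [mul_add] using (S.summable_const K).add (summable_perturb hV (2 * |t| * K))
  · intro i x hx
    have h1 := p.1 i x hx
    have h2 := hu.1 i x hx
    have : ∀ e w : ℂ, e * w = w + (e - 1) * w := fun e w => by ring
    simp only []
    rw [this]
    exact (norm_add_le _ _).trans (add_le_add h2 h1)
  · intro i x hx y hy
    have h1 := p.2 i x hx y hy
    have h2 := hu.2 i x hx y hy
    have : ∀ e w e' w' : ℂ, e * w - e' * w' = (w - w') + ((e - 1) * w - (e' - 1) * w') :=
      fun e w e' w' => by ring
    rw [this, add_mul]
    exact (norm_add_le _ _).trans (add_le_add h2 h1)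

variable (S) in
lemma measurable_birkhoffSum (hvm : Measurable v) (N : ℕ) :
    Measurable (birkhoffSum S.F v N) := by
  unfold birkhoffSum
  exact Finset.measurable_sum _ fun k _ => hvm.comp (S.meas_F.iterate k)

lemma measurable_cexp_mul {w : X → ℝ} (hw : Measurable w) (t : ℝ) :
    Measurable fun x => Complex.exp (Complex.I * (t * w x : ℝ)) := by
  fun_prop

lemma integral_Lt_mul [Countable ι] (hv : S.Branchwise V v) (hV : Summable fun i => S.j i * V i)
    (hvm : Measurable v) {K : ℝ} {u : X → ℂ} (hu : S.Branchwise (fun _ => K) u)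
    (hum : AEStronglyMeasurable u S.m) (t : ℝ) (N : ℕ) :
    ∫ x, S.Lt v t u x * Complex.exp (Complex.I * (t * birkhoffSum S.F v N x : ℝ)) ∂S.m =
      ∫ x, u x * Complex.exp (Complex.I * (t * birkhoffSum S.F v (N + 1) x : ℝ)) ∂S.m := by
  obtain ⟨W, hW, hW'⟩ := hv.twist hV hu t
  unfold Lt
  rw [S.integral_L_mul hW' hW ((measurable_cexp_mul hvm t).aestronglyMeasurable.mul hum)
    (measurable_cexp_mul (S.measurable_birkhoffSum hvm N) t) (B := 1)
    (fun x => (norm_exp_I_mul _).le)]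
  congr 1 with x
  rw [birkhoffSum_succ', mul_add, Complex.ofReal_add, mul_add, Complex.exp_add]
  ring

/-- The iterated twisted operator computes characteristic functions. -/
lemma integral_Lt_iterate [Countable ι] (hv : S.Branchwise V v)
    (hV : Summable fun i => S.j i * V i)
    (hvm : Measurable v) (t : ℝ) (N : ℕ) : ∀ {K : ℝ} {u : X → ℂ}, S.Reg K u →
    (∃ K', S.Reg K' ((S.Lt v t)^[N] u)) ∧ ∫ x, (S.Lt v t)^[N] u x ∂S.m =
      ∫ x, u x * Complex.exp (Complex.I * (t * birkhoffSum S.F v N x : ℝ)) ∂S.m := by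
  induction N with
  | zero => intro K u hu; exact ⟨⟨K, hu⟩, by simp⟩
  | succ N ih =>
    intro K u hu
    have h := ih (hv.reg_Lt hV hu.branchwise t)
    rw [Function.iterate_succ_apply]
    refine ⟨h.1, h.2.trans ?_⟩
    exact integral_Lt_mul hv hV hvm hu.branchwise hu.aesm t N

lemma norm_integral_mul_le {K : ℝ} {u w : X → ℂ} (hu : ∀ x ∈ S.D, ‖u x‖ ≤ K)
    (hw : ∀ x, ‖w x‖ ≤ 1) : ‖∫ x, u x * w x ∂S.m‖ ≤ K := by
  have := norm_integral_le_of_norm_le_const (μ := S.m) (C := K) (f := fun x => u x * w x)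
    (by
      filter_upwards [S.ae_mem] with x hx
      rw [norm_mul]
      have h1 := hu x hx
      have h2 := hw x
      have h3 := norm_nonneg (u x)
      nlinarith [norm_nonneg (w x)])
  simpa using this

/-- Quasi-multiplicativity of characteristic functions of Birkhoff sums. -/
theorem charFun_approx [Countable ι] {h : X → ℝ} {K₀ : ℝ} (hh : S.Density h K₀)
    (hv : S.Branchwise V v) (hV : Summable fun i => S.j i * V i) (hvm : Measurable v) :
    ∃ C : ℝ, 0 ≤ C ∧ ∀ (K : ℝ) (u : X → ℂ), S.Reg K u → ∀ (t : ℝ) (N : ℕ),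
      ‖(∫ x, u x * Complex.exp (Complex.I * (t * birkhoffSum S.F v N x : ℝ)) ∂S.m) -
        (∫ x, h x * Complex.exp (Complex.I * (t * v x : ℝ)) ∂S.m) ^ N * ∫ x, u x ∂S.m‖ ≤
      C * K * (|t| + N * t ^ 2) := by
  have hδ := S.δ_pos
  have hδ1 := S.δ_le_one
  have hC1 := S.C₁_pos
  have hC2 := C₂_pos (S := S)
  have hvb := hv.vbar_nonneg
  have hK0 := hh.reg.nonneg
  set c₀ : ℝ := 2 * S.C₁ * S.vbar V with hc₀
  set c₁ : ℝ := 2 * c₀ * (1 + K₀) * (S.C₂ + K₀) with hc₁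
  set c₂ : ℝ := c₀ * S.C₂ with hc₂
  set B : ℝ := 2 * (1 + K₀) with hB
  set E : ℝ := 2 * c₁ / S.δ with hE
  set r : ℝ := 1 - S.δ / 2 with hr
  have c0' : 0 ≤ c₀ := by positivity
  have c1' : 0 ≤ c₁ := by positivity
  have c2' : 0 ≤ c₂ := by positivity
  have B' : 0 ≤ B := by positivity
  have E' : 0 ≤ E := by positivity
  refine ⟨c₂ * (B * (2 / S.δ) + E) + 4 * c₁ / S.δ, by positivity, ?_⟩
  intro K u hu t N
  have hK := hu.nonneg
  have hhb := hh.reg.ofReal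
  set φ : ℂ := ∫ x, h x * Complex.exp (Complex.I * (t * v x : ℝ)) ∂S.m with hφ
  have hφ1 : ‖φ‖ ≤ 1 := by
    refine (norm_integral_le_integral_norm _).trans (le_of_eq ?_)
    rw [← hh.mass]
    refine integral_congr_ae ?_
    filter_upwards [S.ae_mem] with x hx
    rw [norm_mul, norm_exp_I_mul, mul_one, Complex.norm_real, Real.norm_of_nonneg]
    exact (Real.exp_pos _).le.trans (hh.lower_bound hx)
  have habs : ∀ n : ℕ, ‖∫ x, (S.Lt v t)^[n] u x ∂S.m‖ ≤ K := fun n => by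
    rw [(integral_Lt_iterate hv hV hvm t n hu).2]
    exact norm_integral_mul_le hu.1 fun x => (norm_exp_I_mul _).le
  rw [← (integral_Lt_iterate hv hV hvm t N hu).2]
  by_cases hct : S.δ / 2 < c₁ * |t|
  · have h1 : ‖∫ x, (S.Lt v t)^[N] u x ∂S.m - φ ^ N * ∫ x, u x ∂S.m‖ ≤ K + 1 * K := by
      refine (norm_sub_le _ _).trans (add_le_add (habs N) ?_)
      rw [norm_mul]
      refine mul_le_mul ?_ hu.norm_integral_le (norm_nonneg _) zero_le_one
      rw [norm_pow]; exact pow_le_one₀ (norm_nonneg _) hφ1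
    have h2 : 1 ≤ 2 * c₁ / S.δ * |t| := by
      rw [div_mul_eq_mul_div, one_le_div hδ]; linarith
    have h3 : 0 ≤ c₂ * (B * (2 / S.δ) + E) * K * (|t| + N * t ^ 2) := by positivity
    have h4 : 0 ≤ 4 * c₁ / S.δ * K * (N * t ^ 2) := by positivity
    have h5 : K + 1 * K ≤ 4 * c₁ / S.δ * K * |t| := by
      have : 2 * K * 1 ≤ 2 * K * (2 * c₁ / S.δ * |t|) := by gcongr
      calc _ = 2 * K * 1 := by ring
        _ ≤ _ := this
        _ = _ := by ring
    calc _ ≤ _ := h1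
      _ ≤ _ := h5
      _ ≤ _ := by nlinarith
  push Not at hct
  have hr0 : 0 ≤ r := by rw [hr]; linarith
  -- one step of the recursion
  have dec : ∀ n : ℕ, S.Dec (K * (B * r ^ n + E * |t|))
      (fun x => (S.Lt v t)^[n] u x - (∫ x, (S.Lt v t)^[n] u x ∂S.m) * h x) := by
    intro n
    induction n with
    | zero =>
      have r0 : S.Reg (K * (1 + K₀)) (fun x => u x - (∫ x, u x ∂S.m) * h x) := by
        refine ((hu.add (hhb.const_mul (-(∫ x, u x ∂S.m)))).mono ?_).congr fun x _ => by ring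
        rw [norm_neg, mul_add, mul_one]
        gcongr
        exact hu.norm_integral_le
      refine (r0.dec ?_).mono ?_
      · rw [integral_sub hu.integrable (hhb.integrable.const_mul _), integral_const_mul,
          integral_complex_ofReal, hh.mass]
        simp
      · rw [pow_zero, hB]
        have : 0 ≤ K * (E * |t|) := by positivity
        linarith
    | succ n ih =>
      obtain ⟨Kn, hKn⟩ := (integral_Lt_iterate hv hV hvm t n hu).1
      have hab := habs n
      rw [Function.iterate_succ_apply'] at *
      set w := (S.Lt v t)^[n] u with hw
      set a := ∫ x, w x ∂S.m with ha
      set M := K * (B * r ^ n + E * |t|) with hM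
      have hM0 : 0 ≤ M := by positivity
      have hwr : S.Reg (S.C₂ * M + K * K₀) w := by
        refine ((ih.reg.add (hhb.const_mul a)).mono ?_).congr fun x _ => by ring
        gcongr
      set g := S.L (fun x => (Complex.exp (Complex.I * (t * v x : ℝ)) - 1) * w x) with hg
      have hgr := hv.reg_perturb hV hwr.branchwise t
      rw [← hg, ← hc₀] at hgr
      have hLw : ∀ x ∈ S.D, S.Lt v t w x = S.L w x + g x := fun x hx =>
        hv.Lt_eq hV hwr.branchwise t hx
      have hLwr := S.L_reg hwr.branchwise (S.summable_const _)
      have hintb : ∫ x, S.Lt v t w x ∂S.m = a + ∫ x, g x ∂S.m := by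
        rw [integral_congr_ae (g := fun x => S.L w x + g x)
          (by filter_upwards [S.ae_mem] with x hx using hLw x hx),
          integral_add hLwr.integrable hgr.integrable,
          S.integral_L hwr.branchwise (S.summable_const _) hwr.aesm]
      have hLv : ∀ x ∈ S.D, S.L (fun x => w x - a * h x) x = S.L w x - a * h x := by
        intro x hx
        have := L_add hwr.branchwise (S.summable_const _) (hhb.const_mul (-a)).branchwise
          (S.summable_const _) hx
        rw [L_const_mul, L_ofReal, hh.inv x hx] at this
        rw [show (fun x => w x - a * h x) = fun x => w x + -a * (h x : ℂ) by ext x; ring, this]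
        ring
      set γ := c₀ * |t| * (S.C₂ * M + K * K₀) with hγ
      have hγ0 : 0 ≤ γ := by positivity
      have r0 : S.Reg (γ * (1 + K₀)) (fun x => g x - (∫ x, g x ∂S.m) * h x) := by
        refine ((hgr.add (hhb.const_mul (-(∫ x, g x ∂S.m)))).mono ?_).congr fun x _ => by ring
        rw [norm_neg, mul_add, mul_one]
        gcongr
        exact hgr.norm_integral_le
      have d0 := r0.dec (by
        rw [integral_sub hgr.integrable (hhb.integrable.const_mul _), integral_const_mul,
          integral_complex_ofReal, hh.mass]
        simp)
      refine ((ih.L_contract.add d0).mono ?_).congr fun x hx => ?_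
      · have e1 : 2 * (γ * (1 + K₀)) ≤ c₁ * |t| * (M + K) := by
          rw [hγ, hc₁]
          have : S.C₂ * M + K * K₀ ≤ (S.C₂ + K₀) * (M + K) := by nlinarith [mul_nonneg hC2.le hK]
          calc _ = 2 * c₀ * (1 + K₀) * |t| * (S.C₂ * M + K * K₀) := by ring
            _ ≤ 2 * c₀ * (1 + K₀) * |t| * ((S.C₂ + K₀) * (M + K)) := by gcongr
            _ = _ := by ring
        have e2 : c₁ * |t| * M ≤ S.δ / 2 * M := by gcongr
        have e3 : K * (B * r ^ (n + 1) + E * |t|) = r * M + c₁ * |t| * K := by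
          rw [hM, pow_succ, hr, hE]; field_simp; ring
        rw [e3, hr]
        nlinarith
      · rw [hLw x hx, hLv x hx, hintb]
        ring
  have step : ∀ n : ℕ, ‖∫ x, (S.Lt v t)^[n + 1] u x ∂S.m - φ * ∫ x, (S.Lt v t)^[n] u x ∂S.m‖ ≤
      c₂ * |t| * (K * (B * r ^ n + E * |t|)) := by
    intro n
    obtain ⟨Kn, hKn⟩ := (integral_Lt_iterate hv hV hvm t n hu).1
    have hd := (dec n).reg
    rw [Function.iterate_succ_apply']
    set w := (S.Lt v t)^[n] u with hw
    set a := ∫ x, w x ∂S.m with ha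
    set M := K * (B * r ^ n + E * |t|) with hM
    have hp := hv.perturb hd.branchwise t
    have hgr := hv.reg_perturb hV hd.branchwise t
    have em := measurable_cexp_mul hvm t
    have hd0 : ∫ x, (w x - a * h x) ∂S.m = 0 := by
      rw [integral_sub hKn.integrable (hhb.integrable.const_mul _), integral_const_mul,
        integral_complex_ofReal, hh.mass]
      simp [ha]
    have hbd : ∀ {K : ℝ} {u : X → ℂ}, S.Reg K u →
        Integrable (fun x => Complex.exp (Complex.I * (t * v x : ℝ)) * u x) S.m := fun hu =>
      hu.integrable.bdd_mul em.aestronglyMeasurable (ae_of_all _ fun x => (norm_exp_I_mul _).le)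
    have e1 : ∫ x, S.Lt v t w x ∂S.m = ∫ x, Complex.exp (Complex.I * (t * v x : ℝ)) * w x ∂S.m := by
      obtain ⟨W, hW, hW'⟩ := hv.twist hV hKn.branchwise t
      exact S.integral_L hW' hW (em.aestronglyMeasurable.mul hKn.aesm)
    have e2 : ∫ x, S.Lt v t w x ∂S.m - φ * a =
        ∫ x, (Complex.exp (Complex.I * (t * v x : ℝ)) - 1) * (w x - a * h x) ∂S.m := by
      have : ∀ x, (Complex.exp (Complex.I * (t * v x : ℝ)) - 1) * (w x - a * h x) =
          (Complex.exp (Complex.I * (t * v x : ℝ)) * w x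
          - a * (Complex.exp (Complex.I * (t * v x : ℝ)) * h x)) - (w x - a * h x) :=
        fun x => by ring
      simp_rw [this]
      have i1 : Integrable (fun x => Complex.exp (Complex.I * (t * v x : ℝ)) * w x
          - a * (Complex.exp (Complex.I * (t * v x : ℝ)) * h x)) S.m :=
        (hbd hKn).sub ((hbd hhb).const_mul a)
      rw [integral_sub i1 hd.integrable, hd0,
        integral_sub (hbd hKn) ((hbd hhb).const_mul a), integral_const_mul, e1, hφ]
      simp_rw [mul_comm (h _ : ℂ)]
      ring
    rw [e2, ← S.integral_L hp (summable_perturb hV _)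
      ((em.sub_const 1).aestronglyMeasurable.mul hd.aesm)]
    refine hgr.norm_integral_le.trans (le_of_eq ?_)
    rw [hc₂, hc₀]; ring
  have main : ∀ n : ℕ, ‖∫ x, (S.Lt v t)^[n] u x ∂S.m - φ ^ n * ∫ x, u x ∂S.m‖ ≤
      c₂ * |t| * K * (B * (2 / S.δ) * (1 - r ^ n) + n * (E * |t|)) := by
    intro n
    induction n with
    | zero => simp
    | succ n ih =>
      have e : ∫ x, (S.Lt v t)^[n + 1] u x ∂S.m - φ ^ (n + 1) * ∫ x, u x ∂S.m =
        (∫ x, (S.Lt v t)^[n + 1] u x ∂S.m - φ * ∫ x, (S.Lt v t)^[n] u x ∂S.m) +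
        φ * (∫ x, (S.Lt v t)^[n] u x ∂S.m - φ ^ n * ∫ x, u x ∂S.m) := by ring
      rw [e]
      refine (norm_add_le _ _).trans ?_
      rw [norm_mul]
      have h1 : ‖φ‖ * ‖∫ x, (S.Lt v t)^[n] u x ∂S.m - φ ^ n * ∫ x, u x ∂S.m‖ ≤
          1 * (c₂ * |t| * K * (B * (2 / S.δ) * (1 - r ^ n) + n * (E * |t|))) := by
        gcongr
      refine (add_le_add (step n) h1).trans (le_of_eq ?_)
      rw [pow_succ, hr]; push_cast; field_simp; ring
  refine (main N).trans ?_
  have hrN : 0 ≤ r ^ N := pow_nonneg hr0 N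
  calc c₂ * |t| * K * (B * (2 / S.δ) * (1 - r ^ N) + N * (E * |t|))
      ≤ c₂ * |t| * K * (B * (2 / S.δ) * 1 + N * (E * |t|)) := by gcongr; linarith
    _ = c₂ * K * (B * (2 / S.δ) * |t| + E * (N * t ^ 2)) := by rw [← sq_abs t]; ring
    _ ≤ c₂ * K * ((B * (2 / S.δ) + E) * (|t| + N * t ^ 2)) := by
        have : 0 ≤ E * |t| := by positivity
        have : 0 ≤ B * (2 / S.δ) * (N * t ^ 2) := by positivity
        gcongr; linarith
    _ ≤ _ := by
        have : 0 ≤ 4 * c₁ / S.δ * K * (|t| + N * t ^ 2) := by positivity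
        linarith

end Perturbed

end FullBranch

namespace LSV

/-- The left branch of the LSV map. -/
def gl (a x : ℝ) : ℝ := x * (1 + (2 : ℝ) ^ a * x ^ a)

/-- The derivative of the left branch. -/
def gl' (a x : ℝ) : ℝ := 1 + (1 + a) * ((2 : ℝ) ^ a * x ^ a)

/-- The inverse of the left branch. -/
def ginv (a y : ℝ) : ℝ := Function.invFunOn (gl a) (Ici 0) (max y 0)

section
variable {a : ℝ}

lemma two_rpow_mul_nonneg {x : ℝ} (hx : 0 ≤ x) : 0 ≤ (2 : ℝ) ^ a * x ^ a := by positivity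

lemma two_rpow_mul_mono (ha : 0 < a) {x y : ℝ} (hx : 0 ≤ x) (h : x ≤ y) :
    (2 : ℝ) ^ a * x ^ a ≤ (2 : ℝ) ^ a * y ^ a :=
  mul_le_mul_of_nonneg_left (Real.rpow_le_rpow hx h ha.le) (by positivity)

lemma gl'_pos (ha : 0 < a) {x : ℝ} (hx : 0 ≤ x) : 0 < gl' a x := by
  have := two_rpow_mul_nonneg (a := a) hx
  unfold gl'; positivity

lemma gl'_mono (ha : 0 < a) {x y : ℝ} (hx : 0 ≤ x) (h : x ≤ y) : gl' a x ≤ gl' a y := by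
  have := two_rpow_mul_mono ha hx h
  unfold gl'; gcongr

lemma gl_zero : gl a 0 = 0 := by simp [gl]

lemma le_gl {x : ℝ} (hx : 0 ≤ x) : x ≤ gl a x := by
  have := two_rpow_mul_nonneg (a := a) hx
  unfold gl; nlinarith

lemma gl_half (a : ℝ) : gl a (1 / 2) = 1 := by
  rw [gl, ← Real.mul_rpow (by norm_num) (by norm_num)]; norm_num

lemma sub_le_gl_sub (ha : 0 < a) {x y : ℝ} (hx : 0 ≤ x) (h : x ≤ y) :
    y - x ≤ gl a y - gl a x := by
  have h1 := two_rpow_mul_mono ha hx h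
  have h2 := two_rpow_mul_nonneg (a := a) hx
  unfold gl
  nlinarith [mul_le_mul h h1 h2 (hx.trans h)]

lemma gl_strictMonoOn (ha : 0 < a) : StrictMonoOn (gl a) (Ici 0) := fun x hx y _ h => by
  have := sub_le_gl_sub ha hx h.le
  linarith

lemma gl_continuous (ha : 0 < a) : Continuous (gl a) := by
  unfold gl
  have := Real.continuous_rpow_const ha.le
  fun_prop

lemma hasDerivAt_gl {x : ℝ} (hx : 0 < x) : HasDerivAt (gl a) (gl' a x) x := by
  have h := (hasDerivAt_id x).mul (((Real.hasDerivAt_rpow_const (p := a)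
    (Or.inl hx.ne')).const_mul ((2 : ℝ) ^ a)).const_add 1)
  refine h.congr_deriv ?_
  unfold gl'
  rw [Real.rpow_sub_one hx.ne']
  simp only [id]
  field_simp
  ring

lemma ginv_spec (ha : 0 < a) {y : ℝ} (hy : 0 ≤ y) : 0 ≤ ginv a y ∧ gl a (ginv a y) = y := by
  have : ∃ x ∈ Ici (0 : ℝ), gl a x = max y 0 := by
    rw [max_eq_left hy]
    have := intermediate_value_Icc hy (gl_continuous ha).continuousOn
    obtain ⟨x, hx, h⟩ := this ⟨by rw [gl_zero]; exact hy, le_gl hy⟩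
    exact ⟨x, hx.1, h⟩
  have h1 := Function.invFunOn_mem this
  have h2 := Function.invFunOn_eq this
  exact ⟨h1, h2.trans (max_eq_left hy)⟩

lemma ginv_nonneg (ha : 0 < a) (y : ℝ) : 0 ≤ ginv a y := by
  rcases le_total 0 y with h | h
  · exact (ginv_spec ha h).1
  · have := (ginv_spec ha (le_refl 0)).1
    unfold ginv at *
    rw [max_self] at this
    rwa [max_eq_right h]

lemma gl_ginv (ha : 0 < a) {y : ℝ} (hy : 0 ≤ y) : gl a (ginv a y) = y := (ginv_spec ha hy).2

lemma ginv_gl (ha : 0 < a) {x : ℝ} (hx : 0 ≤ x) : ginv a (gl a x) = x := by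
  have h0 : 0 ≤ gl a x := hx.trans (le_gl hx)
  exact (gl_strictMonoOn ha).injOn (ginv_nonneg ha _) hx (gl_ginv ha h0)

lemma ginv_mono (ha : 0 < a) : Monotone (ginv a) := by
  have key : ∀ y y', 0 ≤ y → y ≤ y' → ginv a y ≤ ginv a y' := fun y y' hy h => by
    rw [← (gl_strictMonoOn ha).le_iff_le (ginv_nonneg ha y) (ginv_nonneg ha y'), gl_ginv ha hy,
      gl_ginv ha (hy.trans h)]
    exact h
  intro y y' h
  have := key (max y 0) (max y' 0) (le_max_right _ _) (max_le_max_right 0 h)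
  unfold ginv at *
  simpa using this

lemma measurable_ginv (ha : 0 < a) : Measurable (ginv a) := (ginv_mono ha).measurable

lemma ginv_pos (ha : 0 < a) {y : ℝ} (hy : 0 < y) : 0 < ginv a y := by
  refine lt_of_le_of_ne (ginv_nonneg ha y) fun h => ?_
  have := gl_ginv ha hy.le
  rw [← h, gl_zero] at this
  linarith

lemma ginv_one (ha : 0 < a) : ginv a 1 = 1 / 2 := by
  have := ginv_gl ha (x := 1 / 2) (by norm_num)
  rwa [gl_half] at this

lemma ginv_le_half (ha : 0 < a) {y : ℝ} (hy : y ≤ 1) : ginv a y ≤ 1 / 2 :=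
  (ginv_mono ha hy).trans (ginv_one ha).le

lemma ginv_sub_le (ha : 0 < a) {x y : ℝ} (hx : 0 ≤ x) (hy : 0 ≤ y) :
    |ginv a x - ginv a y| ≤ |x - y| := by
  wlog h : x ≤ y generalizing x y
  · rw [abs_sub_comm, abs_sub_comm x]; exact this hy hx (le_of_not_ge h)
  have := sub_le_gl_sub ha (ginv_nonneg ha x) (ginv_mono ha h)
  rw [gl_ginv ha hx, gl_ginv ha hy] at this
  rw [abs_sub_comm, abs_sub_comm x, abs_of_nonneg (by linarith [ginv_mono ha h]),
    abs_of_nonneg (by linarith)]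
  exact this

lemma lsv_ginv (ha : 0 < a) {y : ℝ} (hy : 0 ≤ y) (hy1 : y ≤ 1) : lsv a (ginv a y) = y := by
  rw [lsv, if_pos (ginv_le_half ha hy1)]
  exact gl_ginv ha hy

/-- Change of variables for the left branch. -/
lemma lintegral_ginv (ha : 0 < a) (g : ℝ → ENNReal) :
    ∫⁻ x in Ioc 0 (1 / 2), g x =
      ∫⁻ y in Ioc 0 1, ENNReal.ofReal ((gl' a (ginv a y))⁻¹) * g (ginv a y) := by
  have himg : gl a '' Ioc 0 (1 / 2) = Ioc 0 1 := by
    ext y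
    constructor
    · rintro ⟨x, hx, rfl⟩
      refine ⟨hx.1.trans_le (le_gl hx.1.le), ?_⟩
      rw [← gl_half a]
      exact (gl_strictMonoOn ha).monotoneOn hx.1.le (by norm_num : (0 : ℝ) ≤ 1 / 2) hx.2
    · intro hy
      exact ⟨ginv a y, ⟨ginv_pos ha hy.1, ginv_le_half ha hy.2⟩, gl_ginv ha hy.1.le⟩
  have h := lintegral_image_eq_lintegral_abs_deriv_mul (s := Ioc (0 : ℝ) (1 / 2))
    measurableSet_Ioc (f := gl a) (f' := gl' a)
    (fun x hx => (hasDerivAt_gl hx.1).hasDerivWithinAt)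
    ((gl_strictMonoOn ha).injOn.mono fun x hx => hx.1.le)
    (fun y => ENNReal.ofReal ((gl' a (ginv a y))⁻¹) * g (ginv a y))
  rw [himg] at h
  rw [h]
  refine setLIntegral_congr_fun measurableSet_Ioc fun x hx => ?_
  have hp := gl'_pos ha hx.1.le
  simp only [ginv_gl ha hx.1.le]
  rw [← mul_assoc, ← ENNReal.ofReal_mul (abs_nonneg _), abs_of_pos hp, mul_inv_cancel₀ hp.ne',
    ENNReal.ofReal_one, one_mul]

/-- The distortion ratio of the left branch is monotone. -/
lemma ratio_mono (ha : 0 < a) (ha1 : a < 1) {x x' : ℝ} (hx : 0 ≤ x) (h : x ≤ x') :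
    (1 + 2 ^ a * x ^ a) ^ 2 / gl' a x ≤ (1 + 2 ^ a * x' ^ a) ^ 2 / gl' a x' := by
  have h1 := two_rpow_mul_mono ha hx h
  have h2 := two_rpow_mul_nonneg (a := a) hx
  rw [div_le_div_iff₀ (gl'_pos ha hx) (gl'_pos ha (hx.trans h))]
  unfold gl'
  set e := (2 : ℝ) ^ a * x ^ a
  set e' := (2 : ℝ) ^ a * x' ^ a
  have : (1 + e') ^ 2 * (1 + (1 + a) * e) - (1 + e) ^ 2 * (1 + (1 + a) * e') =
    (e' - e) * ((1 - a) + (e + e') + (1 + a) * e * e') := by ring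
  have h3 : 0 ≤ (e' - e) * ((1 - a) + (e + e') + (1 + a) * e * e') := by
    have : 0 ≤ e' := h2.trans h1
    have : 0 ≤ (1 + a) * e * e' := by positivity
    exact mul_nonneg (by linarith) (by linarith)
  linarith

end

end LSV

namespace LSV

/-- The parameters of the random system. -/
structure Par where
  α : ℝ
  β : ℝ
  p : ℝ
  hα : 1 / 2 < α
  hαβ : α < β
  hβ : β < 1
  hp : 0 < p
  hp' : p < 1

namespace Par

variable (P : Par)

/-- The exponent chosen by a digit. -/
def a (s : Bool) : ℝ := if s then P.α else P.β

/-- The weight of a digit. -/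
def w (s : Bool) : ℝ := if s then P.p else 1 - P.p

/-- The inverse branches of the noise dynamics. -/
def b (s : Bool) (ω : ℝ) : ℝ := if s then P.p * ω else P.p + (1 - P.p) * ω

/-- The phase space. -/
def Q : Set (ℝ × ℝ) := Ioc 0 1 ×ˢ Ico 0 1

/-- The inducing domain. -/
def D : Set (ℝ × ℝ) := Ioc (1 / 2) 1 ×ˢ Ico 0 1

/-- The skew product. -/
def T : ℝ × ℝ → ℝ × ℝ := skewLSV P.α P.β P.p

/-- The left inverse branches. -/
def σ (s : Bool) (z : ℝ × ℝ) : ℝ × ℝ := (ginv (P.a s) z.1, P.b s z.2)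

/-- The right inverse branches. -/
def ρ (s : Bool) (z : ℝ × ℝ) : ℝ × ℝ := ((1 + z.1) / 2, P.b s z.2)

/-- The Jacobian of a left inverse branch. -/
def k (s : Bool) (z : ℝ × ℝ) : ℝ := P.w s / gl' (P.a s) (ginv (P.a s) z.1)

/-- Iterated left inverse branches. -/
def br : List Bool → ℝ × ℝ → ℝ × ℝ
  | [], z => z
  | s :: l, z => P.σ s (br l z)

/-- Jacobians of iterated left inverse branches. -/
def jac : List Bool → ℝ × ℝ → ℝ
  | [], _ => 1
  | s :: l, z => jac l z * P.k s (P.br l z)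

/-- Inverse branches of the induced map. -/
def ψ (i : Bool × List Bool) (z : ℝ × ℝ) : ℝ × ℝ := P.ρ i.1 (P.br i.2 z)

/-- Jacobians of the inverse branches of the induced map. -/
def J (i : Bool × List Bool) (z : ℝ × ℝ) : ℝ := P.w i.1 / 2 * P.jac i.2 z

lemma α_pos : 0 < P.α := by linarith [P.hα]

lemma a_pos (s : Bool) : 0 < P.a s := by
  cases s <;> simp [a] <;> linarith [P.hα, P.hαβ]

lemma a_lt_one (s : Bool) : P.a s < 1 := by
  cases s <;> simp [a] <;> linarith [P.hαβ, P.hβ]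

lemma w_pos (s : Bool) : 0 < P.w s := by
  cases s <;> simp [w] <;> linarith [P.hp, P.hp']

lemma w_lt_one (s : Bool) : P.w s < 1 := by
  cases s <;> simp [w] <;> linarith [P.hp, P.hp']

lemma b_mem (s : Bool) {ω : ℝ} (h : ω ∈ Ico (0 : ℝ) 1) : P.b s ω ∈ Ico (0 : ℝ) 1 := by
  have := P.hp
  have := P.hp'
  obtain ⟨h0, h1⟩ := h
  cases s <;> simp [b] <;> constructor <;> nlinarith

lemma phiMap_b (s : Bool) {ω : ℝ} (h : ω ∈ Ico (0 : ℝ) 1) : phiMap P.p (P.b s ω) = ω := by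
  have h1 := P.hp
  have h2 := P.hp'
  obtain ⟨h3, h4⟩ := h
  have h5 : 0 < 1 - P.p := by linarith
  cases s <;> simp only [b, phiMap]
  · simp only [Bool.false_eq_true, if_false]
    rw [if_neg (by nlinarith)]
    field_simp
    ring
  · simp only [if_true]
    rw [if_pos (by nlinarith)]
    field_simp

lemma alphaOf_b (s : Bool) {ω : ℝ} (h : ω ∈ Ico (0 : ℝ) 1) :
    alphaOf P.α P.β P.p (P.b s ω) = P.a s := by
  have h1 := P.hp
  have h2 := P.hp'
  obtain ⟨h3, h4⟩ := h
  cases s <;> simp only [b, alphaOf, a]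
  · simp only [Bool.false_eq_true, if_false]
    rw [if_neg (by nlinarith)]
  · simp only [if_true]
    rw [if_pos (by nlinarith)]

lemma b_true : P.b true = fun ω => P.p * ω := by ext; simp [b]

lemma b_false : P.b false = fun ω => P.p + (1 - P.p) * ω := by ext; simp [b]

lemma b_continuous (s : Bool) : Continuous (P.b s) := by
  cases s
  · rw [b_false]; fun_prop
  · rw [b_true]; fun_prop

lemma b_sub (s : Bool) (ω ω' : ℝ) : P.b s ω - P.b s ω' = P.w s * (ω - ω') := by
  cases s <;> simp [b, w] <;> ring

lemma D_subset_Q : D ⊆ Q := prod_mono (Ioc_subset_Ioc_left (by norm_num)) le_rfl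

lemma measurableSet_Q : MeasurableSet Q := measurableSet_Ioc.prod measurableSet_Ico

lemma measurableSet_D : MeasurableSet D := measurableSet_Ioc.prod measurableSet_Ico

lemma σ_mem (s : Bool) {z : ℝ × ℝ} (hz : z ∈ Q) : P.σ s z ∈ Q :=
  ⟨⟨ginv_pos (P.a_pos s) hz.1.1, (ginv_le_half (P.a_pos s) hz.1.2).trans (by norm_num)⟩,
    P.b_mem s hz.2⟩

lemma σ_le_half (s : Bool) {z : ℝ × ℝ} (hz : z ∈ Q) : (P.σ s z).1 ≤ 1 / 2 :=
  ginv_le_half (P.a_pos s) hz.1.2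

lemma σ_notMem (s : Bool) {z : ℝ × ℝ} (hz : z ∈ Q) : P.σ s z ∉ D := fun h =>
  absurd h.1.1 (not_lt.2 (P.σ_le_half s hz))

lemma T_σ (s : Bool) {z : ℝ × ℝ} (hz : z ∈ Q) : P.T (P.σ s z) = z := by
  unfold T skewLSV σ
  simp only
  rw [P.alphaOf_b s hz.2, P.phiMap_b s hz.2, lsv_ginv (P.a_pos s) hz.1.1.le hz.1.2]

lemma ρ_mem (s : Bool) {z : ℝ × ℝ} (hz : z ∈ Q) : P.ρ s z ∈ D := by
  refine ⟨⟨?_, ?_⟩, P.b_mem s hz.2⟩ <;> simp only [ρ] <;> linarith [hz.1.1, hz.1.2]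

lemma T_ρ (s : Bool) {z : ℝ × ℝ} (hz : z ∈ Q) : P.T (P.ρ s z) = z := by
  have h := hz.1.1
  unfold T skewLSV ρ
  simp only
  rw [P.phiMap_b s hz.2, lsv, if_neg (by linarith)]
  ext <;> simp
  ring

lemma br_mem (l : List Bool) {z : ℝ × ℝ} (hz : z ∈ Q) : P.br l z ∈ Q := by
  induction l with
  | nil => exact hz
  | cons s l ih => exact P.σ_mem s ih

lemma ψ_mem (i : Bool × List Bool) {z : ℝ × ℝ} (hz : z ∈ Q) : P.ψ i z ∈ D :=
  P.ρ_mem _ (P.br_mem _ hz)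

lemma measurable_σ (s : Bool) : Measurable (P.σ s) :=
  ((measurable_ginv (P.a_pos s)).comp measurable_fst).prodMk
    ((P.b_continuous s).measurable.comp measurable_snd)

lemma measurable_ρ (s : Bool) : Measurable (P.ρ s) :=
  ((measurable_fst.const_add 1).div_const 2).prodMk
    ((P.b_continuous s).measurable.comp measurable_snd)

lemma measurable_k (s : Bool) : Measurable (P.k s) := by
  have h : Measurable fun z : ℝ × ℝ => ginv (P.a s) z.1 :=
    (measurable_ginv (P.a_pos s)).comp measurable_fst
  unfold k gl'
  exact measurable_const.div ((((h.pow_const _).const_mul _).const_mul _).const_add _)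

lemma measurable_br (l : List Bool) : Measurable (P.br l) := by
  induction l with
  | nil => exact measurable_id
  | cons s l ih => exact (P.measurable_σ s).comp ih

lemma measurable_jac (l : List Bool) : Measurable (P.jac l) := by
  induction l with
  | nil => exact measurable_const
  | cons s l ih => exact ih.mul ((P.measurable_k s).comp (P.measurable_br l))

lemma measurable_ψ (i : Bool × List Bool) : Measurable (P.ψ i) :=
  (P.measurable_ρ _).comp (P.measurable_br _)

lemma measurable_J (i : Bool × List Bool) : Measurable (P.J i) :=
  (P.measurable_jac _).const_mul _

lemma k_pos (s : Bool) (z : ℝ × ℝ) : 0 < P.k s z :=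
  div_pos (P.w_pos s) (gl'_pos (P.a_pos s) (ginv_nonneg (P.a_pos s) _))

lemma jac_pos (l : List Bool) (z : ℝ × ℝ) : 0 < P.jac l z := by
  induction l with
  | nil => exact one_pos
  | cons s l ih => exact mul_pos ih (P.k_pos s _)

lemma J_pos (i : Bool × List Bool) (z : ℝ × ℝ) : 0 < P.J i z :=
  mul_pos (half_pos (P.w_pos _)) (P.jac_pos _ _)

/-- Change of variables for the noise. -/
lemma lintegral_b (g : ℝ → ENNReal) : ∫⁻ ω in Ico 0 1, g ω =
    ∑ s, ENNReal.ofReal (P.w s) * ∫⁻ ω in Ico 0 1, g (P.b s ω) := by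
  have h1 := P.hp
  have h2 := P.hp'
  have key : ∀ s, ∫⁻ ω in P.b s '' Ico 0 1, g ω =
      ENNReal.ofReal (P.w s) * ∫⁻ ω in Ico 0 1, g (P.b s ω) := by
    intro s
    have hd : ∀ x ∈ Ico (0 : ℝ) 1, HasDerivWithinAt (P.b s) (P.w s) (Ico 0 1) x := by
      intro x _
      refine HasDerivAt.hasDerivWithinAt ?_
      cases s
      · rw [b_false]
        exact (((hasDerivAt_id x).const_mul (1 - P.p)).const_add P.p).congr_deriv (by simp [w])
      · rw [b_true]
        exact ((hasDerivAt_id x).const_mul P.p).congr_deriv (by simp [w])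
    rw [lintegral_image_eq_lintegral_abs_deriv_mul measurableSet_Ico hd, abs_of_pos (P.w_pos s),
      lintegral_const_mul' _ _ ENNReal.ofReal_ne_top]
    intro x _ y _ h
    have := P.b_sub s x y
    rw [sub_eq_zero.2 h] at this
    rcases mul_eq_zero.1 this.symm with h | h
    · exact absurd h (P.w_pos s).ne'
    · linarith
  have e1 : P.b true '' Ico 0 1 = Ico 0 P.p := by
    rw [b_true, Set.image_mul_left_Ico h1]; simp
  have e2 : P.b false '' Ico 0 1 = Ico P.p 1 := by
    have : P.b false = (fun x => P.p + x) ∘ fun x => (1 - P.p) * x := P.b_false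
    rw [this, Set.image_comp, Set.image_mul_left_Ico (by linarith : 0 < 1 - P.p)]
    simp
  rw [Fintype.sum_bool, ← key, ← key, e1, e2, ← lintegral_union measurableSet_Ico
    (Set.Ico_disjoint_Ico.2 (by simp [h1.le, h2.le])), Ico_union_Ico_eq_Ico h1.le h2.le]

lemma lintegral_prod_set {A B : Set ℝ} (g : ℝ × ℝ → ENNReal) (hg : Measurable g) :
    ∫⁻ z in A ×ˢ B, g z = ∫⁻ x in A, ∫⁻ y in B, g (x, y) := by
  rw [Measure.volume_eq_prod, ← Measure.prod_restrict, lintegral_prod _ hg.aemeasurable]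

lemma lintegral_prod_b {A : Set ℝ} (g : ℝ × ℝ → ENNReal) (hg : Measurable g) :
    ∫⁻ z in A ×ˢ Ico 0 1, g z =
      ∑ s, ENNReal.ofReal (P.w s) * ∫⁻ z in A ×ˢ Ico 0 1, g (z.1, P.b s z.2) := by
  have hm : ∀ s, Measurable fun z : ℝ × ℝ => g (z.1, P.b s z.2) := fun s =>
    hg.comp (measurable_fst.prodMk ((P.b_continuous s).measurable.comp measurable_snd))
  rw [lintegral_prod_set g hg]
  simp_rw [P.lintegral_b fun ω => g (_, ω)]
  rw [lintegral_finsetSum]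
  · refine Finset.sum_congr rfl fun s _ => ?_
    rw [lintegral_const_mul' _ _ ENNReal.ofReal_ne_top, lintegral_prod_set _ (hm s)]
  · intro s _
    exact (hm s).lintegral_prod_right'.const_mul _

lemma measurable_weight_σ (s : Bool) {g : ℝ × ℝ → ENNReal} (hg : Measurable g) :
    Measurable fun z => ENNReal.ofReal (P.k s z) * g (P.σ s z) :=
  (P.measurable_k s).ennreal_ofReal.mul (hg.comp (P.measurable_σ s))

lemma measurable_weight_ρ (s : Bool) {g : ℝ × ℝ → ENNReal} (hg : Measurable g) :
    Measurable fun z => ENNReal.ofReal (P.w s / 2) * g (P.ρ s z) :=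
  measurable_const.mul (hg.comp (P.measurable_ρ s))

/-- Change of variables on the left half. -/
lemma lintegral_left (g : ℝ × ℝ → ENNReal) (hg : Measurable g) :
    ∫⁻ z in Ioc 0 (1 / 2) ×ˢ Ico 0 1, g z =
      ∑ s, ∫⁻ z in Q, ENNReal.ofReal (P.k s z) * g (P.σ s z) := by
  rw [P.lintegral_prod_b g hg]
  refine Finset.sum_congr rfl fun s _ => ?_
  have hm : Measurable fun z : ℝ × ℝ => g (z.1, P.b s z.2) :=
    hg.comp (measurable_fst.prodMk ((P.b_continuous s).measurable.comp measurable_snd))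
  rw [lintegral_prod_set _ hm, lintegral_ginv (P.a_pos s), Q,
    lintegral_prod_set _ (P.measurable_weight_σ s hg),
    ← lintegral_const_mul' _ _ ENNReal.ofReal_ne_top]
  refine lintegral_congr fun x => ?_
  rw [← mul_assoc, ← ENNReal.ofReal_mul (P.w_pos s).le, ← div_eq_mul_inv]
  simp only [k, σ]
  rw [lintegral_const_mul' _ _ ENNReal.ofReal_ne_top]

/-- Change of variables on the right half. -/
lemma lintegral_right (g : ℝ × ℝ → ENNReal) (hg : Measurable g) :
    ∫⁻ z in D, g z = ∑ s, ∫⁻ z in Q, ENNReal.ofReal (P.w s / 2) * g (P.ρ s z) := by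
  rw [D, P.lintegral_prod_b g hg]
  refine Finset.sum_congr rfl fun s _ => ?_
  have hm : Measurable fun z : ℝ × ℝ => g (z.1, P.b s z.2) :=
    hg.comp (measurable_fst.prodMk ((P.b_continuous s).measurable.comp measurable_snd))
  have hm' : Measurable fun z : ℝ × ℝ => g (P.ρ s z) := hg.comp (P.measurable_ρ s)
  rw [lintegral_prod_set _ hm, lintegral_const_mul' _ _ ENNReal.ofReal_ne_top, Q,
    lintegral_prod_set _ hm']
  have himg : (fun x : ℝ => (1 + x) / 2) '' Ioc 0 1 = Ioc (1 / 2) 1 := by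
    have : (fun x : ℝ => (1 + x) / 2) = (fun x => 1 / 2 + x) ∘ fun x => 1 / 2 * x := by
      ext x; simp; ring
    rw [this, Set.image_comp, Set.image_mul_left_Ioc (by norm_num)]
    norm_num
  have h := lintegral_image_eq_lintegral_abs_deriv_mul (s := Ioc (0 : ℝ) 1) measurableSet_Ioc
    (f := fun x : ℝ => (1 + x) / 2) (f' := fun _ => 1 / 2)
    (fun x _ => (((hasDerivAt_id x).const_add 1).div_const 2).hasDerivWithinAt)
    (fun x _ y _ h => by simpa using h) (fun x => ∫⁻ y in Ico 0 1, g (x, P.b s y))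
  rw [himg] at h
  rw [h, lintegral_const_mul' _ _ ENNReal.ofReal_ne_top, ← mul_assoc,
    ← ENNReal.ofReal_mul (P.w_pos s).le, abs_of_pos (by norm_num : (0 : ℝ) < 1 / 2),
    mul_one_div]
  rfl

lemma lintegral_Q (g : ℝ × ℝ → ENNReal) (hg : Measurable g) :
    ∫⁻ z in Q, g z =
      (∫⁻ z in D, g z) + ∑ s, ∫⁻ z in Q, ENNReal.ofReal (P.k s z) * g (P.σ s z) := by
  rw [← P.lintegral_left g hg, D, ← lintegral_union
    (measurableSet_Ioc.prod measurableSet_Ico) ?_, ← union_prod, union_comm, Ioc_union_Ioc_eq_Ioc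
    (by norm_num) (by norm_num), Q]
  exact Set.disjoint_prod.2 (Or.inl (Set.Ioc_disjoint_Ioc.2 (by norm_num)).symm)

/-- The total contribution of all left inverse branches. -/
def tot (g : ℝ × ℝ → ENNReal) : ENNReal :=
  ∑' l, ∫⁻ z in D, ENNReal.ofReal (P.jac l z) * g (P.br l z)

lemma tsum_list (F : List Bool → ENNReal) : ∑' l, F l = F [] + ∑ s, ∑' l, F (s :: l) := by
  let e : Unit ⊕ (Bool × List Bool) ≃ List Bool :=
    { toFun := fun o => o.elim (fun _ => []) fun q => q.1 :: q.2
      invFun := fun l => match l with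
        | [] => Sum.inl ()
        | s :: l => Sum.inr (s, l)
      left_inv := fun o => by rcases o with o | o <;> rfl
      right_inv := fun l => by cases l <;> rfl }
  rw [← e.tsum_eq, Summable.tsum_sum (f := fun o => F (e o)) ENNReal.summable ENNReal.summable,
    ENNReal.tsum_prod', tsum_fintype, tsum_fintype]
  simp [e]

lemma tot_eq (g : ℝ × ℝ → ENNReal) :
    P.tot g = (∫⁻ z in D, g z) +
      ∑ s, P.tot fun z => ENNReal.ofReal (P.k s z) * g (P.σ s z) := by
  unfold tot
  rw [tsum_list]
  congr 1
  · simp [jac, br]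
  · refine Finset.sum_congr rfl fun s _ => tsum_congr fun l => lintegral_congr fun z => ?_
    rw [jac, br, ENNReal.ofReal_mul (P.jac_pos l z).le, mul_assoc]

lemma half_add_sq_le {a x : ℝ} (ha1 : a < 1) (hx : 0 ≤ x) (hx2 : x ≤ 1 / 2) :
    x + 2 * x ^ 2 ≤ gl a x := by
  have : 2 * x ≤ (2 * x) ^ a := by
    rcases hx.eq_or_lt with h | h
    · rw [← h]; simp; positivity
    · have := Real.rpow_le_rpow_of_exponent_ge (x := 2 * x) (by linarith) (by linarith) ha1.le
      rwa [Real.rpow_one] at this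
  rw [Real.mul_rpow (by norm_num) hx] at this
  unfold gl
  nlinarith

lemma ginv_le_inv {a : ℝ} (ha : 0 < a) (ha1 : a < 1) {n : ℕ} {y : ℝ} (hy : 0 ≤ y)
    (h : y ≤ 1 / ((n : ℝ) + 1)) : ginv a y ≤ 1 / ((n : ℝ) + 2) := by
  by_contra hc
  push Not at hc
  have hn : (0 : ℝ) ≤ n := Nat.cast_nonneg n
  have h1 : y ≤ 1 := h.trans (by rw [div_le_one (by linarith)]; linarith)
  have h2 := half_add_sq_le ha1 (ginv_nonneg ha y) (ginv_le_half ha h1)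
  rw [gl_ginv ha hy] at h2
  have h3 : 1 / ((n : ℝ) + 1) ≤ 1 / ((n : ℝ) + 2) + 2 * (1 / ((n : ℝ) + 2)) ^ 2 := by
    have e : 1 / ((n : ℝ) + 2) + 2 * (1 / ((n : ℝ) + 2)) ^ 2 = (n + 4) / (n + 2) ^ 2 := by
      field_simp; ring
    rw [e, div_le_div_iff₀ (by positivity) (by positivity)]
    nlinarith
  have h4 : (0 : ℝ) < 1 / ((n : ℝ) + 2) := by positivity
  nlinarith

lemma tot_eq_of_vanish (n : ℕ) : ∀ g : ℝ × ℝ → ENNReal, Measurable g →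
    (∀ z ∈ Q, z.1 ≤ 1 / ((n : ℝ) + 1) → g z = 0) → P.tot g = ∫⁻ z in Q, g z := by
  induction n with
  | zero =>
    intro g hg h
    have h0 : ∀ z ∈ Q, g z = 0 := fun z hz => h z hz (by simpa using hz.1.2)
    rw [setLIntegral_congr_fun measurableSet_Q h0, lintegral_zero]
    unfold tot
    rw [ENNReal.tsum_eq_zero]
    intro l
    rw [setLIntegral_congr_fun (g := fun _ => 0) measurableSet_D, lintegral_zero]
    intro z hz
    simp only
    rw [h0 _ (P.br_mem l (D_subset_Q hz)), mul_zero]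
  | succ n ih =>
    intro g hg h
    rw [P.lintegral_Q g hg, P.tot_eq]
    congr 1
    refine Finset.sum_congr rfl fun s _ => ih _
      (P.measurable_weight_σ s hg) fun z hz hz1 => ?_
    rw [h _ (P.σ_mem s hz), mul_zero]
    have := ginv_le_inv (P.a_pos s) (P.a_lt_one s) hz.1.1.le hz1
    push_cast
    rw [show (n : ℝ) + 1 + 1 = n + 2 by ring]
    exact this

lemma tot_eq_lintegral {g : ℝ × ℝ → ENNReal} (hg : Measurable g) :
    P.tot g = ∫⁻ z in Q, g z := by
  have hmono : ∀ z, z ∈ Q → ⨆ n : ℕ, {z : ℝ × ℝ | 1 / ((n : ℝ) + 1) < z.1}.indicator g z = g z := by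
    intro z hz
    refine le_antisymm (iSup_le fun n => Set.indicator_le_self _ _ _) ?_
    obtain ⟨n, hn⟩ := exists_nat_one_div_lt hz.1.1
    exact le_iSup_of_le n (Set.indicator_of_mem (show z ∈ {z : ℝ × ℝ | 1 / ((n : ℝ) + 1) < z.1}
        from hn) g).ge
  have hms : ∀ n : ℕ, MeasurableSet {z : ℝ × ℝ | 1 / ((n : ℝ) + 1) < z.1} := fun n =>
    measurableSet_lt measurable_const measurable_fst
  have hgn : ∀ n : ℕ, Measurable ({z : ℝ × ℝ | 1 / ((n : ℝ) + 1) < z.1}.indicator g) :=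
    fun n => hg.indicator (hms n)
  have hm : Monotone fun n : ℕ => {z : ℝ × ℝ | 1 / ((n : ℝ) + 1) < z.1}.indicator g := by
    intro n m hnm
    refine Set.indicator_le_indicator_of_subset (fun z hz => ?_) fun _ => zero_le
    exact (one_div_le_one_div_of_le (by positivity : (0 : ℝ) < n + 1)
      (by gcongr)).trans_lt hz
  have key : ∀ n : ℕ, P.tot ({z : ℝ × ℝ | 1 / ((n : ℝ) + 1) < z.1}.indicator g) =
      ∫⁻ z in Q, {z : ℝ × ℝ | 1 / ((n : ℝ) + 1) < z.1}.indicator g z := fun n =>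
    P.tot_eq_of_vanish n _ (hgn n) fun z _ h => Set.indicator_of_notMem (by simpa using h) _
  rw [← setLIntegral_congr_fun measurableSet_Q hmono, lintegral_iSup hgn hm]
  simp_rw [← key]
  unfold tot
  have e : ∀ l, ∫⁻ z in D, ENNReal.ofReal (P.jac l z) * g (P.br l z) =
      ⨆ n : ℕ, ∫⁻ z in D, ENNReal.ofReal (P.jac l z) *
        {z : ℝ × ℝ | 1 / ((n : ℝ) + 1) < z.1}.indicator g (P.br l z) := by
    intro l
    rw [← lintegral_iSup]
    · refine setLIntegral_congr_fun measurableSet_D fun z hz => ?_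
      rw [← ENNReal.mul_iSup, hmono _ (P.br_mem l (D_subset_Q hz))]
    · exact fun n => (P.measurable_jac l).ennreal_ofReal.mul ((hgn n).comp (P.measurable_br l))
    · exact fun n m hnm z => mul_le_mul_right (hm hnm _) _
  simp_rw [e]
  rw [ENNReal.tsum_eq_iSup_sum]
  simp_rw [ENNReal.tsum_eq_iSup_sum]
  rw [iSup_comm]
  congr 1 with s
  rw [ENNReal.finsetSum_iSup_of_monotone]
  exact fun l n m hnm => lintegral_mono fun z => mul_le_mul_right (hm hnm _) _

/-- Change of variables for the induced map. -/
lemma lintegral_D {g : ℝ × ℝ → ENNReal} (hg : Measurable g) :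
    ∫⁻ z in D, g z = ∑' i, ∫⁻ z in D, ENNReal.ofReal (P.J i z) * g (P.ψ i z) := by
  rw [P.lintegral_right g hg, ENNReal.tsum_prod', tsum_fintype]
  refine Finset.sum_congr rfl fun s _ => ?_
  rw [← P.tot_eq_lintegral (P.measurable_weight_ρ s hg)]
  unfold tot
  refine tsum_congr fun l => lintegral_congr fun z => ?_
  rw [← mul_assoc, J, mul_comm (P.w s / 2), ENNReal.ofReal_mul (P.jac_pos l z).le]
  rfl

end Par
end LSV

namespace LSV
namespace Par
variable (P : Par)

lemma br_fst_mono (l : List Bool) {z z' : ℝ × ℝ} (h : z.1 ≤ z'.1) :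
    (P.br l z).1 ≤ (P.br l z').1 := by
  induction l with
  | nil => exact h
  | cons s l ih => exact ginv_mono (P.a_pos s) ih

lemma k_anti (s : Bool) {z z' : ℝ × ℝ} (h : z.1 ≤ z'.1) : P.k s z' ≤ P.k s z :=
  div_le_div_of_nonneg_left (P.w_pos s).le (gl'_pos (P.a_pos s) (ginv_nonneg (P.a_pos s) _))
    (gl'_mono (P.a_pos s) (ginv_nonneg (P.a_pos s) _) (ginv_mono (P.a_pos s) h))

lemma jac_anti (l : List Bool) {z z' : ℝ × ℝ} (h : z.1 ≤ z'.1) : P.jac l z' ≤ P.jac l z := by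
  induction l with
  | nil => exact le_rfl
  | cons s l ih =>
    exact mul_le_mul ih (P.k_anti s (P.br_fst_mono l h)) (P.k_pos s _).le (P.jac_pos l z).le

lemma k_ratio_eq (s : Bool) {z : ℝ × ℝ} (hz : 0 < z.1) :
    z.1 ^ 2 * P.k s z / (P.σ s z).1 ^ 2 = P.w s * ((1 + 2 ^ P.a s * (ginv (P.a s) z.1) ^ P.a s) ^ 2
      / gl' (P.a s) (ginv (P.a s) z.1)) := by
  have h := gl_ginv (P.a_pos s) hz.le
  have hx := ginv_pos (P.a_pos s) hz
  have hg := gl'_pos (P.a_pos s) hx.le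
  simp only [σ, k]
  unfold gl at h
  set x := ginv (P.a s) z.1
  rw [← h]
  field_simp

lemma k_ratio_mono (s : Bool) {z z' : ℝ × ℝ} (hz : 0 < z.1) (h : z.1 ≤ z'.1) :
    z.1 ^ 2 * P.k s z / (P.σ s z).1 ^ 2 ≤ z'.1 ^ 2 * P.k s z' / (P.σ s z').1 ^ 2 := by
  rw [P.k_ratio_eq s hz, P.k_ratio_eq s (hz.trans_le h)]
  exact mul_le_mul_of_nonneg_left (ratio_mono (P.a_pos s) (P.a_lt_one s)
    (ginv_nonneg (P.a_pos s) _) (ginv_mono (P.a_pos s) h)) (P.w_pos s).le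

lemma br_fst_pos (l : List Bool) {z : ℝ × ℝ} (hz : 0 < z.1) : 0 < (P.br l z).1 := by
  induction l with
  | nil => exact hz
  | cons s l ih => exact ginv_pos (P.a_pos s) ih

lemma jac_ratio_mono (l : List Bool) {z z' : ℝ × ℝ} (hz : 0 < z.1) (h : z.1 ≤ z'.1) :
    z.1 ^ 2 * P.jac l z / (P.br l z).1 ^ 2 ≤ z'.1 ^ 2 * P.jac l z' / (P.br l z').1 ^ 2 := by
  have hz' := hz.trans_le h
  induction l with
  | nil => simp [jac, br, hz.ne', hz'.ne']
  | cons s l ih =>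
    have h1 := P.br_fst_pos l hz
    have h1' := P.br_fst_pos l hz'
    have e : ∀ y : ℝ × ℝ, 0 < (P.br l y).1 → y.1 ^ 2 * P.jac (s :: l) y / (P.br (s :: l) y).1 ^ 2 =
        y.1 ^ 2 * P.jac l y / (P.br l y).1 ^ 2 *
          ((P.br l y).1 ^ 2 * P.k s (P.br l y) / (P.σ s (P.br l y)).1 ^ 2) := by
      intro y hy
      simp only [jac, br]
      field_simp
    rw [e z h1, e z' h1']
    have := P.jac_pos l z'
    have := P.k_pos s (P.br l z)
    exact mul_le_mul ih (P.k_ratio_mono s h1 (P.br_fst_mono l h)) (by positivity) (by positivity)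

lemma jac_le (l : List Bool) {z z' : ℝ × ℝ} (hz : 1 / 2 ≤ z.1) (hz' : 1 / 2 ≤ z'.1) :
    P.jac l z ≤ Real.exp (4 * |z.1 - z'.1|) * P.jac l z' := by
  have h0 : 0 < z.1 := by linarith
  have h0' : 0 < z'.1 := by linarith
  have hp := P.jac_pos l z'
  rcases le_total z'.1 z.1 with h | h
  · refine (P.jac_anti l h).trans (le_mul_of_one_le_left hp.le (Real.one_le_exp (by positivity)))
  · have h1 := P.jac_ratio_mono l h0 h
    have h2 := P.br_fst_mono l h
    have h3 := P.br_fst_pos l h0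
    have h4 := P.br_fst_pos l h0'
    have h5 : z.1 ^ 2 * P.jac l z ≤ z'.1 ^ 2 * P.jac l z' := by
      have : z'.1 ^ 2 * P.jac l z' / (P.br l z').1 ^ 2 ≤ z'.1 ^ 2 * P.jac l z' / (P.br l z).1 ^ 2
          := by
        gcongr
      have := h1.trans this
      rwa [div_le_div_iff_of_pos_right (by positivity)] at this
    have h6 : z'.1 ≤ z.1 * Real.exp (2 * |z.1 - z'.1|) := by
      have := Real.add_one_le_exp (2 * |z.1 - z'.1|)
      rw [abs_sub_comm, abs_of_nonneg (sub_nonneg.2 h)] at *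
      nlinarith
    have h7 : z'.1 ^ 2 ≤ z.1 ^ 2 * Real.exp (4 * |z.1 - z'.1|) := by
      rw [show 4 * |z.1 - z'.1| = 2 * |z.1 - z'.1| + 2 * |z.1 - z'.1| by ring, Real.exp_add]
      nlinarith [Real.exp_pos (2 * |z.1 - z'.1|)]
    have h8 : z.1 ^ 2 * P.jac l z ≤ z.1 ^ 2 * (Real.exp (4 * |z.1 - z'.1|) * P.jac l z') := by
      nlinarith
    exact le_of_mul_le_mul_left h8 (by positivity)

lemma dist_σ_le (s : Bool) {z z' : ℝ × ℝ} (hz : z ∈ Q) (hz' : z' ∈ Q) :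
    dist (P.σ s z) (P.σ s z') ≤ dist z z' := by
  rw [Prod.dist_eq, Prod.dist_eq]
  refine max_le_max (ginv_sub_le (P.a_pos s) hz.1.1.le hz'.1.1.le) ?_
  rw [Real.dist_eq, Real.dist_eq]
  simp only [σ]
  rw [b_sub, abs_mul, abs_of_pos (P.w_pos s)]
  exact mul_le_of_le_one_left (abs_nonneg _) (P.w_lt_one s).le

lemma dist_br_le (l : List Bool) {z z' : ℝ × ℝ} (hz : z ∈ Q) (hz' : z' ∈ Q) :
    dist (P.br l z) (P.br l z') ≤ dist z z' := by
  induction l with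
  | nil => exact le_rfl
  | cons s l ih => exact (P.dist_σ_le s (P.br_mem l hz) (P.br_mem l hz')).trans ih

/-- The contraction rate of the induced inverse branches. -/
def rate : ℝ := max (1 / 2) (max P.p (1 - P.p))

lemma rate_pos : 0 < P.rate := lt_max_of_lt_left (by norm_num)

lemma rate_lt_one : P.rate < 1 :=
  max_lt (by norm_num) (max_lt P.hp' (by linarith [P.hp]))

lemma w_le_rate (s : Bool) : P.w s ≤ P.rate := by
  cases s
  · exact (le_max_right _ _).trans (le_max_right _ _)
  · exact (le_max_left _ _).trans (le_max_right _ _)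

lemma dist_ρ_le (s : Bool) (z z' : ℝ × ℝ) : dist (P.ρ s z) (P.ρ s z') ≤ P.rate * dist z z' := by
  have h := P.rate_pos.le
  rw [Prod.dist_eq, Prod.dist_eq, Real.dist_eq, Real.dist_eq, mul_max_of_nonneg _ _ h]
  simp only [ρ, b_sub]
  refine max_le_max ?_ ?_
  · rw [show (1 + z.1) / 2 - (1 + z'.1) / 2 = 1 / 2 * (z.1 - z'.1) by ring, abs_mul,
      abs_of_pos (by norm_num : (0 : ℝ) < 1 / 2)]
    exact mul_le_mul_of_nonneg_right (le_max_left _ _) (abs_nonneg _)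
  · rw [abs_mul, abs_of_pos (P.w_pos s)]
    exact mul_le_mul_of_nonneg_right (P.w_le_rate s) (abs_nonneg _)

lemma dist_ψ_le (i : Bool × List Bool) {z z' : ℝ × ℝ} (hz : z ∈ Q) (hz' : z' ∈ Q) :
    dist (P.ψ i z) (P.ψ i z') ≤ P.rate * dist z z' :=
  (P.dist_ρ_le _ _ _).trans (mul_le_mul_of_nonneg_left (P.dist_br_le _ hz hz') P.rate_pos.le)

lemma measurable_T : Measurable P.T := by
  unfold T skewLSV lsv alphaOf phiMap
  have h2 : Measurable fun z : ℝ × ℝ => if z.2 < P.p then P.α else P.β :=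
    Measurable.ite (measurableSet_lt measurable_snd measurable_const) measurable_const
      measurable_const
  refine Measurable.prodMk (Measurable.ite (measurableSet_le measurable_fst measurable_const)
    ?_ (by fun_prop)) (Measurable.ite (measurableSet_lt measurable_snd measurable_const)
    (by fun_prop) (by fun_prop))
  exact measurable_fst.mul ((((measurable_const (a := (2 : ℝ))).pow h2).mul
    (measurable_fst.pow h2)).const_add 1)

lemma measurable_iter (n : ℕ) : Measurable (P.T^[n]) := P.measurable_T.iterate n

open Classical in
lemma exists_time (z : ℝ × ℝ) :
    ∃ n, (0 < n ∧ P.T^[n] z ∈ D) ∨ ∀ m, 0 < m → P.T^[m] z ∉ D := by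
  by_cases h : ∃ n, 0 < n ∧ P.T^[n] z ∈ D
  · exact h.imp fun n hn => Or.inl hn
  · push Not at h; exact ⟨0, Or.inr h⟩

open Classical in
/-- The first return time to `D` (and `0` if there is no return). -/
def τ (z : ℝ × ℝ) : ℕ := Nat.find (P.exists_time z)

/-- The induced map. -/
def F (z : ℝ × ℝ) : ℝ × ℝ := P.T^[P.τ z] z

/-- The excursion sum of an observable. -/
def exc (g : ℝ × ℝ → ℝ) (z : ℝ × ℝ) : ℝ := ∑ k ∈ Finset.range (P.τ z), g (P.T^[k] z)

open Classical in
lemma measurable_τ : Measurable P.τ := by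
  refine measurable_find _ fun n => ?_
  have h : ∀ m, MeasurableSet {z | P.T^[m] z ∈ D} := fun m => P.measurable_iter m measurableSet_D
  refine MeasurableSet.union ((MeasurableSet.const _).inter (h n)) ?_
  have e : {z | ∀ m, 0 < m → P.T^[m] z ∉ D} = ⋂ m, ⋂ _ : 0 < m, {z | P.T^[m] z ∈ D}ᶜ := by
    ext z; simp
  change MeasurableSet {z | ∀ m, 0 < m → P.T^[m] z ∉ D}
  rw [e]
  exact MeasurableSet.iInter fun m => MeasurableSet.iInter fun _ => (h m).compl

lemma measurable_F : Measurable P.F := by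
  have : Measurable fun q : ℕ × (ℝ × ℝ) => P.T^[q.1] q.2 :=
    measurable_from_prod_countable_right fun n => P.measurable_iter n
  exact this.comp (P.measurable_τ.prodMk measurable_id)

lemma measurable_exc {g : ℝ × ℝ → ℝ} (hg : Measurable g) : Measurable (P.exc g) := by
  have : Measurable fun q : ℕ × (ℝ × ℝ) => ∑ k ∈ Finset.range q.1, g (P.T^[k] q.2) :=
    measurable_from_prod_countable_right fun n => by
      show Measurable fun z => ∑ k ∈ Finset.range n, g (P.T^[k] z)
      exact Finset.measurable_fun_sum _ fun k _ => hg.comp (P.measurable_iter k)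
  exact this.comp (P.measurable_τ.prodMk measurable_id)

open Classical in
lemma τ_eq {z : ℝ × ℝ} {n : ℕ} (hn : 0 < n) (h : P.T^[n] z ∈ D)
    (h' : ∀ m, 0 < m → m < n → P.T^[m] z ∉ D) : P.τ z = n := by
  refine (Nat.find_eq_iff _).2 ⟨Or.inl ⟨hn, h⟩, fun m hm hh => ?_⟩
  rcases hh with hh | hh
  · exact h' m hh.1 hm hh.2
  · exact hh n hn h

lemma iter_br (l : List Bool) {z : ℝ × ℝ} (hz : z ∈ Q) : ∀ k ≤ l.length,
    P.T^[k] (P.br l z) = P.br (l.drop k) z := by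
  induction l with
  | nil => intro k hk; simp at hk; subst hk; rfl
  | cons s l ih =>
    intro k hk
    rcases k with _ | k
    · rfl
    · rw [Function.iterate_succ_apply, br, P.T_σ s (P.br_mem l hz), ih k (by simpa using hk)]
      rfl

lemma iter_ψ (i : Bool × List Bool) {z : ℝ × ℝ} (hz : z ∈ Q) {k : ℕ} (hk : k ≤ i.2.length) :
    P.T^[k + 1] (P.ψ i z) = P.br (i.2.drop k) z := by
  rw [Function.iterate_succ_apply, ψ, P.T_ρ _ (P.br_mem _ hz), P.iter_br _ hz k hk]

lemma br_notMem {l : List Bool} (hl : l ≠ []) {z : ℝ × ℝ} (hz : z ∈ Q) : P.br l z ∉ D := by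
  rcases l with _ | ⟨s, l⟩
  · exact absurd rfl hl
  · exact P.σ_notMem s (P.br_mem l hz)

lemma τ_ψ (i : Bool × List Bool) {z : ℝ × ℝ} (hz : z ∈ D) : P.τ (P.ψ i z) = i.2.length + 1 := by
  refine P.τ_eq (by omega) ?_ fun m hm hm' => ?_
  · rw [P.iter_ψ i (D_subset_Q hz) le_rfl, List.drop_length]; exact hz
  · obtain ⟨m, rfl⟩ := Nat.exists_eq_succ_of_ne_zero hm.ne'
    rw [Nat.succ_eq_add_one, P.iter_ψ i (D_subset_Q hz) (by omega)]
    refine P.br_notMem (fun h => ?_) (D_subset_Q hz)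
    rw [List.drop_eq_nil_iff] at h
    omega

lemma F_ψ (i : Bool × List Bool) {z : ℝ × ℝ} (hz : z ∈ D) : P.F (P.ψ i z) = z := by
  rw [F, P.τ_ψ i hz, P.iter_ψ i (D_subset_Q hz) le_rfl, List.drop_length]; rfl

lemma exc_ψ (g : ℝ × ℝ → ℝ) (i : Bool × List Bool) {z : ℝ × ℝ} (hz : z ∈ D) :
    P.exc g (P.ψ i z) =
      (∑ k ∈ Finset.range i.2.length, g (P.br (i.2.drop k) z)) + g (P.ψ i z) := by
  rw [exc, P.τ_ψ i hz, Finset.sum_range_succ']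
  congr 1
  refine Finset.sum_congr rfl fun k hk => ?_
  rw [P.iter_ψ i (D_subset_Q hz) (Finset.mem_range.1 hk).le]

lemma volume_D : (volume : Measure (ℝ × ℝ)) D = 1 / 2 := by
  rw [D, Measure.volume_eq_prod, Measure.prod_prod, Real.volume_Ioc, Real.volume_Ico]
  norm_num
  rw [ENNReal.ofReal_div_of_pos (by norm_num)]
  simp

lemma dist_le_one {z z' : ℝ × ℝ} (hz : z ∈ Q) (hz' : z' ∈ Q) : dist z z' ≤ 1 := by
  rw [Prod.dist_eq, Real.dist_eq, Real.dist_eq]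
  obtain ⟨⟨h1, h2⟩, h3, h4⟩ := hz
  obtain ⟨⟨h1', h2'⟩, h3', h4'⟩ := hz'
  exact max_le (abs_le.2 ⟨by linarith, by linarith⟩) (abs_le.2 ⟨by linarith, by linarith⟩)

/-- The induced system as a full-branch map, with distance `dist ^ t`. -/
def sys (t : ℝ) (ht : 0 < t) (ht1 : t ≤ 1) : FullBranch (ℝ × ℝ) (Bool × List Bool) where
  m := (2 : ENNReal) • (volume : Measure (ℝ × ℝ)).restrict D
  D := D
  d x y := dist x y ^ t
  F := P.F
  ψ := P.ψ
  J := P.J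
  κ := P.rate ^ t
  Dc := 4
  prob := ⟨by
    rw [Measure.smul_apply, Measure.restrict_apply_univ, volume_D, smul_eq_mul, one_div]
    exact ENNReal.mul_inv_cancel (by norm_num) (by norm_num)⟩
  compl_null := by simp [Measure.restrict_apply measurableSet_D.compl]
  d_nonneg x y := by positivity
  d_le_one x hx y hy := Real.rpow_le_one dist_nonneg
    (dist_le_one (D_subset_Q hx) (D_subset_Q hy)) ht.le
  d_symm x y := by rw [dist_comm]
  κ_nonneg := Real.rpow_nonneg P.rate_pos.le _
  κ_lt := Real.rpow_lt_one P.rate_pos.le P.rate_lt_one ht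
  Dc_nonneg := by norm_num
  maps i x hx := P.ψ_mem i (D_subset_Q hx)
  contr i x hx y hy := by
    rw [← Real.mul_rpow P.rate_pos.le dist_nonneg]
    exact Real.rpow_le_rpow dist_nonneg (P.dist_ψ_le i (D_subset_Q hx) (D_subset_Q hy)) ht.le
  J_nonneg i x _ := (P.J_pos i x).le
  J_dist i x hx y hy := by
    have h1 := P.jac_le i.2 hx.1.1.le hy.1.1.le
    have h2 : |x.1 - y.1| ≤ dist x y ^ t := by
      have h3 := dist_le_one (D_subset_Q hx) (D_subset_Q hy)
      have h4 : |x.1 - y.1| ≤ dist x y := by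
        rw [Prod.dist_eq, Real.dist_eq]; exact le_max_left _ _
      rcases (dist_nonneg (x := x) (y := y)).eq_or_lt with h | h
      · rw [← h] at h4 ⊢
        exact h4.trans (by positivity)
      · have := Real.rpow_le_rpow_of_exponent_ge h h3 ht1
        rw [Real.rpow_one] at this
        exact h4.trans this
    have h5 := P.jac_pos i.2 y
    have h6 := P.w_pos i.1
    unfold J
    calc P.w i.1 / 2 * P.jac i.2 x ≤ P.w i.1 / 2 * (Real.exp (4 * dist x y ^ t) * P.jac i.2 y) := by
          refine mul_le_mul_of_nonneg_left (h1.trans ?_) (by positivity)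
          gcongr
      _ = _ := by ring
  F_ψ i x hx := P.F_ψ i hx
  meas_F := P.measurable_F
  meas_ψ := P.measurable_ψ
  meas_J := P.measurable_J
  dual := by
    ext A hA
    rw [Measure.sum_apply _ hA, Measure.smul_apply, smul_eq_mul, ← lintegral_indicator_one hA,
      P.lintegral_D (measurable_one.indicator hA), ← ENNReal.tsum_mul_left]
    refine tsum_congr fun i => ?_
    rw [Measure.map_apply (P.measurable_ψ i) hA, withDensity_apply _ (P.measurable_ψ i hA),
      ← lintegral_indicator (P.measurable_ψ i hA), lintegral_smul_measure, smul_eq_mul]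
    congr 1
    refine lintegral_congr fun x => ?_
    by_cases h : P.ψ i x ∈ A
    · rw [Set.indicator_of_mem h, Set.indicator_of_mem (show x ∈ P.ψ i ⁻¹' A from h)]; simp
    · rw [Set.indicator_of_notMem h, Set.indicator_of_notMem (show x ∉ P.ψ i ⁻¹' A from h)]; simp
  meas_reg u hu := by
    obtain ⟨K, hK⟩ := hu
    refine AEStronglyMeasurable.smul_measure ?_ _
    refine ContinuousOn.aestronglyMeasurable ?_ measurableSet_D
    intro x hx
    rw [ContinuousWithinAt, tendsto_iff_norm_sub_tendsto_zero]
    have h1 : Tendsto (fun y => K * dist y x ^ t) (𝓝[D] x) (𝓝 0) := by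
      have : Continuous fun y => K * dist y x ^ t :=
        continuous_const.mul ((continuous_id.dist continuous_const).rpow_const
          fun _ => Or.inr ht.le)
      have h2 := this.tendsto x
      rw [dist_self, Real.zero_rpow ht.ne', mul_zero] at h2
      exact h2.mono_left nhdsWithin_le_nhds
    refine squeeze_zero' (Eventually.of_forall fun _ => norm_nonneg _) ?_ h1
    filter_upwards [self_mem_nhdsWithin] with y hy using hK y hy x hx

lemma exc_branchwise {t : ℝ} (ht : 0 < t) (ht1 : t ≤ 1) {g : ℝ × ℝ → ℝ} {C : ℝ}
    (hb : ∀ z ∈ Q, |g z| ≤ C) (hl : ∀ z ∈ Q, ∀ z' ∈ Q, |g z - g z'| ≤ C * dist z z' ^ t) :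
    (P.sys t ht ht1).Branchwise (fun i => C * (i.2.length + 1)) (P.exc g) := by
  have hC : 0 ≤ C := (abs_nonneg _).trans (hb (1, 0) ⟨⟨by norm_num, by norm_num⟩,
    by norm_num, by norm_num⟩)
  constructor
  · intro i z hz
    have hz : z ∈ D := hz
    change ‖P.exc g (P.ψ i z)‖ ≤ C * (i.2.length + 1)
    rw [P.exc_ψ g i hz, mul_add, mul_one]
    refine (norm_add_le _ _).trans (add_le_add ((norm_sum_le _ _).trans ?_)
      (hb _ (D_subset_Q (P.ψ_mem i (D_subset_Q hz)))))
    refine (Finset.sum_le_card_nsmul _ _ C fun k _ => hb _ (P.br_mem _ (D_subset_Q hz))).trans ?_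
    rw [Finset.card_range, nsmul_eq_mul, mul_comm]
  · intro i z hz z' hz'
    have hz : z ∈ D := hz
    have hz' : z' ∈ D := hz'
    change ‖P.exc g (P.ψ i z) - P.exc g (P.ψ i z')‖ ≤ C * (i.2.length + 1) * dist z z' ^ t
    have hd : ∀ x ∈ Q, ∀ x' ∈ Q, dist x x' ≤ dist z z' → |g x - g x'| ≤ C * dist z z' ^ t :=
      fun x hx x' hx' h => (hl x hx x' hx').trans (mul_le_mul_of_nonneg_left
        (Real.rpow_le_rpow dist_nonneg h ht.le) hC)
    rw [P.exc_ψ g i hz, P.exc_ψ g i hz', add_sub_add_comm, ← Finset.sum_sub_distrib,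
      mul_add, mul_one, add_mul]
    refine (norm_add_le _ _).trans (add_le_add ((norm_sum_le _ _).trans ?_) ?_)
    · refine (Finset.sum_le_card_nsmul _ _ _ fun k _ => hd _ (P.br_mem _ (D_subset_Q hz)) _
        (P.br_mem _ (D_subset_Q hz')) (P.dist_br_le _ (D_subset_Q hz) (D_subset_Q hz'))).trans ?_
      rw [Finset.card_range, nsmul_eq_mul]
      apply le_of_eq; ring
    · refine hd _ (D_subset_Q (P.ψ_mem i (D_subset_Q hz))) _
        (D_subset_Q (P.ψ_mem i (D_subset_Q hz'))) ?_
      refine (P.dist_ψ_le i (D_subset_Q hz) (D_subset_Q hz')).trans ?_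
      exact mul_le_of_le_one_left dist_nonneg P.rate_lt_one.le

lemma T_mem {z : ℝ × ℝ} (hz : z ∈ Q) : P.T z ∈ Q := by
  obtain ⟨⟨h1, h2⟩, h3, h4⟩ := hz
  have hp := P.hp
  have hp' := P.hp'
  unfold T skewLSV
  constructor
  · simp only [lsv]
    split_ifs with h
    · refine ⟨h1.trans_le (le_gl h1.le), ?_⟩
      have ha : 0 < alphaOf P.α P.β P.p z.2 := by
        unfold alphaOf; split_ifs <;> linarith [P.hα, P.hαβ]
      have := (gl_strictMonoOn ha).monotoneOn (mem_Ici.2 h1.le)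
        (mem_Ici.2 (by norm_num : (0 : ℝ) ≤ 1 / 2)) h
      rwa [gl_half] at this
    · constructor <;> linarith
  · simp only [phiMap]
    split_ifs with h
    · exact ⟨by positivity, by rwa [div_lt_one hp]⟩
    · exact ⟨div_nonneg (by linarith) (by linarith), by
        rw [div_lt_one (by linarith)]; linarith⟩

lemma iter_mem (n : ℕ) {z : ℝ × ℝ} (hz : z ∈ Q) : P.T^[n] z ∈ Q := by
  induction n with
  | zero => exact hz
  | succ n ih => rw [Function.iterate_succ_apply']; exact P.T_mem ih

lemma fst_le_of_notMem (n : ℕ) : ∀ z ∈ Q, (∀ k < n, P.T^[k] z ∉ D) → z.1 ≤ 1 / ((n : ℝ) + 1) := by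
  induction n with
  | zero => intro z hz _; simpa using hz.1.2
  | succ n ih =>
    intro z hz h
    have h0 : z.1 ≤ 1 / 2 := by
      by_contra hc
      push Not at hc
      exact h 0 (by omega) ⟨⟨hc, hz.1.2⟩, hz.2⟩
    have h1 := ih (P.T z) (P.T_mem hz) fun k hk => by
      rw [← Function.iterate_succ_apply]; exact h _ (by omega)
    have ha : 0 < alphaOf P.α P.β P.p z.2 ∧ alphaOf P.α P.β P.p z.2 < 1 := by
      unfold alphaOf; split_ifs <;> constructor <;> linarith [P.hα, P.hαβ, P.hβ]
    have e : (P.T z).1 = gl (alphaOf P.α P.β P.p z.2) z.1 := by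
      simp only [T, skewLSV, lsv, if_pos h0]; rfl
    rw [e] at h1
    have := ginv_le_inv ha.1 ha.2 (hz.1.1.le.trans (le_gl hz.1.1.le)) h1
    rw [ginv_gl ha.1 hz.1.1.le] at this
    push_cast
    rwa [show (n : ℝ) + 1 + 1 = n + 2 by ring]

lemma exists_mem {z : ℝ × ℝ} (hz : z ∈ Q) : ∃ n, P.T^[n] z ∈ D := by
  by_contra hc
  push Not at hc
  obtain ⟨n, hn⟩ := exists_nat_one_div_lt hz.1.1
  exact absurd (P.fst_le_of_notMem n z hz fun k _ => hc k) (not_le.2 hn)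

lemma exists_return {z : ℝ × ℝ} (hz : z ∈ Q) : ∃ n, 0 < n ∧ P.T^[n] z ∈ D := by
  obtain ⟨n, hn⟩ := P.exists_mem (P.T_mem hz)
  exact ⟨n + 1, by omega, by rwa [Function.iterate_succ_apply]⟩

open Classical in
lemma τ_spec {z : ℝ × ℝ} (hz : z ∈ Q) : 0 < P.τ z ∧ P.T^[P.τ z] z ∈ D := by
  obtain ⟨n, hn⟩ := P.exists_return hz
  rcases Nat.find_spec (P.exists_time z) with h | h
  · exact h
  · exact absurd hn.2 (h n hn.1)

open Classical in
lemma notMem_of_lt_τ {z : ℝ × ℝ} {m : ℕ} (hm : 0 < m) (h : m < P.τ z) : P.T^[m] z ∉ D := fun hh =>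
  Nat.find_min (P.exists_time z) h (Or.inl ⟨hm, hh⟩)

lemma lt_τ_iff {z : ℝ × ℝ} (hz : z ∈ Q) {n : ℕ} :
    n < P.τ z ↔ ∀ m, 0 < m → m ≤ n → P.T^[m] z ∉ D := by
  constructor
  · exact fun h m hm hmn => P.notMem_of_lt_τ hm (by omega)
  · intro h
    by_contra hc
    push Not at hc
    obtain ⟨h1, h2⟩ := P.τ_spec hz
    exact h _ h1 hc h2

lemma F_mem {z : ℝ × ℝ} (hz : z ∈ Q) : P.F z ∈ D := (P.τ_spec hz).2

end Par
end LSV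

namespace LSV
namespace Par
variable (P : Par)

/-- The transfer operator of the noise dynamics. -/
def Po (g : ℝ → ℝ) (ω : ℝ) : ℝ := ∑ s, P.w s * g (P.b s ω)

/-- The noise dynamics. -/
def φ : ℝ → ℝ := phiMap P.p

lemma φ_b (s : Bool) {ω : ℝ} (h : ω ∈ Ico (0 : ℝ) 1) : P.φ (P.b s ω) = ω := P.phiMap_b s h

lemma sum_w : ∑ s, P.w s = 1 := by simp [w]

lemma φ_mem {ω : ℝ} (h : ω ∈ Ico (0 : ℝ) 1) : P.φ ω ∈ Ico (0 : ℝ) 1 :=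
  (P.T_mem (z := (1, ω)) ⟨⟨one_pos, le_rfl⟩, h⟩).2

lemma measurable_φ : Measurable P.φ := by
  unfold φ phiMap
  exact Measurable.ite (measurableSet_lt measurable_id measurable_const)
    (by fun_prop) (by fun_prop)

lemma measurable_Po {g : ℝ → ℝ} (hg : Measurable g) : Measurable (P.Po g) :=
  Finset.measurable_fun_sum _ fun s _ => (hg.comp (P.b_continuous s).measurable).const_mul _

lemma Po_abs_le {g : ℝ → ℝ} {B : ℝ} (hB : ∀ ω ∈ Ico (0 : ℝ) 1, |g ω| ≤ B) :
    ∀ ω ∈ Ico (0 : ℝ) 1, |P.Po g ω| ≤ B := by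
  intro ω hω
  refine (Finset.abs_sum_le_sum_abs _ _).trans ?_
  calc ∑ s, |P.w s * g (P.b s ω)| ≤ ∑ s, P.w s * B := Finset.sum_le_sum fun s _ => by
        rw [abs_mul, abs_of_pos (P.w_pos s)]
        exact mul_le_mul_of_nonneg_left (hB _ (P.b_mem s hω)) (P.w_pos s).le
    _ = B := by rw [← Finset.sum_mul, P.sum_w, one_mul]

lemma lintegral_b_congr {g : ℝ → ENNReal} {g' : Bool → ℝ → ENNReal}
    (h : ∀ s, ∀ ω ∈ Ico (0 : ℝ) 1, g (P.b s ω) = g' s ω) : ∫⁻ ω in Ico 0 1, g ω =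
    ∑ s, ENNReal.ofReal (P.w s) * ∫⁻ ω in Ico 0 1, g' s ω := by
  rw [P.lintegral_b]
  refine Finset.sum_congr rfl fun s _ => ?_
  rw [setLIntegral_congr_fun measurableSet_Ico (h s)]

lemma lintegral_φ (g : ℝ → ENNReal) : ∫⁻ ω in Ico 0 1, g (P.φ ω) = ∫⁻ ω in Ico 0 1, g ω := by
  rw [P.lintegral_b_congr (g' := fun _ => g) fun s ω hω => by rw [P.φ_b s hω], ← Finset.sum_mul,
    ← ENNReal.ofReal_sum_of_nonneg fun s _ => (P.w_pos s).le, P.sum_w, ENNReal.ofReal_one, one_mul]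

/-- One step of the exponential moment bound. -/
lemma Po_exp_le {m : ℝ → ℝ} {B e l : ℝ} (hB : ∀ ω ∈ Ico (0 : ℝ) 1, |m ω| ≤ B)
    (he : ∀ ω ∈ Ico (0 : ℝ) 1, P.Po m ω ≤ e) (hl : 0 ≤ l) (hlB : l * B ≤ 1) {ω : ℝ}
    (hω : ω ∈ Ico (0 : ℝ) 1) :
    ∑ s, P.w s * Real.exp (l * m (P.b s ω)) ≤ Real.exp (l * e + (l * B) ^ 2) := by
  have h1 : ∀ s, Real.exp (l * m (P.b s ω)) ≤ 1 + l * m (P.b s ω) + (l * B) ^ 2 := by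
    intro s
    have hx : |l * m (P.b s ω)| ≤ l * B := by
      rw [abs_mul, abs_of_nonneg hl]
      exact mul_le_mul_of_nonneg_left (hB _ (P.b_mem s hω)) hl
    have h2 := Real.abs_exp_sub_one_sub_id_le (hx.trans hlB)
    have h3 := (abs_le.1 h2).2
    have h4 : (l * m (P.b s ω)) ^ 2 ≤ (l * B) ^ 2 := by
      rw [← sq_abs]; exact pow_le_pow_left₀ (abs_nonneg _) hx 2
    linarith
  calc ∑ s, P.w s * Real.exp (l * m (P.b s ω))
      ≤ ∑ s, P.w s * (1 + l * m (P.b s ω) + (l * B) ^ 2) := Finset.sum_le_sum fun s _ =>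
        mul_le_mul_of_nonneg_left (h1 s) (P.w_pos s).le
    _ = (1 + (l * B) ^ 2) * ∑ s, P.w s + l * P.Po m ω := by
        rw [Po, Finset.mul_sum, Finset.mul_sum, ← Finset.sum_add_distrib]
        exact Finset.sum_congr rfl fun s _ => by ring
    _ ≤ (l * e + (l * B) ^ 2) + 1 := by
        rw [P.sum_w]
        have := mul_le_mul_of_nonneg_left (he ω hω) hl
        linarith
    _ ≤ _ := Real.add_one_le_exp _

lemma exp_moment {m : ℝ → ℝ} {B e l : ℝ} (hB : ∀ ω ∈ Ico (0 : ℝ) 1, |m ω| ≤ B)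
    (he : ∀ ω ∈ Ico (0 : ℝ) 1, P.Po m ω ≤ e) (hl : 0 ≤ l) (hlB : l * B ≤ 1) (hm : Measurable m)
    (n : ℕ) : ∫⁻ ω in Ico 0 1, ENNReal.ofReal (Real.exp (l * birkhoffSum P.φ m n ω)) ≤
      ENNReal.ofReal (Real.exp (n * (l * e + (l * B) ^ 2))) := by
  induction n with
  | zero => simp
  | succ n ih =>
    have hS : Measurable fun ω => birkhoffSum P.φ m n ω :=
      Finset.measurable_fun_sum _ fun k _ => hm.comp (P.measurable_φ.iterate k)
    rw [P.lintegral_b_congr (g' := fun s ω => ENNReal.ofReal (Real.exp (l * m (P.b s ω))) *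
      ENNReal.ofReal (Real.exp (l * birkhoffSum P.φ m n ω)))]
    swap
    · intro s ω hω
      rw [birkhoffSum_succ', P.φ_b s hω, mul_add, Real.exp_add,
        ENNReal.ofReal_mul (Real.exp_pos _).le]
    have hms : ∀ s, Measurable fun ω => ENNReal.ofReal (P.w s) *
        (ENNReal.ofReal (Real.exp (l * m (P.b s ω))) *
          ENNReal.ofReal (Real.exp (l * birkhoffSum P.φ m n ω))) := fun s =>
      (((hm.comp (P.b_continuous s).measurable).const_mul l).exp.ennreal_ofReal.mul
        (hS.const_mul l).exp.ennreal_ofReal).const_mul _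
    simp_rw [← lintegral_const_mul' _ _ ENNReal.ofReal_ne_top]
    rw [← lintegral_finsetSum _ fun s _ => hms s]
    calc _ ≤ ∫⁻ ω in Ico 0 1, ENNReal.ofReal (Real.exp (l * e + (l * B) ^ 2)) *
          ENNReal.ofReal (Real.exp (l * birkhoffSum P.φ m n ω)) := by
          refine setLIntegral_mono' measurableSet_Ico fun ω hω => ?_
          simp_rw [← mul_assoc, ← ENNReal.ofReal_mul (P.w_pos _).le]
          rw [← Finset.sum_mul, ← ENNReal.ofReal_sum_of_nonneg fun s _ =>
            mul_nonneg (P.w_pos s).le (Real.exp_pos _).le]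
          gcongr
          exact P.Po_exp_le hB he hl hlB hω
      _ = ENNReal.ofReal (Real.exp (l * e + (l * B) ^ 2)) *
          ∫⁻ ω in Ico 0 1, ENNReal.ofReal (Real.exp (l * birkhoffSum P.φ m n ω)) :=
          lintegral_const_mul' _ _ ENNReal.ofReal_ne_top
      _ ≤ _ := by
          refine (mul_le_mul_right ih _).trans ?_
          rw [← ENNReal.ofReal_mul (Real.exp_pos _).le, ← Real.exp_add]
          apply le_of_eq
          push_cast
          ring_nf

/-- The corrector in the martingale-type decomposition. -/
def corr (g : ℝ → ℝ) (N : ℕ) (ω : ℝ) : ℝ := ∑ k ∈ Finset.range N, P.Po^[k + 1] g ω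

lemma iter_Po_abs_le {g : ℝ → ℝ} {B : ℝ} (hB : ∀ ω ∈ Ico (0 : ℝ) 1, |g ω| ≤ B) (k : ℕ) :
    ∀ ω ∈ Ico (0 : ℝ) 1, |P.Po^[k] g ω| ≤ B := by
  induction k with
  | zero => exact hB
  | succ k ih => rw [Function.iterate_succ_apply']; exact P.Po_abs_le ih

lemma measurable_iter_Po {g : ℝ → ℝ} (hg : Measurable g) (k : ℕ) : Measurable (P.Po^[k] g) := by
  induction k with
  | zero => exact hg
  | succ k ih => rw [Function.iterate_succ_apply']; exact P.measurable_Po ih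

lemma corr_abs_le {g : ℝ → ℝ} {B : ℝ} (hB : ∀ ω ∈ Ico (0 : ℝ) 1, |g ω| ≤ B) (N : ℕ) {ω : ℝ}
    (hω : ω ∈ Ico (0 : ℝ) 1) : |P.corr g N ω| ≤ N * B := by
  refine (Finset.abs_sum_le_sum_abs _ _).trans ((Finset.sum_le_card_nsmul _ _ B fun k _ =>
    P.iter_Po_abs_le hB _ ω hω).trans ?_)
  rw [Finset.card_range, nsmul_eq_mul]

/-- The martingale-type part of an observable. -/
def mart (g : ℝ → ℝ) (N : ℕ) (ω : ℝ) : ℝ := g ω + P.corr g N ω - P.corr g N (P.φ ω)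

lemma Po_mart (g : ℝ → ℝ) (N : ℕ) {ω : ℝ} (hω : ω ∈ Ico (0 : ℝ) 1) :
    P.Po (P.mart g N) ω = P.Po^[N + 1] g ω := by
  have h1 : P.Po (P.mart g N) ω = P.Po g ω + P.Po (P.corr g N) ω - P.corr g N ω := by
    simp only [Po, mart, Fintype.sum_bool, P.φ_b _ hω]
    have := P.sum_w
    rw [Fintype.sum_bool] at this
    linear_combination (-P.corr g N ω) * this
  have h2 : P.Po (P.corr g N) ω = ∑ k ∈ Finset.range N, P.Po^[k + 2] g ω := by
    simp only [Po, corr, Finset.mul_sum]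
    rw [Finset.sum_comm]
    refine Finset.sum_congr rfl fun k _ => ?_
    rw [Function.iterate_succ_apply' _ (k + 1)]
    rfl
  have h3 := Finset.sum_range_succ (fun k => P.Po^[k + 1] g ω) N
  have h4 := Finset.sum_range_succ' (fun k => P.Po^[k + 1] g ω) N
  rw [h1, h2, corr]
  simp only [zero_add, Function.iterate_one] at h4
  linarith

lemma birkhoffSum_mart (g : ℝ → ℝ) (N n : ℕ) (ω : ℝ) : birkhoffSum P.φ (P.mart g N) n ω =
    birkhoffSum P.φ g n ω + P.corr g N ω - P.corr g N (P.φ^[n] ω) := by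
  induction n with
  | zero => simp
  | succ n ih =>
    rw [birkhoffSum_succ, birkhoffSum_succ, ih, mart, Function.iterate_succ_apply']
    ring

lemma measurable_mart {g : ℝ → ℝ} (hg : Measurable g) (N : ℕ) : Measurable (P.mart g N) := by
  have : Measurable (P.corr g N) :=
    Finset.measurable_fun_sum _ fun k _ => P.measurable_iter_Po hg _
  exact (hg.add this).sub (this.comp P.measurable_φ)

lemma iter_φ_mem (n : ℕ) {ω : ℝ} (h : ω ∈ Ico (0 : ℝ) 1) : P.φ^[n] ω ∈ Ico (0 : ℝ) 1 := by
  induction n with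
  | zero => exact h
  | succ n ih => rw [Function.iterate_succ_apply']; exact P.φ_mem ih

/-- One-sided large deviations for the noise. -/
lemma large_deviation_aux {g : ℝ → ℝ} (hg : Measurable g) {B : ℝ}
    (hB : ∀ ω ∈ Ico (0 : ℝ) 1, |g ω| ≤ B)
    (hP : ∀ e > 0, ∃ N : ℕ, ∀ ω ∈ Ico (0 : ℝ) 1, P.Po^[N + 1] g ω ≤ e) {e : ℝ} (he : 0 < e) :
    ∃ C θ : ℝ, 0 < C ∧ 0 < θ ∧ θ < 1 ∧ ∀ n : ℕ, volume {ω | ω ∈ Ico (0 : ℝ) 1 ∧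
      e * n ≤ birkhoffSum P.φ g n ω} ≤ ENNReal.ofReal (C * θ ^ n) := by
  obtain ⟨N, hN⟩ := hP (e / 4) (by linarith)
  have hB0 : 0 ≤ B := (abs_nonneg _).trans (hB 0 (by simp))
  set B' := B + 2 * (N * B) + 1
  have hNB : 0 ≤ N * B := by positivity
  have hB'1 : 1 ≤ B' := by simp only [B']; linarith
  have hm : ∀ ω ∈ Ico (0 : ℝ) 1, |P.mart g N ω| ≤ B' := by
    intro ω hω
    have h1 := abs_le.1 (hB ω hω)
    have h2 := abs_le.1 (P.corr_abs_le hB N hω)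
    have h3 := abs_le.1 (P.corr_abs_le hB N (P.φ_mem hω))
    unfold mart
    exact abs_le.2 ⟨by simp only [B']; linarith, by simp only [B']; linarith⟩
  have hPm : ∀ ω ∈ Ico (0 : ℝ) 1, P.Po (P.mart g N) ω ≤ e / 4 := fun ω hω => by
    rw [P.Po_mart g N hω]; exact hN ω hω
  set l := min (1 / B') (e / (4 * B' ^ 2)) with hl
  have hl0 : 0 < l := lt_min (by positivity) (by positivity)
  have hl1 : l * B' ≤ 1 := by
    have := min_le_left (1 / B') (e / (4 * B' ^ 2))
    rwa [le_div_iff₀ (by positivity)] at this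
  have hl2 : (l * B') ^ 2 ≤ l * (e / 4) := by
    have := min_le_right (1 / B') (e / (4 * B' ^ 2))
    rw [← hl, le_div_iff₀ (by positivity)] at this
    nlinarith
  refine ⟨Real.exp (l * (2 * (N * B))), Real.exp (-(l * (e / 2))), Real.exp_pos _, Real.exp_pos _,
    Real.exp_lt_one_iff.2 (neg_lt_zero.2 (by positivity)), fun n => ?_⟩
  have h1 := P.exp_moment hm hPm hl0.le hl1 (P.measurable_mart hg N) n
  have hS : Measurable fun ω => ENNReal.ofReal
      (Real.exp (l * birkhoffSum P.φ (P.mart g N) n ω)) := by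
    have : Measurable fun ω => birkhoffSum P.φ (P.mart g N) n ω :=
      Finset.measurable_fun_sum _ fun k _ => (P.measurable_mart hg N).comp
        (P.measurable_φ.iterate k)
    exact (this.const_mul l).exp.ennreal_ofReal
  set c := Real.exp (l * (e * n - 2 * (N * B))) with hc
  have hc0 : 0 < c := Real.exp_pos _
  have h2 := mul_meas_ge_le_lintegral (μ := volume.restrict (Ico (0 : ℝ) 1)) hS (ENNReal.ofReal c)
  have h3 : volume {ω | ω ∈ Ico (0 : ℝ) 1 ∧ e * n ≤ birkhoffSum P.φ g n ω} ≤
      (volume.restrict (Ico (0 : ℝ) 1)) {ω | ENNReal.ofReal c ≤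
        ENNReal.ofReal (Real.exp (l * birkhoffSum P.φ (P.mart g N) n ω))} := by
    rw [Measure.restrict_apply (measurableSet_le measurable_const hS)]
    refine measure_mono fun ω hω => ⟨?_, hω.1⟩
    obtain ⟨hω, h⟩ := hω
    refine ENNReal.ofReal_le_ofReal (Real.exp_le_exp.2 (mul_le_mul_of_nonneg_left ?_ hl0.le))
    rw [P.birkhoffSum_mart]
    have h2 := abs_le.1 (P.corr_abs_le hB N hω)
    have h3 := abs_le.1 (P.corr_abs_le hB N (P.iter_φ_mem n hω))
    linarith
  refine h3.trans ?_
  have h4 := h2.trans h1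
  rw [mul_comm, ← ENNReal.le_div_iff_mul_le (Or.inl (by simpa using hc0))
    (Or.inl ENNReal.ofReal_ne_top), ← ENNReal.ofReal_div_of_pos hc0] at h4
  refine h4.trans (ENNReal.ofReal_le_ofReal ?_)
  rw [hc, ← Real.exp_sub, ← Real.exp_nat_mul, ← Real.exp_add]
  refine Real.exp_le_exp.2 ?_
  have := mul_le_mul_of_nonneg_left hl2 (Nat.cast_nonneg (α := ℝ) n)
  nlinarith

lemma iter_Po_neg (g : ℝ → ℝ) (k : ℕ) : P.Po^[k] (fun ω => -g ω) = fun ω => -P.Po^[k] g ω := by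
  induction k with
  | zero => rfl
  | succ k ih =>
    rw [Function.iterate_succ_apply', ih, Function.iterate_succ_apply']
    ext ω
    simp [Po]

/-- Large deviations for the noise. -/
lemma large_deviation {g : ℝ → ℝ} (hg : Measurable g) {B : ℝ}
    (hB : ∀ ω ∈ Ico (0 : ℝ) 1, |g ω| ≤ B)
    (hP : ∀ e > 0, ∃ N : ℕ, ∀ ω ∈ Ico (0 : ℝ) 1, |P.Po^[N + 1] g ω| ≤ e) {e : ℝ} (he : 0 < e) :
    ∃ C θ : ℝ, 0 < C ∧ 0 < θ ∧ θ < 1 ∧ ∀ n : ℕ, volume {ω | ω ∈ Ico (0 : ℝ) 1 ∧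
      e * n ≤ |birkhoffSum P.φ g n ω|} ≤ ENNReal.ofReal (C * θ ^ n) := by
  obtain ⟨C, θ, hC, hθ, hθ1, h⟩ := P.large_deviation_aux hg hB (fun e he =>
    (hP e he).imp fun N hN ω hω => (abs_le.1 (hN ω hω)).2) he
  obtain ⟨C', θ', hC', hθ', hθ1', h'⟩ := P.large_deviation_aux (g := fun ω => -g ω) hg.neg
    (B := B) (fun ω hω => by rw [abs_neg]; exact hB ω hω) (fun e he =>
    (hP e he).imp fun N hN ω hω => by
      rw [iter_Po_neg]; linarith [(abs_le.1 (hN ω hω)).1]) he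
  refine ⟨C + C', max θ θ', by positivity, lt_max_of_lt_left hθ, max_lt hθ1 hθ1', fun n => ?_⟩
  have hsub : {ω | ω ∈ Ico (0 : ℝ) 1 ∧ e * n ≤ |birkhoffSum P.φ g n ω|} ⊆
      {ω | ω ∈ Ico (0 : ℝ) 1 ∧ e * n ≤ birkhoffSum P.φ g n ω} ∪
      {ω | ω ∈ Ico (0 : ℝ) 1 ∧ e * n ≤ birkhoffSum P.φ (fun ω => -g ω) n ω} := by
    rintro ω ⟨hω, h⟩
    rcases le_abs.1 h with h | h
    · exact Or.inl ⟨hω, h⟩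
    · refine Or.inr ⟨hω, ?_⟩
      simpa [birkhoffSum] using h
  refine (measure_mono hsub).trans ((measure_union_le _ _).trans
      ((add_le_add (h n) (h' n)).trans ?_))
  rw [← ENNReal.ofReal_add (by positivity) (by positivity)]
  refine ENNReal.ofReal_le_ofReal ?_
  rw [add_mul]
  gcongr
  · exact le_max_left _ _
  · exact le_max_right _ _

lemma volume_b : (volume : Measure ℝ).restrict (Ico 0 1) =
    ∑ s, ENNReal.ofReal (P.w s) • ((volume : Measure ℝ).restrict (Ico 0 1)).map (P.b s) := by
  ext A hA
  rw [Measure.finsetSum_apply, ← lintegral_indicator_one hA, P.lintegral_b]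
  refine Finset.sum_congr rfl fun s _ => ?_
  rw [Measure.smul_apply, smul_eq_mul, Measure.map_apply (P.b_continuous s).measurable hA,
    ← lintegral_indicator_one ((P.b_continuous s).measurable hA)]
  rfl

lemma integral_Po {g : ℝ → ℝ} (hg : Measurable g) {B : ℝ}
    (hB : ∀ ω ∈ Ico (0 : ℝ) 1, |g ω| ≤ B) :
    ∫ ω in Ico 0 1, P.Po g ω = ∫ ω in Ico 0 1, g ω := by
  have hintb : ∀ u : ℝ → ℝ, Measurable u → (∀ ω ∈ Ico (0 : ℝ) 1, |u ω| ≤ B) →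
      IntegrableOn u (Ico 0 1) := fun u hu h => by
    refine Integrable.mono' (integrableOn_const (C := B) (by simp)) hu.aestronglyMeasurable ?_
    filter_upwards [ae_restrict_mem measurableSet_Ico] with ω hω using h ω hω
  have h1 : ∀ s, IntegrableOn (fun ω => P.w s * g (P.b s ω)) (Ico 0 1) := fun s =>
    (hintb (fun ω => g (P.b s ω)) (hg.comp (P.b_continuous s).measurable)
      fun ω hω => hB _ (P.b_mem s hω)).const_mul _
  conv_rhs => rw [P.volume_b]
  rw [integral_finsetSum_measure]
  · unfold Po
    rw [integral_finsetSum _ fun s _ => h1 s]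
    refine Finset.sum_congr rfl fun s _ => ?_
    rw [integral_smul_measure, integral_map (P.b_continuous s).measurable.aemeasurable
      hg.aestronglyMeasurable, ENNReal.toReal_ofReal (P.w_pos s).le, smul_eq_mul,
      integral_const_mul]
  · intro s _
    refine Integrable.smul_measure ?_ ENNReal.ofReal_ne_top
    rw [integrable_map_measure hg.aestronglyMeasurable (P.b_continuous s).measurable.aemeasurable]
    exact hintb (fun ω => g (P.b s ω)) (hg.comp (P.b_continuous s).measurable)
      fun ω hω => hB _ (P.b_mem s hω)

/-- Iterates of the transfer operator contract Hölder functions of zero mean. -/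
lemma iter_Po_tendsto {g : ℝ → ℝ} (hg : Measurable g) {C t : ℝ} (ht : 0 < t)
    (hC : ∀ ω ∈ Ico (0 : ℝ) 1, ∀ ω' ∈ Ico (0 : ℝ) 1, |g ω - g ω'| ≤ C * |ω - ω'| ^ t)
    (h0 : ∫ ω in Ico 0 1, g ω = 0) :
    ∀ e > 0, ∃ N : ℕ, ∀ ω ∈ Ico (0 : ℝ) 1, |P.Po^[N + 1] g ω| ≤ e := by
  have hr := P.rate_pos
  have hosc : ∀ k : ℕ, ∀ ω ∈ Ico (0 : ℝ) 1, ∀ ω' ∈ Ico (0 : ℝ) 1,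
      |P.Po^[k] g ω - P.Po^[k] g ω'| ≤ C * (P.rate ^ t) ^ k * |ω - ω'| ^ t := by
    intro k
    induction k with
    | zero => simpa using hC
    | succ k ih =>
      intro ω hω ω' hω'
      rw [Function.iterate_succ_apply', Po, Po, ← Finset.sum_sub_distrib]
      have hk : 0 ≤ C * (P.rate ^ t) ^ k := by
        have := (abs_nonneg _).trans (hC 0 (by simp) (1 / 2) ⟨by norm_num, by norm_num⟩)
        have h2 : 0 < |(0 : ℝ) - 1 / 2| ^ t := by
          refine Real.rpow_pos_of_pos ?_ _; norm_num
        have := nonneg_of_mul_nonneg_left this h2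
        positivity
      have h1 : ∀ s, |P.w s * P.Po^[k] g (P.b s ω) - P.w s * P.Po^[k] g (P.b s ω')| ≤
          P.w s * (C * (P.rate ^ t) ^ (k + 1) * |ω - ω'| ^ t) := by
        intro s
        rw [← mul_sub, abs_mul, abs_of_pos (P.w_pos s)]
        refine mul_le_mul_of_nonneg_left ((ih _ (P.b_mem s hω) _ (P.b_mem s hω')).trans ?_)
          (P.w_pos s).le
        rw [pow_succ, ← mul_assoc, mul_assoc _ (P.rate ^ t), ← Real.mul_rpow hr.le (abs_nonneg _)]
        refine mul_le_mul_of_nonneg_left (Real.rpow_le_rpow (abs_nonneg _) ?_ ht.le) hk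
        rw [P.b_sub, abs_mul, abs_of_pos (P.w_pos s)]
        exact mul_le_mul_of_nonneg_right (P.w_le_rate s) (abs_nonneg _)
      refine (Finset.abs_sum_le_sum_abs _ _).trans ((Finset.sum_le_sum fun s _ => h1 s).trans ?_)
      rw [← Finset.sum_mul, P.sum_w, one_mul]
  have hC0 : 0 ≤ C := by
    have := (abs_nonneg _).trans (hC 0 (by simp) (1 / 2) ⟨by norm_num, by norm_num⟩)
    have h2 : 0 < |(0 : ℝ) - 1 / 2| ^ t := by
      refine Real.rpow_pos_of_pos ?_ _; norm_num
    exact nonneg_of_mul_nonneg_left this h2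
  have hb : ∀ ω ∈ Ico (0 : ℝ) 1, ∀ ω' ∈ Ico (0 : ℝ) 1, |ω - ω'| ^ t ≤ 1 := by
    rintro ω ⟨h1, h2⟩ ω' ⟨h3, h4⟩
    exact Real.rpow_le_one (abs_nonneg _) (abs_le.2 ⟨by linarith, by linarith⟩) ht.le
  have hB : ∀ ω ∈ Ico (0 : ℝ) 1, |g ω| ≤ |g 0| + C := by
    intro ω hω
    have h1 := (hC ω hω 0 (by simp)).trans (mul_le_of_le_one_right hC0 (hb ω hω 0 (by simp)))
    have h2 := abs_sub_abs_le_abs_sub (g ω) (g 0)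
    linarith
  have hintb : ∀ k, ∫ ω in Ico 0 1, P.Po^[k] g ω = 0 := by
    intro k
    induction k with
    | zero => exact h0
    | succ k ih =>
      rw [Function.iterate_succ_apply', P.integral_Po (P.measurable_iter_Po hg k)
        (P.iter_Po_abs_le hB k), ih]
  intro e he
  have hlim : Tendsto (fun k : ℕ => C * (P.rate ^ t) ^ (k + 1)) atTop (𝓝 0) := by
    have := (tendsto_pow_atTop_nhds_zero_of_lt_one (Real.rpow_nonneg hr.le t)
      (Real.rpow_lt_one hr.le P.rate_lt_one ht)).const_mul C
    rw [mul_zero] at this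
    exact this.comp (tendsto_add_atTop_nat 1)
  obtain ⟨N, hN⟩ := (hlim.eventually (gt_mem_nhds he)).exists
  refine ⟨N, fun ω hω => ?_⟩
  have h1 : P.Po^[N + 1] g ω = ∫ ω' in Ico (0 : ℝ) 1, (P.Po^[N + 1] g ω - P.Po^[N + 1] g ω') := by
    rw [integral_sub (by simp) , hintb]
    · simp
    · refine Integrable.mono' (integrableOn_const (C := |g 0| + C) (by simp))
        (P.measurable_iter_Po hg _).aestronglyMeasurable ?_
      filter_upwards [ae_restrict_mem measurableSet_Ico] with ω hω
        using P.iter_Po_abs_le hB _ ω hω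
  rw [h1, ← Real.norm_eq_abs]
  have := norm_setIntegral_le_of_norm_le_const (μ := volume) (s := Ico (0 : ℝ) 1) (C := e)
    (f := fun ω' => P.Po^[N + 1] g ω - P.Po^[N + 1] g ω') (by simp) fun ω' hω' => by
      refine (hosc (N + 1) ω hω ω' hω').trans ?_
      exact (mul_le_of_le_one_right (by positivity) (hb ω hω ω' hω')).trans hN.le
  simpa using this

end Par
end LSV

namespace LSV

section Step
variable {α a u : ℝ}

lemma zstep_eq (hu : 0 < u) :
    (u * (1 + u ^ a)) ^ (-α) = u ^ (-α) * (1 + u ^ a) ^ (-α) :=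
  Real.mul_rpow hu.le (by positivity)

lemma one_sub_le_rpow_neg (hα : 0 < α) (hα1 : α < 1) {v : ℝ} (hv : 0 ≤ v) :
    1 - α * v ≤ (1 + v) ^ (-α) := by
  rw [Real.rpow_neg (by linarith)]
  have h1 := rpow_one_add_le_one_add_mul_self (s := v) (by linarith) hα.le hα1.le
  have h2 : 0 < (1 + v) ^ α := by positivity
  refine le_trans ?_ (inv_anti₀ h2 h1)
  rw [← one_div, le_div_iff₀ (by positivity)]
  nlinarith [sq_nonneg (α * v)]

lemma rpow_neg_le_one_sub (hα : 0 < α) (hα1 : α < 1) {v : ℝ} (hv : 0 ≤ v) :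
    (1 + v) ^ (-α) ≤ 1 - α * (v / (1 + v)) := by
  have h0 : (0 : ℝ) < 1 + v := by linarith
  rw [Real.rpow_neg h0.le, ← Real.inv_rpow h0.le]
  have e : (1 + v)⁻¹ = 1 + -(v / (1 + v)) := by field_simp; ring
  have h2 : v / (1 + v) ≤ 1 := by rw [div_le_one h0]; linarith
  have h1 := rpow_one_add_le_one_add_mul_self (s := -(v / (1 + v))) (by linarith) hα.le hα1.le
  rw [e]
  linarith

lemma zstep_nonneg (hα : 0 < α) (hu : 0 < u) : (u * (1 + u ^ a)) ^ (-α) ≤ u ^ (-α) :=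
  Real.rpow_le_rpow_of_nonpos hu (le_mul_of_one_le_right hu.le
    (by have : 0 < u ^ a := by positivity
        linarith)) (by linarith)

lemma zstep_upper (hα : 0 < α) (hα1 : α < 1) (hu : 0 < u) :
    u ^ (-α) - (u * (1 + u ^ a)) ^ (-α) ≤ α * (u ^ (-α) * u ^ a) := by
  have h1 := one_sub_le_rpow_neg hα hα1 (v := u ^ a) (by positivity)
  have h2 : 0 < u ^ (-α) := by positivity
  rw [zstep_eq hu]
  nlinarith

lemma zstep_lower (hα : 0 < α) (hα1 : α < 1) (hu : 0 < u) :
    α - α / (u ^ (-α) + 1) ≤ u ^ (-α) - (u * (1 + u ^ α)) ^ (-α) := by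
  have h1 := rpow_neg_le_one_sub hα hα1 (v := u ^ α) (by positivity)
  have h2 : 0 < u ^ α := by positivity
  rw [zstep_eq hu]
  have e : u ^ (-α) = (u ^ α)⁻¹ := Real.rpow_neg hu.le _
  have h3 : 0 < u ^ (-α) := by positivity
  have h4 : α - α / (u ^ (-α) + 1) = u ^ (-α) * (α * (u ^ α / (1 + u ^ α))) := by
    rw [e]; field_simp; ring
  rw [h4]
  nlinarith [mul_le_mul_of_nonneg_left h1 h3.le]

end Step

namespace Par
variable (P : Par)

/-- Thresholds for long excursions. -/
def Y : ℕ → ℝ → ℝ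
  | 0, _ => 1
  | n + 1, ω => ginv (alphaOf P.α P.β P.p ω) (Y n (P.φ ω))

lemma alphaOf_pos (ω : ℝ) : 0 < alphaOf P.α P.β P.p ω := by
  unfold alphaOf; split_ifs <;> linarith [P.hα, P.hαβ]

lemma alphaOf_lt_one (ω : ℝ) : alphaOf P.α P.β P.p ω < 1 := by
  unfold alphaOf; split_ifs <;> linarith [P.hαβ, P.hβ]

lemma Y_pos (n : ℕ) (ω : ℝ) : 0 < P.Y n ω := by
  induction n generalizing ω with
  | zero => exact one_pos
  | succ n ih => exact ginv_pos (P.alphaOf_pos ω) (ih _)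

lemma Y_le (n : ℕ) (ω : ℝ) : P.Y n ω ≤ 1 / ((n : ℝ) + 1) := by
  induction n generalizing ω with
  | zero => simp [Y]
  | succ n ih =>
    have := ginv_le_inv (P.alphaOf_pos ω) (P.alphaOf_lt_one ω) (P.Y_pos n _).le (ih (P.φ ω))
    push_cast
    rwa [show (n : ℝ) + 1 + 1 = n + 2 by ring]

lemma Y_le_one (n : ℕ) (ω : ℝ) : P.Y n ω ≤ 1 :=
  (P.Y_le n ω).trans (by rw [div_le_one (by positivity)]; linarith [n.cast_nonneg (α := ℝ)])

lemma Y_succ_le_half (n : ℕ) (ω : ℝ) : P.Y (n + 1) ω ≤ 1 / 2 :=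
  ginv_le_half (P.alphaOf_pos ω) (P.Y_le_one n _)

lemma measurable_Y (n : ℕ) : Measurable (P.Y n) := by
  induction n with
  | zero => exact measurable_const
  | succ n ih =>
    have e : P.Y (n + 1) = fun ω => if ω < P.p then ginv P.α (P.Y n (P.φ ω)) else
        ginv P.β (P.Y n (P.φ ω)) := by
      ext ω
      simp only [Y, alphaOf]
      split_ifs <;> rfl
    rw [e]
    exact Measurable.ite (measurableSet_lt measurable_id measurable_const)
      ((measurable_ginv P.α_pos).comp (ih.comp P.measurable_φ))
      ((measurable_ginv (by linarith [P.hα, P.hαβ])).comp (ih.comp P.measurable_φ))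

lemma avoid_iff (n : ℕ) : ∀ z ∈ Q, (∀ k < n, P.T^[k] z ∉ D) ↔ z.1 ≤ P.Y n z.2 := by
  induction n with
  | zero => intro z hz; simpa [Y] using hz.1.2
  | succ n ih =>
    intro z hz
    have e : ∀ z : ℝ × ℝ, z.1 ≤ 1 / 2 → (P.T z).1 = gl (alphaOf P.α P.β P.p z.2) z.1 := by
      intro z h0
      simp only [T, skewLSV, lsv, if_pos h0]; rfl
    have e2 : (P.T z).2 = P.φ z.2 := rfl
    have ha := P.alphaOf_pos z.2
    have key : z.1 ≤ 1 / 2 → (z.1 ≤ P.Y (n + 1) z.2 ↔ (P.T z).1 ≤ P.Y n (P.T z).2) := by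
      intro h0
      rw [e z h0, e2]
      constructor
      · intro h
        have := (gl_strictMonoOn ha).monotoneOn (mem_Ici.2 hz.1.1.le)
          (mem_Ici.2 (P.Y_pos (n + 1) z.2).le) h
        rwa [Y, gl_ginv ha (P.Y_pos n _).le] at this
      · intro h
        have := ginv_mono ha h
        rwa [ginv_gl ha hz.1.1.le] at this
    constructor
    · intro h
      have h0 : z.1 ≤ 1 / 2 := by
        by_contra hc
        push Not at hc
        exact h 0 (by omega) ⟨⟨hc, hz.1.2⟩, hz.2⟩
      rw [key h0, ← ih _ (P.T_mem hz)]
      intro k hk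
      rw [← Function.iterate_succ_apply]
      exact h _ (by omega)
    · intro h
      have h0 := h.trans (P.Y_succ_le_half n z.2)
      rw [key h0, ← ih _ (P.T_mem hz)] at h
      intro k hk
      rcases k with _ | k
      · exact fun hh => absurd hh.1.1 (not_lt.2 h0)
      · rw [Function.iterate_succ_apply]; exact h k (by omega)

lemma lt_τ_iff_Y {z : ℝ × ℝ} (hz : z ∈ D) (n : ℕ) :
    n < P.τ z ↔ z.1 ≤ (1 + P.Y n (P.φ z.2)) / 2 := by
  have e : (P.T z).1 = 2 * z.1 - 1 := by
    simp only [T, skewLSV, lsv, if_neg (not_le.2 hz.1.1)]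
  rw [P.lt_τ_iff (D_subset_Q hz)]
  have h := P.avoid_iff n (P.T z) (P.T_mem (D_subset_Q hz))
  rw [e, show (P.T z).2 = P.φ z.2 from rfl] at h
  constructor
  · intro h1
    have := h.1 fun k hk => by
      rw [← Function.iterate_succ_apply]; exact h1 _ (by omega) (by omega)
    linarith
  · intro h1 m hm hmn
    obtain ⟨m, rfl⟩ := Nat.exists_eq_succ_of_ne_zero hm.ne'
    rw [Function.iterate_succ_apply]
    exact h.2 (by linarith) m (by omega)

/-- The digit observable. -/
def dg (ω : ℝ) : ℝ := if ω < P.p then 1 else 0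

/-- The linearising coordinate of the thresholds. -/
def Z (n : ℕ) (ω : ℝ) : ℝ := (2 * P.Y n ω) ^ (-P.α)

lemma Z_pos (n : ℕ) (ω : ℝ) : 0 < P.Z n ω := by
  have := P.Y_pos n ω
  unfold Z; positivity

lemma α_lt_one : P.α < 1 := by linarith [P.hαβ, P.hβ]

lemma one_le_Z (n : ℕ) (ω : ℝ) : 1 ≤ P.Z (n + 1) ω :=
  Real.one_le_rpow_of_pos_of_le_one_of_nonpos (by linarith [P.Y_pos (n + 1) ω])
    (by linarith [P.Y_succ_le_half n ω]) (by linarith [P.α_pos])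

lemma Z_zero_le (ω : ℝ) : P.Z 0 ω ≤ 1 := by
  simp only [Z, Y, mul_one]
  exact Real.rpow_le_one_of_one_le_of_nonpos (by norm_num) (by linarith [P.α_pos])

lemma two_mul_Y (n : ℕ) (ω : ℝ) : 2 * P.Y n (P.φ ω) =
    2 * P.Y (n + 1) ω * (1 + (2 * P.Y (n + 1) ω) ^ (alphaOf P.α P.β P.p ω)) := by
  have h := gl_ginv (P.alphaOf_pos ω) (P.Y_pos n (P.φ ω)).le
  rw [Real.mul_rpow (by norm_num) (P.Y_pos _ _).le]
  conv_lhs => rw [← h]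
  rw [gl, Y]
  ring

lemma Z_mono (n : ℕ) (ω : ℝ) : P.Z n (P.φ ω) ≤ P.Z (n + 1) ω := by
  unfold Z
  rw [P.two_mul_Y]
  exact zstep_nonneg P.α_pos (by linarith [P.Y_pos (n + 1) ω])

lemma Z_lower (n : ℕ) {ω : ℝ} (h : ω < P.p) :
    P.α - P.α / (P.Z (n + 1) ω + 1) ≤ P.Z (n + 1) ω - P.Z n (P.φ ω) := by
  have h2 := P.two_mul_Y n ω
  rw [alphaOf, if_pos h] at h2
  unfold Z
  rw [h2]
  exact zstep_lower P.α_pos P.α_lt_one (by linarith [P.Y_pos (n + 1) ω])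

lemma Z_upper_α (n : ℕ) {ω : ℝ} (h : ω < P.p) : P.Z (n + 1) ω - P.Z n (P.φ ω) ≤ P.α := by
  have h2 := P.two_mul_Y n ω
  have hu : 0 < 2 * P.Y (n + 1) ω := by linarith [P.Y_pos (n + 1) ω]
  rw [alphaOf, if_pos h] at h2
  unfold Z
  rw [h2]
  refine (zstep_upper P.α_pos P.α_lt_one hu).trans (le_of_eq ?_)
  rw [← Real.rpow_add hu]
  simp

lemma Z_upper_β (n : ℕ) {ω : ℝ} (h : ¬ω < P.p) {R : ℝ} (hR : 0 < R) (hZ : R ≤ P.Z (n + 1) ω) :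
    P.Z (n + 1) ω - P.Z n (P.φ ω) ≤ P.α * R ^ (-(P.β / P.α - 1)) := by
  have h2 := P.two_mul_Y n ω
  have hu : 0 < 2 * P.Y (n + 1) ω := by linarith [P.Y_pos (n + 1) ω]
  have hα := P.α_pos
  rw [alphaOf, if_neg h] at h2
  have h3 : P.Z (n + 1) ω - P.Z n (P.φ ω) ≤ P.α * P.Z (n + 1) ω ^ (-(P.β / P.α - 1)) := by
    unfold Z
    rw [h2]
    refine (zstep_upper P.α_pos P.α_lt_one hu).trans (le_of_eq ?_)
    rw [← Real.rpow_add hu, ← Real.rpow_mul hu.le]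
    congr 2
    field_simp
    ring
  refine h3.trans (mul_le_mul_of_nonneg_left ?_ hα.le)
  refine Real.rpow_le_rpow_of_nonpos hR hZ ?_
  have : 1 ≤ P.β / P.α := by rw [le_div_iff₀ hα]; linarith [P.hαβ]
  linarith

/-- The number of digits of the first kind. -/
def cnt (n : ℕ) (ω : ℝ) : ℝ := birkhoffSum P.φ P.dg n ω

lemma cnt_succ (n : ℕ) (ω : ℝ) : P.cnt (n + 1) ω = P.dg ω + P.cnt n (P.φ ω) :=
  birkhoffSum_succ' _ _ _ _

lemma dg_nonneg (ω : ℝ) : 0 ≤ P.dg ω := by unfold dg; split_ifs <;> norm_num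

lemma dg_le_one (ω : ℝ) : P.dg ω ≤ 1 := by unfold dg; split_ifs <;> norm_num

lemma cnt_nonneg (n : ℕ) (ω : ℝ) : 0 ≤ P.cnt n ω := by
  change 0 ≤ ∑ k ∈ Finset.range n, P.dg (P.φ^[k] ω)
  exact Finset.sum_nonneg fun k _ => P.dg_nonneg _

lemma cnt_le (n : ℕ) (ω : ℝ) : P.cnt n ω ≤ n := by
  have : ∑ k ∈ Finset.range n, P.dg (P.φ^[k] ω) ≤ ∑ k ∈ Finset.range n, (1 : ℝ) :=
    Finset.sum_le_sum fun k _ => P.dg_le_one _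
  change ∑ k ∈ Finset.range n, P.dg (P.φ^[k] ω) ≤ n
  simpa using this

lemma half_cnt_le_Z (n : ℕ) (ω : ℝ) : P.α / 2 * P.cnt n ω ≤ P.Z n ω := by
  induction n generalizing ω with
  | zero => simpa [cnt] using (P.Z_pos 0 ω).le
  | succ n ih =>
    rw [cnt_succ, mul_add]
    by_cases h : ω < P.p
    · have h1 := P.Z_lower n h
      have h2 : P.α / (P.Z (n + 1) ω + 1) ≤ P.α / 2 :=
        div_le_div_of_nonneg_left P.α_pos.le (by norm_num) (by linarith [P.one_le_Z n ω])
      have h3 : P.dg ω = 1 := if_pos h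
      rw [h3]
      linarith [ih (P.φ ω)]
    · have h3 : P.dg ω = 0 := if_neg h
      rw [h3]
      linarith [ih (P.φ ω), P.Z_mono n ω]

lemma Z_ge (n : ℕ) (ω : ℝ) {R : ℝ} (hR : 1 ≤ R) :
    P.α * (1 - 1 / R) * P.cnt n ω - 2 * R ≤ P.Z n ω := by
  have hα := P.α_pos
  have hc : 0 ≤ 1 / R := by positivity
  induction n generalizing ω with
  | zero =>
    have := (P.Z_pos 0 ω).le
    simp only [cnt, birkhoffSum_zero, mul_zero]
    linarith
  | succ n ih =>
    by_cases hz : P.Z (n + 1) ω < R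
    · have h1 := P.half_cnt_le_Z (n + 1) ω
      have h2 := P.cnt_nonneg (n + 1) ω
      have h3 := P.Z_pos (n + 1) ω
      nlinarith [mul_nonneg (mul_nonneg hα.le hc) h2]
    · push Not at hz
      rw [cnt_succ, mul_add]
      by_cases h : ω < P.p
      · have h1 := P.Z_lower n h
        have h2 : P.α / (P.Z (n + 1) ω + 1) ≤ P.α * (1 / R) := by
          rw [mul_one_div]
          exact div_le_div_of_nonneg_left P.α_pos.le (by linarith) (by linarith)
        have h3 : P.dg ω = 1 := if_pos h
        rw [h3]
        linarith [ih (P.φ ω)]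
      · have h3 : P.dg ω = 0 := if_neg h
        rw [h3]
        linarith [ih (P.φ ω), P.Z_mono n ω]

lemma Z_le (n : ℕ) (ω : ℝ) {R : ℝ} (hR : 1 ≤ R) :
    P.Z n ω ≤ P.α * P.cnt n ω + P.α * R ^ (-(P.β / P.α - 1)) * n + R := by
  have hα := P.α_pos
  have hc : 0 ≤ P.α * R ^ (-(P.β / P.α - 1)) := by positivity
  induction n generalizing ω with
  | zero =>
    have := P.Z_zero_le ω
    simp only [cnt, birkhoffSum_zero, mul_zero, CharP.cast_eq_zero]
    linarith
  | succ n ih =>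
    have hn := mul_nonneg hc (Nat.cast_nonneg (α := ℝ) n)
    by_cases hz : P.Z (n + 1) ω < R
    · have h2 := P.cnt_nonneg (n + 1) ω
      have := mul_nonneg hα.le h2
      push_cast
      linarith
    · push Not at hz
      rw [cnt_succ, mul_add]
      push_cast
      by_cases h : ω < P.p
      · have h1 := P.Z_upper_α n h
        have h3 : P.dg ω = 1 := if_pos h
        rw [h3]
        linarith [ih (P.φ ω)]
      · have h1 := P.Z_upper_β n h (by linarith) hz
        have h3 : P.dg ω = 0 := if_neg h
        rw [h3]
        linarith [ih (P.φ ω)]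

lemma measurable_dg : Measurable P.dg :=
  Measurable.ite (measurableSet_lt measurable_id measurable_const) measurable_const measurable_const

lemma large_deviation_dg {e : ℝ} (he : 0 < e) :
    ∃ C θ : ℝ, 0 < C ∧ 0 < θ ∧ θ < 1 ∧ ∀ n : ℕ, volume {ω | ω ∈ Ico (0 : ℝ) 1 ∧
      e * n ≤ |P.cnt n ω - P.p * n|} ≤ ENNReal.ofReal (C * θ ^ n) := by
  have h := P.large_deviation (g := fun ω => P.dg ω - P.p) (P.measurable_dg.sub_const _) (B := 1)
    (fun ω _ => by
      have := P.hp
      have := P.hp'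
      unfold dg
      split_ifs <;> exact abs_le.2 ⟨by linarith, by linarith⟩)
    (fun e he => ⟨0, fun ω hω => by
      have h1 := P.hp
      have h2 := P.hp'
      obtain ⟨h3, h4⟩ := hω
      have h5 : P.dg (P.b true ω) = 1 := if_pos (by rw [b_true]; nlinarith)
      have h6 : P.dg (P.b false ω) = 0 := if_neg (by rw [b_false]; nlinarith)
      simp only [zero_add, Function.iterate_one, Po, Fintype.sum_bool, h5, h6, w, if_true,
        Bool.false_eq_true, if_false]
      rw [show P.p * (1 - P.p) + (1 - P.p) * (0 - P.p) = 0 by ring, abs_zero]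
      exact he.le⟩) he
  obtain ⟨C, θ, hC, hθ, hθ1, h⟩ := h
  refine ⟨C, θ, hC, hθ, hθ1, fun n => ?_⟩
  have e : ∀ ω, birkhoffSum P.φ (fun ω => P.dg ω - P.p) n ω = P.cnt n ω - P.p * n := by
    intro ω
    simp only [cnt, birkhoffSum, Finset.sum_sub_distrib, Finset.sum_const, Finset.card_range,
      nsmul_eq_mul]
    ring
  simpa only [e] using h n

lemma large_deviation_Z {e : ℝ} (he : 0 < e) :
    ∃ C θ : ℝ, 0 < C ∧ 0 < θ ∧ θ < 1 ∧ ∀ᶠ n : ℕ in atTop, volume {ω | ω ∈ Ico (0 : ℝ) 1 ∧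
      e * n ≤ |P.Z n ω - P.α * P.p * n|} ≤ ENNReal.ofReal (C * θ ^ n) := by
  obtain ⟨C, θ, hC, hθ, hθ1, h⟩ := P.large_deviation_dg (e := e / 4) (by linarith)
  refine ⟨C, θ, hC, hθ, hθ1, ?_⟩
  have hα := P.α_pos
  have hα1 := P.α_lt_one
  have hδ : 0 < P.β / P.α - 1 := by
    rw [sub_pos, lt_div_iff₀ hα]; linarith [P.hαβ]
  have l1 : Tendsto (fun R : ℝ => P.α * R ^ (-(P.β / P.α - 1))) atTop (𝓝 0) := by
    simpa using (tendsto_rpow_neg_atTop hδ).const_mul P.α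
  have l2 : Tendsto (fun R : ℝ => 1 / R) atTop (𝓝 0) := by
    simpa using tendsto_inv_atTop_zero (𝕜 := ℝ)
  obtain ⟨R, hR1, hR2, hR⟩ := ((l1.eventually (gt_mem_nhds (show 0 < e / 4 by linarith))).and
    ((l2.eventually (gt_mem_nhds (show 0 < e / 4 by linarith))).and (eventually_ge_atTop 1))).exists
  have l3 : Tendsto (fun n : ℕ => e / 4 * (n : ℝ)) atTop atTop :=
    tendsto_natCast_atTop_atTop.const_mul_atTop (by linarith)
  filter_upwards [l3.eventually_gt_atTop (2 * R)] with n hn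
  refine (measure_mono ?_).trans (h n)
  rintro ω ⟨hω, h3⟩
  refine ⟨hω, ?_⟩
  by_contra hc
  push Not at hc
  obtain ⟨h4, h5⟩ := abs_lt.1 hc
  have h6 := P.Z_ge n ω hR
  have h7 := P.Z_le n ω hR
  have h8 := P.cnt_le n ω
  have h9 := P.cnt_nonneg n ω
  have hn0 : (0 : ℝ) ≤ n := Nat.cast_nonneg n
  have h10 : P.α * R ^ (-(P.β / P.α - 1)) * n ≤ e / 4 * n :=
    mul_le_mul_of_nonneg_right hR1.le hn0
  have h11 : 1 / R * P.cnt n ω ≤ e / 4 * n := mul_le_mul hR2.le h8 h9 (by linarith)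
  have h12 : 0 ≤ 1 / R := by positivity
  have h13 : 0 ≤ e / 4 * n := by positivity
  refine absurd h3 (not_le.2 (abs_lt.2 ⟨?_, ?_⟩))
  · nlinarith [mul_le_mul_of_nonneg_left h11 hα.le, mul_le_of_le_one_left h13 hα1.le,
      mul_lt_mul_of_pos_left h4 hα]
  · nlinarith [mul_lt_mul_of_pos_left h5 hα, mul_le_of_le_one_left h13 hα1.le]

end Par
end LSV

namespace LSV
namespace Par
variable (P : Par)

lemma measurePreserving_φ : MeasurePreserving P.φ (volume.restrict (Ico (0 : ℝ) 1))
    (volume.restrict (Ico (0 : ℝ) 1)) := by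
  refine ⟨P.measurable_φ, Measure.ext fun s hs => ?_⟩
  rw [Measure.map_apply P.measurable_φ hs, ← lintegral_indicator_one hs,
    ← lintegral_indicator_one (P.measurable_φ hs)]
  exact P.lintegral_φ (s.indicator 1)

/-- The tail exponent. -/
def q : ℝ := 1 / P.α

lemma one_lt_q : 1 < P.q := by
  rw [q, lt_div_iff₀ P.α_pos]; linarith [P.α_lt_one]

lemma q_lt_two : P.q < 2 := by
  rw [q, div_lt_iff₀ P.α_pos]; linarith [P.hα]

/-- The limit of the rescaled thresholds. -/
def κ : ℝ := (P.α * P.p) ^ (-P.q) / 2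

lemma κ_nonneg : 0 ≤ P.κ := by
  have := mul_pos P.α_pos P.hp
  unfold κ; positivity

lemma rescaled_Y (n : ℕ) (hn : 0 < n) (ω : ℝ) :
    (n : ℝ) ^ P.q * P.Y n ω = (P.Z n ω / n) ^ (-P.q) / 2 := by
  have h0 : (0 : ℝ) < n := by exact_mod_cast hn
  have h1 : 0 < 2 * P.Y n ω := by linarith [P.Y_pos n ω]
  have h2 : P.Z n ω ^ (-P.q) = 2 * P.Y n ω := by
    rw [Z, ← Real.rpow_mul h1.le, q, neg_mul_neg, mul_one_div_cancel P.α_pos.ne', Real.rpow_one]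
  rw [Real.div_rpow (P.Z_pos n ω).le h0.le, h2, Real.rpow_neg h0.le]
  field_simp

lemma integrable_Y (n : ℕ) : IntegrableOn (P.Y n) (Ico 0 1) := by
  refine Integrable.of_bound (P.measurable_Y n).aestronglyMeasurable 1 (ae_of_all _ fun ω => ?_)
  rw [Real.norm_eq_abs, abs_of_pos (P.Y_pos n ω)]
  exact P.Y_le_one n ω

lemma tendsto_integral_Y :
    Tendsto (fun n : ℕ => ∫ ω in Ico (0 : ℝ) 1, |(n : ℝ) ^ P.q * P.Y n ω - P.κ|) atTop (𝓝 0) := by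
  have hαp := mul_pos P.α_pos P.hp
  rw [Metric.tendsto_atTop']
  have hcont : ContinuousAt (fun x : ℝ => x ^ (-P.q) / 2) (P.α * P.p) :=
    (Real.continuousAt_rpow_const _ _ (Or.inl hαp.ne')).div_const 2
  suffices h : ∀ e > 0, ∀ᶠ n : ℕ in atTop,
      ∫ ω in Ico (0 : ℝ) 1, |(n : ℝ) ^ P.q * P.Y n ω - P.κ| < e by
    intro e he
    obtain ⟨N, hN⟩ := eventually_atTop.1 (h e he)
    refine ⟨N, fun n hn => ?_⟩
    rw [Real.dist_eq, sub_zero, abs_of_nonneg (integral_nonneg fun _ => abs_nonneg _)]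
    exact hN n hn.le
  intro e he
  obtain ⟨d, hd, hd'⟩ := Metric.continuousAt_iff.1 hcont (e / 2) (by linarith)
  obtain ⟨C, θ, hC, hθ, hθ1, hZ⟩ := P.large_deviation_Z hd
  have hlim : Tendsto (fun n : ℕ => ((n : ℝ) ^ 2 + P.κ) * (C * θ ^ n)) atTop (𝓝 0) := by
    have h1 := (tendsto_pow_const_mul_const_pow_of_lt_one 2 hθ.le hθ1).const_mul C
    have h2 := (tendsto_pow_atTop_nhds_zero_of_lt_one hθ.le hθ1).const_mul (P.κ * C)
    have := h1.add h2
    simp only [mul_zero, add_zero] at this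
    exact this.congr fun n => by ring
  filter_upwards [hZ, hlim.eventually (gt_mem_nhds (show 0 < e / 2 by linarith)),
    eventually_gt_atTop 0] with n hn hl hn0
  have h0 : (1 : ℝ) ≤ n := by exact_mod_cast hn0
  set B : Set ℝ := {ω | ω ∈ Ico (0 : ℝ) 1 ∧ d * n ≤ |P.Z n ω - P.α * P.p * n|}
  have hB : MeasurableSet B := by
    have : Measurable fun ω => |P.Z n ω - P.α * P.p * n| :=
      ((((P.measurable_Y n).const_mul 2).pow_const _).sub_const _).abs
    exact measurableSet_Ico.inter (measurableSet_le measurable_const this)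
  have hpt : ∀ ω ∈ Ico (0 : ℝ) 1, |(n : ℝ) ^ P.q * P.Y n ω - P.κ| ≤
      e / 2 + B.indicator (fun _ => (n : ℝ) ^ 2 + P.κ) ω := by
    intro ω hω
    by_cases hωB : ω ∈ B
    · rw [indicator_of_mem hωB]
      have h3 : (n : ℝ) ^ P.q * P.Y n ω ≤ (n : ℝ) ^ 2 := by
        refine (mul_le_of_le_one_right (by positivity) (P.Y_le_one n ω)).trans ?_
        rw [← Real.rpow_natCast (n : ℝ) 2]
        exact Real.rpow_le_rpow_of_exponent_le h0 (by exact_mod_cast P.q_lt_two.le)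
      have h4 : 0 ≤ (n : ℝ) ^ P.q * P.Y n ω := mul_nonneg (by positivity) (P.Y_pos n ω).le
      rw [abs_le]
      constructor <;> linarith [P.κ_nonneg]
    · rw [indicator_of_notMem hωB, add_zero, P.rescaled_Y n hn0]
      have h3 : |P.Z n ω - P.α * P.p * n| < d * n := by
        by_contra hcon
        exact hωB ⟨hω, not_lt.1 hcon⟩
      refine (hd' (x := P.Z n ω / n) ?_).le
      rw [Real.dist_eq, show P.Z n ω / n - P.α * P.p = (P.Z n ω - P.α * P.p * n) / n by field_simp,
        abs_div, Nat.abs_cast, div_lt_iff₀ (by linarith)]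
      exact h3
  have hi : IntegrableOn (B.indicator fun _ => (n : ℝ) ^ 2 + P.κ) (Ico 0 1) :=
    (integrable_const _).indicator hB
  have hv : volume.real (Ico (0 : ℝ) 1) = 1 := by simp
  calc _ ≤ ∫ ω in Ico (0 : ℝ) 1, (e / 2 + B.indicator (fun _ => (n : ℝ) ^ 2 + P.κ) ω) := by
        refine setIntegral_mono_on ?_ ((integrable_const _).add hi) measurableSet_Ico hpt
        exact (((P.integrable_Y n).const_mul _).sub (integrable_const _)).abs
    _ = e / 2 + (volume.restrict (Ico 0 1)).real B * ((n : ℝ) ^ 2 + P.κ) := by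
        rw [integral_add (integrable_const _) hi, setIntegral_const, hv,
          integral_indicator hB, setIntegral_const, one_smul, smul_eq_mul]
    _ ≤ e / 2 + C * θ ^ n * ((n : ℝ) ^ 2 + P.κ) := by
        gcongr
        · have := P.κ_nonneg
          positivity
        · rw [measureReal_def, Measure.restrict_apply hB]
          refine ENNReal.toReal_le_of_le_ofReal (by positivity)
            ((measure_mono inter_subset_left).trans hn)
    _ < e := by linarith

lemma tendsto_integral_mul_Y {g : ℝ → ℝ} (hg : Measurable g) {G : ℝ}
    (hG : ∀ ω ∈ Ico (0 : ℝ) 1, |g ω| ≤ G) :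
    Tendsto (fun n : ℕ => (n : ℝ) ^ P.q * ∫ ω in Ico (0 : ℝ) 1, g ω * (P.Y n (P.φ ω) / 2)) atTop
      (𝓝 (P.κ / 2 * ∫ ω in Ico (0 : ℝ) 1, g ω)) := by
  have hG0 : 0 ≤ G := (abs_nonneg _).trans (hG 0 (by simp))
  have hgi : IntegrableOn g (Ico 0 1) := Integrable.of_bound hg.aestronglyMeasurable G
    ((ae_restrict_mem measurableSet_Ico).mono hG)
  have key : ∀ n : ℕ, |((n : ℝ) ^ P.q * ∫ ω in Ico (0 : ℝ) 1, g ω * (P.Y n (P.φ ω) / 2)) -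
      P.κ / 2 * ∫ ω in Ico (0 : ℝ) 1, g ω| ≤
      G / 2 * ∫ ω in Ico (0 : ℝ) 1, |(n : ℝ) ^ P.q * P.Y n ω - P.κ| := by
    intro n
    have hm : Measurable fun ω => |(n : ℝ) ^ P.q * P.Y n ω - P.κ| :=
      (((P.measurable_Y n).const_mul _).sub_const _).abs
    have h1 : ∫ ω in Ico (0 : ℝ) 1, |(n : ℝ) ^ P.q * P.Y n ω - P.κ| =
        ∫ ω in Ico (0 : ℝ) 1, |(n : ℝ) ^ P.q * P.Y n (P.φ ω) - P.κ| := by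
      conv_lhs => rw [← P.measurePreserving_φ.map_eq]
      exact integral_map P.measurable_φ.aemeasurable hm.aestronglyMeasurable
    have hY : IntegrableOn (fun ω => P.Y n (P.φ ω)) (Ico 0 1) :=
      P.measurePreserving_φ.integrable_comp_of_integrable (P.integrable_Y n)
    have hgY : IntegrableOn (fun ω => g ω * (P.Y n (P.φ ω) / 2)) (Ico 0 1) :=
      (hY.div_const 2).bdd_mul hg.aestronglyMeasurable
        ((ae_restrict_mem measurableSet_Ico).mono hG)
    rw [h1, ← integral_const_mul, ← integral_const_mul, ← integral_const_mul,
      ← integral_sub (hgY.const_mul _) (hgi.const_mul _)]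
    refine (abs_integral_le_integral_abs).trans (setIntegral_mono_on ?_ ?_ measurableSet_Ico
      fun ω hω => ?_)
    · exact ((hgY.const_mul _).sub (hgi.const_mul _)).abs
    · exact ((hY.const_mul _).sub (integrable_const _)).abs.const_mul _
    · rw [show (n : ℝ) ^ P.q * (g ω * (P.Y n (P.φ ω) / 2)) - P.κ / 2 * g ω =
        g ω / 2 * ((n : ℝ) ^ P.q * P.Y n (P.φ ω) - P.κ) by ring, abs_mul, abs_div, abs_two]
      exact mul_le_mul_of_nonneg_right (by linarith [hG ω hω]) (abs_nonneg _)
  rw [tendsto_iff_norm_sub_tendsto_zero]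
  refine squeeze_zero (fun _ => norm_nonneg _) key ?_
  simpa using P.tendsto_integral_Y.const_mul (G / 2)

lemma setIntegral_tail (n : ℕ) {g : ℝ → ℝ} (hg : Measurable g) {G : ℝ}
    (hG : ∀ ω ∈ Ico (0 : ℝ) 1, |g ω| ≤ G) :
    ∫ z in D ∩ {z | n < P.τ z}, g z.2 = ∫ ω in Ico (0 : ℝ) 1, g ω * (P.Y n (P.φ ω) / 2) := by
  have hS : MeasurableSet (D ∩ {z | n < P.τ z}) :=
    measurableSet_D.inter (measurableSet_lt measurable_const P.measurable_τ)
  have hi : IntegrableOn (fun z : ℝ × ℝ => g z.2) (D ∩ {z | n < P.τ z}) := by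
    refine Measure.integrableOn_of_bounded (M := G) ?_ (hg.comp measurable_snd).aestronglyMeasurable
      ((ae_restrict_mem hS).mono fun z hz => hG _ hz.1.2)
    exact ((measure_mono inter_subset_left).trans_lt (by rw [volume_D]; norm_num)).ne
  rw [← integral_indicator hS, Measure.volume_eq_prod,
    integral_prod_symm _ ((integrable_indicator_iff hS).2 hi), ← integral_indicator
        measurableSet_Ico]
  congr 1
  ext ω
  by_cases hω : ω ∈ Ico (0 : ℝ) 1
  · rw [indicator_of_mem hω]
    have : (fun x => (D ∩ {z | n < P.τ z}).indicator (fun z : ℝ × ℝ => g z.2) (x, ω)) =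
        (Ioc (1 / 2 : ℝ) ((1 + P.Y n (P.φ ω)) / 2)).indicator fun _ => g ω := by
      ext x
      have hiff : ((x, ω) ∈ D ∩ {z | n < P.τ z}) ↔ x ∈ Ioc (1 / 2 : ℝ) ((1 + P.Y n (P.φ ω)) / 2) :=
          by
        constructor
        · rintro ⟨h1, h2⟩
          exact ⟨h1.1.1, (P.lt_τ_iff_Y h1 n).1 h2⟩
        · rintro ⟨h1, h2⟩
          have h3 : (x, ω) ∈ D := ⟨⟨h1, by linarith [P.Y_le_one n (P.φ ω)]⟩, hω⟩
          exact ⟨h3, (P.lt_τ_iff_Y h3 n).2 h2⟩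
      by_cases hx : x ∈ Ioc (1 / 2 : ℝ) ((1 + P.Y n (P.φ ω)) / 2)
      · rw [indicator_of_mem hx, indicator_of_mem (hiff.2 hx)]
      · rw [indicator_of_notMem hx, indicator_of_notMem (mt hiff.1 hx)]
    rw [this, integral_indicator measurableSet_Ioc, setIntegral_const, Real.volume_real_Ioc_of_le
      (by linarith [P.Y_pos n (P.φ ω)]), smul_eq_mul]
    ring
  · rw [indicator_of_notMem hω]
    have : (fun x => (D ∩ {z | n < P.τ z}).indicator (fun z : ℝ × ℝ => g z.2) (x, ω)) =
        fun _ => 0 := by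
      ext x
      exact indicator_of_notMem (fun h => hω h.1.2) _
    rw [this, integral_zero]

/-- Asymptotics of the tail of the return time, against a Lipschitz density. -/
theorem tail_asymptotics {H : ℝ × ℝ → ℝ} {K : NNReal}
    (hH : LipschitzOnWith K H (Icc (1 / 2 : ℝ) 1 ×ˢ Icc (0 : ℝ) 1)) :
    Tendsto (fun n : ℕ => (n : ℝ) ^ P.q * ∫ z in D ∩ {z | n < P.τ z}, H z) atTop
      (𝓝 (P.κ / 2 * ∫ ω in Icc (0 : ℝ) 1, H (1 / 2, ω))) := by
  obtain ⟨H', hH', heq⟩ := hH.extend_real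
  have hDs : D ⊆ Icc (1 / 2 : ℝ) 1 ×ˢ Icc (0 : ℝ) 1 :=
    prod_mono Ioc_subset_Icc_self Ico_subset_Icc_self
  have hS : ∀ n : ℕ, MeasurableSet (D ∩ {z | n < P.τ z}) := fun n =>
    measurableSet_D.inter (measurableSet_lt measurable_const P.measurable_τ)
  have hfin : ∀ n : ℕ, volume (D ∩ {z | n < P.τ z}) ≠ ⊤ := fun n =>
    ((measure_mono inter_subset_left).trans_lt (by rw [volume_D]; norm_num)).ne
  set g : ℝ → ℝ := fun ω => H' (1 / 2, ω) with hgdef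
  have hgc : Continuous g := hH'.continuous.comp (by fun_prop)
  obtain ⟨G, hG⟩ : ∃ G, ∀ ω ∈ Icc (0 : ℝ) 1, ‖g ω‖ ≤ G :=
    isCompact_Icc.exists_bound_of_continuousOn hgc.continuousOn
  have hG' : ∀ ω ∈ Ico (0 : ℝ) 1, |g ω| ≤ G := fun ω hω => hG ω (Ico_subset_Icc_self hω)
  have h1 : ∫ ω in Icc (0 : ℝ) 1, H (1 / 2, ω) = ∫ ω in Ico (0 : ℝ) 1, g ω := by
    rw [← integral_Icc_eq_integral_Ico]
    exact setIntegral_congr_fun measurableSet_Icc fun ω hω => heq ⟨by norm_num, hω⟩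
  rw [h1]
  have h2 := P.tendsto_integral_mul_Y hgc.measurable hG'
  have h3 : Tendsto (fun n : ℕ => (K : ℝ) * (1 / ((n : ℝ) + 1)) *
      ((n : ℝ) ^ P.q * ∫ ω in Ico (0 : ℝ) 1, (1 : ℝ) * (P.Y n (P.φ ω) / 2))) atTop (𝓝 0) := by
    have := (tendsto_one_div_add_atTop_nhds_zero_nat (𝕜 := ℝ)).const_mul (K : ℝ)
    simpa using this.mul (P.tendsto_integral_mul_Y (g := fun _ => 1) measurable_const (G := 1)
      (by simp))
  have key : ∀ n : ℕ, |((n : ℝ) ^ P.q * ∫ z in D ∩ {z | n < P.τ z}, H z) -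
      (n : ℝ) ^ P.q * ∫ ω in Ico (0 : ℝ) 1, g ω * (P.Y n (P.φ ω) / 2)| ≤
      (K : ℝ) * (1 / ((n : ℝ) + 1)) *
      ((n : ℝ) ^ P.q * ∫ ω in Ico (0 : ℝ) 1, (1 : ℝ) * (P.Y n (P.φ ω) / 2)) := by
    intro n
    rw [← P.setIntegral_tail n hgc.measurable hG',
      ← P.setIntegral_tail n (g := fun _ => 1) measurable_const (G := 1) (by simp),
      setIntegral_congr_fun (hS n) (fun z hz => heq (hDs hz.1)), ← mul_sub, abs_mul,
      abs_of_nonneg (by positivity : (0 : ℝ) ≤ (n : ℝ) ^ P.q), mul_left_comm]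
    refine mul_le_mul_of_nonneg_left ?_ (by positivity)
    have hintb : ∀ f : ℝ × ℝ → ℝ, Continuous f → IntegrableOn f (D ∩ {z | n < P.τ z}) := by
      intro f hf
      refine (hf.continuousOn.integrableOn_compact
        (K := Icc (1 / 2 : ℝ) 1 ×ˢ Icc (0 : ℝ) 1) (isCompact_Icc.prod isCompact_Icc)).mono_set ?_
      exact inter_subset_left.trans hDs
    rw [← integral_sub (hintb _ hH'.continuous) (hintb (fun z => g z.2) (by fun_prop))]
    rw [← integral_const_mul]
    refine abs_integral_le_integral_abs.trans (setIntegral_mono_on ?_ ?_ (hS n) fun z hz => ?_)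
    · exact ((hintb _ hH'.continuous).sub (hintb (fun z => g z.2) (by fun_prop))).abs
    · exact integrableOn_const (hfin n)
    · rw [mul_one]
      have h5 := hH'.dist_le_mul z (1 / 2, z.2)
      rw [Real.dist_eq] at h5
      refine h5.trans (mul_le_mul_of_nonneg_left ?_ K.2)
      have h6 := (P.lt_τ_iff_Y hz.1 n).1 hz.2
      have h7 := P.Y_le n (P.φ z.2)
      have h8 : (0 : ℝ) < 1 / ((n : ℝ) + 1) := by positivity
      have h9 := hz.1.1.1
      rw [Prod.dist_eq, dist_self, Real.dist_eq]
      exact max_le (abs_le.2 ⟨by linarith, by linarith⟩) h8.le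
  have h4 : Tendsto (fun n : ℕ => ((n : ℝ) ^ P.q * ∫ z in D ∩ {z | n < P.τ z}, H z) -
      (n : ℝ) ^ P.q * ∫ ω in Ico (0 : ℝ) 1, g ω * (P.Y n (P.φ ω) / 2)) atTop (𝓝 0) :=
    squeeze_zero_norm key h3
  simpa using h4.add h2

end Par
end LSV

namespace LSV
section FourierConstant
variable {q : ℝ}

lemma integrableOn_min_rpow (h1 : 1 < q) (h2 : q < 2) :
    IntegrableOn (fun y : ℝ => min 1 y * y ^ (-q)) (Ioi 0) := by
  rw [← Ioc_union_Ioi_eq_Ioi zero_le_one]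
  refine IntegrableOn.union ?_ ?_
  · have h : IntegrableOn (fun y : ℝ => y ^ (1 - q)) (Ioc 0 1) :=
      (intervalIntegrable_iff_integrableOn_Ioc_of_le zero_le_one).1
        (intervalIntegral.intervalIntegrable_rpow' (r := 1 - q) (by linarith))
    refine h.congr_fun (fun y hy => ?_) measurableSet_Ioc
    have hy0 : 0 < y := hy.1
    beta_reduce
    rw [min_eq_right hy.2, sub_eq_add_neg, Real.rpow_add hy0, Real.rpow_one]
  · refine (integrableOn_Ioi_rpow_of_lt (a := -q) (by linarith) one_pos).congr_fun (fun y hy => ?_)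
      measurableSet_Ioi
    beta_reduce
    rw [min_eq_left (le_of_lt hy), one_mul]

lemma norm_one_sub_exp_le {w : ℂ} (hw : w.re ≤ 0) :
    ‖1 - Complex.exp w‖ ≤ 2 * min 1 ‖w‖ := by
  rcases le_total ‖w‖ 1 with h | h
  · rw [min_eq_right h, norm_sub_rev]
    exact Complex.norm_exp_sub_one_le h
  · rw [min_eq_left h]
    refine (norm_sub_le _ _).trans ?_
    rw [norm_one, Complex.norm_exp]
    linarith [Real.exp_le_one_iff.2 hw]

lemma min_one_mul_le {c y : ℝ} (hy : 0 ≤ y) : min 1 (c * y) ≤ max 1 c * min 1 y := by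
  rcases le_total y 1 with h | h
  · rw [min_eq_right h]
    exact (min_le_right _ _).trans (mul_le_mul_of_nonneg_right (le_max_right _ _) hy)
  · rw [min_eq_left h, mul_one]
    exact (min_le_left _ _).trans (le_max_left _ _)

/-- The integrand of the stable exponent. -/
def stableKernel (q : ℝ) (z : ℂ) (y : ℝ) : ℂ :=
  (1 - Complex.exp (-(z * y))) * ((y ^ (-q) : ℝ) : ℂ)

lemma measurable_stableKernel (z : ℂ) : Measurable (stableKernel q z) := by
  unfold stableKernel; fun_prop

lemma norm_stableKernel_le {z : ℂ} (hz : 0 ≤ z.re) {R : ℝ} (hR : ‖z‖ ≤ R) {y : ℝ}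
    (hy : y ∈ Ioi (0 : ℝ)) :
    ‖stableKernel q z y‖ ≤ 2 * max 1 R * (min 1 y * y ^ (-q)) := by
  have hy0 : 0 < y := hy
  rw [stableKernel, norm_mul, Complex.norm_real, Real.norm_eq_abs,
    abs_of_pos (Real.rpow_pos_of_pos hy0 _), ← mul_assoc]
  refine mul_le_mul_of_nonneg_right ?_ (Real.rpow_pos_of_pos hy0 _).le
  refine (norm_one_sub_exp_le ?_).trans ?_
  · simp only [Complex.neg_re, Complex.mul_re, Complex.ofReal_re, Complex.ofReal_im]
    nlinarith
  · rw [norm_neg, norm_mul, Complex.norm_real, Real.norm_eq_abs, abs_of_pos hy0, mul_assoc]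
    refine mul_le_mul_of_nonneg_left ((min_one_mul_le hy0.le).trans ?_) zero_le_two
    exact mul_le_mul_of_nonneg_right (max_le_max_left _ hR) (le_min zero_le_one hy0.le)

lemma integrable_stableKernel (h1 : 1 < q) (h2 : q < 2) {z : ℂ} (hz : 0 ≤ z.re) :
    IntegrableOn (stableKernel q z) (Ioi 0) :=
  ((integrableOn_min_rpow h1 h2).const_mul _).mono' (measurable_stableKernel z).aestronglyMeasurable
    ((ae_restrict_mem measurableSet_Ioi).mono fun _ hy => norm_stableKernel_le hz le_rfl hy)

/-- The stable exponent on the right half plane. -/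
def stableInt (q : ℝ) (z : ℂ) : ℂ := ∫ y in Ioi (0 : ℝ), stableKernel q z y

lemma hasDerivAt_stableInt (h1 : 1 < q) (h2 : q < 2) {z : ℂ} (hz : 0 < z.re) :
    HasDerivAt (stableInt q)
      (∫ y in Ioi (0 : ℝ), (y : ℂ) * Complex.exp (-(z * y)) * ((y ^ (-q) : ℝ) : ℂ)) z := by
  have hs : {w : ℂ | z.re / 2 < w.re} ∈ 𝓝 z :=
    (isOpen_lt continuous_const Complex.continuous_re).mem_nhds (by
      change z.re / 2 < z.re; linarith)
  refine (hasDerivAt_integral_of_dominated_loc_of_deriv_le (F := stableKernel q)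
    (F' := fun z y => (y : ℂ) * Complex.exp (-(z * y)) * ((y ^ (-q) : ℝ) : ℂ))
    (bound := fun y => y ^ (1 - q) * Real.exp (-(z.re / 2) * y ^ (1 : ℝ)))
    hs (Eventually.of_forall fun w => (measurable_stableKernel w).aestronglyMeasurable)
    (integrable_stableKernel h1 h2 hz.le) ?_ ?_ ?_ ?_).2
  · exact Measurable.aestronglyMeasurable (by fun_prop)
  · refine (ae_restrict_mem measurableSet_Ioi).mono fun y hy w hw => ?_
    have hy0 : 0 < y := hy
    have hw' : z.re / 2 < w.re := hw
    rw [norm_mul, norm_mul, Complex.norm_real, Complex.norm_real, Real.norm_eq_abs,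
      Real.norm_eq_abs, abs_of_pos hy0, abs_of_pos (Real.rpow_pos_of_pos hy0 _), Complex.norm_exp,
      Real.rpow_one, sub_eq_add_neg, Real.rpow_add hy0, Real.rpow_one, mul_right_comm]
    refine mul_le_mul_of_nonneg_left (Real.exp_le_exp.2 ?_) (by positivity)
    simp only [Complex.neg_re, Complex.mul_re, Complex.ofReal_re, Complex.ofReal_im]
    nlinarith
  · exact integrableOn_rpow_mul_exp_neg_mul_rpow (by linarith) one_pos (by linarith)
  · refine (ae_restrict_mem measurableSet_Ioi).mono fun y _ w _ => ?_
    have e : HasDerivAt (fun w : ℂ => -(w * y)) (-(1 * (y : ℂ))) w :=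
      ((hasDerivAt_id w).mul_const (y : ℂ)).neg
    exact ((e.cexp.const_sub 1).mul_const _).congr_deriv (by ring)

lemma stableInt_ofReal {r : ℝ} (hr : 0 < r) :
    stableInt q r = ((r ^ (q - 1) : ℝ) : ℂ) * stableInt q 1 := by
  have h := integral_comp_mul_left_Ioi (fun y => stableKernel q 1 y) 0 hr
  rw [mul_zero] at h
  have e : ∀ y ∈ Ioi (0 : ℝ), stableKernel q r y = ((r ^ q : ℝ) : ℂ) * stableKernel q 1 (r * y) :=
      by
    intro y hy
    have hy0 : 0 < y := hy
    rw [stableKernel, stableKernel, Real.mul_rpow hr.le hy0.le, Real.rpow_neg hr.le]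
    have : ((r ^ q : ℝ) : ℂ) ≠ 0 := by exact_mod_cast (Real.rpow_pos_of_pos hr q).ne'
    push_cast
    field_simp
  rw [stableInt, setIntegral_congr_fun measurableSet_Ioi e, integral_const_mul, h, stableInt,
    Real.rpow_sub_one hr.ne', Complex.real_smul]
  push_cast
  ring

lemma stableInt_one (h1 : 1 < q) (h2 : q < 2) : stableInt q 1 = -(Real.Gamma (1 - q) : ℂ) := by
  have hd := hasDerivAt_stableInt h1 h2 (z := ((1 : ℝ) : ℂ)) (by simp)
  have hM : ∫ y in Ioi (0 : ℝ), (y : ℂ) * Complex.exp (-(((1 : ℝ) : ℂ) * y)) * ((y ^ (-q) : ℝ) : ℂ)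
      =
      (Real.Gamma (2 - q) : ℂ) := by
    rw [Real.Gamma_eq_integral (by linarith), ← integral_complex_ofReal]
    refine setIntegral_congr_fun measurableSet_Ioi fun y hy => ?_
    have hy0 : 0 < y := hy
    rw [show 2 - q - 1 = 1 + -q by ring, Real.rpow_add hy0, Real.rpow_one]
    push_cast
    rw [one_mul]
    ring
  rw [hM] at hd
  have hd1 := hd.comp_ofReal
  have hd2 : HasDerivAt (fun r : ℝ => ((r ^ (q - 1) : ℝ) : ℂ) * stableInt q 1)
      (((q - 1 : ℝ) : ℂ) * stableInt q 1) 1 := by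
    have := (Real.hasDerivAt_rpow_const (x := 1) (p := q - 1) (Or.inl one_ne_zero)).ofReal_comp
    exact (this.mul_const (stableInt q 1)).congr_deriv (by simp)
  have hd3 := hd2.congr_of_eventuallyEq (f₁ := fun r : ℝ => stableInt q r)
    ((lt_mem_nhds one_pos).mono fun r hr => stableInt_ofReal hr)
  have h3 := hd1.unique hd3
  have h4 : Real.Gamma (2 - q) = (1 - q) * Real.Gamma (1 - q) := by
    rw [show 2 - q = (1 - q) + 1 by ring, Real.Gamma_add_one (by linarith)]
  rw [h4] at h3
  have h5 : ((q - 1 : ℝ) : ℂ) ≠ 0 := by exact_mod_cast (by linarith : q - 1 ≠ 0)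
  refine mul_left_cancel₀ h5 (h3.symm.trans ?_)
  push_cast
  ring

lemma stableInt_eq (h1 : 1 < q) (h2 : q < 2) {z : ℂ} (hz : 0 < z.re) :
    stableInt q z = z ^ ((q - 1 : ℝ) : ℂ) * stableInt q 1 := by
  set U : Set ℂ := {w | 0 < w.re}
  have hU : IsOpen U := isOpen_lt continuous_const Complex.continuous_re
  have hf : AnalyticOnNhd ℂ (stableInt q) U := DifferentiableOn.analyticOnNhd
    (fun w hw => (hasDerivAt_stableInt h1 h2 hw).differentiableAt.differentiableWithinAt) hU
  have hg : AnalyticOnNhd ℂ (fun w : ℂ => w ^ ((q - 1 : ℝ) : ℂ) * stableInt q 1) U := by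
    refine DifferentiableOn.analyticOnNhd (fun w hw => ?_) hU
    have : w ∈ Complex.slitPlane := Or.inl hw
    exact ((differentiableAt_id.cpow_const this).mul_const _).differentiableWithinAt
  have hconv : Convex ℝ U := (convex_Ioi (0 : ℝ)).linear_preimage Complex.reLm
  refine hf.eqOn_of_preconnected_of_frequently_eq hg hconv.isPreconnected
    (z₀ := ((1 : ℝ) : ℂ)) (by simp [U]) ?_ hz
  have ht : Tendsto (fun r : ℝ => (r : ℂ)) (𝓝[≠] 1) (𝓝[≠] ((1 : ℝ) : ℂ)) := by
    refine tendsto_nhdsWithin_of_tendsto_nhds_of_eventually_within _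
      (Complex.continuous_ofReal.continuousAt.tendsto.mono_left nhdsWithin_le_nhds) ?_
    filter_upwards [self_mem_nhdsWithin] with r hr
    exact fun h => hr (Complex.ofReal_injective h)
  refine ht.frequently (Eventually.frequently ?_)
  filter_upwards [mem_nhdsWithin_of_mem_nhds (lt_mem_nhds one_pos)] with r hr
  rw [stableInt_ofReal hr, Complex.ofReal_cpow (le_of_lt hr)]

lemma stableInt_neg_I (h1 : 1 < q) (h2 : q < 2) :
    stableInt q (-Complex.I) = (-Complex.I) ^ ((q - 1 : ℝ) : ℂ) * stableInt q 1 := by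
  set γ : ℝ → ℂ := fun e => (e : ℂ) - Complex.I
  have hγ : Tendsto γ (𝓝[>] 0) (𝓝 (-Complex.I)) := by
    have : ContinuousAt γ 0 := by fun_prop
    have h := this.tendsto
    simp only [γ, Complex.ofReal_zero, zero_sub] at h
    exact h.mono_left nhdsWithin_le_nhds
  have hs : Ioo (0 : ℝ) 1 ∈ 𝓝[>] (0 : ℝ) := Ioo_mem_nhdsGT one_pos
  have l1 : Tendsto (fun e => stableInt q (γ e)) (𝓝[>] 0) (𝓝 (stableInt q (-Complex.I))) := by
    refine tendsto_integral_filter_of_dominated_convergence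
      (fun y => 2 * max 1 2 * (min 1 y * y ^ (-q)))
      (Eventually.of_forall fun e => (measurable_stableKernel _).aestronglyMeasurable) ?_
      ((integrableOn_min_rpow h1 h2).const_mul _) ?_
    · filter_upwards [hs] with e he
      refine (ae_restrict_mem measurableSet_Ioi).mono fun y hy => norm_stableKernel_le ?_ ?_ hy
      · simpa [γ] using he.1.le
      · refine (norm_sub_le _ _).trans ?_
        rw [Complex.norm_real, Complex.norm_I, Real.norm_eq_abs, abs_of_pos he.1]
        linarith [he.2]
    · refine ae_of_all _ fun y => ?_
      have hc : Continuous fun z : ℂ => stableKernel q z y := by unfold stableKernel; fun_prop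
      exact (hc.tendsto _).comp hγ
  have l2 : Tendsto (fun e => stableInt q (γ e)) (𝓝[>] 0)
      (𝓝 ((-Complex.I) ^ ((q - 1 : ℝ) : ℂ) * stableInt q 1)) := by
    have hc : ContinuousAt (fun z : ℂ => z ^ ((q - 1 : ℝ) : ℂ)) (-Complex.I) :=
      continuousAt_cpow_const (Or.inr (by simp))
    refine ((hc.tendsto.comp hγ).mul_const (stableInt q 1)).congr' ?_
    filter_upwards [hs] with e he
    exact (stableInt_eq h1 h2 (by simpa [γ] using he.1)).symm
  exact tendsto_nhds_unique l1 l2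

/-- The constant of the one-sided stable law of index `q`. -/
theorem fourier_constant (h1 : 1 < q) (h2 : q < 2) :
    Complex.I * ∫ y in Ioi (0 : ℝ), (Complex.exp (Complex.I * y) - 1) * ((y ^ (-q) : ℝ) : ℂ) =
      -((Real.Gamma (1 - q) * Real.cos (Real.pi / 2 * q) : ℝ) : ℂ) *
        (1 - Complex.I * (Real.tan (Real.pi / 2 * q) : ℝ)) := by
  have e : ∫ y in Ioi (0 : ℝ), (Complex.exp (Complex.I * y) - 1) * ((y ^ (-q) : ℝ) : ℂ) =
      -stableInt q (-Complex.I) := by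
    rw [stableInt, ← integral_neg]
    congr 1
    ext y
    rw [stableKernel, neg_mul, neg_neg]
    ring
  have hI : (-Complex.I) ^ ((q - 1 : ℝ) : ℂ) =
      Complex.exp (-((Real.pi / 2 * q : ℝ) : ℂ) * Complex.I) * Complex.I := by
    rw [Complex.cpow_def_of_ne_zero (neg_ne_zero.2 Complex.I_ne_zero), Complex.log_neg_I]
    calc _ = Complex.exp (-((Real.pi / 2 * q : ℝ) : ℂ) * Complex.I) *
          Complex.exp (Real.pi / 2 * Complex.I) := by
          rw [← Complex.exp_add]
          congr 1
          push_cast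
          ring
      _ = _ := by rw [Complex.exp_pi_div_two_mul_I]
  have hcos : Real.cos (Real.pi / 2 * q) ≠ 0 := by
    refine (Real.cos_neg_of_pi_div_two_lt_of_lt ?_ ?_).ne <;> nlinarith [Real.pi_pos]
  rw [e, stableInt_neg_I h1 h2, stableInt_one h1 h2, hI, Complex.exp_mul_I, Real.tan_eq_sin_div_cos]
  have hc' : ((Real.cos (Real.pi / 2 * q) : ℝ) : ℂ) ≠ 0 := by exact_mod_cast hcos
  rw [Complex.cos_neg, Complex.sin_neg, ← Complex.ofReal_cos, ← Complex.ofReal_sin]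
  push_cast
  push_cast at hc'
  generalize Complex.cos _ = x at *
  generalize Complex.sin _ = y at *
  field_simp
  linear_combination (x - Complex.I * y) * (Real.Gamma (1 - q) : ℂ) * Complex.I_sq

end FourierConstant
end LSV

namespace LSV
section Tail
variable {X : Type*} [MeasurableSpace X] {μ : Measure X} [IsFiniteMeasure μ] {τ : X → ℕ} {q A : ℝ}

lemma tail_bound (hq : 1 < q)
    (hA : Tendsto (fun n : ℕ => (n : ℝ) ^ q * μ.real {z | n < τ z}) atTop (𝓝 A)) :
    ∃ C ≥ 0, ∀ n : ℕ, μ.real {z | n < τ z} ≤ C * ((n : ℝ) + 1) ^ (-q) := by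
  obtain ⟨B, hB⟩ := hA.bddAbove_range
  have hB' : ∀ n : ℕ, (n : ℝ) ^ q * μ.real {z | n < τ z} ≤ B := fun n => hB ⟨n, rfl⟩
  have hB0 : 0 ≤ B := le_trans (by positivity) (hB' 0)
  refine ⟨B * 2 ^ q + μ.real univ, by positivity, fun n => ?_⟩
  rcases Nat.eq_zero_or_pos n with rfl | hn
  · have h1 : μ.real {z | 0 < τ z} ≤ μ.real univ := measureReal_mono (subset_univ _)
    have h2 : 0 ≤ B * (2 : ℝ) ^ q := by positivity
    simp only [CharP.cast_eq_zero, zero_add, Real.one_rpow, mul_one]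
    linarith
  · have h0 : (1 : ℝ) ≤ n := by exact_mod_cast hn
    have h1 : ((n : ℝ) + 1) ^ q ≤ 2 ^ q * (n : ℝ) ^ q := by
      rw [← Real.mul_rpow (by norm_num) (by linarith)]
      exact Real.rpow_le_rpow (by linarith) (by linarith) (by linarith)
    have h2 : 0 < ((n : ℝ) + 1) ^ q := by positivity
    rw [Real.rpow_neg (by positivity), ← div_eq_mul_inv, le_div_iff₀ h2]
    have h3 := hB' n
    have h4 : 0 ≤ μ.real {z | n < τ z} := measureReal_nonneg
    have h5 : 0 ≤ μ.real (univ : Set X) := measureReal_nonneg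
    have h6 : (0 : ℝ) < 2 ^ q := by positivity
    nlinarith [mul_le_mul_of_nonneg_left h1 h4, mul_le_mul_of_nonneg_left h3 h6.le]

omit [IsFiniteMeasure μ] in
lemma lintegral_nat (hτ : Measurable τ) :
    ∫⁻ z, (τ z : ENNReal) ∂μ = ∑' n : ℕ, μ {z | n < τ z} := by
  have hm : ∀ n : ℕ, MeasurableSet {z | n < τ z} := fun n => measurableSet_lt measurable_const hτ
  have e : ∀ z, (τ z : ENNReal) = ∑' n : ℕ, {z | n < τ z}.indicator (fun _ => (1 : ENNReal)) z := by
    intro z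
    rw [tsum_eq_sum (s := Finset.range (τ z)), Finset.sum_congr rfl (g := fun _ => 1)]
    · simp
    · intro n hn
      exact indicator_of_mem (s := {z | n < τ z}) (Finset.mem_range.1 hn) _
    · intro n hn
      exact indicator_of_notMem (s := {z | n < τ z}) (mt Finset.mem_range.2 hn) _
  simp_rw [e]
  rw [lintegral_tsum fun n => (measurable_const.indicator (hm n)).aemeasurable]
  refine tsum_congr fun n => ?_
  rw [lintegral_indicator_const (hm n), one_mul]

lemma integrable_of_tail (hq : 1 < q) (hτ : Measurable τ)
    (hA : Tendsto (fun n : ℕ => (n : ℝ) ^ q * μ.real {z | n < τ z}) atTop (𝓝 A)) :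
    Integrable (fun z => (τ z : ℝ)) μ := by
  obtain ⟨C, hC, hb⟩ := tail_bound hq hA
  have hsum : Summable fun n : ℕ => C * ((n : ℝ) + 1) ^ (-q) := by
    have := (summable_nat_add_iff 1).2 (Real.summable_nat_rpow.2 (show -q < -1 by linarith))
    exact (this.congr fun n => by push_cast; rfl).mul_left C
  refine ⟨(measurable_from_nat.comp hτ).aestronglyMeasurable, ?_⟩
  rw [hasFiniteIntegral_iff_ofReal (ae_of_all _ fun z => Nat.cast_nonneg _)]
  simp only [ENNReal.ofReal_natCast]
  rw [lintegral_nat hτ]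
  refine (ENNReal.tsum_le_tsum fun n => ?_).trans_lt hsum.tsum_ofReal_lt_top
  rw [← ofReal_measureReal]
  exact ENNReal.ofReal_le_ofReal (hb n)

lemma integral_eq_tail (hτ : Measurable τ) (hi : Integrable (fun z => (τ z : ℝ)) μ)
    {g g' : ℝ → ℂ} (h0 : g 0 = 0) (hg : ∀ y, HasDerivAt g (g' y) y) (hc : Continuous g') {B : ℝ}
    (hB : ∀ y, 0 ≤ y → ‖g' y‖ ≤ B) {x : ℝ} (hx : 0 < x) :
    ∫ z, g (x * τ z) ∂μ =
      ∫ y in Ioi (0 : ℝ), (μ.real {z | ⌊y / x⌋₊ < τ z} : ℂ) * g' y := by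
  have hS : MeasurableSet {p : X × ℝ | p.2 < x * τ p.1} :=
    measurableSet_lt measurable_snd
      ((measurable_from_nat.comp (hτ.comp measurable_fst)).const_mul x)
  have hslice : ∀ z, ∀ f : ℝ → ℂ, ∫ y in Ioi (0 : ℝ), (Iio (x * τ z)).indicator f y =
      ∫ y in (0 : ℝ)..(x * τ z), f y := by
    intro z f
    rw [intervalIntegral.integral_of_le (by positivity), setIntegral_indicator measurableSet_Iio,
      Ioi_inter_Iio, integral_Ioc_eq_integral_Ioo]
  have hK : Integrable (Function.uncurry fun (z : X) (y : ℝ) => (Iio (x * τ z)).indicator g' y)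
      (μ.prod (volume.restrict (Ioi (0 : ℝ)))) := by
    have e : (Function.uncurry fun (z : X) (y : ℝ) => (Iio (x * τ z)).indicator g' y) =
        {p : X × ℝ | p.2 < x * τ p.1}.indicator fun p => g' p.2 := rfl
    have hintb : ∀ z : X, ∀ f : ℝ → ℂ, Continuous f → IntegrableOn ((Iio (x * τ z)).indicator f)
        (Ioi (0 : ℝ)) := by
      intro z f hf
      rw [IntegrableOn, integrable_indicator_iff measurableSet_Iio, IntegrableOn,
        Measure.restrict_restrict measurableSet_Iio, Iio_inter_Ioi]
      exact (hf.integrableOn_Icc (a := 0) (b := x * τ z)).mono_set Ioo_subset_Icc_self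
    rw [integrable_prod_iff]
    · refine ⟨ae_of_all _ fun z => hintb z g' hc, ?_⟩
      refine (hi.const_mul (B * x)).mono' ?_ (ae_of_all _ fun z => ?_)
      · rw [e]
        exact ((hc.measurable.comp measurable_snd).indicator hS).norm.stronglyMeasurable
          |>.integral_prod_right.aestronglyMeasurable
      · rw [Real.norm_eq_abs, abs_of_nonneg (integral_nonneg fun _ => norm_nonneg _)]
        have hB0 : 0 ≤ B := (norm_nonneg _).trans (hB 0 le_rfl)
        have h1 : ∫ y in Ioi (0 : ℝ), ‖(Iio (x * τ z)).indicator g' y‖ ≤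
            ∫ y in Ioi (0 : ℝ), (Iio (x * τ z)).indicator (fun _ => B) y := by
          refine setIntegral_mono_on (hintb z g' hc).norm ?_ measurableSet_Ioi fun y hy => ?_
          · rw [IntegrableOn, integrable_indicator_iff measurableSet_Iio, IntegrableOn,
              Measure.restrict_restrict measurableSet_Iio, Iio_inter_Ioi]
            exact integrableOn_const (by simp)
          · rw [norm_indicator_eq_indicator_norm]
            exact indicator_le_indicator (hB y (le_of_lt hy))
        refine h1.trans (le_of_eq ?_)
        rw [setIntegral_indicator measurableSet_Iio, Ioi_inter_Iio, setIntegral_const,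
          Real.volume_real_Ioo_of_le (by positivity), smul_eq_mul]
        ring
    · rw [e]
      exact ((hc.measurable.comp measurable_snd).indicator hS).aestronglyMeasurable
  have h1 : ∀ z, g (x * τ z) = ∫ y in Ioi (0 : ℝ), (Iio (x * τ z)).indicator g' y := by
    intro z
    rw [hslice, intervalIntegral.integral_eq_sub_of_hasDerivAt (fun y _ => hg y)
      (hc.intervalIntegrable _ _), h0, sub_zero]
  simp_rw [h1]
  rw [integral_integral_swap hK]
  refine setIntegral_congr_fun measurableSet_Ioi fun y hy => ?_
  have hy0 : 0 ≤ y := le_of_lt hy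
  have h2 : (fun z => (Iio (x * τ z)).indicator g' y) =
      {z | ⌊y / x⌋₊ < τ z}.indicator fun _ => g' y := by
    ext z
    have : y ∈ Iio (x * (τ z : ℝ)) ↔ z ∈ {z | ⌊y / x⌋₊ < τ z} := by
      rw [mem_ofPred_eq, Nat.floor_lt (by positivity), div_lt_iff₀ hx, mul_comm, mem_Iio]
    by_cases h : y ∈ Iio (x * (τ z : ℝ))
    · rw [indicator_of_mem h, indicator_of_mem (this.1 h)]
    · rw [indicator_of_notMem h, indicator_of_notMem (mt this.2 h)]
  rw [h2, integral_indicator (measurableSet_lt measurable_const hτ), setIntegral_const,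
    Complex.real_smul]

omit [IsFiniteMeasure μ] in
lemma tendsto_rescaled_tail (hA : Tendsto (fun n : ℕ => (n : ℝ) ^ q * μ.real {z | n < τ z}) atTop
    (𝓝 A))
    {y : ℝ} (hy : 0 < y) :
    Tendsto (fun x : ℝ => x ^ (-q) * μ.real {z | ⌊y / x⌋₊ < τ z}) (𝓝[>] 0) (𝓝 (A * y ^ (-q))) := by
  have h1 : Tendsto (fun x : ℝ => x⁻¹) (𝓝[>] 0) atTop := tendsto_inv_nhdsGT_zero
  have h2 : Tendsto (fun x : ℝ => ⌊y / x⌋₊) (𝓝[>] 0) atTop := by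
    refine tendsto_nat_floor_atTop.comp ?_
    exact (h1.const_mul_atTop hy).congr fun x => (div_eq_mul_inv y x).symm
  have h3 : Tendsto (fun x : ℝ => (⌊y / x⌋₊ : ℝ) * x) (𝓝[>] 0) (𝓝 y) := by
    refine ((tendsto_nat_floor_mul_div_atTop hy.le).comp h1).congr fun x => ?_
    rw [Function.comp_apply, div_inv_eq_mul, div_eq_mul_inv y x]
  have h4 : Tendsto (fun x : ℝ => ((⌊y / x⌋₊ : ℝ) * x) ^ (-q)) (𝓝[>] 0) (𝓝 (y ^ (-q))) :=
    (Real.continuousAt_rpow_const _ _ (Or.inl hy.ne')).tendsto.comp h3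
  refine ((hA.comp h2).mul h4).congr' ?_
  filter_upwards [self_mem_nhdsWithin, h2.eventually_gt_atTop 0] with x hx hN
  have hx0 : 0 < x := hx
  have hN0 : (0 : ℝ) < ⌊y / x⌋₊ := by exact_mod_cast hN
  rw [Function.comp_apply, Real.mul_rpow hN0.le hx0.le, Real.rpow_neg hN0.le]
  field_simp

/-- Abelian asymptotics for the expectation of a smooth function of a variable with a regularly
varying tail. -/
theorem tail_transform (hq : 1 < q) (hq2 : q < 2) (hτ : Measurable τ)
    (hA : Tendsto (fun n : ℕ => (n : ℝ) ^ q * μ.real {z | n < τ z}) atTop (𝓝 A))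
    {g g' : ℝ → ℂ} (h0 : g 0 = 0) (hg : ∀ y, HasDerivAt g (g' y) y) (hc : Continuous g') {B : ℝ}
    (hB : ∀ y, 0 ≤ y → ‖g' y‖ ≤ B * min 1 y) :
    Tendsto (fun x : ℝ => ((x ^ (-q) : ℝ) : ℂ) * ∫ z, g (x * τ z) ∂μ) (𝓝[>] 0)
      (𝓝 (A * ∫ y in Ioi (0 : ℝ), g' y * ((y ^ (-q) : ℝ) : ℂ))) := by
  have hi := integrable_of_tail hq hτ hA
  obtain ⟨C, hC, hb⟩ := tail_bound hq hA
  have hB0 : 0 ≤ B := by simpa using (norm_nonneg _).trans (hB 1 zero_le_one)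
  have hB1 : ∀ y, 0 ≤ y → ‖g' y‖ ≤ B := fun y hy =>
    (hB y hy).trans (mul_le_of_le_one_right hB0 (min_le_left _ _))
  have e : ∀ᶠ x : ℝ in 𝓝[>] 0, (∫ y in Ioi (0 : ℝ),
      ((x ^ (-q) * μ.real {z | ⌊y / x⌋₊ < τ z} : ℝ) : ℂ) * g' y) =
      ((x ^ (-q) : ℝ) : ℂ) * ∫ z, g (x * τ z) ∂μ := by
    filter_upwards [self_mem_nhdsWithin] with x hx
    rw [integral_eq_tail hτ hi h0 hg hc hB1 hx, ← integral_const_mul]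
    congr 1
    ext y
    push_cast
    ring
  refine Tendsto.congr' e ?_
  rw [← integral_const_mul]
  have hmeas : ∀ x : ℝ, Measurable fun y : ℝ => μ.real {z | ⌊y / x⌋₊ < τ z} := fun x =>
    (measurable_from_nat (f := fun n : ℕ => μ.real {z | n < τ z})).comp
      (Nat.measurable_floor.comp (measurable_id.div_const x))
  refine tendsto_integral_filter_of_dominated_convergence
    (fun y => C * B * (min 1 y * y ^ (-q))) ?_ ?_ ((integrableOn_min_rpow hq hq2).const_mul _) ?_
  · refine Eventually.of_forall fun x => ?_
    exact ((Complex.measurable_ofReal.comp ((hmeas x).const_mul _)).mul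
      hc.measurable).aestronglyMeasurable
  · filter_upwards [self_mem_nhdsWithin] with x hx
    have hx0 : 0 < x := hx
    refine (ae_restrict_mem measurableSet_Ioi).mono fun y hy => ?_
    have hy0 : 0 < y := hy
    have h1 : x ^ (-q) * μ.real {z | ⌊y / x⌋₊ < τ z} ≤ C * y ^ (-q) := by
      have h2 : ((⌊y / x⌋₊ : ℝ) + 1) ^ (-q) ≤ (y / x) ^ (-q) :=
        Real.rpow_le_rpow_of_nonpos (by positivity) (Nat.lt_floor_add_one _).le (by linarith)
      refine (mul_le_mul_of_nonneg_left ((hb _).trans (mul_le_mul_of_nonneg_left h2 hC))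
        (by positivity)).trans (le_of_eq ?_)
      rw [Real.div_rpow hy0.le hx0.le]
      have : x ^ (-q) ≠ 0 := (Real.rpow_pos_of_pos hx0 _).ne'
      field_simp
    rw [norm_mul, Complex.norm_real, Real.norm_eq_abs, abs_of_nonneg (by positivity)]
    refine (mul_le_mul h1 (hB y hy0.le) (norm_nonneg _) (by positivity)).trans (le_of_eq ?_)
    ring
  · refine (ae_restrict_mem measurableSet_Ioi).mono fun y hy => ?_
    have h := (Complex.continuous_ofReal.tendsto _).comp (tendsto_rescaled_tail hA hy)
    refine (h.mul_const (g' y)).trans (le_of_eq ?_)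
    congr 1
    push_cast
    ring

end Tail
end LSV

namespace LSV
section Compare

/-- The remainder of the exponential after its linear part. -/
def expRem (y : ℝ) : ℂ := Complex.exp (Complex.I * y) - 1 - Complex.I * y

lemma hasDerivAt_expRem (y : ℝ) :
    HasDerivAt expRem (Complex.I * (Complex.exp (Complex.I * y) - 1)) y := by
  have h : HasDerivAt (fun y : ℝ => Complex.I * (y : ℂ)) (Complex.I * 1) y :=
    (HasDerivAt.ofReal_comp (hasDerivAt_id y)).const_mul Complex.I |>.congr_deriv (by simp)
  exact ((h.cexp.sub_const 1).sub h).congr_deriv (by ring)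

lemma norm_deriv_expRem_le (y : ℝ) :
    ‖Complex.I * (Complex.exp (Complex.I * y) - 1)‖ ≤ 2 * min 1 |y| := by
  rw [norm_mul, Complex.norm_I, one_mul, norm_sub_rev]
  refine (norm_one_sub_exp_le (by simp)).trans (le_of_eq ?_)
  rw [norm_mul, Complex.norm_I, one_mul, Complex.norm_real, Real.norm_eq_abs]

lemma expRem_zero : expRem 0 = 0 := by simp [expRem]

lemma measurable_expRem : Measurable expRem := by unfold expRem; fun_prop

lemma norm_expRem_sub_le (a b : ℝ) :
    ‖expRem a - expRem b‖ ≤ 2 * min 1 (max |a| |b|) * |a - b| := by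
  refine Convex.norm_image_sub_le_of_norm_hasDerivWithin_le (s := uIcc a b)
    (fun y _ => (hasDerivAt_expRem y).hasDerivWithinAt) (fun y hy => ?_) (convex_uIcc a b)
    right_mem_uIcc left_mem_uIcc
  refine (norm_deriv_expRem_le y).trans ?_
  have : |y| ≤ max |a| |b| := by
    rcases le_total a b with h | h
    · rw [uIcc_of_le h] at hy
      exact abs_le_max_abs_abs hy.1 hy.2
    · rw [uIcc_of_ge h] at hy
      rw [max_comm]
      exact abs_le_max_abs_abs hy.1 hy.2
  gcongr

lemma norm_expRem_le (a : ℝ) : ‖expRem a‖ ≤ 2 * |a| := by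
  have h := norm_expRem_sub_le a 0
  rw [expRem_zero, sub_zero, sub_zero] at h
  refine h.trans (mul_le_mul_of_nonneg_right ?_ (abs_nonneg _))
  linarith [min_le_left 1 (max |a| |(0 : ℝ)|)]

lemma expRem_neg (y : ℝ) : expRem (-y) = (starRingEnd ℂ) (expRem y) := by
  simp only [expRem, map_sub, map_mul, map_one, Complex.conj_I, Complex.conj_ofReal,
    ← Complex.exp_conj]
  push_cast
  ring_nf

variable {X : Type*} [MeasurableSpace X] {μ : Measure X} [IsFiniteMeasure μ] {τ : X → ℕ} {q A : ℝ}

/-- The exponent of the totally skewed stable law with orientation `s`. -/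
def stableExp (q s : ℝ) : ℂ :=
  -((Real.Gamma (1 - q) * Real.cos (Real.pi / 2 * q) : ℝ) : ℂ) *
    (1 - Complex.I * ((s * Real.tan (Real.pi / 2 * q) : ℝ) : ℂ))

lemma stableExp_neg (q s : ℝ) : stableExp q (-s) = (starRingEnd ℂ) (stableExp q s) := by
  simp only [stableExp, map_mul, map_neg, map_sub, map_one, Complex.conj_I, Complex.conj_ofReal]
  push_cast
  ring

lemma tendsto_integral_expRem_one (hq : 1 < q) (hq2 : q < 2) (hτ : Measurable τ)
    (hA : Tendsto (fun n : ℕ => (n : ℝ) ^ q * μ.real {z | n < τ z}) atTop (𝓝 A)) :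
    Tendsto (fun x : ℝ => ((x ^ (-q) : ℝ) : ℂ) * ∫ z, expRem (x * τ z) ∂μ) (𝓝[>] 0)
      (𝓝 (A * stableExp q 1)) := by
  have h := tail_transform hq hq2 hτ hA expRem_zero hasDerivAt_expRem (by fun_prop)
    (fun y hy => by simpa [abs_of_nonneg hy] using norm_deriv_expRem_le y)
  rw [stableExp, one_mul, ← fourier_constant hq hq2, ← integral_const_mul]
  simpa only [mul_assoc] using h

lemma tendsto_integral_expRem (hq : 1 < q) (hq2 : q < 2) (hτ : Measurable τ)
    (hA : Tendsto (fun n : ℕ => (n : ℝ) ^ q * μ.real {z | n < τ z}) atTop (𝓝 A)) {c : ℝ}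
    (hc : c ≠ 0) :
    Tendsto (fun x : ℝ => ((x ^ (-q) : ℝ) : ℂ) * ∫ z, expRem (x * (c * τ z)) ∂μ) (𝓝[>] 0)
      (𝓝 (A * ((|c| ^ q : ℝ) : ℂ) * stableExp q (Real.sign c))) := by
  have hpos : ∀ {c : ℝ}, 0 < c →
      Tendsto (fun x : ℝ => ((x ^ (-q) : ℝ) : ℂ) * ∫ z, expRem (x * (c * τ z)) ∂μ) (𝓝[>] 0)
      (𝓝 (A * ((c ^ q : ℝ) : ℂ) * stableExp q 1)) := by
    intro c hc
    have h1 : Tendsto (fun x : ℝ => x * c) (𝓝[>] 0) (𝓝[>] 0) := by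
      refine tendsto_nhdsWithin_of_tendsto_nhds_of_eventually_within _ ?_ ?_
      · have : ContinuousAt (fun x : ℝ => x * c) 0 := by fun_prop
        simpa using this.tendsto.mono_left nhdsWithin_le_nhds
      · filter_upwards [self_mem_nhdsWithin] with x hx
        exact mul_pos hx hc
    have h2 := ((tendsto_integral_expRem_one hq hq2 hτ hA).comp h1).const_mul ((c ^ q : ℝ) : ℂ)
    rw [show (A : ℂ) * ((c ^ q : ℝ) : ℂ) * stableExp q 1 =
      ((c ^ q : ℝ) : ℂ) * (A * stableExp q 1) by ring]
    refine h2.congr' ?_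
    filter_upwards [self_mem_nhdsWithin] with x hx
    have hx0 : 0 < x := hx
    simp only [Function.comp_apply, mul_assoc]
    rw [Real.mul_rpow hx0.le hc.le, Real.rpow_neg hc.le, ← mul_assoc, ← Complex.ofReal_mul]
    congr 2
    have : c ^ q ≠ 0 := (Real.rpow_pos_of_pos hc q).ne'
    field_simp
  rcases lt_or_gt_of_ne hc with h | h
  · have h1 := (Complex.continuous_conj.tendsto _).comp (hpos (neg_pos.2 h))
    rw [abs_of_neg h, Real.sign_of_neg h, stableExp_neg]
    simp only [map_mul, Complex.conj_ofReal] at h1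
    refine h1.congr fun x => ?_
    simp only [Function.comp_apply, map_mul, Complex.conj_ofReal]
    rw [← integral_conj]
    simp only [← expRem_neg]
    congr 3
    ext z
    congr 1
    ring
  · rw [abs_of_pos h, Real.sign_of_pos h]
    exact hpos h

lemma mul_min_le_sqrt {y : ℝ} (hy : 0 ≤ y) : y * min 1 y ≤ 3 * (√(1 + y ^ 2) - 1) := by
  have h1 := Real.sq_sqrt (show 0 ≤ 1 + y ^ 2 by positivity)
  have h2 := Real.sqrt_nonneg (1 + y ^ 2)
  rcases le_total y 1 with h | h
  · rw [min_eq_right h]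
    have h3 : √(1 + y ^ 2) ≤ 2 := by
      rw [Real.sqrt_le_left two_pos.le]
      nlinarith
    have h4 : 1 ≤ √(1 + y ^ 2) := by
      rw [Real.one_le_sqrt]
      nlinarith
    nlinarith [mul_nonneg (sub_nonneg.2 h4) (sub_nonneg.2 h3)]
  · rw [min_eq_left h]
    nlinarith

lemma integral_mul_min_le (hq : 1 < q) (hq2 : q < 2) (hτ : Measurable τ)
    (hA : Tendsto (fun n : ℕ => (n : ℝ) ^ q * μ.real {z | n < τ z}) atTop (𝓝 A)) :
    ∃ C ≥ 0, ∀ᶠ x : ℝ in 𝓝[>] 0, ∫ z, x * τ z * min 1 (x * τ z) ∂μ ≤ C * x ^ q := by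
  have hd : ∀ y : ℝ, HasDerivAt (fun y : ℝ => √(1 + y ^ 2) - 1) (y / √(1 + y ^ 2)) y := by
    intro y
    have h : HasDerivAt (fun y : ℝ => 1 + y ^ 2) (2 * y) y := by
      simpa using (hasDerivAt_pow 2 y).const_add 1
    refine ((h.sqrt (by positivity)).sub_const 1).congr_deriv ?_
    rw [mul_div_mul_left _ _ two_ne_zero]
  have h := tail_transform hq hq2 hτ hA (g := fun y => ((√(1 + y ^ 2) - 1 : ℝ) : ℂ))
    (g' := fun y => ((y / √(1 + y ^ 2) : ℝ) : ℂ)) (B := 1) (by simp)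
    (fun y => (hd y).ofReal_comp) ?_ ?_
  · have h2 := h.norm.eventually (gt_mem_nhds (lt_add_one _))
    set L := ‖(A : ℂ) * ∫ y in Ioi (0 : ℝ), ((y / √(1 + y ^ 2) : ℝ) : ℂ) * ((y ^ (-q) : ℝ) : ℂ)‖
    have hL : 0 ≤ L := norm_nonneg _
    refine ⟨3 * (L + 1), by positivity, ?_⟩
    filter_upwards [h2, self_mem_nhdsWithin] with x hx hx0
    have hx0 : 0 < x := hx0
    have hi := integrable_of_tail hq hτ hA
    have h3 : ∫ z, x * τ z * min 1 (x * τ z) ∂μ ≤ 3 * ∫ z, (√(1 + (x * τ z) ^ 2) - 1) ∂μ := by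
      rw [← integral_const_mul]
      refine integral_mono ?_ ?_ fun z => mul_min_le_sqrt (by positivity)
      · refine (hi.const_mul x).mono' ?_ (ae_of_all _ fun z => ?_)
        · exact Measurable.aestronglyMeasurable (by fun_prop)
        · rw [Real.norm_eq_abs, abs_of_nonneg (by positivity)]
          exact mul_le_of_le_one_right (by positivity) (min_le_left _ _)
      · refine ((hi.const_mul x).mono' ?_ (ae_of_all _ fun z => ?_)).const_mul 3
        · exact Measurable.aestronglyMeasurable (by fun_prop)
        · have h4 : 1 ≤ √(1 + (x * τ z) ^ 2) := Real.one_le_sqrt.2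
            (by nlinarith [sq_nonneg (x * τ z)])
          rw [Real.norm_eq_abs, abs_of_nonneg (by linarith), sub_le_iff_le_add]
          refine Real.sqrt_le_iff.2 ⟨by positivity, ?_⟩
          have : 0 ≤ x * τ z := by positivity
          nlinarith
    rw [norm_mul, integral_complex_ofReal, Complex.norm_real, Complex.norm_real, Real.norm_eq_abs,
      Real.norm_eq_abs, abs_of_pos (Real.rpow_pos_of_pos hx0 _), Real.rpow_neg hx0.le,
      inv_mul_lt_iff₀ (Real.rpow_pos_of_pos hx0 _)] at hx
    linarith [le_abs_self (∫ z, (√(1 + (x * τ z) ^ 2) - 1) ∂μ)]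
  · have : ∀ y : ℝ, √(1 + y ^ 2) ≠ 0 := fun y => (Real.sqrt_pos.2 (by positivity)).ne'
    exact Complex.continuous_ofReal.comp (continuous_id.div (by fun_prop) this)
  · intro y hy
    have h4 : 1 ≤ √(1 + y ^ 2) := Real.one_le_sqrt.2 (by nlinarith [sq_nonneg y])
    have h5 : y ≤ √(1 + y ^ 2) := Real.le_sqrt_of_sq_le (by linarith)
    rw [one_mul, Complex.norm_real, Real.norm_eq_abs, abs_of_nonneg (by positivity)]
    exact le_min (div_le_one_of_le₀ h5 (by linarith)) (div_le_self hy h4)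

/-- Asymptotics of the characteristic function at zero of a centred variable which is close to a
multiple of `τ`. -/
theorem charFun_asymptotics (hq : 1 < q) (hq2 : q < 2) (hτ : Measurable τ)
    (hA : Tendsto (fun n : ℕ => (n : ℝ) ^ q * μ.real {z | n < τ z}) atTop (𝓝 A))
    {v : X → ℝ} (hv : Measurable v) {c M : ℝ} (hc : c ≠ 0) (hM1 : 1 ≤ M) (hcM : |c| ≤ M)
    (hM : ∀ᵐ z ∂μ, |v z| ≤ M * τ z) (hv0 : ∫ z, v z ∂μ = 0)
    (happ : ∀ e > 0, ∃ R : X → ℝ, (∀ z, 0 ≤ R z) ∧ Integrable (fun z => R z * τ z) μ ∧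
      ∀ᵐ z ∂μ, |v z - c * τ z| ≤ e * τ z + R z) :
    Tendsto (fun x : ℝ => ((x ^ (-q) : ℝ) : ℂ) *
        ∫ z, (Complex.exp (Complex.I * ((x * v z : ℝ) : ℂ)) - 1) ∂μ) (𝓝[>] 0)
      (𝓝 (A * ((|c| ^ q : ℝ) : ℂ) * stableExp q (Real.sign c))) := by
  have hi := integrable_of_tail hq hτ hA
  have hvi : Integrable v μ := (hi.const_mul M).mono' hv.aestronglyMeasurable hM
  have hrem : ∀ (x : ℝ) {w : X → ℝ}, Measurable w → Integrable w μ →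
      Integrable (fun z => expRem (x * w z)) μ := by
    intro x w hw hwi
    refine (hwi.abs.const_mul (2 * |x|)).mono'
      (measurable_expRem.comp (hw.const_mul x)).aestronglyMeasurable (ae_of_all _ fun z => ?_)
    refine (norm_expRem_le _).trans (le_of_eq ?_)
    rw [abs_mul, mul_assoc]
  have hcτ : Measurable fun z => c * (τ z : ℝ) := by fun_prop
  have hcτi : Integrable (fun z => c * (τ z : ℝ)) μ := hi.const_mul c
  have h1 : ∀ x : ℝ, ∫ z, (Complex.exp (Complex.I * ((x * v z : ℝ) : ℂ)) - 1) ∂μ =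
      ∫ z, expRem (x * v z) ∂μ := by
    intro x
    have h2 : ∫ z, Complex.I * ((x * v z : ℝ) : ℂ) ∂μ = 0 := by
      rw [integral_const_mul, integral_complex_ofReal, integral_const_mul, hv0]
      simp
    have h3 : Integrable (fun z => Complex.I * ((x * v z : ℝ) : ℂ)) μ :=
      ((hvi.const_mul x).ofReal).const_mul _
    rw [← add_zero (∫ z, expRem (x * v z) ∂μ), ← h2, ← integral_add (hrem x hv hvi) h3]
    simp only [expRem, sub_add_cancel]
  simp_rw [h1]
  obtain ⟨C, hC, hmin⟩ := integral_mul_min_le hq hq2 hτ hA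
  suffices hdiff : Tendsto (fun x : ℝ => ((x ^ (-q) : ℝ) : ℂ) * ∫ z, expRem (x * v z) ∂μ -
      ((x ^ (-q) : ℝ) : ℂ) * ∫ z, expRem (x * (c * τ z)) ∂μ) (𝓝[>] 0) (𝓝 0) by
    simpa using hdiff.add (tendsto_integral_expRem hq hq2 hτ hA hc)
  rw [Metric.tendsto_nhds]
  intro η hη
  have hM0 : 0 < M := by linarith
  obtain ⟨R, hR0, hR, hR'⟩ := happ (η / (4 * M * (C + 1))) (by positivity)
  have hlim : Tendsto (fun x : ℝ => 2 * M * (x ^ (2 - q) * ∫ z, R z * τ z ∂μ)) (𝓝[>] 0) (𝓝 0) := by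
    have : ContinuousAt (fun x : ℝ => x ^ (2 - q)) 0 :=
      Real.continuousAt_rpow_const _ _ (Or.inr (by linarith))
    have h := this.tendsto.mono_left (nhdsWithin_le_nhds (s := Ioi 0))
    rw [Real.zero_rpow (by linarith)] at h
    simpa using (h.mul_const (∫ z, R z * τ z ∂μ)).const_mul (2 * M)
  filter_upwards [hmin, hlim.eventually (gt_mem_nhds (half_pos hη)), self_mem_nhdsWithin]
    with x hx1 hx2 hx
  have hx0 : 0 < x := hx
  have hmi : Integrable (fun z => x * τ z * min 1 (x * τ z)) μ := by
    refine (hi.const_mul x).mono' (Measurable.aestronglyMeasurable (by fun_prop))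
      (ae_of_all _ fun z => ?_)
    rw [Real.norm_eq_abs, abs_of_nonneg (by positivity)]
    exact mul_le_of_le_one_right (by positivity) (min_le_left _ _)
  set e := η / (4 * M * (C + 1)) with he
  have hpt : ∀ᵐ z ∂μ, ‖expRem (x * v z) - expRem (x * (c * τ z))‖ ≤
      2 * M * (e * (x * τ z * min 1 (x * τ z)) + x ^ 2 * (R z * τ z)) := by
    filter_upwards [hR', hM] with z hz hz'
    have hτ0 : (0 : ℝ) ≤ τ z := Nat.cast_nonneg _
    have hxτ : 0 ≤ x * τ z := by positivity
    have hmax : max |x * v z| |x * (c * τ z)| ≤ M * (x * τ z) := by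
      refine max_le ?_ ?_
      · rw [abs_mul, abs_of_pos hx0]
        nlinarith
      · rw [abs_mul, abs_of_pos hx0, abs_mul, Nat.abs_cast]
        nlinarith [mul_le_mul_of_nonneg_right hcM hxτ]
    have h2 : min 1 (max |x * v z| |x * (c * τ z)|) ≤ M * min 1 (x * τ z) := by
      rw [mul_min_of_nonneg _ _ hM0.le, mul_one]
      exact min_le_min hM1 hmax
    have h3 : |x * v z - x * (c * τ z)| ≤ x * (e * τ z + R z) := by
      rw [← mul_sub, abs_mul, abs_of_pos hx0]
      exact mul_le_mul_of_nonneg_left hz hx0.le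
    have hm0 : 0 ≤ min 1 (x * τ z) := le_min zero_le_one hxτ
    have h4 : |x * v z - x * (c * τ z)| * min 1 (x * τ z) ≤
        e * (x * τ z * min 1 (x * τ z)) + x ^ 2 * (R z * τ z) := by
      have hRz := hR0 z
      calc _ ≤ x * (e * τ z + R z) * min 1 (x * τ z) := mul_le_mul_of_nonneg_right h3 hm0
        _ = e * (x * τ z * min 1 (x * τ z)) + x * R z * min 1 (x * τ z) := by ring
        _ ≤ e * (x * τ z * min 1 (x * τ z)) + x * R z * (x * τ z) := by
          have := min_le_right 1 (x * τ z)
          gcongr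
        _ = _ := by ring
    calc _ ≤ 2 * min 1 (max |x * v z| |x * (c * τ z)|) * |x * v z - x * (c * τ z)| :=
          norm_expRem_sub_le _ _
      _ ≤ 2 * (M * min 1 (x * τ z)) * |x * v z - x * (c * τ z)| := by gcongr
      _ = 2 * M * (|x * v z - x * (c * τ z)| * min 1 (x * τ z)) := by ring
      _ ≤ _ := by gcongr
  have hintb : ‖∫ z, expRem (x * v z) ∂μ - ∫ z, expRem (x * (c * τ z)) ∂μ‖ ≤
      2 * M * (e * (C * x ^ q) + x ^ 2 * ∫ z, R z * τ z ∂μ) := by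
    rw [← integral_sub (hrem x hv hvi) (hrem x hcτ hcτi)]
    refine (norm_integral_le_of_norm_le (g := fun z => 2 * M * (e * (x * τ z *
      min 1 (x * τ z)) + x ^ 2 * (R z * τ z)))
      (((hmi.const_mul e).add (hR.const_mul (x ^ 2))).const_mul (2 * M)) hpt).trans ?_
    rw [integral_const_mul, integral_add (hmi.const_mul e) (hR.const_mul (x ^ 2)),
      integral_const_mul, integral_const_mul]
    gcongr
  rw [dist_zero_right, ← mul_sub, norm_mul, Complex.norm_real, Real.norm_eq_abs,
    abs_of_pos (Real.rpow_pos_of_pos hx0 _)]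
  have hxq : x ^ (-q) * x ^ q = 1 := by rw [← Real.rpow_add hx0]; simp
  have hxq2 : x ^ (-q) * x ^ 2 = x ^ (2 - q) := by
    rw [← Real.rpow_natCast x 2, ← Real.rpow_add hx0]; congr 1; push_cast; ring
  have heC : 2 * M * (e * C) ≤ η / 2 := by
    rw [he]
    rw [show 2 * M * (η / (4 * M * (C + 1)) * C) = η / 2 * (C / (C + 1)) by field_simp; ring]
    exact mul_le_of_le_one_right (by positivity) (div_le_one_of_le₀ (by linarith) (by linarith))
  calc _ ≤ x ^ (-q) * (2 * M * (e * (C * x ^ q) + x ^ 2 * ∫ z, R z * τ z ∂μ)) := by gcongr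
    _ = 2 * M * (e * C) * (x ^ (-q) * x ^ q) +
        2 * M * ((x ^ (-q) * x ^ 2) * ∫ z, R z * τ z ∂μ) := by ring
    _ < η := by rw [hxq, hxq2]; linarith

end Compare
end LSV

namespace LSV

section Kac

variable {X : Type*} [MeasurableSpace X] {ν : Measure X} [IsFiniteMeasure ν] {T : X → X} {D : Set X}

/-- **Kac's formula**: a finite invariant measure is recovered from the excursions off `D`. -/
theorem kac (hT : MeasurePreserving T ν ν) (hD : MeasurableSet D)
    (hret : ∀ᵐ z ∂ν, ∃ n, T^[n] z ∈ D) {B : Set X} (hB : MeasurableSet B) :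
    ν B = ∑' k, ν (D ∩ {z | ∀ j < k, T^[j + 1] z ∉ D} ∩ T^[k] ⁻¹' B) := by
  have hTn : ∀ n, Measurable T^[n] := fun n => hT.measurable.iterate n
  set W : ℕ → Set X := fun n => {z | ∀ k ≤ n, T^[k] z ∉ D} with hW
  have hWm : ∀ n, MeasurableSet (W n) := fun n => by
    have : W n = ⋂ k ∈ Iic n, T^[k] ⁻¹' Dᶜ := by ext; simp [hW]
    rw [this]
    exact MeasurableSet.biInter (to_countable _) fun k _ => hTn k hD.compl
  have hsplit : ∀ n, ν B = ∑ k ∈ Finset.range (n + 1),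
      ν (D ∩ {z | ∀ j < k, T^[j + 1] z ∉ D} ∩ T^[k] ⁻¹' B) + ν (W n ∩ T^[n] ⁻¹' B) := by
    intro n
    induction n with
    | zero =>
      rw [← measure_inter_add_sdiff B hD]
      simp [hW, inter_comm, sdiff_eq, compl_def]
    | succ n ih =>
      rw [ih, Finset.sum_range_succ _ (n + 1), add_assoc]
      congr 1
      rw [← hT.measure_preimage ((hWm n).inter (hTn n hB)).nullMeasurableSet,
        ← measure_inter_add_sdiff _ hD]
      congr 2
      · ext z
        simp only [hW, mem_inter_iff, mem_preimage, mem_ofPred_eq, Function.iterate_succ_apply,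
          Nat.lt_succ_iff]
        tauto
      · ext z
        simp only [hW, mem_inter_iff, mem_preimage, mem_ofPred_eq, Set.mem_sdiff]
        constructor
        · rintro ⟨⟨h1, h2⟩, h3⟩
          refine ⟨fun k hk => ?_, by rwa [Function.iterate_succ_apply]⟩
          cases k with
          | zero => exact h3
          | succ k => rw [Function.iterate_succ_apply]; exact h1 k (by omega)
        · rintro ⟨h1, h2⟩
          refine ⟨⟨fun k hk => ?_, by rwa [Function.iterate_succ_apply] at h2⟩, h1 0 (by omega)⟩
          have := h1 (k + 1) (by omega)
          rwa [Function.iterate_succ_apply] at this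
  have hlim : Tendsto (fun n => ν (W n ∩ T^[n] ⁻¹' B)) atTop (𝓝 0) := by
    have hnull : ν (⋂ n, W n) = 0 := by
      refine measure_mono_null (fun z hz => ?_) hret
      rintro ⟨n, hn⟩
      exact mem_iInter.1 hz n n le_rfl hn
    have := tendsto_measure_iInter_atTop (μ := ν) (s := W) (fun n => (hWm n).nullMeasurableSet)
      (fun m n hmn z hz k hk => hz k (hk.trans hmn)) ⟨0, measure_ne_top _ _⟩
    rw [hnull] at this
    exact tendsto_of_tendsto_of_tendsto_of_le_of_le tendsto_const_nhds this (fun _ => bot_le)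
      fun n => measure_mono inter_subset_left
  have h := ((ENNReal.tendsto_nat_tsum
    fun k => ν (D ∩ {z | ∀ j < k, T^[j + 1] z ∉ D} ∩ T^[k] ⁻¹' B)).comp
        (tendsto_add_atTop_nat 1)).add hlim
  rw [add_zero] at h
  exact tendsto_nhds_unique ((tendsto_const_nhds (x := ν B)).congr hsplit) h

open Classical in
/-- The first-return map preserves the restriction of an invariant measure. -/
theorem measure_first_return (hT : MeasurePreserving T ν ν) (hD : MeasurableSet D) {F : X → X}
    (hF : Measurable F)
    (hFT : ∀ᵐ z ∂ν, F z = if T z ∈ D then T z else F (T z))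
    {B : Set X} (hB : MeasurableSet B) : ν (D ∩ F ⁻¹' B) = ν (D ∩ B) := by
  have h1 : ν (F ⁻¹' B) = ν (T ⁻¹' (D ∩ B)) + ν (T ⁻¹' (F ⁻¹' B \ D)) := by
    rw [← measure_union (by
      refine Disjoint.preimage _ (disjoint_left.2 fun z hz hz' => hz'.2 hz.1))
      (hT.measurable ((hF hB).diff hD))]
    refine measure_congr ?_
    filter_upwards [hFT] with z hz
    refine propext ?_
    change F z ∈ B ↔ (T z ∈ D ∧ T z ∈ B) ∨ (F (T z) ∈ B ∧ T z ∉ D)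
    rw [hz]
    split_ifs with h <;> simp [h]
  rw [hT.measure_preimage (hD.inter hB).nullMeasurableSet,
    hT.measure_preimage ((hF hB).diff hD).nullMeasurableSet, ← measure_inter_add_sdiff (F ⁻¹' B) hD]
    at h1
  rw [inter_comm]
  exact (ENNReal.add_left_inj (measure_ne_top _ _)).1 h1

end Kac

end LSV

namespace LSV.Par

/-- An absolutely continuous invariant probability measure with density `h`, Lipschitz over the
inducing domain. -/
structure Inv (P : Par) (ν : Measure (ℝ × ℝ)) (h : ℝ × ℝ → ℝ) : Prop where
  prob : IsProbabilityMeasure ν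
  null : ν Qᶜ = 0
  inv : MeasurePreserving P.T ν ν
  den : ν = volume.withDensity fun z => ENNReal.ofReal (h z)
  lip : ∃ K : NNReal, LipschitzOnWith K h (Icc (1 / 2 : ℝ) 1 ×ˢ Icc (0 : ℝ) 1)

variable {P : Par} {ν : Measure (ℝ × ℝ)} {h : ℝ × ℝ → ℝ}

lemma D_subset_Icc : D ⊆ Icc (1 / 2 : ℝ) 1 ×ˢ Icc (0 : ℝ) 1 :=
  prod_mono Ioc_subset_Icc_self Ico_subset_Icc_self

variable (P) in
lemma τ_eq_τ_T {z : ℝ × ℝ} (hz : z ∈ Q) (hT : P.T z ∉ D) : P.τ z = P.τ (P.T z) + 1 := by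
  obtain ⟨h1, h2⟩ := P.τ_spec (P.T_mem hz)
  refine P.τ_eq (by omega) (by rwa [Function.iterate_succ_apply]) fun m hm hmn => ?_
  obtain ⟨m, rfl⟩ := Nat.exists_eq_add_of_lt hm
  rw [zero_add, Function.iterate_succ_apply]
  rcases Nat.eq_zero_or_pos m with rfl | h
  · exact hT
  · exact P.notMem_of_lt_τ h (by omega)

variable (P) in
open Classical in
lemma F_eq {z : ℝ × ℝ} (hz : z ∈ Q) : P.F z = if P.T z ∈ D then P.T z else P.F (P.T z) := by
  split_ifs with hT
  · rw [F, P.τ_eq (n := 1) one_pos (by simpa using hT) (fun m hm hm' => by omega)]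
    simp
  · rw [F, P.τ_eq_τ_T hz hT, Function.iterate_succ_apply]
    rfl

namespace Inv

variable (I : P.Inv ν h)
include I

lemma ae_Q : ∀ᵐ z ∂ν, z ∈ Q := by
  rw [ae_iff]; exact I.null

lemma measure_F {B : Set (ℝ × ℝ)} (hB : MeasurableSet B) : ν (D ∩ P.F ⁻¹' B) = ν (D ∩ B) := by
  have := I.prob
  classical
  exact measure_first_return I.inv measurableSet_D P.measurable_F
    (I.ae_Q.mono fun z hz => P.F_eq hz) hB

lemma kac_τ {B : Set (ℝ × ℝ)} (hB : MeasurableSet B) :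
    ν B = ∑' k, ν (D ∩ {z | k < P.τ z} ∩ P.T^[k] ⁻¹' B) := by
  have := I.prob
  rw [kac I.inv measurableSet_D (I.ae_Q.mono fun z hz => P.exists_mem hz) hB]
  congr! 4 with k
  ext z
  simp only [mem_inter_iff, and_congr_right_iff]
  intro hz
  change (∀ j < k, P.T^[j + 1] z ∉ D) ↔ k < P.τ z
  rw [P.lt_τ_iff (D_subset_Q hz)]
  constructor
  · intro h m hm hmk
    obtain ⟨j, rfl⟩ := Nat.exists_eq_add_of_lt hm
    simpa using h (0 + j) (by omega)
  · exact fun h j hj => h _ (by omega) (by omega)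

lemma measure_D_ne_zero : ν D ≠ 0 := by
  have := I.prob
  intro h0
  have h1 := I.kac_τ MeasurableSet.univ
  rw [measure_univ] at h1
  have h2 : ∀ k, ν (D ∩ {z | k < P.τ z} ∩ P.T^[k] ⁻¹' univ) = 0 := fun k =>
    measure_mono_null (fun z hz => hz.1.1) h0
  rw [ENNReal.tsum_eq_zero.2 h2] at h1
  exact one_ne_zero h1

lemma real_D_pos : 0 < ν.real D := by
  have := I.prob
  exact ENNReal.toReal_pos I.measure_D_ne_zero (measure_ne_top _ _)

omit I in
/-- The density of the normalised restriction with respect to the reference measure. -/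
def hd (ν : Measure (ℝ × ℝ)) (h : ℝ × ℝ → ℝ) (z : ℝ × ℝ) : ℝ := max (h z) 0 / (2 * ν.real D)

omit I in
lemma hd_nonneg (z : ℝ × ℝ) : 0 ≤ hd ν h z := by unfold hd; positivity

lemma exists_lip_max : ∃ K : NNReal,
    LipschitzOnWith K (fun z => max (h z) 0) (Icc (1 / 2 : ℝ) 1 ×ˢ Icc (0 : ℝ) 1) := by
  obtain ⟨K, hK⟩ := I.lip
  refine ⟨K, LipschitzOnWith.of_dist_le_mul fun z hz z' hz' => ?_⟩
  refine le_trans ?_ (hK.dist_le_mul z hz z' hz')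
  rw [Real.dist_eq, Real.dist_eq]
  exact abs_max_sub_max_le_abs _ _ _

lemma exists_bound : ∃ B : ℝ, 0 ≤ B ∧ ∀ z ∈ D, |max (h z) 0| ≤ B := by
  obtain ⟨K, hK⟩ := I.exists_lip_max
  have h1 : ((1 : ℝ), (0 : ℝ)) ∈ D := ⟨by norm_num, by norm_num⟩
  refine ⟨|max (h (1, 0)) 0| + K, by positivity, fun z hz => ?_⟩
  have h2 := hK.dist_le_mul z (D_subset_Icc hz) _ (D_subset_Icc h1)
  rw [Real.dist_eq] at h2
  have h3 := dist_le_one (D_subset_Q hz) (D_subset_Q h1)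
  have h4 : (K : ℝ) * dist z (1, 0) ≤ K := mul_le_of_le_one_right K.2 h3
  linarith [abs_sub_abs_le_abs_sub (max (h z) 0) (max (h (1, 0)) 0)]

lemma exists_reg {t : ℝ} (ht : 0 < t) (ht1 : t ≤ 1) : ∃ K₀, (P.sys t ht ht1).Reg K₀ (hd ν h) := by
  obtain ⟨K, hK⟩ := I.exists_lip_max
  obtain ⟨B, hB0, hB⟩ := I.exists_bound
  have hb := I.real_D_pos
  have hd0 : 0 < 2 * ν.real D := by positivity
  refine ⟨(B + K) / (2 * ν.real D), fun z hz => ?_, fun z hz z' hz' => ?_⟩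
  · rw [hd, Real.norm_eq_abs, abs_div, abs_of_pos hd0]
    gcongr
    exact (hB z hz).trans (le_add_of_nonneg_right K.2)
  · have hdd := dist_le_one (D_subset_Q hz) (D_subset_Q hz')
    have h1 := hK.dist_le_mul z (D_subset_Icc hz) _ (D_subset_Icc hz')
    have h2 : dist z z' ≤ dist z z' ^ t := by
      simpa using Real.rpow_le_rpow_of_exponent_ge' dist_nonneg hdd ht.le ht1
    rw [hd, hd, ← sub_div, Real.norm_eq_abs, abs_div, abs_of_pos hd0, div_mul_eq_mul_div]
    gcongr
    rw [Real.dist_eq] at h1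
    calc _ ≤ K * dist z z' := h1
      _ ≤ (B + K) * dist z z' ^ t := by gcongr; linarith

lemma aesm_hd : AEStronglyMeasurable (hd ν h) ((2 : ENNReal) • (volume : Measure (ℝ × ℝ)).restrict
    D) := by
  obtain ⟨K₀, hK⟩ := I.exists_reg one_pos le_rfl
  exact (P.sys 1 one_pos le_rfl).aestronglyMeasurable_of_lip hK.2

lemma restrict_eq : ν.restrict D = ((2 : ENNReal) • (volume : Measure (ℝ × ℝ)).restrict
    D).withDensity
    fun z => ENNReal.ofReal (ν.real D * hd ν h z) := by
  have hb := I.real_D_pos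
  conv_lhs => rw [I.den]
  rw [restrict_withDensity measurableSet_D]
  have hm : AEMeasurable (fun z => ENNReal.ofReal (ν.real D * hd ν h z))
      ((volume : Measure (ℝ × ℝ)).restrict D) := by
    have := I.aesm_hd.aemeasurable
    rw [aemeasurable_smul_measure_iff two_ne_zero] at this
    exact (this.const_mul _).ennreal_ofReal
  rw [withDensity_smul_measure, ← withDensity_smul' _ _ (by norm_num)]
  congr 1
  ext z
  rw [Pi.smul_apply, smul_eq_mul, show (2 : ENNReal) = ENNReal.ofReal 2 by norm_num,
    ← ENNReal.ofReal_mul two_pos.le, hd]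
  rw [show 2 * (ν.real D * (max (h z) 0 / (2 * ν.real D))) = max (h z) 0 by field_simp]
  rcases le_total 0 (h z) with h0 | h0
  · rw [max_eq_left h0]
  · rw [max_eq_right h0, ENNReal.ofReal_of_nonpos h0, ENNReal.ofReal_zero]

lemma integral_D {t : ℝ} (ht : 0 < t) (ht1 : t ≤ 1) (g : ℝ × ℝ → ℂ) :
    ∫ z in D, g z ∂ν = ν.real D * ∫ z, (hd ν h z : ℂ) * g z ∂(P.sys t ht ht1).m := by
  rw [I.restrict_eq, integral_withDensity_eq_integral_toReal_smul₀
    (I.aesm_hd.aemeasurable.const_mul _).ennreal_ofReal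
        (ae_of_all _ fun _ => ENNReal.ofReal_lt_top),
    ← integral_const_mul]
  refine integral_congr_ae (ae_of_all _ fun z => ?_)
  have h0 : 0 ≤ ν.real D * hd ν h z := mul_nonneg measureReal_nonneg (hd_nonneg z)
  simp only [ENNReal.toReal_ofReal h0, Complex.real_smul]
  push_cast; ring

lemma integral_hd_indicator {t : ℝ} (ht : 0 < t) (ht1 : t ≤ 1) {B : Set (ℝ × ℝ)}
    (hB : MeasurableSet B) :
    ∫ z in B, hd ν h z ∂(P.sys t ht ht1).m = ν.real (D ∩ B) / ν.real D := by
  have hb := I.real_D_pos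
  have h1 := I.integral_D ht ht1 (B.indicator fun _ => 1)
  rw [integral_indicator hB, Measure.restrict_restrict hB, inter_comm B D] at h1
  have h2 : ∀ z, (hd ν h z : ℂ) * B.indicator (fun _ => (1 : ℂ)) z =
      ((B.indicator (hd ν h) z : ℝ) : ℂ) := by
    intro z
    by_cases hz : z ∈ B <;> simp [hz]
  simp only [h2] at h1
  rw [integral_complex_ofReal, integral_indicator hB] at h1
  simp only [integral_const, measureReal_restrict_apply MeasurableSet.univ, univ_inter,
    Complex.real_smul, mul_one] at h1
  rw [eq_div_iff hb.ne', mul_comm]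
  exact_mod_cast h1.symm

end Inv
end LSV.Par

namespace FullBranch

variable {X ι : Type*} [MeasurableSpace X] {S : FullBranch X ι}

/-- If the measure with density `h` is invariant then `h` is a fixed point of the transfer
operator, almost everywhere. -/
lemma L_ae_eq [Countable ι] {h : X → ℝ} {K₀ : ℝ} (hh : S.Reg K₀ h)
    (hinv : ∀ B, MeasurableSet B → ∫ x in S.F ⁻¹' B, h x ∂S.m = ∫ x in B, h x ∂S.m) :
    S.L h =ᵐ[S.m] h := by
  have hi : ∀ {K : ℝ} {u : X → ℝ}, S.Reg K u → Integrable u S.m := fun {K u} hu => by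
    simpa using hu.ofReal.integrable.re
  have hL := S.L_reg hh.branchwise (S.summable_const _)
  refine (hi hL).ae_eq_of_forall_setIntegral_eq _ _ (hi hh) fun B hB _ => ?_
  rw [← hinv B hB, ← integral_indicator hB, ← integral_indicator (S.meas_F hB)]
  have := S.integral_L_mul hh.branchwise (S.summable_const _) (hi hh).1
    (w := B.indicator fun _ => (1 : ℝ)) (measurable_const.indicator hB) (B := 1)
    (fun x => by by_cases hx : x ∈ B <;> simp [hx])
  refine Eq.trans (integral_congr_ae (ae_of_all _ fun x => ?_))
    (this.trans (integral_congr_ae (ae_of_all _ fun x => ?_)))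
  · by_cases hx : x ∈ B <;> simp [hx]
  · by_cases hx : S.F x ∈ B <;> simp [hx]

end FullBranch

namespace LSV.Par

variable {P : Par} {ν : Measure (ℝ × ℝ)} {h : ℝ × ℝ → ℝ}

lemma D_subset_closure : D ⊆ closure (interior D) := by
  rw [D, interior_prod_eq, closure_prod_eq, interior_Ioc, interior_Ico,
    closure_Ioo (by norm_num), closure_Ioo (by norm_num)]
  exact D_subset_Icc

lemma continuousOn_of_reg {t : ℝ} (ht : 0 < t) (ht1 : t ≤ 1) {K : ℝ} {u : ℝ × ℝ → ℝ}
    (hu : (P.sys t ht ht1).Reg K u) : ContinuousOn u D := by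
  intro z hz
  refine tendsto_iff_dist_tendsto_zero.2 ?_
  have h1 : Tendsto (fun z' : ℝ × ℝ => K * dist z' z ^ t) (𝓝[D] z) (𝓝 0) := by
    have : Continuous fun z' : ℝ × ℝ => K * dist z' z ^ t :=
      continuous_const.mul ((continuous_id.dist continuous_const).rpow_const fun _ => Or.inr ht.le)
    have h2 := this.continuousWithinAt (s := D) (x := z)
    have h3 : K * dist z z ^ t = 0 := by simp [Real.zero_rpow ht.ne']
    rwa [ContinuousWithinAt, h3] at h2
  refine squeeze_zero' (Eventually.of_forall fun _ => dist_nonneg) ?_ h1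
  filter_upwards [self_mem_nhdsWithin] with z' hz'
  exact hu.2 z' hz' z hz

namespace Inv

variable (I : P.Inv ν h)
include I

lemma density {t : ℝ} (ht : 0 < t) (ht1 : t ≤ 1) :
    ∃ K₀, (P.sys t ht ht1).Density (hd ν h) K₀ := by
  obtain ⟨K₀, hK⟩ := I.exists_reg ht ht1
  have hb := I.real_D_pos
  refine ⟨K₀, hK, ?_, ?_⟩
  · have := I.integral_hd_indicator ht ht1 MeasurableSet.univ
    rwa [Measure.restrict_univ, inter_univ, div_self hb.ne'] at this
  · have h1 := FullBranch.L_ae_eq hK fun B hB => by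
      change ∫ x in P.F ⁻¹' B, _ ∂_ = _
      rw [I.integral_hd_indicator ht ht1 hB, I.integral_hd_indicator ht ht1 (P.measurable_F hB),
        Measure.real, I.measure_F hB, ← Measure.real]
    have h2 : (P.sys t ht ht1).L (hd ν h) =ᵐ[volume.restrict D] hd ν h := by
      have h3 : (volume : Measure (ℝ × ℝ)).restrict D ≪
          (2 : ENNReal) • (volume : Measure (ℝ × ℝ)).restrict D :=
        Measure.absolutelyContinuous_smul two_ne_zero
      exact h3.ae_le h1
    have hL := (P.sys t ht ht1).L_reg hK.branchwise ((P.sys t ht ht1).summable_const _)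
    exact Measure.eqOn_of_ae_eq h2 (continuousOn_of_reg ht ht1 hL) (continuousOn_of_reg ht ht1 hK)
      D_subset_closure

lemma h_pos {z : ℝ × ℝ} (hz : z ∈ D) : 0 < h z := by
  obtain ⟨K₀, hK⟩ := I.density one_pos le_rfl
  have h1 := (Real.exp_pos _).trans_le (hK.lower_bound hz)
  by_contra hc
  rw [hd, max_eq_right (not_lt.1 hc), zero_div] at h1
  exact h1.false

lemma h_half_nonneg {ω : ℝ} (hω : ω ∈ Ico (0 : ℝ) 1) : 0 ≤ h (1 / 2, ω) := by
  obtain ⟨K, hK⟩ := I.lip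
  have h1 : ContinuousOn h (Icc (1 / 2 : ℝ) 1 ×ˢ Icc (0 : ℝ) 1) := hK.continuousOn
  have h2 : (1 / 2, ω) ∈ Icc (1 / 2 : ℝ) 1 ×ˢ Icc (0 : ℝ) 1 :=
    ⟨by norm_num, Ico_subset_Icc_self hω⟩
  have h3 : (1 / 2, ω) ∈ closure D := by
    rw [D, closure_prod_eq, closure_Ioc (by norm_num), closure_Ico (by norm_num)]
    exact h2
  have h4 := (h1 _ h2).mono D_subset_Icc
  have : (𝓝[D] ((1 : ℝ) / 2, ω)).NeBot := mem_closure_iff_nhdsWithin_neBot.1 h3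
  exact ge_of_tendsto h4 (eventually_nhdsWithin_of_forall fun z hz => (I.h_pos hz).le)

end Inv
end LSV.Par

namespace LSV.Par

variable {P : Par} {ν : Measure (ℝ × ℝ)} {h : ℝ × ℝ → ℝ}

variable (P) in
lemma measurableSet_lt_τ (n : ℕ) : MeasurableSet {z | n < P.τ z} :=
  measurableSet_lt measurable_const P.measurable_τ

variable (P) in
lemma integrable_τ_volume : IntegrableOn (fun z => (P.τ z : ℝ)) D volume := by
  have hfin : IsFiniteMeasure ((volume : Measure (ℝ × ℝ)).restrict D) :=
    ⟨by rw [Measure.restrict_apply_univ, volume_D]; norm_num⟩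
  have h1 := P.tail_asymptotics (H := fun _ => 1) (K := 0) (LipschitzWith.const 1).lipschitzOnWith
  refine integrable_of_tail (q := P.q) P.one_lt_q P.measurable_τ (h1.congr fun n => ?_)
  rw [measureReal_restrict_apply (P.measurableSet_lt_τ n), inter_comm]
  simp

variable (P) in
lemma summable_length {t : ℝ} (ht : 0 < t) (ht1 : t ≤ 1) (C : ℝ) :
    Summable fun i => (P.sys t ht ht1).j i * (C * (i.2.length + 1)) := by
  suffices hs : Summable fun i : Bool × List Bool => (P.sys t ht ht1).j i * (i.2.length + 1) by
    refine (hs.mul_left C).congr fun i => ?_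
    ring
  have h1 := P.lintegral_D (g := fun z => (P.τ z : ENNReal))
      (measurable_from_nat.comp P.measurable_τ)
  have h2 : ∫⁻ z in D, (P.τ z : ENNReal) ≠ ⊤ := by
    have := P.integrable_τ_volume.2
    rw [hasFiniteIntegral_iff_ofReal (ae_of_all _ fun z => Nat.cast_nonneg _)] at this
    simpa using this.ne
  rw [h1] at h2
  refine ((ENNReal.summable_toReal h2).mul_left 2).congr fun i => ?_
  have h3 : ∫⁻ z in D, ENNReal.ofReal (P.J i z) * (P.τ (P.ψ i z) : ENNReal) =
      (∫⁻ z in D, ENNReal.ofReal (P.J i z)) * ((i.2.length + 1 : ℕ) : ENNReal) := by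
    rw [← lintegral_mul_const _ (P.measurable_J i).ennreal_ofReal]
    exact setLIntegral_congr_fun measurableSet_D fun z hz => by rw [P.τ_ψ i hz]
  change 2 * (∫⁻ z in D, ENNReal.ofReal (P.J i z) * (P.τ (P.ψ i z) : ENNReal)).toReal =
    (∫ z, P.J i z ∂((2 : ENNReal) • (volume : Measure (ℝ × ℝ)).restrict D)) * _
  rw [h3, ENNReal.toReal_mul, integral_smul_measure, integral_eq_lintegral_of_nonneg_ae
    (ae_of_all _ fun z => (P.J_pos i z).le) (P.measurable_J i).aestronglyMeasurable]
  rw [ENNReal.toReal_natCast, ENNReal.toReal_ofNat, smul_eq_mul]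
  push_cast
  ring

namespace Inv

variable (I : P.Inv ν h)
include I

lemma real_inter_D {S : Set (ℝ × ℝ)} (hS : MeasurableSet S) :
    ν.real (D ∩ S) = ∫ z in D ∩ S, max (h z) 0 := by
  have hb := I.real_D_pos
  have h1 := I.integral_hd_indicator one_pos le_rfl hS
  change ∫ z in S, hd ν h z ∂((2 : ENNReal) • (volume : Measure (ℝ × ℝ)).restrict D) = _ at h1
  rw [Measure.restrict_smul, Measure.restrict_restrict hS, integral_smul_measure, inter_comm S D,
    eq_div_iff hb.ne'] at h1
  rw [← h1]
  simp only [hd, integral_div]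
  simp
  field_simp

theorem tail : Tendsto (fun n : ℕ => (n : ℝ) ^ P.q * (ν.restrict D).real {z | n < P.τ z}) atTop
    (𝓝 (Aconst P.α P.p h)) := by
  obtain ⟨K, hK⟩ := I.exists_lip_max
  have h1 := P.tail_asymptotics hK
  have h2 : P.κ / 2 * ∫ ω in Icc (0 : ℝ) 1, max (h (1 / 2, ω)) 0 = Aconst P.α P.p h := by
    rw [Aconst, κ, q]
    congr 1
    · ring
    rw [integral_Icc_eq_integral_Ico, integral_Icc_eq_integral_Ico]
    exact setIntegral_congr_fun measurableSet_Ico fun ω hω => max_eq_left (I.h_half_nonneg hω)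
  rw [h2] at h1
  refine h1.congr fun n => ?_
  rw [measureReal_restrict_apply (P.measurableSet_lt_τ n), inter_comm _ D, I.real_inter_D
    (P.measurableSet_lt_τ n)]

lemma integrable_τ : IntegrableOn (fun z => (P.τ z : ℝ)) D ν := by
  have := I.prob
  exact integrable_of_tail (q := P.q) P.one_lt_q P.measurable_τ I.tail

lemma integral_τ : ∫ z in D, (P.τ z : ℝ) ∂ν = 1 := by
  have := I.prob
  have h1 : ∫⁻ z in D, (P.τ z : ENNReal) ∂ν = 1 := by
    rw [lintegral_nat P.measurable_τ, ← measure_univ (μ := ν), I.kac_τ MeasurableSet.univ]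
    refine tsum_congr fun n => ?_
    rw [Measure.restrict_apply (P.measurableSet_lt_τ n), preimage_univ, inter_univ, inter_comm]
  rw [integral_eq_lintegral_of_nonneg_ae (ae_of_all _ fun z => Nat.cast_nonneg _)
    I.integrable_τ.1]
  simp [h1]

lemma kac_measure : ν = Measure.sum fun k => (ν.restrict (D ∩ {z | k < P.τ z})).map P.T^[k] := by
  ext B hB
  rw [Measure.sum_apply _ hB, I.kac_τ hB]
  refine tsum_congr fun k => ?_
  rw [Measure.map_apply (P.measurable_iter k) hB,
    Measure.restrict_apply (P.measurable_iter k hB), inter_comm]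

lemma kac_integral {Φ : ℝ × ℝ → ℂ} (hΦ : Integrable Φ ν) :
    HasSum (fun k => ∫ z in D ∩ {z | k < P.τ z}, Φ (P.T^[k] z) ∂ν) (∫ z, Φ z ∂ν) := by
  have h1 := hΦ
  rw [I.kac_measure] at h1
  have h2 := hasSum_integral_measure h1
  rw [← I.kac_measure] at h2
  have h3 : ∀ k, ∫ z in D ∩ {z | k < P.τ z}, Φ (P.T^[k] z) ∂ν =
      ∫ z, Φ z ∂(ν.restrict (D ∩ {z | k < P.τ z})).map P.T^[k] := fun k => by
    rw [integral_map (P.measurable_iter k).aemeasurable]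
    refine hΦ.1.mono_measure ?_
    conv_rhs => rw [I.kac_measure]
    exact Measure.le_sum _ k
  simpa only [h3] using h2

lemma summable_tail : Summable fun k : ℕ => ν.real (D ∩ {z | k < P.τ z}) := by
  have := I.prob
  have h1 := I.kac_τ MeasurableSet.univ
  rw [measure_univ] at h1
  simp only [preimage_univ, inter_univ] at h1
  exact ENNReal.summable_toReal (h1 ▸ ENNReal.one_ne_top)

lemma hasSum_excursion {G : ℕ → ℝ × ℝ → ℂ} (hG : ∀ k, Measurable (G k)) {C : ℝ}
    (hC : ∀ k, ∀ z ∈ Q, ‖G k z‖ ≤ C) :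
    HasSum (fun k => ∫ z in D ∩ {z | k < P.τ z}, G k z ∂ν)
      (∫ z in D, ∑ k ∈ Finset.range (P.τ z), G k z ∂ν) := by
  have := I.prob
  have hm : ∀ k, MeasurableSet (D ∩ {z | k < P.τ z}) := fun k =>
    measurableSet_D.inter (P.measurableSet_lt_τ k)
  set H : ℕ → ℝ × ℝ → ℂ := fun k => (D ∩ {z | k < P.τ z}).indicator (G k) with hH
  have hb : ∀ k, ∀ z, ‖H k z‖ ≤ (D ∩ {z | k < P.τ z}).indicator (fun _ => C) z := fun k z => by
    by_cases hz : z ∈ D ∩ {z | k < P.τ z}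
    · simpa [hH, hz] using hC k z (D_subset_Q hz.1)
    · simp [hH, hz]
  have hi : ∀ k, Integrable ((D ∩ {z | k < P.τ z}).indicator fun _ => C) ν := fun k =>
    (integrable_const C).indicator (hm k)
  have hHi : ∀ k, Integrable (H k) ν := fun k =>
    (hi k).mono' ((hG k).indicator (hm k)).aestronglyMeasurable (ae_of_all _ (hb k))
  have hs : Summable fun k => ∫ z, ‖H k z‖ ∂ν := by
    refine Summable.of_nonneg_of_le (fun k => integral_nonneg fun _ => norm_nonneg _) (fun k => ?_)
      (I.summable_tail.mul_right C)
    refine (integral_mono (hHi k).norm (hi k) (hb k)).trans_eq ?_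
    rw [integral_indicator (hm k)]
    simp
  have h1 := hasSum_integral_of_summable_integral_norm hHi hs
  have h2 : ∫ z, ∑' k, H k z ∂ν = ∫ z in D, ∑ k ∈ Finset.range (P.τ z), G k z ∂ν := by
    rw [← integral_indicator measurableSet_D]
    refine integral_congr_ae (ae_of_all _ fun z => ?_)
    beta_reduce
    rw [tsum_eq_sum (s := Finset.range (P.τ z)) fun k hk => by
      simp only [hH]
      rw [indicator_of_notMem]
      exact fun h => hk (Finset.mem_range.2 h.2)]
    by_cases hz : z ∈ D
    · rw [indicator_of_mem hz]
      refine Finset.sum_congr rfl fun k hk => ?_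
      exact indicator_of_mem (show z ∈ D ∩ {z | k < P.τ z} from ⟨hz, Finset.mem_range.1 hk⟩) _
    · rw [indicator_of_notMem hz]
      refine Finset.sum_eq_zero fun k hk => ?_
      exact indicator_of_notMem (fun h => hz h.1) _
  rw [h2] at h1
  simpa only [hH, integral_indicator (hm _)] using h1

lemma integral_exc {g : ℝ × ℝ → ℝ} (hg : Measurable g) {C : ℝ} (hC : ∀ z ∈ Q, |g z| ≤ C) :
    ∫ z in D, P.exc g z ∂ν = ∫ z, g z ∂ν := by
  have := I.prob
  have hgi : Integrable (fun z => (g z : ℂ)) ν := by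
    refine Integrable.of_bound (Complex.measurable_ofReal.comp hg).aestronglyMeasurable C ?_
    filter_upwards [I.ae_Q] with z hz
    simpa using hC z hz
  have h1 := I.kac_integral hgi
  have h2 := I.hasSum_excursion (G := fun k z => (g (P.T^[k] z) : ℂ))
    (fun k => Complex.measurable_ofReal.comp (hg.comp (P.measurable_iter k))) (C := C)
    (fun k z hz => by simpa using hC _ (P.iter_mem k hz))
  have h3 := h2.unique h1
  rw [integral_complex_ofReal] at h3
  have h4 : ∀ z, ∑ k ∈ Finset.range (P.τ z), (g (P.T^[k] z) : ℂ) = ((P.exc g z : ℝ) : ℂ) := fun z =>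
    by simp [exc]
  simp only [h4] at h3
  rw [integral_complex_ofReal] at h3
  exact_mod_cast h3

end Inv
end LSV.Par

namespace LSV.Par

/-- A bounded Hölder observable with mean `c` over the neutral fibre. -/
structure Obs (f : ℝ × ℝ → ℝ) (C t c : ℝ) : Prop where
  meas : Measurable f
  t_pos : 0 < t
  t_le_one : t ≤ 1
  bound : ∀ z ∈ Icc (0 : ℝ) 1 ×ˢ Icc (0 : ℝ) 1, |f z| ≤ C
  holder : ∀ z ∈ Icc (0 : ℝ) 1 ×ˢ Icc (0 : ℝ) 1, ∀ z' ∈ Icc (0 : ℝ) 1 ×ˢ Icc (0 : ℝ) 1,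
    |f z - f z'| ≤ C * dist z z' ^ t
  mean : ∫ ω in Ico (0 : ℝ) 1, f (0, ω) = c

lemma Q_subset_Icc : Q ⊆ Icc (0 : ℝ) 1 ×ˢ Icc (0 : ℝ) 1 :=
  prod_mono Ioc_subset_Icc_self Ico_subset_Icc_self

variable {P : Par} {ν : Measure (ℝ × ℝ)} {h : ℝ × ℝ → ℝ} {f : ℝ × ℝ → ℝ} {C t c : ℝ}

variable (P) in
lemma iter_snd (k : ℕ) (z : ℝ × ℝ) : (P.T^[k] z).2 = P.φ^[k] z.2 := by
  induction k generalizing z with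
  | zero => rfl
  | succ k ih => rw [Function.iterate_succ_apply, ih, Function.iterate_succ_apply]; rfl

lemma sum_ite_sub_lt (n M : ℕ) {A : ℝ} (hA : 0 ≤ A) :
    ∑ k ∈ Finset.range n, (if n - k < M then A else 0) ≤ A * M := by
  rw [← Finset.sum_filter, Finset.sum_const, nsmul_eq_mul, mul_comm]
  gcongr
  calc ((Finset.range n).filter fun k => n - k < M).card
      ≤ ((Finset.range M).image fun i => n - i).card := by
        refine Finset.card_le_card fun k hk => ?_
        simp only [Finset.mem_filter, Finset.mem_range, Finset.mem_image] at hk ⊢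
        exact ⟨n - k, hk.2, by omega⟩
    _ ≤ M := Finset.card_image_le.trans (by simp)

namespace Obs

variable (O : Obs f C t c)
include O

lemma C_nonneg : 0 ≤ C := (abs_nonneg _).trans (O.bound (0, 0) (by simp))

lemma fibre_bound {ω : ℝ} (hω : ω ∈ Ico (0 : ℝ) 1) : |f (0, ω)| ≤ C :=
  O.bound _ ⟨by simp, Ico_subset_Icc_self hω⟩

lemma abs_mean_le : |c| ≤ C := by
  have h1 := norm_setIntegral_le_of_norm_le_const (μ := (volume : Measure ℝ)) (s := Ico (0 : ℝ) 1)
    (f := fun ω => f (0, ω)) (C := C) (by simp) fun ω hω => O.fibre_bound hω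
  rw [O.mean] at h1
  simpa using h1

lemma measurable_fibre : Measurable fun ω : ℝ => f (0, ω) - c :=
  (O.meas.comp measurable_prodMk_left).sub_const c

lemma sub_fibre_le {z : ℝ × ℝ} (hz : z ∈ Q) : |f z - f (0, z.2)| ≤ C * z.1 ^ t := by
  refine (O.holder z (Q_subset_Icc hz) (0, z.2) ⟨by simp, Ico_subset_Icc_self hz.2⟩).trans_eq ?_
  rw [Prod.dist_eq, dist_self, Real.dist_eq, sub_zero, abs_of_pos hz.1.1, max_eq_left hz.1.1.le]

variable (P) in
lemma exc_approx {e : ℝ} (he : 0 < e) : ∃ K : ℝ, 0 ≤ K ∧ ∀ z ∈ D,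
    |P.exc f z - c * P.τ z - birkhoffSum P.φ (fun ω => f (0, ω) - c) (P.τ z) z.2|
      ≤ e * P.τ z + K := by
  have hC := O.C_nonneg
  obtain ⟨M, hM⟩ : ∃ M : ℕ, C * (1 / ((M : ℝ) + 1)) ^ t ≤ e := by
    have h1 : Tendsto (fun M : ℕ => C * (1 / ((M : ℝ) + 1)) ^ t) atTop (𝓝 (C * 0 ^ t)) :=
      ((tendsto_one_div_add_atTop_nhds_zero_nat).rpow_const (Or.inr O.t_pos.le)).const_mul C
    rw [Real.zero_rpow O.t_pos.ne', mul_zero] at h1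
    exact ((h1.eventually (gt_mem_nhds he)).exists).imp fun _ => le_of_lt
  refine ⟨2 * C * M + 2 * C, by positivity, fun z hz => ?_⟩
  set n := P.τ z
  have hzQ := D_subset_Q hz
  have h1 : P.exc f z - c * n - birkhoffSum P.φ (fun ω => f (0, ω) - c) n z.2 =
      ∑ k ∈ Finset.range n, (f (P.T^[k] z) - f (0, (P.T^[k] z).2)) := by
    simp only [exc, birkhoffSum, Finset.sum_sub_distrib, iter_snd]
    simp [n]
    ring
  have h2 : ∀ k ∈ Finset.range n, |f (P.T^[k] z) - f (0, (P.T^[k] z).2)| ≤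
      e + (if n - k < M then 2 * C else 0) + (if k = 0 then 2 * C else 0) := by
    intro k hk
    rw [Finset.mem_range] at hk
    have hq := P.iter_mem k hzQ
    have htriv : |f (P.T^[k] z) - f (0, (P.T^[k] z).2)| ≤ 2 * C := by
      have h3 := O.bound _ (Q_subset_Icc hq)
      have h4 := O.fibre_bound hq.2
      exact (abs_sub _ _).trans (by linarith)
    by_cases h0 : k = 0
    · simp only [h0, if_true] at htriv ⊢
      split_ifs <;> linarith
    by_cases hl : n - k < M
    · simp only [hl, h0, if_true, if_false]; linarith
    · simp only [hl, h0, if_false, add_zero]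
      refine (O.sub_fibre_le hq).trans (le_trans ?_ hM)
      gcongr
      · exact hq.1.1.le
      · exact O.t_pos.le
      · refine (P.fst_le_of_notMem (n - k) _ hq fun m hm => ?_).trans ?_
        · rw [← Function.iterate_add_apply]
          exact P.notMem_of_lt_τ (by omega) (by omega : m + k < n)
        · have : (M : ℝ) ≤ ((n - k : ℕ) : ℝ) := by exact_mod_cast not_lt.1 hl
          gcongr
  rw [h1]
  refine (Finset.abs_sum_le_sum_abs _ _).trans ((Finset.sum_le_sum h2).trans ?_)
  rw [Finset.sum_add_distrib, Finset.sum_add_distrib]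
  have h5 := sum_ite_sub_lt n M (A := 2 * C) (by positivity)
  have h6 : ∑ k ∈ Finset.range n, (if k = 0 then 2 * C else 0) ≤ 2 * C := by
    rw [Finset.sum_ite_eq' (Finset.range n) 0]
    split_ifs <;> linarith
  have h7 : ∑ k ∈ Finset.range n, e = e * n := by simp [mul_comm]
  linarith

lemma abs_exc_le {z : ℝ × ℝ} (hz : z ∈ Q) : |P.exc f z| ≤ C * P.τ z := by
  refine (Finset.abs_sum_le_sum_abs _ _).trans ((Finset.sum_le_sum fun k _ =>
    O.bound _ (Q_subset_Icc (P.iter_mem k hz))).trans_eq ?_)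
  simp [mul_comm]

end Obs
end LSV.Par

namespace LSV.Par

variable {P : Par} {ν : Measure (ℝ × ℝ)} {h : ℝ × ℝ → ℝ} {f : ℝ × ℝ → ℝ} {C t c : ℝ}

lemma Inv.measure_inter_D_le (I : P.Inv ν h) : ∃ B : ℝ, 0 ≤ B ∧ ∀ S : Set (ℝ × ℝ),
    MeasurableSet S → ν (D ∩ S) ≤ ENNReal.ofReal B * volume (D ∩ S) := by
  obtain ⟨B, hB, hh⟩ := I.exists_bound
  refine ⟨B, hB, fun S hS => ?_⟩
  rw [I.den, withDensity_apply _ (measurableSet_D.inter hS), ← setLIntegral_const]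
  refine setLIntegral_mono' (measurableSet_D.inter hS) fun z hz => ENNReal.ofReal_le_ofReal ?_
  exact (le_max_left _ 0).trans ((le_abs_self _).trans (hh z hz.1))

/-- The excursions along which the fibre average deviates from its mean. -/
def bad (P : Par) (f : ℝ × ℝ → ℝ) (c e : ℝ) : Set (ℝ × ℝ) :=
  {z | e * P.τ z ≤ |P.exc (fun z => f (0, z.2) - c) z|}

lemma exc_fibre (z : ℝ × ℝ) : P.exc (fun z => f (0, z.2) - c) z =
    birkhoffSum P.φ (fun ω => f (0, ω) - c) (P.τ z) z.2 := by
  simp [exc, birkhoffSum, iter_snd]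

namespace Obs

variable (O : Obs f C t c)
include O

lemma measurable_sub_mean : Measurable fun z : ℝ × ℝ => f (0, z.2) - c :=
  O.measurable_fibre.comp measurable_snd

lemma measurableSet_bad (e : ℝ) : MeasurableSet (P.bad f c e) := by
  have h1 : Measurable fun z => (P.τ z : ℝ) := measurable_from_nat.comp P.measurable_τ
  exact measurableSet_le (h1.const_mul e) (P.measurable_exc O.measurable_sub_mean).abs

lemma integrable_bad (I : P.Inv ν h) {e : ℝ} (he : 0 < e) :
    IntegrableOn (fun z => (P.bad f c e).indicator (fun z => (P.τ z : ℝ)) z * P.τ z) D ν := by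
  have hτ : Measurable fun z => (P.τ z : ℝ) := measurable_from_nat.comp P.measurable_τ
  have hC := O.C_nonneg
  obtain ⟨B, hB, hνB⟩ := I.measure_inter_D_le
  have h0 : ∀ ω ∈ Ico (0 : ℝ) 1, |f (0, ω) - c| ≤ 2 * C := fun ω hω =>
    (abs_sub _ _).trans (by linarith [O.fibre_bound hω, O.abs_mean_le])
  obtain ⟨C', θ, hC', hθ, hθ1, hld⟩ := P.large_deviation O.measurable_fibre h0
    (P.iter_Po_tendsto O.measurable_fibre (C := C) O.t_pos (fun ω hω ω' hω' => by
      rw [sub_sub_sub_cancel_right]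
      refine (O.holder (0, ω) ⟨by simp, Ico_subset_Icc_self hω⟩ (0, ω')
        ⟨by simp, Ico_subset_Icc_self hω'⟩).trans_eq ?_
      rw [Prod.dist_eq, dist_self, Real.dist_eq, max_eq_right (abs_nonneg _)]) (by
      rw [integral_sub, O.mean]
      · simp
      · refine Integrable.of_bound (O.meas.comp measurable_prodMk_left).aestronglyMeasurable C ?_
        exact (ae_restrict_iff' measurableSet_Ico).2 (ae_of_all _ fun ω hω => O.fibre_bound hω)
      · simp)) he
  set S : ℕ → Set (ℝ × ℝ) := fun n => {z | e * n ≤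
    |birkhoffSum P.φ (fun ω => f (0, ω) - c) n z.2|}
  have hS : ∀ n, MeasurableSet (S n) := fun n => by
    have h1 : Measurable fun z : ℝ × ℝ => birkhoffSum P.φ (fun ω => f (0, ω) - c) n z.2 :=
      (Finset.measurable_fun_sum _ fun k _ => O.measurable_fibre.comp
        (P.measurable_φ.iterate k)).comp measurable_snd
    exact measurableSet_le measurable_const h1.abs
  have hSν : ∀ n, ν (D ∩ S n) ≤ ENNReal.ofReal (B * (C' * θ ^ n)) := fun n => by
    refine (hνB _ (hS n)).trans ?_
    rw [ENNReal.ofReal_mul hB]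
    gcongr
    have h1 : D ∩ S n ⊆ Ioc (1 / 2) 1 ×ˢ {ω | ω ∈ Ico (0 : ℝ) 1 ∧
        e * n ≤ |birkhoffSum P.φ (fun ω => f (0, ω) - c) n ω|} :=
      fun z hz => ⟨hz.1.1, hz.1.2, hz.2⟩
    refine (measure_mono h1).trans ?_
    rw [Measure.volume_eq_prod, Measure.prod_prod]
    refine (mul_le_mul' ?_ (hld n)).trans_eq (one_mul _)
    rw [Real.volume_Ioc, ← ENNReal.ofReal_one]
    exact ENNReal.ofReal_le_ofReal (by norm_num)
  refine ⟨((hτ.indicator (O.measurableSet_bad e)).mul hτ).aestronglyMeasurable, ?_⟩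
  rw [hasFiniteIntegral_iff_ofReal (ae_of_all _ fun z => mul_nonneg
    (indicator_nonneg (fun _ _ => Nat.cast_nonneg _) _) (Nat.cast_nonneg _))]
  have h2 : ∀ z, ENNReal.ofReal ((P.bad f c e).indicator (fun z => (P.τ z : ℝ)) z * P.τ z) ≤
      ∑' n : ℕ, (S n).indicator (fun _ => ENNReal.ofReal ((n : ℝ) * n)) z := fun z => by
    by_cases hz : z ∈ P.bad f c e
    · rw [indicator_of_mem hz]
      refine le_trans ?_ (ENNReal.le_tsum (P.τ z))
      have h3 : z ∈ S (P.τ z) := by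
        have := hz
        simp only [bad, mem_ofPred_eq, exc_fibre] at this
        exact this
      rw [indicator_of_mem h3]
    · rw [indicator_of_notMem hz]; simp
  have h4 : Summable fun n : ℕ => (n : ℝ) * n * (B * (C' * θ ^ n)) := by
    have := (summable_pow_mul_geometric_of_norm_lt_one 2 (r := θ)
      (by rwa [Real.norm_eq_abs, abs_of_pos hθ])).mul_left (B * C')
    exact this.congr fun n => by ring
  calc ∫⁻ z in D, ENNReal.ofReal ((P.bad f c e).indicator (fun z => (P.τ z : ℝ)) z * P.τ z) ∂ν
      ≤ ∫⁻ z in D, ∑' n : ℕ, (S n).indicator (fun _ => ENNReal.ofReal ((n : ℝ) * n)) z ∂ν :=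
        lintegral_mono h2
    _ = ∑' n : ℕ, ENNReal.ofReal ((n : ℝ) * n) * ν (D ∩ S n) := by
        rw [lintegral_tsum fun n => (measurable_const.indicator (hS n)).aemeasurable]
        refine tsum_congr fun n => ?_
        rw [lintegral_indicator (hS n), setLIntegral_const, Measure.restrict_apply (hS n),
          inter_comm]
    _ ≤ ∑' n : ℕ, ENNReal.ofReal ((n : ℝ) * n * (B * (C' * θ ^ n))) := by
        refine ENNReal.tsum_le_tsum fun n => ?_
        rw [ENNReal.ofReal_mul (by positivity : (0 : ℝ) ≤ (n : ℝ) * n)]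
        gcongr
        exact hSν n
    _ < ⊤ := h4.tsum_ofReal_lt_top

lemma charFun_exc (I : P.Inv ν h) (hf0 : ∫ z, f z ∂ν = 0) (hc : c ≠ 0) :
    Tendsto (fun x : ℝ => ((x ^ (-P.q) : ℝ) : ℂ) *
        ∫ z in D, (Complex.exp (Complex.I * ((x * P.exc f z : ℝ) : ℂ)) - 1) ∂ν) (𝓝[>] 0)
      (𝓝 ((Aconst P.α P.p h : ℂ) * ((|c| ^ P.q : ℝ) : ℂ) * stableExp P.q (Real.sign c))) := by
  have := I.prob
  have hC := O.C_nonneg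
  have haeD : ∀ᵐ z ∂ν.restrict D, z ∈ D := ae_restrict_mem measurableSet_D
  refine charFun_asymptotics (M := max 1 C) P.one_lt_q P.q_lt_two P.measurable_τ I.tail
    (P.measurable_exc O.meas) hc (le_max_left _ _) (O.abs_mean_le.trans (le_max_right _ _)) ?_ ?_ ?_
  · filter_upwards [haeD] with z hz
    refine (O.abs_exc_le (D_subset_Q hz)).trans ?_
    gcongr
    exact le_max_right _ _
  · rw [I.integral_exc O.meas fun z hz => O.bound z (Q_subset_Icc hz), hf0]
  · intro e he
    obtain ⟨K, hK, hKz⟩ := O.exc_approx P (half_pos he)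
    refine ⟨fun z => K + 2 * C * (P.bad f c (e / 2)).indicator (fun z => (P.τ z : ℝ)) z,
      fun z => add_nonneg hK (mul_nonneg (by positivity)
        (indicator_nonneg (fun _ _ => Nat.cast_nonneg _) _)), ?_, ?_⟩
    · refine ((I.integrable_τ.const_mul K).add
        ((O.integrable_bad I (half_pos he)).const_mul (2 * C))).congr (ae_of_all _ fun z => ?_)
      simp only [Pi.add_apply]; ring
    · filter_upwards [haeD] with z hz
      have h1 := hKz z hz
      rw [← exc_fibre] at h1
      have h2 : |P.exc f z - c * P.τ z| ≤ e / 2 * P.τ z + K +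
          |P.exc (fun z => f (0, z.2) - c) z| := by
        have := abs_add_le (P.exc f z - c * P.τ z - P.exc (fun z => f (0, z.2) - c) z)
          (P.exc (fun z => f (0, z.2) - c) z)
        rw [sub_add_cancel] at this
        linarith
      by_cases hb : z ∈ P.bad f c (e / 2)
      · rw [indicator_of_mem hb]
        have h3 := O.abs_exc_le (P := P) (D_subset_Q hz)
        have h4 : |c * P.τ z| ≤ C * P.τ z := by
          rw [abs_mul, Nat.abs_cast]
          exact mul_le_mul_of_nonneg_right O.abs_mean_le (Nat.cast_nonneg _)
        have h5 := abs_sub (P.exc f z) (c * P.τ z)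
        have : 0 ≤ e * P.τ z := by positivity
        nlinarith
      · rw [indicator_of_notMem hb]
        have h3 : |P.exc (fun z => f (0, z.2) - c) z| < e / 2 * P.τ z := not_le.1 hb
        nlinarith

end Obs

namespace Inv

variable (I : P.Inv ν h)
include I

lemma real_D_le_one : ν.real D ≤ 1 := by
  have := I.prob
  exact measureReal_le_one

lemma charFun_τ : Tendsto (fun x : ℝ => ((x ^ (-P.q) : ℝ) : ℂ) *
      ∫ z in D, (Complex.exp (Complex.I * ((x * (P.τ z - 1 / ν.real D) : ℝ) : ℂ)) - 1) ∂ν) (𝓝[>] 0)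
      (𝓝 ((Aconst P.α P.p h : ℂ) * ((|(1 : ℝ)| ^ P.q : ℝ) : ℂ) * stableExp P.q (Real.sign 1))) := by
  have := I.prob
  have hb := I.real_D_pos
  have hb' : 0 < 1 / ν.real D := by positivity
  have haeD : ∀ᵐ z ∂ν.restrict D, z ∈ D := ae_restrict_mem measurableSet_D
  have hm : Measurable fun z => (P.τ z : ℝ) - 1 / ν.real D :=
    (measurable_from_nat.comp P.measurable_τ).sub_const _
  refine charFun_asymptotics (M := 1 + 1 / ν.real D) P.one_lt_q P.q_lt_two P.measurable_τ I.tail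
    hm one_ne_zero (by linarith)
    (by rw [abs_one]; linarith) ?_ ?_ ?_
  · filter_upwards [haeD] with z hz
    have h1 : (1 : ℝ) ≤ P.τ z := by exact_mod_cast (P.τ_spec (D_subset_Q hz)).1
    refine (abs_sub _ _).trans ?_
    rw [Nat.abs_cast, abs_of_pos hb']
    nlinarith
  · rw [integral_sub I.integrable_τ (by simp), I.integral_τ]
    simp [hb.ne']
  · intro e he
    refine ⟨fun _ => 1 / ν.real D, fun _ => hb'.le, I.integrable_τ.const_mul _, ae_of_all _ fun z
        => ?_⟩
    have : 0 ≤ e * P.τ z := by positivity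
    rw [show (P.τ z : ℝ) - 1 / ν.real D - 1 * P.τ z = -(1 / ν.real D) by ring, abs_neg,
      abs_of_pos hb']
    linarith

end Inv
end LSV.Par

namespace LSV

lemma tendsto_one_add_pow {w : ℕ → ℂ} {z : ℂ} (hw : Tendsto (fun n : ℕ => n * w n) atTop (𝓝 z))
    {N : ℕ → ℕ} {b : ℝ} (hN : Tendsto (fun n => (N n : ℝ) / n) atTop (𝓝 b)) :
    Tendsto (fun n => (1 + w n) ^ N n) atTop (𝓝 (Complex.exp (b * z))) := by
  have h0 : Tendsto w atTop (𝓝 0) := by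
    have h1 := hw.mul (tendsto_inv_atTop_nhds_zero_nat (𝕜 := ℂ))
    rw [mul_zero] at h1
    refine h1.congr' ?_
    filter_upwards [eventually_ne_atTop 0] with n hn
    have : (n : ℂ) ≠ 0 := by exact_mod_cast hn
    field_simp
  have h1 := Complex.tendsto_nat_mul_log_one_add_of_tendsto hw
  have h2 : Tendsto (fun n => (((N n : ℝ) / n : ℝ) : ℂ) * (n * Complex.log (1 + w n))) atTop
      (𝓝 (b * z)) :=
    ((Complex.continuous_ofReal.tendsto b).comp hN).mul h1
  refine ((Complex.continuous_exp.tendsto _).comp h2).congr' ?_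
  have h3 : ∀ᶠ n in atTop, 1 + w n ≠ 0 := by
    have h4 : Tendsto (fun n => 1 + w n) atTop (𝓝 1) := by simpa using h0.const_add 1
    exact h4.eventually_ne one_ne_zero
  filter_upwards [h3, eventually_ne_atTop 0] with n hn hn0
  have : (n : ℂ) ≠ 0 := by exact_mod_cast hn0
  rw [Function.comp_apply, show (((N n : ℝ) / n : ℝ) : ℂ) * (n * Complex.log (1 + w n)) =
    N n * Complex.log (1 + w n) by push_cast; field_simp, Complex.exp_nat_mul, Complex.exp_log hn]

lemma tendsto_div_rpow {a : ℝ} (ha : 0 < a) (s : ℝ) :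
    Tendsto (fun n : ℕ => s / (n : ℝ) ^ a) atTop (𝓝 0) :=
  ((tendsto_rpow_atTop ha).comp tendsto_natCast_atTop_atTop).const_div_atTop s

end LSV

namespace FullBranch

variable {X ι : Type*} [MeasurableSpace X] {S : FullBranch X ι} {V : ι → ℝ} {v : X → ℝ}

theorem tendsto_charFun [Countable ι] {h : X → ℝ} {K₀ : ℝ} (hh : S.Density h K₀)
    (hv : S.Branchwise V v) (hV : Summable fun i => S.j i * V i) (hvm : Measurable v)
    {a : ℝ} (ha : 1 / 2 < a) {s : ℝ} {z : ℂ}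
    (hz : Tendsto (fun n : ℕ => (n : ℂ) *
      ((∫ x, h x * Complex.exp (Complex.I * (s / (n : ℝ) ^ a * v x : ℝ)) ∂S.m) - 1)) atTop (𝓝 z))
    {k : ℕ → ℕ} {b : ℝ} (hb : 0 < b) (hk : Tendsto (fun n => (k n : ℝ) / n) atTop (𝓝 b))
    {K : ℝ} {u : X → ℂ} (hu : S.Branchwise (fun _ => K) u) (hum : AEStronglyMeasurable u S.m) :
    Tendsto (fun n : ℕ => ∫ x, u x *
      Complex.exp (Complex.I * (s / (n : ℝ) ^ a * birkhoffSum S.F v (k n) x : ℝ)) ∂S.m) atTop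
      (𝓝 (Complex.exp (b * z) * ∫ x, u x ∂S.m)) := by
  have ha0 : 0 < a := by linarith
  obtain ⟨C, hC, happ⟩ := charFun_approx hh hv hV hvm
  set t : ℕ → ℝ := fun n => s / (n : ℝ) ^ a
  have ht : Tendsto t atTop (𝓝 0) := LSV.tendsto_div_rpow ha0 s
  set N : ℕ → ℕ := fun n => k n - 1
  have hk1 : ∀ᶠ n in atTop, 1 ≤ k n := by
    filter_upwards [hk.eventually (lt_mem_nhds hb)] with n hn
    by_contra hc
    have : k n = 0 := by omega
    simp [this] at hn
  have hN : Tendsto (fun n => (N n : ℝ) / n) atTop (𝓝 b) := by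
    have h1 := hk.sub (tendsto_one_div_atTop_nhds_zero_nat (𝕜 := ℝ))
    rw [sub_zero] at h1
    refine h1.congr' ?_
    filter_upwards [hk1] with n hn
    simp only [N, Nat.cast_sub hn]
    push_cast; ring
  have hNt : Tendsto (fun n => (N n : ℝ) * t n ^ 2) atTop (𝓝 0) := by
    have h1 := (tendsto_rpow_neg_atTop (y := 2 * a - 1) (by linarith)).comp
      (tendsto_natCast_atTop_atTop (R := ℝ))
    have h2 := (hN.mul h1).mul_const (s ^ 2)
    rw [mul_zero, zero_mul] at h2
    refine h2.congr' ?_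
    filter_upwards [eventually_gt_atTop 0] with n hn
    have hn' : (0 : ℝ) < n := by exact_mod_cast hn
    simp only [Function.comp_apply, t]
    rw [Real.rpow_neg hn'.le, Real.rpow_sub hn', Real.rpow_one, two_mul, Real.rpow_add hn']
    field_simp
  have hui : Integrable u S.m := S.integrable_of_branchwise hu.1 (S.summable_const K) hum
  have hE := LSV.tendsto_one_add_pow hz hN
  simp only [add_sub_cancel] at hE
  have hu1 : Tendsto (fun n => ∫ x, S.Lt v (t n) u x ∂S.m) atTop (𝓝 (∫ x, u x ∂S.m)) := by
    have h1 : ∀ n, ∫ x, S.Lt v (t n) u x ∂S.m =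
        ∫ x, u x * Complex.exp (Complex.I * (t n * v x : ℝ)) ∂S.m := fun n => by
      simpa using integral_Lt_mul hv hV hvm hu hum (t n) 0
    simp only [h1]
    refine tendsto_integral_of_dominated_convergence (fun x => ‖u x‖)
      (fun n => hum.mul (measurable_cexp_mul hvm (t n)).aestronglyMeasurable) hui.norm
      (fun n => ae_of_all _ fun x => by rw [norm_mul, norm_exp_I_mul, mul_one])
      (ae_of_all _ fun x => ?_)
    have h2 : Tendsto (fun n => Complex.exp (Complex.I * ((t n * v x : ℝ) : ℂ))) atTop
        (𝓝 (Complex.exp (Complex.I * ((0 * v x : ℝ) : ℂ)))) := by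
      have : Continuous fun y : ℝ => Complex.exp (Complex.I * ((y * v x : ℝ) : ℂ)) := by fun_prop
      exact (this.tendsto 0).comp ht
    simpa using h2.const_mul (u x)
  have hmain := hE.mul hu1
  have herr : Tendsto (fun n => C * (S.C₁ * K + 2 * S.C₁ * S.vbar V * |t n| * K) *
      (|t n| + N n * t n ^ 2)) atTop (𝓝 0) := by
    have h1 : Tendsto (fun n => |t n|) atTop (𝓝 0) := by simpa using ht.abs
    have h2 := ((((h1.const_mul (2 * S.C₁ * S.vbar V)).mul_const K).const_add
      (S.C₁ * K)).const_mul C).mul (h1.add hNt)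
    simpa using h2
  have hdiff := squeeze_zero_norm' (a := fun n : ℕ => C *
      (S.C₁ * K + 2 * S.C₁ * S.vbar V * |t n| * K) *
      (|t n| + N n * t n ^ 2)) (f := fun n : ℕ => (∫ x, u x * Complex.exp (Complex.I *
        (s / (n : ℝ) ^ a * birkhoffSum S.F v (k n) x : ℝ)) ∂S.m) -
      (∫ x, h x * Complex.exp (Complex.I * (s / (n : ℝ) ^ a * v x : ℝ)) ∂S.m) ^ N n *
        ∫ x, S.Lt v (t n) u x ∂S.m) ?_ herr
  · simpa using hdiff.add hmain
  · filter_upwards [hk1] with n hn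
    have h1 := happ _ _ (hv.reg_Lt hV hu (t n)) (t n) (N n)
    rw [integral_Lt_mul hv hV hvm hu hum (t n) (N n), Nat.sub_add_cancel hn] at h1
    exact h1

end FullBranch

namespace LSV.Par

variable {P : Par} {ν : Measure (ℝ × ℝ)} {h : ℝ × ℝ → ℝ}

/-- The characteristic exponent of the limit law of an observable with drift `c`. -/
def lam (P : Par) (h : ℝ × ℝ → ℝ) (c s : ℝ) : ℂ :=
  (Aconst P.α P.p h : ℂ) * ((|s * c| ^ P.q : ℝ) : ℂ) * stableExp P.q (Real.sign (s * c))

lemma q_ne_zero : P.q ≠ 0 := by linarith [P.one_lt_q]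

lemma lam_zero (c : ℝ) : P.lam h c 0 = 0 := by simp [lam, Real.zero_rpow P.q_ne_zero]

lemma lam_neg (c s : ℝ) : P.lam h c (-s) = (starRingEnd ℂ) (P.lam h c s) := by
  simp only [lam, neg_mul, abs_neg, map_mul, Complex.conj_ofReal, ← stableExp_neg]
  rw [Real.sign_neg]

lemma lam_of_pos (c : ℝ) {s : ℝ} (hs : 0 < s) : P.lam h c s = ((s ^ P.q : ℝ) : ℂ) *
    ((Aconst P.α P.p h : ℂ) * ((|c| ^ P.q : ℝ) : ℂ) * stableExp P.q (Real.sign c)) := by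
  have h1 : Real.sign (s * c) = Real.sign c := by
    rcases lt_trichotomy c 0 with h | h | h
    · rw [Real.sign_of_neg h, Real.sign_of_neg (by nlinarith)]
    · simp [h]
    · rw [Real.sign_of_pos h, Real.sign_of_pos (by positivity)]
  rw [lam, h1, abs_mul, abs_of_pos hs, Real.mul_rpow hs.le (abs_nonneg _)]
  push_cast; ring

/-- An observable on the inducing domain in the domain of attraction of the stable law. -/
structure Attracted (P : Par) (ν : Measure (ℝ × ℝ)) (h v : ℝ × ℝ → ℝ) (c : ℝ) : Prop where
  meas : Measurable v
  branchwise : ∃ (t : ℝ) (ht : 0 < t) (ht1 : t ≤ 1) (C : ℝ),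
    (P.sys t ht ht1).Branchwise (fun i => C * (i.2.length + 1)) v
  lim : Tendsto (fun x : ℝ => ((x ^ (-P.q) : ℝ) : ℂ) *
    ∫ z in D, (Complex.exp (Complex.I * ((x * v z : ℝ) : ℂ)) - 1) ∂ν) (𝓝[>] 0)
    (𝓝 ((Aconst P.α P.p h : ℂ) * ((|c| ^ P.q : ℝ) : ℂ) * stableExp P.q (Real.sign c)))

namespace Attracted

variable {v : ℝ × ℝ → ℝ} {c : ℝ} (A : P.Attracted ν h v c)
include A

lemma tendsto_nat_mul (s : ℝ) : Tendsto (fun n : ℕ => (n : ℂ) *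
    ∫ z in D, (Complex.exp (Complex.I * ((s / (n : ℝ) ^ P.α * v z : ℝ) : ℂ)) - 1) ∂ν) atTop
    (𝓝 (P.lam h c s)) := by
  have hpos : ∀ s : ℝ, 0 < s → Tendsto (fun n : ℕ => (n : ℂ) *
      ∫ z in D, (Complex.exp (Complex.I * ((s / (n : ℝ) ^ P.α * v z : ℝ) : ℂ)) - 1) ∂ν) atTop
      (𝓝 (P.lam h c s)) := by
    intro s hs
    have h1 : Tendsto (fun n : ℕ => s / (n : ℝ) ^ P.α) atTop (𝓝[>] 0) := by
      refine tendsto_nhdsWithin_iff.2 ⟨tendsto_div_rpow P.α_pos s, ?_⟩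
      filter_upwards [eventually_gt_atTop 0] with n hn
      have hn' : (0 : ℝ) < n := by exact_mod_cast hn
      exact div_pos hs (Real.rpow_pos_of_pos hn' _)
    rw [lam_of_pos c hs]
    refine ((A.lim.comp h1).const_mul _).congr' ?_
    filter_upwards [eventually_gt_atTop 0] with n hn
    have hn' : (0 : ℝ) < n := by exact_mod_cast hn
    have h2 : s ^ P.q * (s / (n : ℝ) ^ P.α) ^ (-P.q) = n := by
      rw [Real.rpow_neg (by positivity), Real.div_rpow hs.le (by positivity), ← Real.rpow_mul
          hn'.le,
        q, mul_one_div_cancel P.α_pos.ne', Real.rpow_one]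
      have := (Real.rpow_pos_of_pos hs (1 / P.α)).ne'
      field_simp
    rw [Function.comp_apply, ← mul_assoc, ← Complex.ofReal_mul, h2, Complex.ofReal_natCast]
  rcases lt_trichotomy s 0 with hs | rfl | hs
  · have h1 := (Complex.continuous_conj.tendsto _).comp (hpos (-s) (by linarith))
    rw [← lam_neg, neg_neg] at h1
    refine h1.congr fun n => ?_
    rw [Function.comp_apply, map_mul, Complex.conj_natCast, ← integral_conj]
    congr 2
    funext z
    rw [map_sub, map_one, ← Complex.exp_conj, map_mul, Complex.conj_I, Complex.conj_ofReal]
    congr 2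
    push_cast; ring
  · simp [lam_zero]
  · exact hpos s hs

end Attracted

namespace Inv

variable (I : P.Inv ν h)
include I

lemma integral_hd_mul_sub_one {t : ℝ} (ht : 0 < t) (ht1 : t ≤ 1) {v : ℝ × ℝ → ℝ} (hv : Measurable v)
    (s : ℝ) : (∫ z, (hd ν h z : ℂ) * Complex.exp (Complex.I * ((s * v z : ℝ) : ℂ))
        ∂(P.sys t ht ht1).m) - 1 = (1 / ν.real D : ℝ) *
      ∫ z in D, (Complex.exp (Complex.I * ((s * v z : ℝ) : ℂ)) - 1) ∂ν := by
  obtain ⟨K₀, hK⟩ := I.density ht ht1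
  have hi : Integrable (fun z => (hd ν h z : ℂ)) (P.sys t ht ht1).m := hK.reg.ofReal.integrable
  have hi' : Integrable (fun z => (hd ν h z : ℂ) * Complex.exp (Complex.I * ((s * v z : ℝ) : ℂ)))
      (P.sys t ht ht1).m :=
    hi.mul_bdd (c := 1) (FullBranch.measurable_cexp_mul hv s).aestronglyMeasurable
      (ae_of_all _ fun z => (FullBranch.norm_exp_I_mul _).le)
  have hb : (ν.real D : ℂ) ≠ 0 := by exact_mod_cast I.real_D_pos.ne'
  rw [I.integral_D ht ht1]
  simp only [mul_sub, mul_one]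
  rw [integral_sub hi' hi, integral_complex_ofReal, hK.mass]
  push_cast
  field_simp

lemma tendsto_charFun {v : ℝ × ℝ → ℝ} {c : ℝ} (A : P.Attracted ν h v c) (s : ℝ)
    {k : ℕ → ℕ} {b : ℝ} (hb : 0 < b) (hk : Tendsto (fun n => (k n : ℝ) / n) atTop (𝓝 b))
    {u : ℝ × ℝ → ℂ} (hu : ∀ t ht ht1, ∃ K, (P.sys t ht ht1).Branchwise (fun _ => K) u)
    (hum : AEStronglyMeasurable u (volume.restrict D)) :
    Tendsto (fun n : ℕ => ∫ z in D, u z * Complex.exp (Complex.I *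
      ((s / (n : ℝ) ^ P.α * birkhoffSum P.F v (k n) z : ℝ) : ℂ))) atTop
      (𝓝 (Complex.exp ((b / ν.real D : ℝ) * P.lam h c s) * ∫ z in D, u z)) := by
  obtain ⟨t, ht, ht1, C, hv⟩ := A.branchwise
  obtain ⟨K₀, hK⟩ := I.density ht ht1
  obtain ⟨K, hu⟩ := hu t ht ht1
  have h1 : Tendsto (fun n : ℕ => (n : ℂ) * ((∫ z, (hd ν h z : ℂ) * Complex.exp (Complex.I *
      ((s / (n : ℝ) ^ P.α * v z : ℝ) : ℂ)) ∂(P.sys t ht ht1).m) - 1)) atTop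
      (𝓝 ((1 / ν.real D : ℝ) * P.lam h c s)) := by
    refine ((A.tendsto_nat_mul s).const_mul ((1 / ν.real D : ℝ) : ℂ)).congr fun n => ?_
    rw [I.integral_hd_mul_sub_one ht ht1 A.meas]
    ring
  have hum' : AEStronglyMeasurable u (P.sys t ht ht1).m := hum.smul_measure _
  have h2 := FullBranch.tendsto_charFun hK hv (P.summable_length ht ht1 C) A.meas P.hα h1 hb hk hu
    hum'
  have h3 : ∀ g : ℝ × ℝ → ℂ, ∫ z, g z ∂(P.sys t ht ht1).m = 2 * ∫ z in D, g z := fun g => by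
    change ∫ z, g z ∂((2 : ENNReal) • (volume : Measure (ℝ × ℝ)).restrict D) = _
    rw [integral_smul_measure]
    simp
  simp only [h3] at h2
  have h4 := h2.const_mul (1 / 2 : ℂ)
  have h5 : (1 / 2 : ℂ) * (Complex.exp (b * ((1 / ν.real D : ℝ) * P.lam h c s)) *
      (2 * ∫ z in D, u z)) = Complex.exp ((b / ν.real D : ℝ) * P.lam h c s) * ∫ z in D, u z := by
    push_cast
    ring_nf
  rw [h5] at h4
  refine h4.congr fun n => ?_
  change (1 / 2 : ℂ) * (2 * ∫ z in D, u z * Complex.exp (Complex.I *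
      ((s / (n : ℝ) ^ P.α * birkhoffSum P.F v (k n) z : ℝ) : ℂ))) = _
  ring

lemma attracted_τ : P.Attracted ν h (fun z => P.τ z - 1 / ν.real D) 1 where
  meas := (measurable_from_nat.comp P.measurable_τ).sub_const _
  branchwise := by
    have hb := I.real_D_pos
    refine ⟨1, one_pos, le_rfl, 1 + 1 / ν.real D, fun i z hz => ?_, fun i z hz z' hz' => ?_⟩
    · change ‖(P.τ (P.ψ i z) : ℝ) - 1 / ν.real D‖ ≤ _
      rw [P.τ_ψ i hz, Real.norm_eq_abs]
      have h1 : 0 < 1 / ν.real D := by positivity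
      have h2 : (0 : ℝ) ≤ i.2.length := Nat.cast_nonneg _
      refine (abs_sub _ _).trans ?_
      rw [abs_of_pos h1, Nat.abs_cast]
      push_cast
      nlinarith
    · change ‖(P.τ (P.ψ i z) : ℝ) - 1 / ν.real D - (P.τ (P.ψ i z') - 1 / ν.real D)‖ ≤ _
      rw [P.τ_ψ i hz, P.τ_ψ i hz', sub_self, norm_zero]
      exact mul_nonneg (by positivity) (FullBranch.d_nonneg _ _ _)
  lim := I.charFun_τ

end Inv

lemma Obs.attracted {f : ℝ × ℝ → ℝ} {C t c : ℝ} (O : Obs f C t c) (I : P.Inv ν h)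
    (hf0 : ∫ z, f z ∂ν = 0) (hc : c ≠ 0) : P.Attracted ν h (P.exc f) c where
  meas := P.measurable_exc O.meas
  branchwise := ⟨t, O.t_pos, O.t_le_one, C, P.exc_branchwise O.t_pos O.t_le_one
    (fun z hz => O.bound z (Q_subset_Icc hz))
    fun z hz z' hz' => O.holder z (Q_subset_Icc hz) z' (Q_subset_Icc hz')⟩
  lim := O.charFun_exc I hf0 hc

end LSV.Par

namespace LSV

lemma exists_limit_law {μ : ℕ → ProbabilityMeasure ℝ} {ψ : ℝ → ℂ} (hψ : ContinuousAt ψ 0)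
    (h : ∀ t, Tendsto (fun n => charFun (μ n : Measure ℝ) t) atTop (𝓝 (ψ t))) :
    ∃ μ₀ : ProbabilityMeasure ℝ, Tendsto μ atTop (𝓝 μ₀) ∧
      ∀ t, charFun (μ₀ : Measure ℝ) t = ψ t := by
  have ht := isTightMeasureSet_of_tendsto_charFun hψ h
  have hc : IsCompact (closure (range μ)) := by
    refine isCompact_closure_of_isTightMeasureSet ?_
    convert! ht using 1
    ext x
    simp
  obtain ⟨μ₀, -, s, hs, hμ⟩ := hc.tendsto_subseq fun n => subset_closure (mem_range_self n)
  have h1 : ∀ t, charFun (μ₀ : Measure ℝ) t = ψ t := fun t =>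
    tendsto_nhds_unique (ProbabilityMeasure.tendsto_iff_tendsto_charFun.1 hμ t)
      ((h t).comp hs.tendsto_atTop)
  exact ⟨μ₀, ProbabilityMeasure.tendsto_of_tendsto_charFun fun t => by rw [h1]; exact h t, h1⟩

lemma exists_tight_bound {μ : ℕ → ProbabilityMeasure ℝ} {ψ : ℝ → ℂ} (hψ : ContinuousAt ψ 0)
    (h : ∀ t, Tendsto (fun n => charFun (μ n : Measure ℝ) t) atTop (𝓝 (ψ t))) {e : ℝ} (he : 0 < e) :
    ∃ R : ℝ, 0 < R ∧ ∀ n, (μ n : Measure ℝ).real {x | R < |x|} ≤ e := by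
  have ht := isTightMeasureSet_of_tendsto_charFun hψ h
  obtain ⟨K, hK, hKe⟩ := isTightMeasureSet_iff_exists_isCompact_measure_compl_le.1 ht
    (ENNReal.ofReal e) (by simpa using he)
  obtain ⟨R, hR⟩ := hK.isBounded.exists_norm_le
  refine ⟨max R 1, by positivity, fun n => ENNReal.toReal_le_of_le_ofReal he.le ?_⟩
  refine (measure_mono fun x hx hxK => ?_).trans (hKe _ (mem_range_self n))
  exact absurd (hR x hxK) (not_le.2 ((le_max_left _ _).trans_lt hx))

namespace Par

variable {P : Par} {ν : Measure (ℝ × ℝ)} {h : ℝ × ℝ → ℝ}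

lemma continuousAt_lam (c : ℝ) : ContinuousAt (P.lam h c) 0 := by
  rw [ContinuousAt, lam_zero]
  set B := ‖(Aconst P.α P.p h : ℂ)‖
  set G := |Real.Gamma (1 - P.q) * Real.cos (Real.pi / 2 * P.q)|
  set Tn := |Real.tan (Real.pi / 2 * P.q)|
  have h1 : Tendsto (fun s : ℝ => B * |s * c| ^ P.q * (G * (1 + Tn))) (𝓝 0) (𝓝 0) := by
    have h2 : ContinuousAt (fun s : ℝ => B * |s * c| ^ P.q * (G * (1 + Tn))) 0 := by
      have : ContinuousAt (fun s : ℝ => |s * c| ^ P.q) 0 :=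
        (by fun_prop : Continuous fun s : ℝ => |s * c|).continuousAt.rpow_const
          (Or.inr (by linarith [P.one_lt_q]))
      exact (this.const_mul B).mul_const _
    simpa [ContinuousAt, Real.zero_rpow P.q_ne_zero] using h2
  refine squeeze_zero_norm (fun s => ?_) h1
  rw [lam, norm_mul, norm_mul, Complex.norm_real (_ ^ _), Real.norm_of_nonneg
      (Real.rpow_nonneg (abs_nonneg _) _)]
  refine mul_le_mul_of_nonneg_left ?_ (by positivity)
  rw [stableExp, norm_mul, norm_neg, Complex.norm_real]
  gcongr
  · rfl
  refine (norm_sub_le _ _).trans ?_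
  rw [norm_one, norm_mul, Complex.norm_I, one_mul, Complex.norm_real, norm_mul]
  gcongr
  have : ‖Real.sign (s * c)‖ ≤ 1 := by
    rcases Real.sign_apply_eq (s * c) with h | h | h <;> simp [h]
  exact mul_le_of_le_one_left (norm_nonneg _) this

namespace Inv

variable (I : P.Inv ν h)
include I

lemma tendsto_charFun_τ {v : ℝ × ℝ → ℝ} {c : ℝ} (A : P.Attracted ν h v c) (s : ℝ)
    {k : ℕ → ℕ} {b : ℝ} (hb : 0 < b) (hk : Tendsto (fun n => (k n : ℝ) / n) atTop (𝓝 b))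
    {g : ℕ → ℝ} {R : ℝ} (hg : ∀ n, |g n| ≤ R) :
    Tendsto (fun n : ℕ => ∫ z in D, (g (P.τ z) : ℂ) * Complex.exp (Complex.I *
      ((s / (n : ℝ) ^ P.α * birkhoffSum P.F v (k n) z : ℝ) : ℂ)) ∂ν) atTop
      (𝓝 (Complex.exp ((b / ν.real D : ℝ) * P.lam h c s) * ∫ z in D, (g (P.τ z) : ℂ) ∂ν)) := by
  have hgm : Measurable fun z => ((g (P.τ z) : ℝ) : ℂ) :=
    Complex.measurable_ofReal.comp (measurable_from_nat.comp P.measurable_τ)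
  have hR : 0 ≤ R := (abs_nonneg _).trans (hg 0)
  have hhd : AEStronglyMeasurable (fun z => (hd ν h z : ℂ))
      ((2 : ENNReal) • (volume : Measure (ℝ × ℝ)).restrict D) :=
    Complex.continuous_ofReal.comp_aestronglyMeasurable I.aesm_hd
  have hhd' : AEStronglyMeasurable (fun z => (hd ν h z : ℂ))
      ((volume : Measure (ℝ × ℝ)).restrict D) :=
    hhd.mono_ac (Measure.absolutelyContinuous_smul two_ne_zero)
  have h1 := I.tendsto_charFun A s hb hk (u := fun z => (hd ν h z : ℂ) * (g (P.τ z) : ℂ)) (by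
    intro t ht ht1
    obtain ⟨K₀, hK⟩ := I.exists_reg ht ht1
    have hB := hK.ofReal.branchwise
    refine ⟨K₀ * R, fun i z hz => ?_, fun i z hz z' hz' => ?_⟩
    · change ‖(hd ν h (P.ψ i z) : ℂ) * (g (P.τ (P.ψ i z)) : ℂ)‖ ≤ K₀ * R
      rw [norm_mul, Complex.norm_real (g _)]
      exact mul_le_mul (hB.1 i z hz) (hg _) (abs_nonneg _) hK.nonneg
    · change ‖(hd ν h (P.ψ i z) : ℂ) * (g (P.τ (P.ψ i z)) : ℂ) -
        (hd ν h (P.ψ i z') : ℂ) * (g (P.τ (P.ψ i z')) : ℂ)‖ ≤ _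
      rw [P.τ_ψ i hz, P.τ_ψ i hz', ← sub_mul, norm_mul, Complex.norm_real (g _), mul_right_comm]
      exact mul_le_mul (hB.2 i z hz z' hz') (hg _) (abs_nonneg _)
        (mul_nonneg hK.nonneg (FullBranch.d_nonneg _ _ _))) (hhd'.mul hgm.aestronglyMeasurable)
  have h3 : ∀ g : ℝ × ℝ → ℂ, ∫ z in D, g z ∂ν = (2 * ν.real D : ℝ) * ∫ z in D, (hd ν h z : ℂ) * g z
      :=
      fun g => by
    rw [I.integral_D one_pos le_rfl]
    change _ * ∫ z, (hd ν h z : ℂ) * g z ∂((2 : ENNReal) • (volume : Measure (ℝ × ℝ)).restrict D) =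
        _
    rw [integral_smul_measure]
    simp
    ring
  simp only [h3]
  have h4 := h1.const_mul ((2 * ν.real D : ℝ) : ℂ)
  rw [mul_left_comm] at h4
  simpa only [mul_assoc] using h4

/-- Stationarity of the induced map. -/
lemma measure_iter_F (k : ℕ) {B : Set (ℝ × ℝ)} (hB : MeasurableSet B) :
    ν (D ∩ P.F^[k] ⁻¹' B) = ν (D ∩ B) := by
  induction k generalizing B with
  | zero => rfl
  | succ k ih =>
    rw [Function.iterate_succ, preimage_comp, I.measure_F ((P.measurable_F.iterate k) hB), ih hB]

omit I in
lemma measurable_birkhoffSum_F {v : ℝ × ℝ → ℝ} (hv : Measurable v) (k : ℕ) :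
    Measurable fun z => birkhoffSum P.F v k z :=
  Finset.measurable_fun_sum _ fun j _ => hv.comp (P.measurable_F.iterate j)

lemma tight {v : ℝ × ℝ → ℝ} {c : ℝ} (A : P.Attracted ν h v c) {e : ℝ} (he : 0 < e) :
    ∃ R : ℝ, 0 < R ∧ ∀ k : ℕ, 0 < k →
      ν.real (D ∩ {z | R * (k : ℝ) ^ P.α < |birkhoffSum P.F v k z|}) ≤ e := by
  have hb := I.real_D_pos
  have := I.prob
  have hbν : ν D ≠ 0 := I.measure_D_ne_zero
  set X : ℕ → ℝ × ℝ → ℝ := fun n z => 1 / (n : ℝ) ^ P.α * birkhoffSum P.F v n z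
  have hX : ∀ n, Measurable (X n) := fun n => (measurable_birkhoffSum_F A.meas n).const_mul _
  have hcond : IsProbabilityMeasure ((ν D)⁻¹ • ν.restrict D) := ⟨by
    simp [ENNReal.inv_mul_cancel hbν (measure_ne_top ν D)]⟩
  set μ : ℕ → ProbabilityMeasure ℝ := fun n => ⟨((ν D)⁻¹ • ν.restrict D).map (X n),
    Measure.isProbabilityMeasure_map (hX n).aemeasurable⟩
  have h1 : ∀ t, Tendsto (fun n => charFun (μ n : Measure ℝ) t) atTop
      (𝓝 (Complex.exp ((1 / ν.real D : ℝ) * P.lam h c t))) := by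
    intro t
    have h2 := I.tendsto_charFun_τ A t one_pos (k := fun n => n)
      (tendsto_const_nhds.congr' (by
        filter_upwards [eventually_ne_atTop 0] with n hn
        rw [div_self (by exact_mod_cast hn)])) (g := fun _ => 1) (R := 1) (by simp)
    have h3 := h2.const_mul (((ν.real D)⁻¹ : ℝ) : ℂ)
    have h4 : (((ν.real D)⁻¹ : ℝ) : ℂ) * (Complex.exp ((1 / ν.real D : ℝ) * P.lam h c t) *
        ∫ z in D, ((1 : ℝ) : ℂ) ∂ν) = Complex.exp ((1 / ν.real D : ℝ) * P.lam h c t) := by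
      have : (ν.real D : ℂ) ≠ 0 := by exact_mod_cast hb.ne'
      simp
      field_simp
    rw [h4] at h3
    refine h3.congr fun n => ?_
    change _ = charFun (((ν D)⁻¹ • ν.restrict D).map (X n)) t
    rw [charFun_apply_real, integral_map (hX n).aemeasurable (by fun_prop), integral_smul_measure,
      ENNReal.toReal_inv]
    change _ = (ν.real D)⁻¹ • _
    rw [Complex.real_smul]
    congr 1
    refine integral_congr_ae (ae_of_all _ fun z => ?_)
    simp only [X, Complex.ofReal_one, one_mul]
    congr 1
    push_cast; ring
  obtain ⟨R, hR, hRe⟩ := exists_tight_bound (ψ := fun t => Complex.exp ((1 / ν.real D : ℝ) *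
    P.lam h c t)) (((continuousAt_lam c).const_mul _).cexp) h1 he
  refine ⟨R, hR, fun k hk => ?_⟩
  have h2 := hRe k
  have hS : MeasurableSet {x : ℝ | R < |x|} := measurableSet_lt measurable_const (by fun_prop)
  change (((ν D)⁻¹ • ν.restrict D).map (X k)).real {x | R < |x|} ≤ e at h2
  rw [map_measureReal_apply (hX k) hS, measureReal_ennreal_smul_apply,
    measureReal_restrict_apply ((hX k) hS), ENNReal.toReal_inv] at h2
  change (ν.real D)⁻¹ • _ ≤ e at h2
  have h5 : ν.real (X k ⁻¹' {x | R < |x|} ∩ D) ≤ e := by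
    refine le_trans ?_ h2
    rw [smul_eq_mul]
    exact le_mul_of_one_le_left measureReal_nonneg ((one_le_inv₀ hb).2 I.real_D_le_one)
  have hk' : (0 : ℝ) < (k : ℝ) ^ P.α := Real.rpow_pos_of_pos (by exact_mod_cast hk) _
  refine le_trans (measureReal_mono (?_ : _ ⊆ X k ⁻¹' {x | R < |x|} ∩ D)) h5
  refine fun z hz => ⟨?_, hz.1⟩
  change R < |1 / (k : ℝ) ^ P.α * birkhoffSum P.F v k z|
  rw [abs_mul, abs_of_pos (by positivity), one_div, inv_mul_eq_div, lt_div_iff₀ hk']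
  exact hz.2

end Inv
end Par
end LSV

namespace LSV
namespace Par

variable {P : Par} {ν : Measure (ℝ × ℝ)} {h : ℝ × ℝ → ℝ}

section Orbit

variable (P)

lemma iter_F (k : ℕ) (z : ℝ × ℝ) : P.F^[k] z = P.T^[birkhoffSum P.F P.τ k z] z := by
  induction k with
  | zero => simp [birkhoffSum_zero]
  | succ k ih =>
    rw [Function.iterate_succ_apply', birkhoffSum_succ, add_comm, Function.iterate_add_apply, ← ih]
    rfl

lemma birkhoffSum_exc (f : ℝ × ℝ → ℝ) (k : ℕ) (z : ℝ × ℝ) :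
    birkhoffSum P.F (P.exc f) k z = birkhoffSum P.T f (birkhoffSum P.F P.τ k z) z := by
  induction k with
  | zero => simp [birkhoffSum_zero]
  | succ k ih =>
    rw [birkhoffSum_succ, birkhoffSum_succ, birkhoffSum_add, ih, ← P.iter_F]
    rfl

lemma birkhoffSum_τ_sub (b : ℝ) (k : ℕ) (z : ℝ × ℝ) :
    birkhoffSum P.F (fun z => (P.τ z : ℝ) - b) k z = (birkhoffSum P.F P.τ k z : ℕ) - k * b := by
  simp [birkhoffSum, Finset.sum_sub_distrib]

lemma iter_F_mem {z : ℝ × ℝ} (hz : z ∈ D) (k : ℕ) : P.F^[k] z ∈ D := by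
  induction k with
  | zero => exact hz
  | succ k ih => rw [Function.iterate_succ_apply']; exact P.F_mem (D_subset_Q ih)

variable {P}

lemma Obs.abs_birkhoffSum_le {f : ℝ × ℝ → ℝ} {C t c : ℝ} (O : Obs f C t c) {z : ℝ × ℝ}
    (hz : z ∈ Q) (n : ℕ) : |birkhoffSum P.T f n z| ≤ n * C := by
  refine (Finset.abs_sum_le_sum_abs _ _).trans ((Finset.sum_le_sum fun k _ =>
    O.bound _ (Q_subset_Icc (P.iter_mem k hz))).trans_eq ?_)
  simp

/-- Comparison of the Birkhoff sum at a time located in one of `m` blocks of `r` returns with the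
induced Birkhoff sum over the first `k` returns. -/
lemma Obs.exists_block {f : ℝ × ℝ → ℝ} {C t c : ℝ} (O : Obs f C t c) {z : ℝ × ℝ} (hz : z ∈ D)
    {n k r m : ℕ} (h1 : birkhoffSum P.F P.τ k z ≤ n)
    (h2 : n < birkhoffSum P.F P.τ (k + m * r) z) :
    ∃ j < m, |birkhoffSum P.T f n z - birkhoffSum P.F (P.exc f) k z| ≤
      |birkhoffSum P.F (P.exc f) (j * r) (P.F^[k] z)| +
        C * birkhoffSum P.F P.τ r (P.F^[k + j * r] z) := by
  induction m with
  | zero => simp at h2; omega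
  | succ m ih =>
    by_cases h3 : n < birkhoffSum P.F P.τ (k + m * r) z
    · obtain ⟨j, hj, hle⟩ := ih h3
      exact ⟨j, hj.trans (Nat.lt_succ_self m), hle⟩
    push Not at h3
    refine ⟨m, Nat.lt_succ_self m, ?_⟩
    have e1 : birkhoffSum P.F (P.exc f) (m * r) (P.F^[k] z) =
        birkhoffSum P.F (P.exc f) (k + m * r) z - birkhoffSum P.F (P.exc f) k z := by
      rw [birkhoffSum_add]; ring
    rw [Nat.succ_mul, ← add_assoc, birkhoffSum_add _ _ (k + m * r)] at h2
    set N := birkhoffSum P.F P.τ (k + m * r) z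
    obtain ⟨l, rfl⟩ := Nat.exists_eq_add_of_le h3
    have e2 : birkhoffSum P.T f (N + l) z = birkhoffSum P.F (P.exc f) (k + m * r) z +
        birkhoffSum P.T f l (P.F^[k + m * r] z) := by
      rw [birkhoffSum_add, P.birkhoffSum_exc, P.iter_F]
    have h4 := O.abs_birkhoffSum_le (P := P) (D_subset_Q (P.iter_F_mem hz (k + m * r))) l
    have h5 : (l : ℝ) ≤ (birkhoffSum P.F P.τ r (P.F^[k + m * r] z) : ℕ) := by
      exact_mod_cast (by omega : l ≤ birkhoffSum P.F P.τ r (P.F^[k + m * r] z))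
    rw [e2, e1, add_sub_right_comm]
    refine (abs_add_le _ _).trans (add_le_add_right (h4.trans ?_) _)
    rw [mul_comm]
    exact mul_le_mul_of_nonneg_left h5 O.C_nonneg

end Orbit

variable (P) in
lemma tendsto_block_div (ε : ℝ) :
    Tendsto (fun n : ℕ => ((⌈ε * (n : ℝ) ^ P.α⌉₊ : ℕ) : ℝ) / n) atTop (𝓝 0) := by
  have h1 : Tendsto (fun n : ℕ => |ε| * (n : ℝ) ^ (-(1 - P.α)) + 1 / (n : ℝ)) atTop (𝓝 0) := by
    have h2 := ((tendsto_rpow_neg_atTop (by linarith [P.hαβ, P.hβ] : 0 < 1 - P.α)).comp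
      tendsto_natCast_atTop_atTop).const_mul |ε|
    simpa using h2.add tendsto_one_div_atTop_nhds_zero_nat
  refine squeeze_zero' (Eventually.of_forall fun n => by positivity) ?_ h1
  filter_upwards [eventually_gt_atTop 0] with n hn
  have hn' : (0 : ℝ) < n := by exact_mod_cast hn
  have h3 : ((⌈ε * (n : ℝ) ^ P.α⌉₊ : ℕ) : ℝ) ≤ |ε| * (n : ℝ) ^ P.α + 1 := by
    refine (Nat.cast_le.2 (Nat.ceil_mono (mul_le_mul_of_nonneg_right (le_abs_self ε)
      (by positivity)))).trans (Nat.ceil_lt_add_one (by positivity)).le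
  rw [neg_sub, Real.rpow_sub_one hn'.ne', mul_div_assoc', ← add_div]
  gcongr

namespace Inv

variable (I : P.Inv ν h)
include I

lemma tendsto_tail {v : ℝ × ℝ → ℝ} {c : ℝ} (A : P.Attracted ν h v c) {κ : ℝ} (hκ : 0 < κ)
    {l : ℕ → ℕ} (hl : Tendsto (fun n => (l n : ℝ) / n) atTop (𝓝 0)) :
    Tendsto (fun n : ℕ => ν.real (D ∩ {z | κ * (n : ℝ) ^ P.α < |birkhoffSum P.F v (l n) z|}))
      atTop (𝓝 0) := by
  have := I.prob
  refine Metric.tendsto_nhds.2 fun e he => ?_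
  obtain ⟨R, hR, hRe⟩ := I.tight A (half_pos he)
  have h1 : Tendsto (fun n : ℕ => R * ((l n : ℝ) / n) ^ P.α) atTop (𝓝 0) := by
    simpa [Real.zero_rpow P.α_pos.ne'] using
      (hl.rpow_const (Or.inr P.α_pos.le) : Tendsto _ _ (𝓝 ((0 : ℝ) ^ P.α))).const_mul R
  filter_upwards [h1.eventually_le_const hκ, eventually_gt_atTop 0] with n hn hn0
  rw [Real.dist_0_eq_abs, abs_of_nonneg measureReal_nonneg]
  refine lt_of_le_of_lt ?_ (half_lt_self he)
  rcases Nat.eq_zero_or_pos (l n) with h0 | h0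
  · have : {z | κ * (n : ℝ) ^ P.α < |birkhoffSum P.F v (l n) z|} = ∅ := by
      refine eq_empty_of_forall_notMem fun z hz => ?_
      have hz' : κ * (n : ℝ) ^ P.α < |birkhoffSum P.F v (l n) z| := hz
      rw [h0, birkhoffSum_zero, abs_zero] at hz'
      exact hz'.not_ge (by positivity)
    rw [this]
    simp [half_pos he |>.le]
  refine (measureReal_mono ?_).trans (hRe _ h0)
  refine fun z hz => ⟨hz.1, ?_⟩
  have hz2 : κ * (n : ℝ) ^ P.α < |birkhoffSum P.F v (l n) z| := hz.2
  change R * (l n : ℝ) ^ P.α < |birkhoffSum P.F v (l n) z|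
  refine lt_of_le_of_lt ?_ hz2
  have hn' : (0 : ℝ) < (n : ℝ) ^ P.α := Real.rpow_pos_of_pos (by exact_mod_cast hn0) _
  rw [Real.div_rpow (by positivity) (by positivity), mul_div_assoc', div_le_iff₀ hn'] at hn
  exact hn

lemma real_iter_F (k : ℕ) {B : Set (ℝ × ℝ)} (hB : MeasurableSet B) :
    ν.real (D ∩ P.F^[k] ⁻¹' B) = ν.real (D ∩ B) :=
  congrArg ENNReal.toReal (I.measure_iter_F k hB)

/-- Up to small probability, the `n`-th iterate lies in a window of `O(ε n^α)` returns around the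
mean number of returns. -/
lemma exists_window {e ε : ℝ} (he : 0 < e) (hε : 0 < ε) : ∃ (J : ℕ), ∀ᶠ n : ℕ in atTop,
    ν.real (D ∩ {z | n < birkhoffSum P.F P.τ (⌊ν.real D * n⌋₊ - J * ⌈ε * (n : ℝ) ^ P.α⌉₊) z}) ≤ e ∧
    ν.real (D ∩ {z | birkhoffSum P.F P.τ (⌊ν.real D * n⌋₊ + J * ⌈ε * (n : ℝ) ^ P.α⌉₊) z ≤ n}) ≤ e
      := by
  have := I.prob
  have hb := I.real_D_pos
  have hb1 := I.real_D_le_one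
  obtain ⟨R, hR, hRe⟩ := I.tight I.attracted_τ he
  set b := ν.real D
  refine ⟨⌈3 * R / ε⌉₊, ?_⟩
  set J := ⌈3 * R / ε⌉₊
  have hJ : 3 * R ≤ J * ε := (div_le_iff₀ hε).1 (Nat.le_ceil _)
  have hJ0 : 0 < J := Nat.ceil_pos.2 (by positivity)
  have hlim := (tendsto_rpow_atTop P.α_pos).comp (tendsto_natCast_atTop_atTop (R := ℝ))
  have hJr := (P.tendsto_block_div ε).const_mul (J : ℝ)
  rw [mul_zero] at hJr
  filter_upwards [hlim.eventually_ge_atTop (1 / R), hJr.eventually_le_const one_pos,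
    eventually_gt_atTop 0] with n hn1 hn2 hn0
  have hn : (0 : ℝ) < n := by exact_mod_cast hn0
  have hn1' : 1 / R ≤ (n : ℝ) ^ P.α := hn1
  rw [div_le_iff₀ hR] at hn1'
  set r := ⌈ε * (n : ℝ) ^ P.α⌉₊
  have hr : ε * (n : ℝ) ^ P.α ≤ r := Nat.le_ceil _
  have hr0 : 0 < r := Nat.ceil_pos.2 (by positivity)
  have hJr : 3 * R * (n : ℝ) ^ P.α ≤ J * r := by
    calc 3 * R * (n : ℝ) ^ P.α ≤ J * ε * (n : ℝ) ^ P.α := by gcongr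
      _ = J * (ε * (n : ℝ) ^ P.α) := by ring
      _ ≤ J * r := by gcongr
  have hJn : (J : ℝ) * r ≤ n := by rwa [mul_div_assoc', div_le_one hn] at hn2
  have hnb : b * n ≤ n := mul_le_of_le_one_left hn.le hb1
  have hfl : (⌊b * n⌋₊ : ℝ) ≤ b * n := Nat.floor_le (by positivity)
  have hfl' : b * n < ⌊b * n⌋₊ + 1 := Nat.lt_floor_add_one _
  constructor
  · set k := ⌊b * n⌋₊ - J * r with hk
    rcases Nat.eq_zero_or_pos k with hk0 | hk0
    · simp [hk0, birkhoffSum_zero, he.le]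
    have hk' : (k : ℝ) = ⌊b * n⌋₊ - J * r := by
      rw [hk, Nat.cast_sub (by omega)]; push_cast; rfl
    refine (measureReal_mono ?_).trans (hRe k hk0)
    refine fun z hz => ⟨hz.1, ?_⟩
    have hz2 : (n : ℝ) < (birkhoffSum P.F P.τ k z : ℕ) := by exact_mod_cast hz.2
    change R * (k : ℝ) ^ P.α < |birkhoffSum P.F (fun z => (P.τ z : ℝ) - 1 / b) k z|
    rw [P.birkhoffSum_τ_sub]
    refine lt_of_lt_of_le ?_ (le_abs_self _)
    have h1 : (k : ℝ) * (1 / b) ≤ n - J * r := by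
      rw [mul_one_div, div_le_iff₀ hb, hk']
      nlinarith [mul_nonneg (mul_nonneg (Nat.cast_nonneg (α := ℝ) J) (Nat.cast_nonneg (α := ℝ) r))
        (sub_nonneg.2 hb1)]
    have h2 : (k : ℝ) ^ P.α ≤ (n : ℝ) ^ P.α :=
      Real.rpow_le_rpow (by positivity) (by nlinarith) P.α_pos.le
    nlinarith [mul_le_mul_of_nonneg_left h2 hR.le]
  · set k := ⌊b * n⌋₊ + J * r with hk
    have hk0 : 0 < k := by positivity
    have hk' : (k : ℝ) = ⌊b * n⌋₊ + J * r := by rw [hk]; push_cast; rfl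
    refine (measureReal_mono ?_).trans (hRe k hk0)
    refine fun z hz => ⟨hz.1, ?_⟩
    have hz2 : ((birkhoffSum P.F P.τ k z : ℕ) : ℝ) ≤ n := by exact_mod_cast hz.2
    change R * (k : ℝ) ^ P.α < |birkhoffSum P.F (fun z => (P.τ z : ℝ) - 1 / b) k z|
    rw [P.birkhoffSum_τ_sub]
    refine lt_of_lt_of_le ?_ (neg_le_abs _)
    have h0 : (1 : ℝ) ≤ J * r := by
      exact_mod_cast Nat.one_le_iff_ne_zero.2 (Nat.mul_pos hJ0 hr0).ne'
    have h1 : n + (J * r - 1) < (k : ℝ) * (1 / b) := by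
      rw [mul_one_div, lt_div_iff₀ hb, hk']
      nlinarith [mul_nonneg (sub_nonneg.2 h0) (sub_nonneg.2 hb1)]
    have h2 : (k : ℝ) ^ P.α ≤ 2 * (n : ℝ) ^ P.α := by
      have h3 : (k : ℝ) ^ P.α ≤ (2 * (n : ℝ)) ^ P.α :=
        Real.rpow_le_rpow (by positivity) (by nlinarith) P.α_pos.le
      rw [Real.mul_rpow two_pos.le hn.le] at h3
      refine h3.trans (mul_le_mul_of_nonneg_right ?_ (by positivity))
      exact (Real.rpow_le_rpow_of_exponent_le one_le_two
        (by linarith [P.hαβ, P.hβ] : P.α ≤ 1)).trans_eq (Real.rpow_one _)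
    nlinarith [mul_le_mul_of_nonneg_left h2 hR.le]

lemma _root_.LSV.Par.Obs.approx {f : ℝ × ℝ → ℝ} {C t c : ℝ} (O : Obs f C t c)
    (hf0 : ∫ z, f z ∂ν = 0) (hc : c ≠ 0) {δ : ℝ} (hδ : 0 < δ) :
    ∃ k : ℕ → ℕ, Tendsto (fun n => (k n : ℝ) / n) atTop (𝓝 (ν.real D)) ∧
      ∀ᶠ n : ℕ in atTop, ν.real (D ∩ {z | δ * (n : ℝ) ^ P.α <
        |birkhoffSum P.T f n z - birkhoffSum P.F (P.exc f) (k n) z|}) ≤ δ := by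
  have := I.prob
  have hb := I.real_D_pos
  set b := ν.real D
  have hC := O.C_nonneg
  set ε := b * δ / (8 * (C + 1)) with hεd
  have hε : 0 < ε := by positivity
  obtain ⟨J, hJ⟩ := I.exists_window (by positivity : 0 < δ / 4) hε
  set r : ℕ → ℕ := fun n => ⌈ε * (n : ℝ) ^ P.α⌉₊
  set k : ℕ → ℕ := fun n => ⌊b * n⌋₊ - J * r n with hk
  have hr : Tendsto (fun n => (r n : ℝ) / n) atTop (𝓝 0) := P.tendsto_block_div ε
  have hfl : Tendsto (fun n : ℕ => ((⌊b * n⌋₊ : ℕ) : ℝ) / n) atTop (𝓝 b) :=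
    (tendsto_nat_floor_mul_div_atTop hb.le).comp tendsto_natCast_atTop_atTop
  have hsub : Tendsto (fun n : ℕ => ((⌊b * n⌋₊ : ℕ) : ℝ) / n - J * ((r n : ℝ) / n)) atTop (𝓝 b) :=
      by
    simpa using hfl.sub (hr.const_mul (J : ℝ))
  have hle : ∀ᶠ n : ℕ in atTop, J * r n ≤ ⌊b * n⌋₊ := by
    filter_upwards [hsub.eventually_const_lt hb, eventually_gt_atTop 0] with n hn hn0
    have hn' : (0 : ℝ) < n := by exact_mod_cast hn0
    rw [mul_div_assoc', ← sub_div] at hn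
    have := (div_pos_iff_of_pos_right hn').1 hn
    exact_mod_cast (sub_pos.1 this).le
  refine ⟨k, hsub.congr' ?_, ?_⟩
  · filter_upwards [hle] with n hn
    rw [hk, Nat.cast_sub hn, sub_div]
    push_cast
    ring
  have hX := O.attracted I hf0 hc
  set κ := δ / (4 * (C + 1)) with hκ
  set E : ℕ → ℝ := fun n => ∑ j ∈ Finset.range (2 * J),
    (ν.real (D ∩ {z | δ / 2 * (n : ℝ) ^ P.α < |birkhoffSum P.F (P.exc f) (j * r n) z|}) +
      ν.real (D ∩ {z | κ * (n : ℝ) ^ P.α <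
        |birkhoffSum P.F (fun z => (P.τ z : ℝ) - 1 / b) (r n) z|}))
  have hE : Tendsto E atTop (𝓝 0) := by
    have := tendsto_finsetSum (Finset.range (2 * J)) fun j _ =>
      (I.tendsto_tail hX (half_pos hδ) (l := fun n => j * r n) (by
        simpa [mul_div_assoc] using hr.const_mul (j : ℝ))).add
        (I.tendsto_tail I.attracted_τ (by positivity : 0 < κ) hr)
    rw [add_zero, Finset.sum_const_zero] at this
    exact this
  have hlim := (tendsto_rpow_atTop P.α_pos).comp (tendsto_natCast_atTop_atTop (R := ℝ))
  filter_upwards [hJ, hle, hE.eventually_le_const (half_pos hδ),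
    hlim.eventually_ge_atTop (1 / ε)] with n ⟨hJ1, hJ2⟩ hn1 hn2 hn3
  have hn3' : 1 / ε ≤ (n : ℝ) ^ P.α := hn3
  rw [div_le_iff₀ hε] at hn3'
  have hrn : (r n : ℝ) * (1 / b) ≤ κ * (n : ℝ) ^ P.α := by
    have h1 : (r n : ℝ) ≤ ε * (n : ℝ) ^ P.α + 1 := (Nat.ceil_lt_add_one (by positivity)).le
    have h2 : κ * b = 2 * ε := by rw [hκ, hεd]; field_simp; ring
    rw [mul_one_div, div_le_iff₀ hb]
    nlinarith
  set A₁ : ℕ → Set (ℝ × ℝ) := fun j =>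
    {z | δ / 2 * (n : ℝ) ^ P.α < |birkhoffSum P.F (P.exc f) (j * r n) z|}
  set A₂ : Set (ℝ × ℝ) :=
    {z | κ * (n : ℝ) ^ P.α < |birkhoffSum P.F (fun z => (P.τ z : ℝ) - 1 / b) (r n) z|}
  have hA₁ : ∀ j, MeasurableSet (A₁ j) := fun j =>
    measurableSet_lt measurable_const (measurable_birkhoffSum_F hX.meas _).abs
  have hA₂ : MeasurableSet A₂ :=
    measurableSet_lt measurable_const (measurable_birkhoffSum_F I.attracted_τ.meas _).abs
  have hkn : k n + 2 * J * r n = ⌊b * n⌋₊ + J * r n := by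
    have : k n = ⌊b * n⌋₊ - J * r n := rfl
    have h2 : 2 * J * r n = J * r n + J * r n := by ring
    omega
  have hcover : D ∩ {z | δ * (n : ℝ) ^ P.α <
        |birkhoffSum P.T f n z - birkhoffSum P.F (P.exc f) (k n) z|} ⊆
      ((D ∩ {z | n < birkhoffSum P.F P.τ (k n) z}) ∪
        (D ∩ {z | birkhoffSum P.F P.τ (⌊b * n⌋₊ + J * r n) z ≤ n})) ∪
      ⋃ j ∈ Finset.range (2 * J), ((D ∩ P.F^[k n] ⁻¹' A₁ j) ∪ (D ∩ P.F^[k n + j * r n] ⁻¹' A₂)) :=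
          by
    rintro z ⟨hz, hzn⟩
    by_contra hcon
    simp only [mem_union, mem_iUnion, Finset.mem_range, not_or, not_exists] at hcon
    obtain ⟨⟨h1, h2⟩, h3⟩ := hcon
    have h1' : birkhoffSum P.F P.τ (k n) z ≤ n := not_lt.1 fun h => h1 ⟨hz, h⟩
    have h2' : n < birkhoffSum P.F P.τ (k n + 2 * J * r n) z := by
      rw [hkn]; exact not_le.1 fun h => h2 ⟨hz, h⟩
    obtain ⟨j, hj, hle⟩ := O.exists_block hz h1' h2'
    obtain ⟨h4, h5⟩ := h3 j hj
    have h4' : |birkhoffSum P.F (P.exc f) (j * r n) (P.F^[k n] z)| ≤ δ / 2 * (n : ℝ) ^ P.α :=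
      not_lt.1 fun h => h4 ⟨hz, h⟩
    have h5' : |birkhoffSum P.F (fun z => (P.τ z : ℝ) - 1 / b) (r n) (P.F^[k n + j * r n] z)| ≤
      κ * (n : ℝ) ^ P.α := not_lt.1 fun h => h5 ⟨hz, h⟩
    rw [P.birkhoffSum_τ_sub] at h5'
    have h6 := (abs_le.1 h5').2
    have h7 : C * (birkhoffSum P.F P.τ (r n) (P.F^[k n + j * r n] z) : ℕ) ≤
        δ / 2 * (n : ℝ) ^ P.α := by
      calc C * ((birkhoffSum P.F P.τ (r n) (P.F^[k n + j * r n] z) : ℕ) : ℝ)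
          ≤ (C + 1) * (2 * (κ * (n : ℝ) ^ P.α)) :=
            mul_le_mul (by linarith) (by linarith) (by positivity) (by linarith)
        _ = δ / 2 * (n : ℝ) ^ P.α := by rw [hκ]; field_simp; ring
    have hzn' : δ * (n : ℝ) ^ P.α <
      |birkhoffSum P.T f n z - birkhoffSum P.F (P.exc f) (k n) z| := hzn
    linarith
  refine (measureReal_mono hcover).trans ((measureReal_union_le _ _).trans ?_)
  have hU := (measureReal_union_le (μ := ν) (D ∩ {z | n < birkhoffSum P.F P.τ (k n) z})
    (D ∩ {z | birkhoffSum P.F P.τ (⌊b * n⌋₊ + J * r n) z ≤ n})).trans (add_le_add hJ1 hJ2)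
  have hV : ν.real (⋃ j ∈ Finset.range (2 * J), ((D ∩ P.F^[k n] ⁻¹' A₁ j) ∪
      (D ∩ P.F^[k n + j * r n] ⁻¹' A₂))) ≤ E n := by
    refine (measureReal_biUnion_finset_le _ _).trans (Finset.sum_le_sum fun j _ => ?_)
    refine (measureReal_union_le _ _).trans_eq ?_
    rw [I.real_iter_F _ (hA₁ j), I.real_iter_F _ hA₂]
  linarith

end Inv

end Par
end LSV

namespace LSV
namespace Par

variable {P : Par} {ν : Measure (ℝ × ℝ)} {h : ℝ × ℝ → ℝ} {f : ℝ × ℝ → ℝ} {C t c : ℝ}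

variable (P) in
/-- The Fourier character of the normalised Birkhoff sum. -/
def character (f : ℝ × ℝ → ℝ) (s : ℝ) (n : ℕ) (z : ℝ × ℝ) : ℂ :=
  Complex.exp (Complex.I * ((s / (n : ℝ) ^ P.α * birkhoffSum P.T f n z : ℝ) : ℂ))

lemma norm_character (s : ℝ) (n : ℕ) (z : ℝ × ℝ) : ‖P.character f s n z‖ = 1 :=
  FullBranch.norm_exp_I_mul _

namespace Obs

lemma measurable_birkhoffSum_T (O : Obs f C t c) (n : ℕ) :
    Measurable fun z => birkhoffSum P.T f n z :=
  Finset.measurable_fun_sum _ fun j _ => O.meas.comp (P.measurable_T.iterate j)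

lemma measurable_character (O : Obs f C t c) (s : ℝ) (n : ℕ) : Measurable (P.character f s n) := by
  unfold character
  exact FullBranch.measurable_cexp_mul (O.measurable_birkhoffSum_T n) _

lemma norm_character_iter_sub_le (O : Obs f C t c) (s : ℝ) (n k : ℕ) {z : ℝ × ℝ} (hz : z ∈ Q) :
    ‖P.character f s n (P.T^[k] z) - P.character f s n z‖ ≤ |s / (n : ℝ) ^ P.α| * (2 * k * C) := by
  refine (FullBranch.norm_exp_sub_le _ _).trans ?_
  rw [← mul_sub, abs_mul]
  refine mul_le_mul_of_nonneg_left ?_ (abs_nonneg _)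
  have h1 : birkhoffSum P.T f n (P.T^[k] z) - birkhoffSum P.T f n z =
      birkhoffSum P.T f k (P.T^[n] z) - birkhoffSum P.T f k z := by
    have h2 := birkhoffSum_add P.T f k n z
    have h3 := birkhoffSum_add P.T f n k z
    rw [add_comm, h3] at h2
    linarith
  rw [h1]
  have h4 := O.abs_birkhoffSum_le (P := P) (P.iter_mem n hz) k
  have h5 := O.abs_birkhoffSum_le (P := P) hz k
  rw [abs_le] at h4 h5 ⊢
  constructor <;> linarith [h4.1, h4.2, h5.1, h5.2]

variable (O : Obs f C t c) (I : P.Inv ν h) (hf0 : ∫ z, f z ∂ν = 0) (hc : c ≠ 0)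
include O I

lemma tendsto_integral_sub (s : ℝ) :
    Tendsto (fun n : ℕ => (∫ z, P.character f s n z ∂ν) -
      ∫ z in D, (P.τ z : ℂ) * P.character f s n z ∂ν) atTop (𝓝 0) := by
  have := I.prob
  have hsum : ∀ n : ℕ, (∫ z, P.character f s n z ∂ν) -
      ∫ z in D, (P.τ z : ℂ) * P.character f s n z ∂ν =
      ∑' k : ℕ, ∫ z in D ∩ {z | k < P.τ z},
        (P.character f s n (P.T^[k] z) - P.character f s n z) ∂ν := by
    intro n
    have hintb : Integrable (P.character f s n) ν :=
      Integrable.of_bound (O.measurable_character s n).aestronglyMeasurable 1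
        (ae_of_all _ fun z => (norm_character s n z).le)
    have h1 := I.kac_integral hintb
    have h2 := I.hasSum_excursion (G := fun _ => P.character f s n) (C := 1)
      (fun _ => O.measurable_character s n) fun _ z _ => (norm_character s n z).le
    simp only [Finset.sum_const, Finset.card_range, nsmul_eq_mul] at h2
    rw [← (h1.sub h2).tsum_eq]
    refine tsum_congr fun k => (integral_sub ?_ hintb.integrableOn).symm
    exact (Integrable.of_bound ((O.measurable_character s n).comp
      (P.measurable_T.iterate k)).aestronglyMeasurable 1
        (ae_of_all _ fun z => (norm_character s n _).le)).integrableOn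
  simp only [hsum]
  rw [← tsum_zero (α := ℂ) (β := ℕ)]
  refine tendsto_tsum_of_dominated_convergence (I.summable_tail.mul_left 2) (fun k => ?_)
    (Eventually.of_forall fun n k => ?_)
  · have h3 : Tendsto (fun n : ℕ => |s / (n : ℝ) ^ P.α| * (2 * k * C)) atTop (𝓝 0) := by
      simpa using (tendsto_div_rpow P.α_pos s).abs.mul_const (2 * k * C)
    refine squeeze_zero_norm (fun n => ?_) h3
    refine (norm_setIntegral_le_of_norm_le_const (measure_lt_top _ _) fun z hz =>
      O.norm_character_iter_sub_le s n k (D_subset_Q hz.1)).trans ?_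
    exact mul_le_of_le_one_right (mul_nonneg (abs_nonneg _)
      (mul_nonneg (by positivity) O.C_nonneg)) measureReal_le_one
  · refine norm_setIntegral_le_of_norm_le_const (measure_lt_top _ _) fun z _ => ?_
    refine (norm_sub_le _ _).trans ?_
    rw [norm_character, norm_character]
    norm_num

include hf0 hc

lemma tendsto_integral_weight (s : ℝ) {g : ℕ → ℝ} {R : ℝ} (hg : ∀ n, |g n| ≤ R) :
    Tendsto (fun n : ℕ => ∫ z in D, (g (P.τ z) : ℂ) * P.character f s n z ∂ν) atTop
      (𝓝 (Complex.exp (P.lam h c s) * ∫ z in D, (g (P.τ z) : ℂ) ∂ν)) := by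
  have := I.prob
  have hR : 0 ≤ R := (abs_nonneg _).trans (hg 0)
  have hX := O.attracted I hf0 hc
  refine Metric.tendsto_nhds.2 fun e he => ?_
  set δ := e / (2 * (R * (|s| + 2) + 1))
  have hδ : 0 < δ := by positivity
  obtain ⟨k, hk, hkδ⟩ := O.approx I hf0 hc hδ
  have h1 := I.tendsto_charFun_τ hX s I.real_D_pos hk hg
  rw [div_self I.real_D_pos.ne', Complex.ofReal_one, one_mul] at h1
  filter_upwards [Metric.tendsto_nhds.1 h1 _ (half_pos he), hkδ, eventually_gt_atTop 0] with
    n hn1 hn2 hn0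
  have hn : (0 : ℝ) < (n : ℝ) ^ P.α := Real.rpow_pos_of_pos (by exact_mod_cast hn0) _
  set B : Set (ℝ × ℝ) := {z | δ * (n : ℝ) ^ P.α <
        |birkhoffSum P.T f n z - birkhoffSum P.F (P.exc f) (k n) z|}
  have hB : MeasurableSet B := measurableSet_lt measurable_const
    ((O.measurable_birkhoffSum_T n).sub (Inv.measurable_birkhoffSum_F hX.meas (k n))).abs
  set Y : ℝ × ℝ → ℂ := fun z => Complex.exp (Complex.I *
      ((s / (n : ℝ) ^ P.α * birkhoffSum P.F (P.exc f) (k n) z : ℝ) : ℂ))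
  have hY : Measurable Y :=
    FullBranch.measurable_cexp_mul (Inv.measurable_birkhoffSum_F hX.meas (k n)) _
  have hgm : Measurable fun z => ((g (P.τ z) : ℝ) : ℂ) :=
    Complex.measurable_ofReal.comp (measurable_from_nat.comp P.measurable_τ)
  have hgn : ∀ z, ‖((g (P.τ z) : ℝ) : ℂ)‖ ≤ R := fun z => by
    rw [Complex.norm_real]; exact hg _
  have hi : ∀ X : ℝ × ℝ → ℂ, Measurable X → (∀ z, ‖X z‖ = 1) →
      IntegrableOn (fun z => (g (P.τ z) : ℂ) * X z) D ν := fun X hX hX1 =>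
    (Integrable.of_bound (hgm.mul hX).aestronglyMeasurable R (ae_of_all _ fun z => by
      rw [Pi.mul_apply, norm_mul, hX1, mul_one]; exact hgn z)).integrableOn
  have hpt : ∀ z, ‖(g (P.τ z) : ℂ) * P.character f s n z - (g (P.τ z) : ℂ) * Y z‖ ≤
      R * (|s| * δ) + B.indicator (fun _ => R * 2) z := by
    intro z
    rw [← mul_sub, norm_mul]
    refine (mul_le_mul_of_nonneg_right (hgn z) (norm_nonneg _)).trans ?_
    by_cases hz : z ∈ B
    · rw [indicator_of_mem hz, ← mul_add]
      refine mul_le_mul_of_nonneg_left ?_ hR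
      refine (norm_sub_le _ _).trans ?_
      rw [norm_character, FullBranch.norm_exp_I_mul]
      have : 0 ≤ |s| * δ := by positivity
      linarith
    · rw [indicator_of_notMem hz, add_zero]
      refine mul_le_mul_of_nonneg_left ((FullBranch.norm_exp_sub_le _ _).trans ?_) hR
      have hz' : |birkhoffSum P.T f n z - birkhoffSum P.F (P.exc f) (k n) z| ≤
        δ * (n : ℝ) ^ P.α := not_lt.1 hz
      rw [← mul_sub, abs_mul, abs_div, abs_of_pos hn, div_mul_eq_mul_div, div_le_iff₀ hn, mul_assoc]
      exact mul_le_mul_of_nonneg_left hz' (abs_nonneg _)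
  have hbd : ‖(∫ z in D, (g (P.τ z) : ℂ) * P.character f s n z ∂ν) -
      ∫ z in D, (g (P.τ z) : ℂ) * Y z ∂ν‖ ≤ R * (|s| * δ) + R * 2 * δ := by
    rw [← integral_sub (hi _ (O.measurable_character s n) (norm_character s n))
      (hi Y hY fun z => FullBranch.norm_exp_I_mul _)]
    have hi1 : IntegrableOn (fun _ : ℝ × ℝ => R * (|s| * δ)) D ν := integrableOn_const
        (by finiteness)
    have hi2 : IntegrableOn (B.indicator fun _ : ℝ × ℝ => R * 2) D ν :=
      ((integrable_const (R * 2)).indicator hB).integrableOn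
    refine (norm_integral_le_of_norm_le (hi1.add hi2) (ae_of_all _ hpt)).trans ?_
    rw [integral_add' hi1 hi2, setIntegral_const, setIntegral_indicator hB, setIntegral_const,
      smul_eq_mul, smul_eq_mul]
    refine add_le_add (mul_le_of_le_one_left (by positivity) I.real_D_le_one) ?_
    rw [mul_comm]
    exact mul_le_mul_of_nonneg_left hn2 (by positivity)
  have hδe : R * (|s| * δ) + R * 2 * δ < e / 2 := by
    have : (2 * (R * (|s| + 2) + 1)) * δ = e := mul_div_cancel₀ _ (by positivity)
    nlinarith
  rw [dist_eq_norm] at hn1 ⊢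
  have htri := norm_add_le ((∫ z in D, (g (P.τ z) : ℂ) * P.character f s n z ∂ν) -
    ∫ z in D, (g (P.τ z) : ℂ) * Y z ∂ν) ((∫ z in D, (g (P.τ z) : ℂ) * Y z ∂ν) -
      Complex.exp (P.lam h c s) * ∫ z in D, (g (P.τ z) : ℂ) ∂ν)
  rw [sub_add_sub_cancel] at htri
  linarith

lemma tendsto_integral_mul_τ (s : ℝ) :
    Tendsto (fun n : ℕ => ∫ z in D, (P.τ z : ℂ) * P.character f s n z ∂ν) atTop
      (𝓝 (Complex.exp (P.lam h c s))) := by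
  have := I.prob
  set L := Complex.exp (P.lam h c s)
  set g : ℕ → ℕ → ℝ := fun M m => if m ≤ M then m else 0
  have hg0 : ∀ M m, 0 ≤ g M m := fun M m => by dsimp only [g]; split_ifs <;> positivity
  have hgM : ∀ M m, |g M m| ≤ M := fun M m => by
    rw [abs_of_nonneg (hg0 M m)]
    dsimp only [g]
    split_ifs with hm
    · exact_mod_cast hm
    · positivity
  have hgm : ∀ M m, g M m ≤ m := fun M m => by dsimp only [g]; split_ifs <;> simp
  have hmeas : ∀ M, Measurable fun z => g M (P.τ z) := fun M =>
    (measurable_from_nat (f := g M)).comp P.measurable_τ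
  have hτ := I.integrable_τ
  have hgi : ∀ M, IntegrableOn (fun z => g M (P.τ z)) D ν := fun M =>
    Integrable.mono' hτ (hmeas M).aestronglyMeasurable (ae_of_all _ fun z => by
      rw [Real.norm_of_nonneg (hg0 _ _)]; exact hgm _ _)
  have hlim : Tendsto (fun M => ∫ z in D, g M (P.τ z) ∂ν) atTop (𝓝 1) := by
    rw [← I.integral_τ]
    refine tendsto_integral_of_dominated_convergence (fun z => (P.τ z : ℝ))
      (fun M => (hmeas M).aestronglyMeasurable) hτ (fun M => ae_of_all _ fun z => by
      rw [Real.norm_of_nonneg (hg0 _ _)]; exact hgm _ _) (ae_of_all _ fun z => ?_)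
    refine tendsto_const_nhds.congr' ?_
    filter_upwards [eventually_ge_atTop (P.τ z)] with M hM
    simp [g, hM]
  have hlim2 : Tendsto (fun M => (1 + ‖L‖) * (1 - ∫ z in D, g M (P.τ z) ∂ν)) atTop (𝓝 0) := by
    simpa using (hlim.const_sub 1).const_mul (1 + ‖L‖)
  refine Metric.tendsto_nhds.2 fun e he => ?_
  obtain ⟨M, hM⟩ := (hlim2.eventually_lt_const (half_pos he)).exists
  set a := ∫ z in D, g M (P.τ z) ∂ν
  have ha : a ≤ 1 := by
    rw [← I.integral_τ]
    exact integral_mono (hgi M) hτ fun z => hgm _ _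
  filter_upwards [Metric.tendsto_nhds.1 (O.tendsto_integral_weight I hf0 hc s (hgM M)) _
    (half_pos he)] with n hn
  have hga : ∫ z in D, (g M (P.τ z) : ℂ) ∂ν = a := integral_ofReal
  rw [hga] at hn
  have hi : ∀ u : ℝ × ℝ → ℝ, Measurable u → IntegrableOn u D ν →
      IntegrableOn (fun z => (u z : ℂ) * P.character f s n z) D ν := fun u hu hui =>
    Integrable.mono' hui.abs ((Complex.measurable_ofReal.comp hu).mul
      (O.measurable_character s n)).aestronglyMeasurable (ae_of_all _ fun z => by
        rw [norm_mul, norm_character, mul_one, Complex.norm_real, Real.norm_eq_abs])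
  have hτm : Measurable fun z => (P.τ z : ℝ) := measurable_from_nat.comp P.measurable_τ
  have h1 : ‖(∫ z in D, (P.τ z : ℂ) * P.character f s n z ∂ν) -
      ∫ z in D, (g M (P.τ z) : ℂ) * P.character f s n z ∂ν‖ ≤ 1 - a := by
    have hi1 := hi _ hτm hτ
    simp only [Complex.ofReal_natCast] at hi1
    rw [← integral_sub hi1 (hi _ (hmeas M) (hgi M)), ← I.integral_τ, ← integral_sub hτ (hgi M)]
    refine norm_integral_le_of_norm_le (hτ.sub (hgi M)) (ae_of_all _ fun z => ?_)
    rw [← sub_mul, norm_mul, norm_character, mul_one, ← Complex.ofReal_natCast,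
      ← Complex.ofReal_sub, Complex.norm_real, Real.norm_of_nonneg (sub_nonneg.2 (hgm _ _))]
  have h2 : ‖L * (a : ℂ) - L‖ = ‖L‖ * (1 - a) := by
    rw [← mul_sub_one, norm_mul, ← Complex.ofReal_one, ← Complex.ofReal_sub, Complex.norm_real,
      Real.norm_of_nonpos (by linarith), neg_sub]
  rw [dist_eq_norm] at hn ⊢
  have htri := norm_add₃_le (a := (∫ z in D, (P.τ z : ℂ) * P.character f s n z ∂ν) -
      ∫ z in D, (g M (P.τ z) : ℂ) * P.character f s n z ∂ν)
    (b := (∫ z in D, (g M (P.τ z) : ℂ) * P.character f s n z ∂ν) - L * (a : ℂ))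
    (c := L * (a : ℂ) - L)
  rw [sub_add_sub_cancel, sub_add_sub_cancel] at htri
  linarith

lemma tendsto_integral_character (s : ℝ) :
    Tendsto (fun n : ℕ => ∫ z, P.character f s n z ∂ν) atTop (𝓝 (Complex.exp (P.lam h c s))) := by
  simpa using (O.tendsto_integral_sub I s).add (O.tendsto_integral_mul_τ I hf0 hc s)

/-- The stable limit law for the skew product. -/
theorem tendsto_stable : ∃ μ₀ : ProbabilityMeasure ℝ,
    (∀ s, charFun (μ₀ : Measure ℝ) s = Complex.exp (P.lam h c s)) ∧
    ∀ g : BoundedContinuousFunction ℝ ℝ, Tendsto (fun n : ℕ =>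
      ∫ z, g (birkhoffSum P.T f n z / (n : ℝ) ^ P.α) ∂ν) atTop (𝓝 (∫ x, g x ∂μ₀)) := by
  have := I.prob
  have hX : ∀ n : ℕ, Measurable fun z => birkhoffSum P.T f n z / (n : ℝ) ^ P.α := fun n =>
    (O.measurable_birkhoffSum_T n).div_const _
  set μ : ℕ → ProbabilityMeasure ℝ := fun n =>
    ⟨ν.map fun z => birkhoffSum P.T f n z / (n : ℝ) ^ P.α,
      Measure.isProbabilityMeasure_map (hX n).aemeasurable⟩
  obtain ⟨μ₀, hμ, hch⟩ := exists_limit_law (μ := μ) (ψ := fun s => Complex.exp (P.lam h c s))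
    (continuousAt_lam c).cexp fun s => by
      refine (O.tendsto_integral_character I hf0 hc s).congr fun n => ?_
      change _ = charFun (ν.map fun z => birkhoffSum P.T f n z / (n : ℝ) ^ P.α) s
      rw [charFun_apply_real, integral_map (hX n).aemeasurable (by fun_prop)]
      refine integral_congr_ae (ae_of_all _ fun z => ?_)
      simp only [character]
      congr 1
      push_cast
      ring
  refine ⟨μ₀, hch, fun g => ?_⟩
  refine (ProbabilityMeasure.tendsto_iff_forall_integral_tendsto.1 hμ g).congr fun n => ?_
  exact integral_map (hX n).aemeasurable g.continuous.aestronglyMeasurable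

end Obs
end Par
end LSV

namespace LSV
namespace Par

/-- A Hölder observable on the closed square, extended by zero, is an admissible observable. -/
lemma exists_obs {f : ℝ × ℝ → ℝ} {c : ℝ} (hf : ∃ C t : ℝ, 0 < t ∧ t ≤ 1 ∧
      ∀ p ∈ Icc (0 : ℝ) 1 ×ˢ Icc (0 : ℝ) 1, ∀ q ∈ Icc (0 : ℝ) 1 ×ˢ Icc (0 : ℝ) 1,
        |f p - f q| ≤ C * dist p q ^ t)
    (hc : c = ∫ ω in Icc (0 : ℝ) 1, f (0, ω)) :
    ∃ C t, Obs ((Icc (0 : ℝ) 1 ×ˢ Icc (0 : ℝ) 1).indicator f) C t c := by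
  obtain ⟨C, t, ht, ht1, hC⟩ := hf
  set K : Set (ℝ × ℝ) := Icc (0 : ℝ) 1 ×ˢ Icc (0 : ℝ) 1
  have hKc : IsCompact K := isCompact_Icc.prod isCompact_Icc
  have hcont : ContinuousOn f K := fun z hz => by
    refine tendsto_iff_dist_tendsto_zero.2 ?_
    have h1 : Tendsto (fun y => C * dist y z ^ t) (𝓝[K] z) (𝓝 0) := by
      have : ContinuousAt (fun y => C * dist y z ^ t) z :=
        ((by fun_prop : Continuous fun y => dist y z).continuousAt.rpow_const
          (Or.inr ht.le)).const_mul C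
      have h2 := this.tendsto.mono_left (nhdsWithin_le_nhds (s := K))
      simpa [Real.zero_rpow ht.ne'] using h2
    exact squeeze_zero' (Eventually.of_forall fun y => dist_nonneg)
      (eventually_nhdsWithin_of_forall fun y hy => hC y hy z hz) h1
  obtain ⟨B, hB⟩ := hKc.exists_bound_of_continuousOn hcont
  refine ⟨max B C, t, ?_, ht, ht1, fun z hz => ?_, fun z hz z' hz' => ?_, ?_⟩
  · classical
    rw [← piecewise_eq_indicator]
    exact hcont.measurable_piecewise continuousOn_const hKc.measurableSet
  · rw [indicator_of_mem hz]
    exact (hB z hz).trans (le_max_left _ _)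
  · rw [indicator_of_mem hz, indicator_of_mem hz']
    exact (hC z hz z' hz').trans
      (mul_le_mul_of_nonneg_right (le_max_right _ _) (by positivity))
  · rw [hc, integral_Icc_eq_integral_Ico]
    refine setIntegral_congr_fun measurableSet_Ico fun ω hω => ?_
    exact indicator_of_mem (show ((0 : ℝ), ω) ∈ K from ⟨by simp, Ico_subset_Icc_self hω⟩) f

lemma measure_compl_Q {ν : Measure (ℝ × ℝ)} (hac : ν ≪ (volume : Measure (ℝ × ℝ)))
    (hsupp : ν ((Icc (0 : ℝ) 1 ×ˢ Icc (0 : ℝ) 1)ᶜ) = 0) : ν Qᶜ = 0 := by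
  have h1 : ν ({0} ×ˢ univ) = 0 := hac (by rw [Measure.volume_eq_prod, Measure.prod_prod]; simp)
  have h2 : ν (univ ×ˢ {1}) = 0 := hac (by rw [Measure.volume_eq_prod, Measure.prod_prod]; simp)
  refine measure_mono_null (fun z hz => ?_)
    (measure_union_null (measure_union_null hsupp h1) h2)
  by_contra hcon
  simp only [mem_union, not_or] at hcon
  obtain ⟨⟨h3, h4⟩, h5⟩ := hcon
  obtain ⟨⟨h6, h7⟩, h8, h9⟩ := not_not.1 h3
  refine hz ⟨⟨lt_of_le_of_ne h6 fun h => h4 ⟨h.symm, trivial⟩, h7⟩, h8,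
    lt_of_le_of_ne h9 fun h => h5 ⟨trivial, h⟩⟩

lemma exp_lam (P : Par) (h : ℝ × ℝ → ℝ) (c t : ℝ) : Complex.exp (P.lam h c t) = Complex.exp
    (-((Aconst P.α P.p h * |c| ^ (1 / P.α) * Real.Gamma (1 - 1 / P.α) *
        Real.cos (Real.pi / (2 * P.α)) * |t| ^ (1 / P.α) : ℝ) : ℂ) *
      (1 - Complex.I * ((Real.sign (c * t) * Real.tan (Real.pi / (2 * P.α)) : ℝ) : ℂ))) := by
  have h1 : Real.pi / 2 * P.q = Real.pi / (2 * P.α) := by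
    rw [q, mul_one_div, div_div]
  have h2 : |t * c| ^ P.q = |t| ^ (1 / P.α) * |c| ^ (1 / P.α) := by
    rw [abs_mul, Real.mul_rpow (abs_nonneg _) (abs_nonneg _), q]
  congr 1
  rw [lam, stableExp, h1, h2, mul_comm t c, q]
  push_cast
  ring

end Par
end LSV

/-- Theorem 3.2 (4): stable law for `1/2 < α < 1` when `c ≠ 0`. -/
theorem stable_law (α β p₁ : ℝ) (hα : 1 / 2 < α) (hαβ : α < β) (hβ : β < 1)
    (hp₁ : 0 < p₁) (hp₁' : p₁ < 1)
    (ν : Measure (ℝ × ℝ)) (hprob : IsProbabilityMeasure ν)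
    (hac : ν ≪ (volume : Measure (ℝ × ℝ)))
    (hsupp : ν ((Icc (0 : ℝ) 1 ×ˢ Icc (0 : ℝ) 1)ᶜ) = 0)
    (hinv : ∀ A : Set (ℝ × ℝ), MeasurableSet A → ν (skewLSV α β p₁ ⁻¹' A) = ν A)
    (h : ℝ × ℝ → ℝ) (hden : ν = volume.withDensity (fun p => ENNReal.ofReal (h p)))
    (hLip : ∀ K : Set (ℝ × ℝ), K ⊆ Ioc (0 : ℝ) 1 ×ˢ Icc (0 : ℝ) 1 → IsCompact K →
      ∃ L : NNReal, LipschitzOnWith L h K)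
    (f : ℝ × ℝ → ℝ)
    (hf : ∃ C t : ℝ, 0 < t ∧ t ≤ 1 ∧
      ∀ p ∈ Icc (0 : ℝ) 1 ×ˢ Icc (0 : ℝ) 1, ∀ q ∈ Icc (0 : ℝ) 1 ×ˢ Icc (0 : ℝ) 1,
        |f p - f q| ≤ C * dist p q ^ t)
    (hf0 : (∫ p, f p ∂ν) = 0)
    (c : ℝ) (hcdef : c = ∫ ω in Icc (0 : ℝ) 1, f (0, ω)) (hc : c ≠ 0) :
    ∃ μZ : Measure ℝ, IsProbabilityMeasure μZ ∧
      (∀ t : ℝ,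
        (∫ x : ℝ, Complex.exp (Complex.I * (t : ℂ) * (x : ℂ)) ∂μZ) =
          Complex.exp
            (-((Aconst α p₁ h * |c| ^ (1 / α) * Real.Gamma (1 - 1 / α) *
                Real.cos (Real.pi / (2 * α)) * |t| ^ (1 / α) : ℝ) : ℂ) *
              (1 - Complex.I * ((Real.sign (c * t) * Real.tan (Real.pi / (2 * α)) : ℝ) : ℂ)))) ∧
      ∀ g : BoundedContinuousFunction ℝ ℝ,
        Tendsto (fun n : ℕ => ∫ p, g (birkhoff α β p₁ f n p / (n : ℝ) ^ α) ∂ν) atTop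
          (𝓝 (∫ x, g x ∂μZ)) := by
  set P : LSV.Par := ⟨α, β, p₁, hα, hαβ, hβ, hp₁, hp₁'⟩
  have hT : P.T = skewLSV α β p₁ := rfl
  have I : P.Inv ν h :=
    { prob := hprob
      null := LSV.Par.measure_compl_Q hac hsupp
      inv := ⟨P.measurable_T, Measure.ext fun A hA => by
        rw [Measure.map_apply P.measurable_T hA]; exact hinv A hA⟩
      den := hden
      lip := hLip _ (prod_mono (Icc_subset_Ioc_iff (by norm_num) |>.2 (by norm_num)) le_rfl)
        (isCompact_Icc.prod isCompact_Icc) }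
  obtain ⟨C, t, O⟩ := LSV.Par.exists_obs hf hcdef
  set f' := (Icc (0 : ℝ) 1 ×ˢ Icc (0 : ℝ) 1).indicator f
  have hf' : ∀ z ∈ LSV.Par.Q, f' z = f z := fun z hz =>
    indicator_of_mem (LSV.Par.Q_subset_Icc hz) f
  have hf0' : ∫ z, f' z ∂ν = 0 := by
    rw [← hf0]
    exact integral_congr_ae (I.ae_Q.mono hf')
  obtain ⟨μ₀, hch, hlim⟩ := O.tendsto_stable I hf0' hc
  refine ⟨μ₀, inferInstance, fun s => ?_, fun g => (hlim g).congr fun n => ?_⟩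
  · rw [← P.exp_lam h c s, ← hch s, charFun_apply_real]
    refine integral_congr_ae (ae_of_all _ fun x => ?_)
    change Complex.exp _ = Complex.exp _
    congr 1
    ring
  · refine integral_congr_ae (I.ae_Q.mono fun z hz => ?_)
    have : birkhoffSum P.T f' n z = birkhoff α β p₁ f n z :=
      Finset.sum_congr rfl fun k _ => hf' _ (P.iter_mem k hz)
    change g (birkhoffSum P.T f' n z / (n : ℝ) ^ α) = _
    rw [this]
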